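/- Let k be a field and let G be a finite group acting on the rational function field k(x1,x2,x3,x4) by purely monomial k-automorphisms. Suppose the action is decomposable: there exists m with 1 ≤ m ≤ 3 such that for every σ ∈ G, σ(x_i) is a monomial ∏_{1≤j≤m} x_j^{a_{ij}} for each 1 ≤ i ≤ m, and σ(x_i) is a monomial ∏_{m<j≤4} x_j^{a_{ij}} for each m < i ≤ 4 (i.e. the associated G-lattice of rank 4 decomposes as a direct sum M1 ⊕ M2 of ℤ[G]-sublattices of ranks m and 4−m). Then k(x1,x2,x3,x4)^G is k-rational. -/

import Mathlib

open MvPolynomial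

noncomputable section

/-- A field extension `K` of `k` is `k`-rational if it is isomorphic, as a `k`-algebra,
to a rational function field `k(x₁, …, xₙ)` in finitely many variables. -/
def IsRational (k K : Type*) [Field k] [Field K] [Algebra k K] : Prop :=
  ∃ n : ℕ, Nonempty (K ≃ₐ[k] FractionRing (MvPolynomial (Fin n) k))

section Framework

open IntermediateField
open Submodule (span)

section

variable {k Ω : Type*} [Field k] [Field Ω] [Algebra k Ω] {K L : IntermediateField k Ω} {x y : Ω}

/-- The relative algebraic closure of an intermediate field, as an intermediate field. -/
def acl (K : IntermediateField k Ω) : IntermediateField k Ω :=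
  (algebraicClosure K Ω).restrictScalars k

theorem mem_acl : x ∈ acl K ↔ IsAlgebraic K x :=
  mem_algebraicClosure_iff

theorem le_acl (K : IntermediateField k Ω) : K ≤ acl K := fun x hx =>
  mem_acl.2 (isAlgebraic_algebraMap (⟨x, hx⟩ : K))

theorem mem_acl_of_poly (p : Polynomial Ω) (hp : p ≠ 0) (hc : ∀ i, p.coeff i ∈ K)
    (hx : p.eval x = 0) : x ∈ acl K := by
  rw [mem_acl]
  have hl : p ∈ Polynomial.lifts (algebraMap K Ω) := by
    rw [Polynomial.lifts_iff_coeff_lifts]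
    intro i
    exact ⟨⟨_, hc i⟩, rfl⟩
  obtain ⟨q, hq⟩ := hl
  refine ⟨q, ?_, ?_⟩
  · rintro rfl
    simp at hq
    exact hp hq.symm
  · rw [← hx, ← hq]
    simp [Polynomial.eval_map_algebraMap]

theorem acl_le (h : L ≤ acl K) : acl L ≤ acl K := by
  intro x hx
  rw [mem_acl] at hx
  obtain ⟨p, hp, hpx⟩ := hx
  have key : IsAlgebraic (algebraicClosure K Ω) x := by
    have hl : (p.map (algebraMap L Ω)) ∈ Polynomial.lifts (algebraMap (algebraicClosure K Ω) Ω) := by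
      rw [Polynomial.lifts_iff_coeff_lifts]
      intro i
      rw [Polynomial.coeff_map]
      exact ⟨⟨_, h (p.coeff i).2⟩, rfl⟩
    obtain ⟨q, hq⟩ := hl
    refine ⟨q, ?_, ?_⟩
    · rintro rfl
      simp at hq
      have := (Polynomial.map_eq_zero (algebraMap L Ω)).1 hq.symm
      exact hp this
    · have := congrArg (Polynomial.eval x) hq
      simp only [Polynomial.coe_mapRingHom, Polynomial.eval_map_algebraMap] at this
      rw [this, hpx]
  rw [mem_acl]
  exact IsAlgebraic.restrictScalars K key

theorem acl_mono (h : K ≤ L) : acl K ≤ acl L :=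
  acl_le (h.trans (le_acl L))

theorem mem_left (h : x ∈ K) : x ∈ K ⊔ L :=
  le_sup_left (a := K) h

theorem mem_right (K : IntermediateField k Ω) (x : Ω) : x ∈ K ⊔ k⟮x⟯ :=
  le_sup_right (a := K) (mem_adjoin_simple_self k x)

theorem sup_simple_le : K ⊔ k⟮x⟯ ≤ L ↔ K ≤ L ∧ x ∈ L := by
  rw [sup_le_iff, adjoin_simple_le_iff]

theorem acl_sup_simple (h : x ∈ acl K) : acl (K ⊔ k⟮x⟯) = acl K :=
  le_antisymm (acl_le (sup_simple_le.2 ⟨le_acl K, h⟩)) (acl_mono le_sup_left)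

theorem mem_sup_simple_iff :
    y ∈ K ⊔ k⟮x⟯ ↔ ∃ p q : Polynomial K, y = Polynomial.aeval x p / Polynomial.aeval x q := by
  rw [← restrictScalars_adjoin_eq_sup, mem_restrictScalars, mem_adjoin_simple_iff]

theorem mem_acl_quadratic {x a b : Ω} (ha : a ∈ K) (hb : b ∈ K) (h : x ^ 2 + a * x + b = 0) :
    x ∈ acl K := by
  refine mem_acl_of_poly (Polynomial.X ^ 2 + Polynomial.C a * Polynomial.X + Polynomial.C b) ?_ ?_ (by simpa using h)
  · exact (by monicity! : (Polynomial.X ^ 2 + Polynomial.C a * Polynomial.X + Polynomial.C b : Polynomial Ω).Monic).ne_zero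
  · intro i
    simp only [Polynomial.coeff_add, Polynomial.coeff_X_pow, Polynomial.coeff_C_mul, Polynomial.coeff_X, Polynomial.coeff_C]
    refine add_mem (add_mem ?_ (mul_mem ha ?_)) ?_ <;> split_ifs <;> simp [*]

theorem mem_acl_cubic {x a b c : Ω} (ha : a ∈ K) (hb : b ∈ K) (hc : c ∈ K)
    (h : x ^ 3 + a * x ^ 2 + b * x + c = 0) : x ∈ acl K := by
  refine mem_acl_of_poly (Polynomial.X ^ 3 + Polynomial.C a * Polynomial.X ^ 2 + Polynomial.C b * Polynomial.X + Polynomial.C c) ?_ ?_ (by simpa using h)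
  · exact (by monicity! : (Polynomial.X ^ 3 + Polynomial.C a * Polynomial.X ^ 2 + Polynomial.C b * Polynomial.X + Polynomial.C c : Polynomial Ω).Monic).ne_zero
  · intro i
    simp only [Polynomial.coeff_add, Polynomial.coeff_X_pow, Polynomial.coeff_C_mul, Polynomial.coeff_X, Polynomial.coeff_C]
    refine add_mem (add_mem (add_mem ?_ (mul_mem ha ?_)) (mul_mem hb ?_)) ?_ <;>
      split_ifs <;> simp [*]

/-- Every set generating `L` over `K` up to algebraic closure has at least `n` elements. -/
def Big (n : ℕ) (K L : IntermediateField k Ω) : Prop :=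
  ∀ s : Finset Ω, L ≤ acl (K ⊔ adjoin k (s : Set Ω)) → n ≤ s.card

theorem Big.mono {m n : ℕ} {K K' L L' : IntermediateField k Ω} (h : Big n K L) (hmn : m ≤ n)
    (hK : K' ≤ acl K) (hL : L ≤ L') : Big m K' L' := by
  intro s hs
  refine hmn.trans (h s (hL.trans (hs.trans (acl_le ?_))))
  exact sup_le (hK.trans (acl_mono le_sup_left)) (le_sup_right.trans (le_acl _))

theorem Big.acl_right {n : ℕ} {K L L' : IntermediateField k Ω} (h : Big n K L)
    (hL : L ≤ acl L') : Big n K L' := by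
  intro s hs
  exact h s (hL.trans (acl_le hs))

theorem sup_adjoin_insert (K : IntermediateField k Ω) (x : Ω) (s : Set Ω) :
    K ⊔ adjoin k (insert x s) = K ⊔ k⟮x⟯ ⊔ adjoin k s := by
  rw [Set.insert_eq, adjoin_union, sup_assoc]

theorem Big.adjoin {n : ℕ} (h : Big (n + 1) K L) (x : Ω) : Big n (K ⊔ k⟮x⟯) L := by
  classical
  intro s hs
  have := h (insert x s) (by rwa [Finset.coe_insert, sup_adjoin_insert])
  have h2 := Finset.card_insert_le x s
  omega

theorem Big.one (h : Big 1 K L) (hL : L ≤ acl (K ⊔ k⟮x⟯)) : x ∉ acl K := by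
  intro hx
  rw [acl_sup_simple hx] at hL
  have := h ∅ (by simpa using hL)
  simp at this

theorem Big.two (h : Big 2 K L) (hL : L ≤ acl (K ⊔ k⟮x⟯ ⊔ k⟮y⟯)) :
    x ∉ acl K ∧ y ∉ acl (K ⊔ k⟮x⟯) := by
  refine ⟨fun hx => ?_, (h.adjoin x).one hL⟩
  refine absurd (h.adjoin y) fun h' => ?_
  have hL' : L ≤ acl (K ⊔ k⟮y⟯ ⊔ k⟮x⟯) := by rwa [sup_right_comm]
  exact h'.one hL' (acl_mono le_sup_left hx)

theorem Big.three (h : Big 3 K L) (hL : L ≤ acl (K ⊔ k⟮x⟯ ⊔ k⟮y⟯ ⊔ k⟮z⟯)) :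
    x ∉ acl K ∧ y ∉ acl (K ⊔ k⟮x⟯) ∧ z ∉ acl (K ⊔ k⟮x⟯ ⊔ k⟮y⟯) := by
  refine ⟨fun hx => ?_, (h.adjoin x).two hL⟩
  refine ((h.adjoin y).two (x := x) (y := z) ?_).1 (acl_mono le_sup_left hx)
  rwa [sup_right_comm K]

theorem sup_adjoin_finset_le {s : Set Ω} : K ⊔ adjoin k s ≤ L ↔ K ≤ L ∧ s ⊆ L := by
  rw [sup_le_iff, adjoin_le_iff]

/-- `E` is generated over `F` by at most `n` elements. -/
def GenBy (n : ℕ) (F E : IntermediateField k Ω) : Prop :=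
  ∃ s : Finset Ω, s.card ≤ n ∧ E = F ⊔ adjoin k (s : Set Ω)

theorem GenBy.one (F : IntermediateField k Ω) (f : Ω) : GenBy 1 F (F ⊔ k⟮f⟯) :=
  ⟨{f}, by simp, by simp⟩

theorem GenBy.trans {m n : ℕ} {F E L : IntermediateField k Ω} (h : GenBy m F E)
    (h' : GenBy n E L) : GenBy (m + n) F L := by
  classical
  obtain ⟨s, hs, rfl⟩ := h
  obtain ⟨t, ht, rfl⟩ := h'
  refine ⟨s ∪ t, (Finset.card_union_le s t).trans (by omega), ?_⟩
  rw [Finset.coe_union, adjoin_union, sup_assoc]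

theorem GenBy.of_eq {F E : IntermediateField k Ω} {f : Ω} (h : E = F ⊔ k⟮f⟯) : GenBy 1 F E :=
  h ▸ GenBy.one F f

theorem Big.of_genBy {m n : ℕ} {F K L : IntermediateField k Ω} (h : Big (m + n) F L)
    (hK : GenBy m F K) : Big n K L := by
  classical
  obtain ⟨s, hs, rfl⟩ := hK
  intro t ht
  have := h (s ∪ t) (by rwa [Finset.coe_union, adjoin_union, ← sup_assoc])
  have h2 := Finset.card_union_le s t
  omega

/-! ### Invariants -/

variable {G : Type*} [Group G] {ρ : G →* (Ω ≃ₐ[k] Ω)}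

/-- The elements of `K` fixed by all `ρ g`. -/
def FixIn (ρ : G →* (Ω ≃ₐ[k] Ω)) (K : IntermediateField k Ω) : IntermediateField k Ω :=
  K ⊓ fixedField ρ.range

theorem mem_FixIn : x ∈ FixIn ρ K ↔ x ∈ K ∧ ∀ g, ρ g x = x := by
  unfold FixIn
  rw [IntermediateField.mem_inf, mem_fixedField_iff]
  simp

theorem FixIn_le (ρ : G →* (Ω ≃ₐ[k] Ω)) (K : IntermediateField k Ω) : FixIn ρ K ≤ K := inf_le_left

theorem FixIn_mono (ρ : G →* (Ω ≃ₐ[k] Ω)) (h : K ≤ L) : FixIn ρ K ≤ FixIn ρ L := inf_le_inf_right _ h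

/-- `K` is mapped into itself by all `ρ g`. -/
def Stable (ρ : G →* (Ω ≃ₐ[k] Ω)) (K : IntermediateField k Ω) : Prop :=
  ∀ g, ∀ x ∈ K, ρ g x ∈ K

theorem stable_bot (ρ : G →* (Ω ≃ₐ[k] Ω)) : Stable ρ ⊥ := by
  intro g x hx
  rw [mem_bot] at hx ⊢
  obtain ⟨a, rfl⟩ := hx
  exact ⟨a, by simp⟩

theorem map_mem_sup_adjoin {K M : IntermediateField k Ω} {s : Set Ω} (f : Ω ≃ₐ[k] Ω)
    (hK : ∀ x ∈ K, f x ∈ M) (hs : ∀ x ∈ s, f x ∈ M) :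
    ∀ x ∈ K ⊔ adjoin k s, f x ∈ M := by
  have h : K ⊔ adjoin k s ≤ M.comap (f : Ω →ₐ[k] Ω) := by
    rw [sup_adjoin_finset_le]
    exact ⟨fun x hx => hK x hx, fun x hx => hs x hx⟩
  exact fun x hx => h hx

theorem Stable.sup_simple (hK : Stable ρ K) (hx : ∀ g, ρ g x ∈ K ⊔ k⟮x⟯) :
    Stable ρ (K ⊔ k⟮x⟯) := fun g =>
  map_mem_sup_adjoin _ (fun y hy => mem_left (hK g y hy)) (by simpa using hx g)

end

section

variable {k Ω : Type*} [Field k] [Field Ω] [Algebra k Ω] {G : Type*} [Group G]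
  {ρ : G →* (Ω ≃ₐ[k] Ω)} {K E L : IntermediateField k Ω} {f : Ω ≃ₐ[k] Ω} {x y z : Ω}

/-- Values at `x` of polynomials over `K` of degree at most `d`. -/
def polyVals (K : IntermediateField k Ω) (x : Ω) (d : ℕ) : Set Ω :=
  {y | ∃ p : Polynomial K, p.natDegree ≤ d ∧ Polynomial.aeval x p = y}

theorem aeval_inj (hx : x ∉ acl K) {p q : Polynomial K}
    (h : Polynomial.aeval x p = Polynomial.aeval x q) : p = q := by
  rw [mem_acl] at hx
  exact transcendental_iff_injective.1 hx h

theorem map_polyVals {x a b : Ω} {f : Ω ≃ₐ[k] Ω} (hK : ∀ y ∈ K, f y ∈ K) (ha : a ∈ K) (hb : b ∈ K)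
    (hf : f x = a * x + b) {d : ℕ} (hy : y ∈ polyVals K x d) : f y ∈ polyVals K x d := by
  obtain ⟨p, hp, rfl⟩ := hy
  let fK : K →+* K := ((f : Ω →+* Ω).comp (algebraMap K Ω)).codRestrict K (fun y => hK _ y.2)
  refine ⟨(p.map fK).comp (Polynomial.C ⟨a, ha⟩ * Polynomial.X + Polynomial.C ⟨b, hb⟩), ?_, ?_⟩
  · refine Polynomial.natDegree_comp_le.trans ?_
    have h1 := Polynomial.natDegree_linear_le (a := (⟨a, ha⟩ : K)) (b := ⟨b, hb⟩)
    have h2 : (p.map fK).natDegree ≤ p.natDegree := Polynomial.natDegree_map_le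
    calc _ ≤ d * 1 := Nat.mul_le_mul (h2.trans hp) h1
      _ = d := mul_one d
  · rw [Polynomial.aeval_comp]
    have hl : Polynomial.aeval x (Polynomial.C ⟨a, ha⟩ * Polynomial.X + Polynomial.C ⟨b, hb⟩ :
        Polynomial K) = f x := by
      rw [hf]; simp
    rw [hl, Polynomial.aeval_def, Polynomial.aeval_def, Polynomial.eval₂_map,
      show f (Polynomial.eval₂ (algebraMap K Ω) x p) =
        (f : Ω →+* Ω) (Polynomial.eval₂ (algebraMap K Ω) x p) from rfl, Polynomial.hom_eval₂]
    rfl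

theorem fixIn_sup_simple [Finite G] (hK : Stable ρ K) (hx : x ∉ acl K)
    (hg : ∀ g, ∃ a ∈ K, ∃ b ∈ K, ρ g x = a * x + b) :
    ∃ f, FixIn ρ (K ⊔ k⟮x⟯) = FixIn ρ K ⊔ k⟮f⟯ := by
  classical
  cases nonempty_fintype G
  have hstab : ∀ g d y, y ∈ polyVals K x d → ρ g y ∈ polyVals K x d := by
    intro g d y hy
    obtain ⟨a, ha, b, hb, h⟩ := hg g
    exact map_polyVals (hK g) ha hb h hy
  have hval : ∀ (g : G) (p : Polynomial K), ∃ q : Polynomial K, q.natDegree ≤ p.natDegree ∧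
      Polynomial.aeval x q = ρ g (Polynomial.aeval x p) := fun g p =>
    hstab g _ _ ⟨p, le_rfl, rfl⟩
  have hxK : x ∉ K := fun h => hx (le_acl K h)
  -- a fixed polynomial of positive degree
  have hprod : ∀ w : Ω, ∀ g, ρ g (∏ h : G, ρ h w) = ∏ h : G, ρ h w := by
    intro w g
    rw [map_prod]
    refine Fintype.prod_equiv (Equiv.mulLeft g) _ _ fun h => ?_
    simp [map_mul]
  have hex : ∃ d : ℕ, ∃ p : Polynomial K, p.natDegree = d ∧ 0 < d ∧
      ∀ g, ρ g (Polynomial.aeval x p) = Polynomial.aeval x p := by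
    have hlin : ∀ g, ∃ p : Polynomial K, p.natDegree = 1 ∧ Polynomial.aeval x p = ρ g x := by
      intro g
      obtain ⟨a, ha, b, hb, h⟩ := hg g
      refine ⟨Polynomial.C ⟨a, ha⟩ * Polynomial.X + Polynomial.C ⟨b, hb⟩,
        Polynomial.natDegree_linear ?_, by rw [h]; simp⟩
      intro h0
      have ha0 : a = 0 := congrArg Subtype.val h0
      apply hxK
      have := hK g⁻¹ b hb
      rwa [← zero_add b, ← zero_mul x, ← ha0, ← h, ← AlgEquiv.mul_apply, ← map_mul,
        inv_mul_cancel, map_one, AlgEquiv.one_apply] at this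
    choose P hP1 hP2 using hlin
    refine ⟨_, ∏ g, P g, rfl, ?_, ?_⟩
    · rw [Polynomial.natDegree_prod _ _ (fun g _ h0 => by have := hP1 g; simp [h0] at this)]
      simp [hP1, Fintype.card_pos]
    · intro g
      rw [map_prod]
      simp only [hP2]
      exact hprod x g
  obtain ⟨p, hpd, hp0, hpf⟩ := Nat.find_spec hex
  have hmin := fun m => Nat.find_min hex (m := m)
  rw [← hpd] at hmin hp0
  have hpne : p ≠ 0 := by rintro rfl; simp at hp0
  set f := Polynomial.aeval x p with hf
  refine ⟨f, le_antisymm ?_ ?_⟩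
  swap
  · rw [sup_simple_le]
    refine ⟨FixIn_mono ρ le_sup_left, mem_FixIn.2 ⟨?_, hpf⟩⟩
    exact mem_sup_simple_iff.2 ⟨p, 1, by simp [hf]⟩
  have hpoly : ∀ n : ℕ, ∀ P : Polynomial K, P.natDegree ≤ n →
      (∀ g, ρ g (Polynomial.aeval x P) = Polynomial.aeval x P) →
      Polynomial.aeval x P ∈ FixIn ρ K ⊔ k⟮f⟯ := by
    intro n
    induction n using Nat.strong_induction_on with
    | _ n ih =>
    intro P hPn hPf
    by_cases hP0 : P.natDegree = 0
    · rw [Polynomial.natDegree_eq_zero] at hP0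
      obtain ⟨c, rfl⟩ := hP0
      rw [Polynomial.aeval_C] at hPf ⊢
      exact mem_left (mem_FixIn.2 ⟨c.2, hPf⟩)
    have hdiv : p * (P / p) + P % p = P := EuclideanDomain.div_add_mod P p
    have hdivg : ∀ g, ρ g (Polynomial.aeval x (P / p)) = Polynomial.aeval x (P / p) ∧
        ρ g (Polynomial.aeval x (P % p)) = Polynomial.aeval x (P % p) := by
      intro g
      obtain ⟨Q, hQ1, hQ2⟩ := hval g (P / p)
      obtain ⟨R, hR1, hR2⟩ := hval g (P % p)
      have hRd : R.natDegree < p.natDegree :=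
        hR1.trans_lt (Polynomial.natDegree_mod_lt P hp0.ne')
      have e : R + p * Q = P := by
        apply aeval_inj hx
        rw [← hPf g, map_add, map_mul, hQ2, hR2]
        nth_rewrite 3 [← hdiv]
        rw [map_add, map_mul, map_add, map_mul, hpf g]
        ring
      have h1 : P / p = Q := by
        have e2 : p * (P / p - Q) = R - P % p := by
          linear_combination hdiv - e
        by_contra hne
        have h3 := congrArg Polynomial.natDegree e2
        rw [Polynomial.natDegree_mul hpne (sub_ne_zero.2 hne)] at h3
        have h4 := Polynomial.natDegree_sub_le R (P % p)
        have h5 := Polynomial.natDegree_mod_lt P hp0.ne'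
        have h6 := max_lt hRd h5
        omega
      have h2 : P % p = R := by
        have := hdiv
        rw [h1] at this
        rw [← e] at this
        rw [← e]
        linear_combination this
      rw [← hQ2, ← hR2, h1, h2]
      exact ⟨rfl, rfl⟩
    have hmod : (P % p).natDegree = 0 := by
      by_contra hne
      refine hmin _ ?_ ⟨P % p, rfl, Nat.pos_of_ne_zero hne, fun g => (hdivg g).2⟩
      exact Polynomial.natDegree_mod_lt P hp0.ne'
    have hR : Polynomial.aeval x (P % p) ∈ FixIn ρ K ⊔ k⟮f⟯ := by
      have h2 := fun g => (hdivg g).2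
      rw [Polynomial.natDegree_eq_zero] at hmod
      obtain ⟨c, hc⟩ := hmod
      rw [← hc, Polynomial.aeval_C] at h2 ⊢
      exact mem_left (mem_FixIn.2 ⟨c.2, h2⟩)
    have hQ : Polynomial.aeval x (P / p) ∈ FixIn ρ K ⊔ k⟮f⟯ := by
      refine ih (P / p).natDegree (lt_of_lt_of_le ?_ hPn) _ le_rfl fun g => (hdivg g).1
      have hPne : P ≠ 0 := by rintro rfl; simp at hP0
      have h3 : P / p ≠ 0 ∨ P / p = 0 := ne_or_eq _ _
      rcases h3 with h3 | h3
      · have h4 := congrArg Polynomial.natDegree hdiv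
        have h5 := Polynomial.natDegree_mul hpne h3
        rw [Polynomial.natDegree_add_eq_left_of_natDegree_lt (by omega)] at h4
        omega
      · rw [h3]; simpa using Nat.pos_of_ne_zero hP0
    rw [← hdiv, map_add, map_mul]
    exact add_mem (mul_mem (mem_right _ _) hQ) hR
  intro y hy
  rw [mem_FixIn, mem_sup_simple_iff] at hy
  obtain ⟨⟨u, w, rfl⟩, hfx⟩ := hy
  by_cases hw : Polynomial.aeval x w = 0
  · rw [hw]; simp
  choose W hW1 hW2 using fun g => hval g w
  have hN : Polynomial.aeval x (∏ g, W g) = ∏ g, ρ g (Polynomial.aeval x w) := by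
    rw [map_prod]; simp only [hW2]
  have hN0 : Polynomial.aeval x (∏ g, W g) ≠ 0 := by
    rw [hN, Finset.prod_ne_zero_iff]
    intro g _ h0
    exact hw ((map_eq_zero_iff _ (ρ g).injective).1 h0)
  have hNf : ∀ g, ρ g (Polynomial.aeval x (∏ g, W g)) = Polynomial.aeval x (∏ g, W g) := by
    rw [hN]; exact hprod _
  have hu : Polynomial.aeval x (u * ∏ g ∈ Finset.univ.erase (1 : G), W g) =
      Polynomial.aeval x u / Polynomial.aeval x w * Polynomial.aeval x (∏ g, W g) := by
    rw [← Finset.mul_prod_erase Finset.univ W (Finset.mem_univ (1 : G)), map_mul, map_mul, hW2 1,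
      map_one, AlgEquiv.one_apply]
    field_simp
  have h1 := hpoly _ _ le_rfl hNf
  have h2 := hpoly _ (u * ∏ g ∈ Finset.univ.erase (1 : G), W g) le_rfl (by
    intro g
    rw [hu, map_mul, hNf, hfx])
  rw [hu] at h2
  rw [← mul_div_cancel_right₀ (Polynomial.aeval x u / Polynomial.aeval x w) hN0]
  exact div_mem h2 h1

/-- Membership of a rational expression in an intermediate field, by structural search. -/
theorem fmem {K : IntermediateField k Ω} {x : Ω} (h : x ∈ K := by
      (with_reducible_and_instances repeat' first
        | assumption
        | exact one_mem _
        | exact zero_mem _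
        | exact ofNat_mem _ _
        | exact mem_right _ _
        | (apply mem_left; assumption)
        | (apply mem_left; exact mem_right _ _)
        | (apply mem_left; apply mem_left; assumption)
        | (apply mem_left; apply mem_left; exact mem_right _ _)
        | apply div_mem
        | apply mul_mem
        | apply sub_mem
        | apply add_mem
        | apply neg_mem
        | apply inv_mem
        | apply pow_mem)) : x ∈ K := h

theorem mem_of_eq {K : IntermediateField k Ω} {x : Ω} (y : Ω) (h : x = y)
    (hy : y ∈ K := by exact fmem) : x ∈ K := h ▸ hy

theorem sup_simple_eq (h : x ∈ K ⊔ k⟮y⟯) (h' : y ∈ K ⊔ k⟮x⟯) : K ⊔ k⟮x⟯ = K ⊔ k⟮y⟯ :=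
  le_antisymm (sup_simple_le.2 ⟨le_sup_left, h⟩) (sup_simple_le.2 ⟨le_sup_left, h'⟩)

theorem ne_of_not_mem (hx : x ∉ acl K) (hy : y ∈ K) : x ≠ y := fun h => hx (h ▸ le_acl K hy)

theorem not_mem_acl_of_sup (hx : x ∉ acl K) (hy : x ∈ K ⊔ k⟮y⟯) : y ∉ acl K := fun h =>
  hx (acl_sup_simple h ▸ le_acl _ hy)

theorem fixIn_sup_of_inv [Finite G] (hK : Stable ρ K) (hx : x ∉ acl K)
    (hg : ∀ g, ρ g x = x ∨ ρ g x = 1 / x) : ∃ f, FixIn ρ (K ⊔ k⟮x⟯) = FixIn ρ K ⊔ k⟮f⟯ := by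
  have h0 : x ≠ 0 := ne_of_not_mem hx (zero_mem _)
  have h1 : 1 + x ≠ 0 := fun h => ne_of_not_mem hx (y := -1) fmem (by linear_combination h)
  have e1 : x ∈ K ⊔ k⟮1 / (1 + x)⟯ := by
    exact mem_of_eq (1 / (1 / (1 + x)) - 1) (by field_simp; ring)
  have e2 : K ⊔ k⟮x⟯ = K ⊔ k⟮1 / (1 + x)⟯ := sup_simple_eq e1 fmem
  rw [e2]
  refine fixIn_sup_simple hK (not_mem_acl_of_sup hx e1) fun g => ?_
  rcases hg g with h | h
  · exact ⟨1, fmem, 0, fmem, by simp [h]⟩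
  · exact ⟨-1, fmem, 1, fmem, by
      have h2 : x + 1 ≠ 0 := by rwa [add_comm]
      rw [map_div₀, map_add, map_one, h]; field_simp; ring⟩

theorem fixIn_sup_of_norm [Finite G] (hK : Stable ρ K) {x e A : Ω} (hx : x ∉ acl K) (he : e ∈ K)
    (he0 : e ≠ 0) (hA0 : A ≠ 0)
    (hg : ∀ g, (ρ g x = x ∧ ρ g e = e) ∨ (ρ g x = A / x ∧ ρ g e = A / e)) :
    ∃ f, FixIn ρ (K ⊔ k⟮x⟯) = FixIn ρ K ⊔ k⟮f⟯ := by
  have h0 : x ≠ 0 := ne_of_not_mem hx (zero_mem _)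
  have e1 : x ∈ K ⊔ k⟮x / e⟯ := by
    exact mem_of_eq (x / e * e) (by field_simp)
  rw [sup_simple_eq e1 fmem]
  refine fixIn_sup_of_inv hK (not_mem_acl_of_sup hx e1) fun g => ?_
  rcases hg g with ⟨h, h'⟩ | ⟨h, h'⟩
  · left; rw [map_div₀, h, h']
  · right; rw [map_div₀, h, h']; field_simp

theorem mem_of_conjugates {θ : Ω} {n : ℕ} (c : Fin n → Ω) (hc : ∀ i, c i ∈ E)
    (hrel : θ ^ n = ∑ i : Fin n, c i * θ ^ (i : ℕ)) (τ : Fin n → Ω ≃ₐ[k] Ω)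
    (hτ : ∀ i, ∀ y ∈ E, τ i y = y) (hinj : Function.Injective fun i => τ i θ) (hx : x ∈ E ⊔ k⟮θ⟯)
    (hfix : ∀ i, τ i x = x) : x ∈ E := by
  set P : Polynomial E := Polynomial.X ^ n -
    ∑ i : Fin n, Polynomial.C ⟨c i, hc i⟩ * Polynomial.X ^ (i : ℕ) with hP
  have hlt := Polynomial.degree_sum_fin_lt (fun i => (⟨c i, hc i⟩ : E))
  have hPm : P.Monic := Polynomial.monic_X_pow_sub hlt
  have hPd : P.degree = n := by
    rw [hP, Polynomial.degree_sub_eq_left_of_degree_lt] <;> rw [Polynomial.degree_X_pow]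
    exact hlt
  have hPθ : Polynomial.aeval θ P = 0 := by
    rw [hP, map_sub, map_sum]
    simp only [map_mul, map_pow, Polynomial.aeval_X, Polynomial.aeval_C]
    rw [sub_eq_zero, hrel]
    rfl
  have halg : IsAlgebraic E θ := ⟨P, hPm.ne_zero, hPθ⟩
  rw [← restrictScalars_adjoin_eq_sup, mem_restrictScalars, ← IntermediateField.mem_toSubalgebra,
    adjoin_simple_toSubalgebra_of_isAlgebraic halg, Algebra.adjoin_singleton_eq_range_aeval] at hx
  obtain ⟨Q, hQ⟩ := hx
  change Polynomial.aeval θ Q = x at hQ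
  set R := Q %ₘ P with hR
  have hRx : Polynomial.aeval θ R = x := by
    rw [← hQ, ← Polynomial.modByMonic_add_div Q P, map_add, map_mul, hPθ, zero_mul, add_zero]
  have hRd : R.degree < n := hPd ▸ Polynomial.degree_modByMonic_lt Q hPm
  set S : Polynomial Ω := R.map (algebraMap E Ω) - Polynomial.C x with hS
  have hS0 : S = 0 := by
    by_cases hn : n = 0
    · subst hn
      simp at hrel
    refine Polynomial.eq_zero_of_natDegree_lt_card_of_eval_eq_zero S hinj (fun i => ?_) ?_
    · rw [hS, Polynomial.eval_sub, Polynomial.eval_C, sub_eq_zero, Polynomial.eval_map]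
      have h1 : (τ i : Ω →+* Ω) (Polynomial.eval₂ (algebraMap E Ω) θ R) = x := by
        rw [← Polynomial.aeval_def, hRx]; exact hfix i
      rw [Polynomial.hom_eval₂] at h1
      rw [← h1]
      congr 1
      ext y
      exact (hτ i y y.2).symm
    · rw [Fintype.card_fin]
      refine (Polynomial.natDegree_sub_le _ _).trans_lt ?_
      rw [Polynomial.natDegree_C, Polynomial.natDegree_map, max_lt_iff]
      refine ⟨?_, Nat.pos_of_ne_zero hn⟩
      by_cases hR0 : R = 0
      · rw [hR0]; simpa using Nat.pos_of_ne_zero hn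
      · exact (Polynomial.natDegree_lt_iff_degree_lt hR0).2 hRd
  have := congrArg (Polynomial.eval 0) hS0
  rw [hS, Polynomial.eval_sub, Polynomial.eval_C, Polynomial.eval_map, Polynomial.eval₂_at_zero,
    Polynomial.eval_zero, sub_eq_zero] at this
  rw [← this]
  exact (R.coeff 0).2

theorem fixIn_le_of_conjugates {θ : Ω} (hL : L ≤ E ⊔ k⟮θ⟯) {n : ℕ} (c : Fin n → Ω)
    (hc : ∀ i, c i ∈ E) (hrel : θ ^ n = ∑ i : Fin n, c i * θ ^ (i : ℕ)) (τ : Fin n → G)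
    (hτ : ∀ i, ∀ y ∈ E, ρ (τ i) y = y) (hinj : Function.Injective fun i => ρ (τ i) θ) :
    FixIn ρ L ≤ FixIn ρ E := by
  intro x hx
  rw [mem_FixIn] at hx ⊢
  exact ⟨mem_of_conjugates c hc hrel (fun i => ρ (τ i)) hτ hinj (hL hx.1) fun i => hx.2 _, hx.2⟩

theorem fixIn_eq_of_conj_two {θ : Ω} (hEL : E ≤ L) (hL : L ≤ E ⊔ k⟮θ⟯) (a b : Ω) (ha : a ∈ E)
    (hb : b ∈ E) (hrel : θ ^ 2 = a * θ + b) (g : G) (hg : ∀ y ∈ E, ρ g y = y) (hne : ρ g θ ≠ θ) :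
    FixIn ρ L = FixIn ρ E := by
  refine le_antisymm ?_ (FixIn_mono ρ hEL)
  refine fixIn_le_of_conjugates hL ![b, a] ?_ ?_ ![1, g] ?_ ?_
  · intro i; fin_cases i <;> simpa
  · simp [Fin.sum_univ_succ, hrel]; ring
  · intro i; fin_cases i
    · simp
    · simpa using hg
  · intro i j
    fin_cases i <;> fin_cases j <;> simp [hne, hne.symm]

theorem fixIn_eq_of_conj_three {θ : Ω} (hEL : E ≤ L) (hL : L ≤ E ⊔ k⟮θ⟯) (a b c : Ω) (ha : a ∈ E)
    (hb : b ∈ E) (hc : c ∈ E) (hrel : θ ^ 3 = a * θ ^ 2 + b * θ + c) (g h : G)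
    (hg : ∀ y ∈ E, ρ g y = y) (hh : ∀ y ∈ E, ρ h y = y) (h1 : ρ g θ ≠ θ) (h2 : ρ h θ ≠ θ)
    (h3 : ρ g θ ≠ ρ h θ) : FixIn ρ L = FixIn ρ E := by
  refine le_antisymm ?_ (FixIn_mono ρ hEL)
  refine fixIn_le_of_conjugates hL ![c, b, a] ?_ ?_ ![1, g, h] ?_ ?_
  · intro i; fin_cases i <;> simpa
  · simp [Fin.sum_univ_succ, hrel]; ring
  · intro i; fin_cases i
    · simp
    · simpa using hg
    · simpa using hh
  · intro i j
    fin_cases i <;> fin_cases j <;> simp [h1, h1.symm, h2, h2.symm, h3, h3.symm]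

theorem fixIn_eq_of_conj_four {θ : Ω} (hEL : E ≤ L) (hL : L ≤ E ⊔ k⟮θ⟯) (a b c d : Ω) (ha : a ∈ E)
    (hb : b ∈ E) (hc : c ∈ E) (hd : d ∈ E) (hrel : θ ^ 4 = a * θ ^ 3 + b * θ ^ 2 + c * θ + d)
    (τ : Fin 4 → G) (hτ : ∀ i, ∀ y ∈ E, ρ (τ i) y = y)
    (hinj : Function.Injective fun i => ρ (τ i) θ) : FixIn ρ L = FixIn ρ E := by
  refine le_antisymm ?_ (FixIn_mono ρ hEL)
  refine fixIn_le_of_conjugates hL ![d, c, b, a] ?_ ?_ τ hτ hinj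
  · intro i; fin_cases i <;> simpa
  · simp [Fin.sum_univ_succ, hrel]; ring

theorem exists_generator_of_le_simple {w : Ω} (hw : w ∉ acl (⊥ : IntermediateField k Ω))
    {F : IntermediateField k Ω} (hF : F ≤ k⟮w⟯) : ∃ f, F = k⟮f⟯ := by
  have ht : Transcendental k w := by
    intro h
    apply hw
    rw [mem_acl]
    exact h.tower_top _
  let φ : RatFunc k →ₐ[k] Ω :=
    (k⟮w⟯).val.comp (RatFunc.algEquivOfTranscendental w ht : RatFunc k →ₐ[k] k⟮w⟯)
  refine ⟨φ (RatFunc.Luroth.generator (F.comap φ)), ?_⟩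
  have h1 : (F.comap φ).map φ = F := by
    apply le_antisymm
    · rw [map_le_iff_le_comap]
    · intro x hx
      refine ⟨(RatFunc.algEquivOfTranscendental w ht).symm ⟨x, hF hx⟩, ?_, ?_⟩
      · change φ _ ∈ F
        simpa [φ] using hx
      · change φ _ = x
        simp [φ]
  rw [← h1]
  conv_lhs => rw [RatFunc.Luroth.eq_adjoin_generator (E := F.comap φ)]
  rw [adjoin_map, Set.image_singleton]
  rw [h1]

theorem isAlgebraic_of_top_le_acl {s : Set Ω} (h : ⊤ ≤ acl (adjoin k s)) :
    Algebra.IsAlgebraic (Algebra.adjoin k s) Ω := by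
  rw [← isAlgebraic_adjoin_iff_top]
  exact ⟨fun x => mem_acl.1 (h trivial)⟩

theorem big_of_trdeg {n : ℕ} (h : Algebra.trdeg k Ω = n) : Big n (⊥ : IntermediateField k Ω) ⊤ := by
  intro s hs
  rw [bot_sup_eq] at hs
  have := isAlgebraic_of_top_le_acl hs
  have h2 := Algebra.IsAlgebraic.trdeg_le_cardinalMk k (s : Set Ω)
  rw [h] at h2
  simpa using h2

theorem isRational_of_genBy {n : ℕ} (h : Algebra.trdeg k Ω = n) (hE : GenBy n ⊥ E)
    (htop : ⊤ ≤ acl E) : ∃ n : ℕ, Nonempty (E ≃ₐ[k] FractionRing (MvPolynomial (Fin n) k)) := by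
  obtain ⟨s, hs, rfl⟩ := hE
  rw [bot_sup_eq] at htop ⊢
  let x : Fin s.card → Ω := fun i => (s.equivFin.symm i : Ω)
  have hx : Set.range x = (s : Set Ω) := by
    ext y
    simp only [Set.mem_range, x, Finset.mem_coe]
    constructor
    · rintro ⟨i, rfl⟩; exact (s.equivFin.symm i).2
    · intro hy; exact ⟨s.equivFin ⟨y, hy⟩, by simp⟩
  rw [← hx] at htop ⊢
  have := isAlgebraic_of_top_le_acl htop
  have hb : IsTranscendenceBasis k x := by
    refine Algebra.IsAlgebraic.isTranscendenceBasis_of_lift_le_trdeg_of_finite k x ?_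
    rw [h]
    simpa using hs
  exact ⟨s.card, ⟨hb.1.aevalEquivField.symm⟩⟩

theorem mem_acl_quartic {x a b c d : Ω} (ha : a ∈ K) (hb : b ∈ K) (hc : c ∈ K) (hd : d ∈ K)
    (h : x ^ 4 + a * x ^ 3 + b * x ^ 2 + c * x + d = 0) : x ∈ acl K := by
  refine mem_acl_of_poly (Polynomial.X ^ 4 + Polynomial.C a * Polynomial.X ^ 3 +
    Polynomial.C b * Polynomial.X ^ 2 + Polynomial.C c * Polynomial.X + Polynomial.C d) ?_ ?_
    (by simpa using h)
  · exact (by monicity! : (Polynomial.X ^ 4 + Polynomial.C a * Polynomial.X ^ 3 +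
      Polynomial.C b * Polynomial.X ^ 2 + Polynomial.C c * Polynomial.X + Polynomial.C d :
      Polynomial Ω).Monic).ne_zero
  · intro i
    simp only [Polynomial.coeff_add, Polynomial.coeff_X_pow, Polynomial.coeff_C_mul,
      Polynomial.coeff_X, Polynomial.coeff_C]
    refine add_mem (add_mem (add_mem (add_mem ?_ (mul_mem ha ?_)) (mul_mem hb ?_))
      (mul_mem hc ?_)) ?_ <;> split_ifs <;> simp [*]

/-- The invariants of `L` are generated by `n` elements over the invariants of `K`. -/
def RelGen (ρ : G →* (Ω ≃ₐ[k] Ω)) (n : ℕ) (K L : IntermediateField k Ω) : Prop :=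
  GenBy n (FixIn ρ K) (FixIn ρ L)

theorem RelGen.trans {m n : ℕ} {K L M : IntermediateField k Ω} (h : RelGen ρ m K L)
    (h' : RelGen ρ n L M) : RelGen ρ (m + n) K M :=
  GenBy.trans h h'

theorem RelGen.affine [Finite G] (hK : Stable ρ K) (hx : x ∉ acl K)
    (hg : ∀ g, ∃ a ∈ K, ∃ b ∈ K, ρ g x = a * x + b) : RelGen ρ 1 K (K ⊔ k⟮x⟯) := by
  obtain ⟨f, hf⟩ := fixIn_sup_simple hK hx hg
  exact GenBy.of_eq hf

theorem RelGen.inv [Finite G] (hK : Stable ρ K) (hx : x ∉ acl K)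
    (hg : ∀ g, ρ g x = x ∨ ρ g x = 1 / x) : RelGen ρ 1 K (K ⊔ k⟮x⟯) := by
  obtain ⟨f, hf⟩ := fixIn_sup_of_inv hK hx hg
  exact GenBy.of_eq hf

theorem fixIn_bot (ρ : G →* (Ω ≃ₐ[k] Ω)) : FixIn ρ ⊥ = ⊥ :=
  le_antisymm (FixIn_le ρ ⊥) bot_le

theorem RelGen.luroth (ρ : G →* (Ω ≃ₐ[k] Ω)) {w : Ω}
    (hw : w ∉ acl (⊥ : IntermediateField k Ω)) : RelGen ρ 1 ⊥ (⊥ ⊔ k⟮w⟯) := by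
  obtain ⟨f, hf⟩ := exists_generator_of_le_simple hw (F := FixIn ρ (⊥ ⊔ k⟮w⟯))
    ((FixIn_le ρ _).trans (by rw [bot_sup_eq]))
  refine GenBy.of_eq (f := f) ?_
  rw [hf, fixIn_bot, bot_sup_eq]

/-- If `x` is moved affinely over `K` and `y` affinely over `K(x)`, the invariants of `K(x, y)`
are generated by two elements. -/
theorem RelGen.affine_two [Finite G] (hK : Stable ρ K) (hx : x ∉ acl K) (hy : y ∉ acl (K ⊔ k⟮x⟯))
    (hgx : ∀ g, ∃ a ∈ K, ∃ b ∈ K, ρ g x = a * x + b)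
    (hgy : ∀ g, ∃ a ∈ K ⊔ k⟮x⟯, ∃ b ∈ K ⊔ k⟮x⟯, ρ g y = a * y + b) :
    RelGen ρ 2 K (K ⊔ k⟮x⟯ ⊔ k⟮y⟯) := by
  refine (RelGen.affine hK hx hgx).trans (RelGen.affine (hK.sup_simple fun g => ?_) hy hgy)
  obtain ⟨a, ha, b, hb, h⟩ := hgx g
  rw [h]
  exact fmem

theorem perm_three_cases : ∀ π : Equiv.Perm (Fin 3),
    (π 0 = 0 ∧ π 1 = 1 ∧ π 2 = 2) ∨ (π 0 = 1 ∧ π 1 = 2 ∧ π 2 = 0) ∨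
    (π 0 = 2 ∧ π 1 = 0 ∧ π 2 = 1) ∨ (π 0 = 1 ∧ π 1 = 0 ∧ π 2 = 2) ∨
    (π 0 = 0 ∧ π 1 = 2 ∧ π 2 = 1) ∨ (π 0 = 2 ∧ π 1 = 1 ∧ π 2 = 0) := by
  decide

theorem hex_relation (h : x * y * z = 1) (e₁ e₂ θ : Ω) (h₁ : e₁ = x + y + z)
    (h₂ : e₂ = y * z + z * x + x * y) (hθ : θ = x ^ 2 * y + y ^ 2 * z + z ^ 2 * x) :
    θ * (e₁ * e₂ - 3 - θ) = e₁ ^ 3 + e₂ ^ 3 - 6 * e₁ * e₂ + 9 := by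
  subst h₁ h₂ hθ
  grind

theorem hex_action {z : Fin 3 → Ω} {g : G} (hg : ∃ π : Equiv.Perm (Fin 3),
      (∀ i, ρ g (z i) = z (π i)) ∨ (∀ i, ρ g (z i) = 1 / z (π i))) (e₁ e₂ θ θ' : Ω)
    (h₁ : e₁ = z 0 + z 1 + z 2) (h₂ : e₂ = 1 / z 0 + 1 / z 1 + 1 / z 2)
    (hθ : θ = z 0 / z 2 + z 1 / z 0 + z 2 / z 1) (hθ' : θ' = z 2 / z 0 + z 0 / z 1 + z 1 / z 2) :
    (ρ g e₁ = e₁ ∧ ρ g e₂ = e₂ ∧ ρ g θ = θ ∧ ρ g θ' = θ') ∨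
    (ρ g e₁ = e₁ ∧ ρ g e₂ = e₂ ∧ ρ g θ = θ' ∧ ρ g θ' = θ) ∨
    (ρ g e₁ = e₂ ∧ ρ g e₂ = e₁ ∧ ρ g θ = θ ∧ ρ g θ' = θ') ∨
    (ρ g e₁ = e₂ ∧ ρ g e₂ = e₁ ∧ ρ g θ = θ' ∧ ρ g θ' = θ) := by
  obtain ⟨π, h⟩ := hg
  subst h₁ h₂ hθ hθ'
  rcases h with h | h <;>
  simp only [map_add, map_div₀, map_one, h] <;>
  rcases perm_three_cases π with ⟨a, b, c⟩ | ⟨a, b, c⟩ | ⟨a, b, c⟩ | ⟨a, b, c⟩ | ⟨a, b, c⟩ |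
    ⟨a, b, c⟩ <;> simp -failIfUnchanged only [a, b, c, inv_inv, div_eq_mul_inv, one_mul]
  all_goals first
    | exact Or.inl ⟨by first | trivial | ring1, by first | trivial | ring1, by first | trivial | ring1, by first | trivial | ring1⟩
    | exact Or.inr (Or.inl ⟨by first | trivial | ring1, by first | trivial | ring1, by first | trivial | ring1, by first | trivial | ring1⟩)
    | exact Or.inr (Or.inr (Or.inl ⟨by first | trivial | ring1, by first | trivial | ring1, by first | trivial | ring1, by first | trivial | ring1⟩))
    | exact Or.inr (Or.inr (Or.inr ⟨by first | trivial | ring1, by first | trivial | ring1, by first | trivial | ring1, by first | trivial | ring1⟩))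

/-- Projection of the quadric surface `M M' = 1 - 3 v (1 - v)` from its fixed point. -/
theorem relGen_hex_quadric [Finite G] (hK : Stable ρ K) {v M M' : Ω}
    (hB : Big 2 K (K ⊔ k⟮v⟯ ⊔ k⟮M⟯)) (hrel : M * M' = 1 - 3 * v * (1 - v))
    (hg : ∀ g, (ρ g v = v ∨ ρ g v = 1 - v) ∧
      (ρ g M = M ∧ ρ g M' = M' ∨ ρ g M = M' ∧ ρ g M' = M)) : RelGen ρ 2 K (K ⊔ k⟮v⟯ ⊔ k⟮M⟯) := by
  obtain ⟨hv, hM⟩ := hB.two (le_acl _)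
  have hM0 : M ≠ 0 := ne_of_not_mem hM (zero_mem _)
  have hM' : M' = (1 - 3 * v * (1 - v)) / M := by
    rw [← hrel]; field_simp
  have hd : 2 * v - 1 ≠ 0 := by
    intro h
    by_cases h2 : (2 : Ω) = 0
    · rw [h2] at h; simp at h
    · exact ne_of_not_mem hv (y := 1 / 2) fmem (by field_simp; linear_combination h)
  obtain ⟨d, hdd⟩ : ∃ d, d = 2 * v - 1 := ⟨_, rfl⟩
  rw [← hdd] at hd
  obtain ⟨w, hw⟩ : ∃ w, w = (M - M') / d := ⟨_, rfl⟩
  obtain ⟨x, hx⟩ : ∃ x, x = (M - v) / d := ⟨_, rfl⟩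
  have hwd : w * d = M - M' := by rw [hw]; field_simp
  have hxd : x * d = M - v := by rw [hx]; field_simp
  have key' : (1 - v) * (2 * x - w + 1) + d * ((1 + x) * (1 + x - w) - 1) = 0 := by
    have h1 : d * ((1 - v) * (2 * x - w + 1) + d * ((1 + x) * (1 + x - w) - 1)) = 0 := by
      have e1 : d * ((1 - v) * (2 * x - w + 1) + d * ((1 + x) * (1 + x - w) - 1)) =
        (1 - v) * (2 * (x * d) - w * d + d) +
          ((d + x * d) * (d + x * d - w * d) - d * d) := by ring
      rw [e1, hwd, hxd, hdd]
      linear_combination hrel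
    exact (mul_eq_zero.1 h1).resolve_left hd
  have key : d * ((2 * x - w + 1) - 2 * ((1 + x) * (1 + x - w) - 1)) = 2 * x - w + 1 := by
    rw [hdd] at key' ⊢
    linear_combination (-2 : Ω) * key'
  have hMv : M = v + x * d := by linear_combination -hxd
  have hden : (2 * x - w + 1) - 2 * ((1 + x) * (1 + x - w) - 1) ≠ 0 := by
    intro h
    rw [h, mul_zero] at key
    have hxa : x ∈ acl K := by
      refine mem_acl_quadratic (a := 1) (b := 1) (one_mem _) (one_mem _) ?_
      rw [← key, mul_zero, zero_add] at key'
      have h5 := (mul_eq_zero.1 key').resolve_left hd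
      linear_combination -h5 - (1 + x) * key
    apply hM
    rw [hMv]
    have h3 : v ∈ acl (K ⊔ k⟮v⟯) := le_acl _ (mem_right _ _)
    have h4 : x ∈ acl (K ⊔ k⟮v⟯) := acl_mono le_sup_left hxa
    rw [hdd]
    exact fmem
  have hdE : d ∈ K ⊔ k⟮w⟯ ⊔ k⟮x⟯ := by
    refine mem_of_eq ((2 * x - w + 1) / ((2 * x - w + 1) - 2 * ((1 + x) * (1 + x - w) - 1))) ?_
    rw [eq_div_iff hden]
    exact key
  have hvE : v ∈ K ⊔ k⟮w⟯ ⊔ k⟮x⟯ := by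
    have h1 : 1 - v = -((1 + x) * (1 + x - w) - 1) /
        ((2 * x - w + 1) - 2 * ((1 + x) * (1 + x - w) - 1)) := by
      rw [eq_div_iff hden]
      linear_combination key' - ((1 + x) * (1 + x - w) - 1) * hdd
    refine mem_of_eq (1 - -((1 + x) * (1 + x - w) - 1) /
        ((2 * x - w + 1) - 2 * ((1 + x) * (1 + x - w) - 1))) ?_
    rw [← h1]; ring
  have hME : M ∈ K ⊔ k⟮w⟯ ⊔ k⟮x⟯ := by rw [hMv]; exact fmem
  have hdv : d ∈ K ⊔ k⟮v⟯ ⊔ k⟮M⟯ := by rw [hdd]; exact fmem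
  have hM'v : M' ∈ K ⊔ k⟮v⟯ ⊔ k⟮M⟯ := by rw [hM']; exact fmem
  have heq : K ⊔ k⟮v⟯ ⊔ k⟮M⟯ = K ⊔ k⟮w⟯ ⊔ k⟮x⟯ := by
    refine le_antisymm (sup_simple_le.2 ⟨sup_simple_le.2 ⟨le_sup_left.trans le_sup_left, hvE⟩, hME⟩)
      (sup_simple_le.2 ⟨sup_simple_le.2 ⟨le_sup_left.trans le_sup_left, ?_⟩, ?_⟩)
    · rw [hw]; exact fmem
    · rw [hx]; exact fmem
  rw [heq] at hB ⊢
  obtain ⟨hw', hx'⟩ := hB.two (le_acl _)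
  have hgd : ∀ g, ρ g v = 1 - v → ρ g d = -d := by
    intro g h
    simp only [hdd, map_sub, map_mul, map_ofNat, map_one, h]; ring
  have hgd' : ∀ g, ρ g v = v → ρ g d = d := by
    intro g h
    simp only [hdd, map_sub, map_mul, map_ofNat, map_one, h]
  refine RelGen.affine_two hK hw' hx' (fun g => ?_) (fun g => ?_)
  · obtain ⟨h1 | h1, ⟨h2, h3⟩ | ⟨h2, h3⟩⟩ := hg g
    · exact ⟨1, fmem, 0, fmem, by rw [hw, map_div₀, map_sub, h2, h3, hgd' g h1]; ring⟩
    · exact ⟨-1, fmem, 0, fmem, by rw [hw, map_div₀, map_sub, h2, h3, hgd' g h1]; ring⟩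
    · exact ⟨-1, fmem, 0, fmem, by rw [hw, map_div₀, map_sub, h2, h3, hgd g h1]; ring⟩
    · exact ⟨1, fmem, 0, fmem, by rw [hw, map_div₀, map_sub, h2, h3, hgd g h1]; ring⟩
  · obtain ⟨h1 | h1, ⟨h2, h3⟩ | ⟨h2, h3⟩⟩ := hg g
    · exact ⟨1, fmem, 0, fmem, by rw [hx, map_div₀, map_sub, h2, h1, hgd' g h1]; ring⟩
    · exact ⟨1, fmem, -w, fmem, by rw [hw, hx, map_div₀, map_sub, h2, h1, hgd' g h1]; ring⟩
    · refine ⟨-1, fmem, -1, fmem, ?_⟩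
      rw [hx, map_div₀, map_sub, h2, h1, hgd g h1]
      field_simp
      rw [hdd]; ring
    · refine ⟨-1, fmem, w - 1, fmem, ?_⟩
      rw [hw, hx, map_div₀, map_sub, h2, h1, hgd g h1]
      field_simp
      rw [hdd]; ring

set_option maxHeartbeats 1000000 in
theorem relGen_hex_cubic [Finite G] (hK : Stable ρ K) {e₁ e₂ θ θ' : Ω}
    (hB : Big 2 K (K ⊔ k⟮e₁⟯ ⊔ k⟮e₂⟯)) (hsum : θ + θ' = e₁ * e₂ - 3)
    (hprod : θ * θ' = e₁ ^ 3 + e₂ ^ 3 - 6 * e₁ * e₂ + 9)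
    (hg : ∀ g, (ρ g e₁ = e₁ ∧ ρ g e₂ = e₂ ∧ ρ g θ = θ ∧ ρ g θ' = θ') ∨
      (ρ g e₁ = e₁ ∧ ρ g e₂ = e₂ ∧ ρ g θ = θ' ∧ ρ g θ' = θ) ∨
      (ρ g e₁ = e₂ ∧ ρ g e₂ = e₁ ∧ ρ g θ = θ ∧ ρ g θ' = θ') ∨
      (ρ g e₁ = e₂ ∧ ρ g e₂ = e₁ ∧ ρ g θ = θ' ∧ ρ g θ' = θ)) :
    RelGen ρ 2 K (K ⊔ k⟮e₁⟯ ⊔ k⟮e₂⟯ ⊔ k⟮θ⟯) := by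
  obtain ⟨a, ha⟩ : ∃ a, a = e₁ - 3 := ⟨_, rfl⟩
  obtain ⟨b, hb⟩ : ∃ b, b = e₂ - 3 := ⟨_, rfl⟩
  obtain ⟨c, hc⟩ : ∃ c, c = θ - 3 := ⟨_, rfl⟩
  obtain ⟨c', hc'⟩ : ∃ c', c' = θ' - 3 := ⟨_, rfl⟩
  have he₁ : e₁ = a + 3 := by rw [ha]; ring
  have he₂ : e₂ = b + 3 := by rw [hb]; ring
  have hθ : θ = c + 3 := by rw [hc]; ring
  have hθ' : θ' = c' + 3 := by rw [hc']; ring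
  have hcc : c + c' = a * b + 3 * a + 3 * b := by
    rw [hc, hc', ha, hb]; linear_combination hsum
  have hcc' : c * c' = (a ^ 2 - a * b + b ^ 2) * (a + b + 9) := by
    rw [hc, hc', ha, hb]; linear_combination hprod - 3 * hsum
  have hb0 : b ≠ 0 := by
    intro h
    exact ne_of_not_mem (hB.two (le_acl _)).2 (y := 3) fmem (by rw [he₂, h, zero_add])
  have hp : a / b ∉ acl K := by
    refine (hB.two (x := a / b) (y := b) ?_).1
    refine (le_trans ?_ (le_acl _))
    refine sup_simple_le.2 ⟨sup_simple_le.2 ⟨le_sup_left.trans le_sup_left, ?_⟩, ?_⟩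
    · exact mem_of_eq (a / b * b + 3) (by rw [he₁]; field_simp)
    · rw [he₂]; exact fmem
  have hab : a + b ≠ 0 := by
    intro h
    exact ne_of_not_mem hp (y := -1) fmem (by field_simp; linear_combination h)
  have ha0 : a ≠ 0 := by
    intro h
    exact ne_of_not_mem hp (y := 0) fmem (by rw [h]; simp)
  have hN : a ^ 2 - a * b + b ^ 2 ≠ 0 := by
    intro h
    apply hp
    exact mem_acl_quadratic (a := -1) (b := 1) fmem fmem (by field_simp; linear_combination h)
  obtain ⟨v, hv⟩ : ∃ v, v = b / (a + b) := ⟨_, rfl⟩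
  obtain ⟨M, hM⟩ : ∃ M, M = a * b * c / ((a ^ 2 - a * b + b ^ 2) * (a + b)) - 1 := ⟨_, rfl⟩
  obtain ⟨M', hM'⟩ : ∃ M', M' = a * b * c' / ((a ^ 2 - a * b + b ^ 2) * (a + b)) - 1 := ⟨_, rfl⟩
  have hMM : M * M' * (a + b) ^ 2 = a ^ 2 - a * b + b ^ 2 := by
    have : M * M' = a ^ 2 * b ^ 2 * (c * c') / ((a ^ 2 - a * b + b ^ 2) * (a + b)) ^ 2 -
      a * b * (c + c') / ((a ^ 2 - a * b + b ^ 2) * (a + b)) + 1 := by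
      rw [hM, hM']
      generalize (a ^ 2 - a * b + b ^ 2) * (a + b) = S
      ring
    rw [this, hcc, hcc']
    generalize hNN : a ^ 2 - a * b + b ^ 2 = N at hN ⊢
    field_simp
    rw [← hNN]
    ring
  have hM0 : M ≠ 0 := by
    rintro rfl
    apply hN
    rw [← hMM]; ring
  have hrel : M * M' = 1 - 3 * v * (1 - v) := by
    rw [eq_div_of_mul_eq (pow_ne_zero 2 hab) hMM, hv]
    field_simp
    ring
  have hv0 : v ≠ 0 := by rw [hv]; exact div_ne_zero hb0 hab
  obtain ⟨p, hp'⟩ : ∃ p, p = (1 - v) / v := ⟨_, rfl⟩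
  have hap : a = p * b := by rw [hp', hv]; field_simp; ring
  have hp0 : p ≠ 0 := by rintro rfl; simp at hap; exact ha0 hap
  have hp1 : p + 1 ≠ 0 := by
    intro h; apply hab; rw [hap]; linear_combination b * h
  have hpn : p ^ 2 - p + 1 ≠ 0 := by
    intro h; apply hN; rw [hap]; linear_combination b ^ 2 * h
  obtain ⟨β, hβ⟩ : ∃ β, β = (M + 1) * ((p ^ 2 - p + 1) * (p + 1)) / p := ⟨_, rfl⟩
  have hN' : a ^ 2 - a * b + b ^ 2 = b ^ 2 * (p ^ 2 - p + 1) := by rw [hap]; ring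
  have hab' : a + b = b * (p + 1) := by rw [hap]; ring
  have hcβ : c = β * b := by
    rw [hβ, hM, hN', hab', hap]
    generalize p ^ 2 - p + 1 = n at hpn ⊢
    field_simp
    ring
  have hquad : c ^ 2 - (a * b + 3 * a + 3 * b) * c + (a ^ 2 - a * b + b ^ 2) * (a + b + 9) = 0 := by
    rw [← hcc, ← hcc']; ring
  have hb' : b = (β ^ 2 - 3 * (p + 1) * β + 9 * (p ^ 2 - p + 1)) /
      (M * ((p ^ 2 - p + 1) * (p + 1))) := by
    have h1 : β * p = (M + 1) * ((p ^ 2 - p + 1) * (p + 1)) := by rw [hβ]; field_simp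
    rw [eq_div_iff (mul_ne_zero hM0 (mul_ne_zero hpn hp1))]
    rw [hcβ, hap] at hquad
    have h2 : b ^ 2 * (β ^ 2 - (p * b + 3 * p + 3) * β + (p ^ 2 - p + 1) * (p * b + b + 9)) = 0 := by
      linear_combination hquad
    have h3 := (mul_eq_zero.1 h2).resolve_left (pow_ne_zero 2 hb0)
    linear_combination -h3 - b * h1
  have heq : K ⊔ k⟮e₁⟯ ⊔ k⟮e₂⟯ ⊔ k⟮θ⟯ = K ⊔ k⟮v⟯ ⊔ k⟮M⟯ := by
    have hp2 : p ∈ K ⊔ k⟮v⟯ ⊔ k⟮M⟯ := by rw [hp']; exact fmem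
    have hβ2 : β ∈ K ⊔ k⟮v⟯ ⊔ k⟮M⟯ := by rw [hβ]; exact fmem
    have hb2 : b ∈ K ⊔ k⟮v⟯ ⊔ k⟮M⟯ := by rw [hb']; exact fmem
    have ha3 : a ∈ K ⊔ k⟮e₁⟯ ⊔ k⟮e₂⟯ ⊔ k⟮θ⟯ := by rw [ha]; exact fmem
    have hb3 : b ∈ K ⊔ k⟮e₁⟯ ⊔ k⟮e₂⟯ ⊔ k⟮θ⟯ := by rw [hb]; exact fmem
    have hc3 : c ∈ K ⊔ k⟮e₁⟯ ⊔ k⟮e₂⟯ ⊔ k⟮θ⟯ := by rw [hc]; exact fmem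
    refine le_antisymm ?_ ?_
    · simp only [sup_simple_le]
      refine ⟨⟨⟨le_sup_left.trans le_sup_left, ?_⟩, ?_⟩, ?_⟩
      · rw [he₁, hap]; exact fmem
      · rw [he₂]; exact fmem
      · rw [hθ, hcβ]; exact fmem
    · simp only [sup_simple_le]
      refine ⟨⟨le_sup_left.trans (le_sup_left.trans le_sup_left), ?_⟩, ?_⟩
      · rw [hv]; exact fmem
      · rw [hM]; exact fmem
  have hB2 : Big 2 K (K ⊔ k⟮v⟯ ⊔ k⟮M⟯) := by
    rw [← heq]
    exact hB.mono le_rfl (le_acl _) le_sup_left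
  rw [heq]
  refine relGen_hex_quadric hK hB2 hrel fun g => ?_
  have hba : b + a ≠ 0 := by rwa [add_comm]
  have hN2 : b ^ 2 - b * a + a ^ 2 ≠ 0 := by intro h; apply hN; linear_combination h
  have e1 : 1 - b / (a + b) = a / (b + a) := by field_simp; ring
  have e2 : ∀ x, b * a * x / ((b ^ 2 - b * a + a ^ 2) * (b + a)) =
      a * b * x / ((a ^ 2 - a * b + b ^ 2) * (a + b)) := by intro x; congr 1 <;> ring
  obtain ⟨h1, h2, h3, h4⟩ | ⟨h1, h2, h3, h4⟩ | ⟨h1, h2, h3, h4⟩ | ⟨h1, h2, h3, h4⟩ := hg g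
  · have i1 : ρ g a = a := by rw [ha, map_sub, map_ofNat, h1]
    have i2 : ρ g b = b := by rw [hb, map_sub, map_ofNat, h2]
    have i3 : ρ g c = c := by rw [hc, map_sub, map_ofNat, h3]
    have i4 : ρ g c' = c' := by rw [hc', map_sub, map_ofNat, h4]
    refine ⟨Or.inl ?_, Or.inl ⟨?_, ?_⟩⟩ <;> simp only [hv, hM, hM', map_div₀, map_mul, map_add, map_sub, map_pow, map_one, i1, i2, i3, i4]
  · have i1 : ρ g a = a := by rw [ha, map_sub, map_ofNat, h1]
    have i2 : ρ g b = b := by rw [hb, map_sub, map_ofNat, h2]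
    have i3 : ρ g c = c' := by rw [hc, map_sub, map_ofNat, h3, hc']
    have i4 : ρ g c' = c := by rw [hc', map_sub, map_ofNat, h4, hc]
    refine ⟨Or.inl ?_, Or.inr ⟨?_, ?_⟩⟩ <;> simp only [hv, hM, hM', map_div₀, map_mul, map_add, map_sub, map_pow, map_one, i1, i2, i3, i4]
  · have i1 : ρ g a = b := by rw [ha, map_sub, map_ofNat, h1, hb]
    have i2 : ρ g b = a := by rw [hb, map_sub, map_ofNat, h2, ha]
    have i3 : ρ g c = c := by rw [hc, map_sub, map_ofNat, h3]
    have i4 : ρ g c' = c' := by rw [hc', map_sub, map_ofNat, h4]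
    refine ⟨Or.inr ?_, Or.inl ⟨?_, ?_⟩⟩ <;> simp only [hv, hM, hM', map_div₀, map_mul, map_add, map_sub, map_pow, map_one, i1, i2, i3, i4, e1, e2]
  · have i1 : ρ g a = b := by rw [ha, map_sub, map_ofNat, h1, hb]
    have i2 : ρ g b = a := by rw [hb, map_sub, map_ofNat, h2, ha]
    have i3 : ρ g c = c' := by rw [hc, map_sub, map_ofNat, h3, hc']
    have i4 : ρ g c' = c := by rw [hc', map_sub, map_ofNat, h4, hc]
    refine ⟨Or.inr ?_, Or.inr ⟨?_, ?_⟩⟩ <;> simp only [hv, hM, hM', map_div₀, map_mul, map_add, map_sub, map_pow, map_one, i1, i2, i3, i4, e1, e2]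

theorem fix_sup_simple {f : Ω ≃ₐ[k] Ω} (hK : ∀ y ∈ K, f y = y) (hx : f x = x) :
    ∀ y ∈ K ⊔ k⟮x⟯, f y = y := by
  have key : ∀ z, z ∈ fixedField (Subgroup.zpowers f) ↔ f z = z := by
    intro z
    rw [mem_fixedField_iff]
    refine ⟨fun h => h f (Subgroup.mem_zpowers f), fun h g hg => ?_⟩
    have h2 : f ∈ MulAction.stabilizer (Ω ≃ₐ[k] Ω) z := h
    exact (Subgroup.zpowers_le.2 h2) hg
  intro y hy
  rw [← key]
  refine (sup_simple_le.2 ⟨fun z hz => ?_, ?_⟩ : K ⊔ k⟮x⟯ ≤ fixedField (Subgroup.zpowers f)) hy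
  · rw [key]; exact hK z hz
  · rw [key]; exact hx

set_option maxHeartbeats 1000000 in
/-- Two-dimensional hexagonal actions, relative to a base field `K` fixed by a rotation. -/
theorem relGen_hex [Finite G] (hK : Stable ρ K) {z : Fin 3 → Ω} (hz : z 0 * z 1 * z 2 = 1)
    (hB : Big 2 K (K ⊔ k⟮z 0⟯ ⊔ k⟮z 1⟯)) (hg : ∀ g, ∃ π : Equiv.Perm (Fin 3),
      (∀ i, ρ g (z i) = z (π i)) ∨ (∀ i, ρ g (z i) = 1 / z (π i))) (c : G)
    (hcK : ∀ y ∈ K, ρ c y = y) (hcz : ∀ i, ρ c (z i) = z (i + 1)) :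
    RelGen ρ 2 K (K ⊔ k⟮z 0⟯ ⊔ k⟮z 1⟯) := by
  have hz0 : z 0 ≠ 0 := by intro h; simp [h] at hz
  have hz1 : z 1 ≠ 0 := by intro h; simp [h] at hz
  have hz2 : z 2 ≠ 0 := by intro h; simp [h] at hz
  obtain ⟨e₁, h₁⟩ : ∃ e₁, e₁ = z 0 + z 1 + z 2 := ⟨_, rfl⟩
  obtain ⟨e₂, h₂⟩ : ∃ e₂, e₂ = 1 / z 0 + 1 / z 1 + 1 / z 2 := ⟨_, rfl⟩
  obtain ⟨θ, hθ⟩ : ∃ θ, θ = z 0 / z 2 + z 1 / z 0 + z 2 / z 1 := ⟨_, rfl⟩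
  obtain ⟨θ', hθ'⟩ : ∃ θ', θ' = z 2 / z 0 + z 0 / z 1 + z 1 / z 2 := ⟨_, rfl⟩
  have i0 : 1 / z 0 = z 1 * z 2 := by field_simp; linear_combination -hz
  have i1 : 1 / z 1 = z 2 * z 0 := by field_simp; linear_combination -hz
  have i2 : 1 / z 2 = z 0 * z 1 := by field_simp; linear_combination -hz
  have j2 : z 2 = 1 / (z 0 * z 1) := by field_simp; linear_combination hz
  have h₂' : e₂ = z 1 * z 2 + z 2 * z 0 + z 0 * z 1 := by rw [h₂, i0, i1, i2]
  have hθ2 : θ = z 0 ^ 2 * z 1 + z 1 ^ 2 * z 2 + z 2 ^ 2 * z 0 := by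
    rw [hθ, div_eq_mul_one_div, i2, div_eq_mul_one_div (z 1), i0, div_eq_mul_one_div (z 2), i1]; ring
  have hsum : θ + θ' = e₁ * e₂ - 3 := by
    rw [hθ, hθ', h₁, h₂]
    field_simp
    ring
  have hθ'2 : θ' = e₁ * e₂ - 3 - θ := by linear_combination hsum
  have hprod : θ * θ' = e₁ ^ 3 + e₂ ^ 3 - 6 * e₁ * e₂ + 9 := by
    rw [hθ'2]
    exact hex_relation hz e₁ e₂ θ h₁ h₂' hθ2
  have hcub : ∀ x, (x - z 0) * (x - z 1) * (x - z 2) = 0 → x ^ 3 + (-e₁) * x ^ 2 + e₂ * x + (-1) = 0 := by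
    intro x hx
    rw [h₁, h₂']
    linear_combination hx + hz
  have hBe : Big 2 K (K ⊔ k⟮e₁⟯ ⊔ k⟮e₂⟯) := by
    refine hB.acl_right ?_
    simp only [sup_simple_le]
    refine ⟨⟨(le_sup_left.trans le_sup_left).trans (le_acl _), ?_⟩, ?_⟩
    · exact mem_acl_cubic fmem fmem fmem (hcub _ (by ring))
    · exact mem_acl_cubic fmem fmem fmem (hcub _ (by ring))
  obtain ⟨hn0, hn1⟩ := hB.two (le_acl _)
  have n10 : z 1 ≠ z 0 := ne_of_not_mem hn1 (mem_right _ _)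
  have n20 : z 2 ≠ z 0 := by
    intro h
    have : z 1 = 1 / z 0 ^ 2 := by
      rw [h] at hz; field_simp; linear_combination hz
    exact ne_of_not_mem hn1 fmem this
  have n12 : z 1 ≠ z 2 := by
    intro h
    apply hn1
    refine mem_acl_quadratic (a := 0) (b := - (1 / z 0)) fmem fmem ?_
    rw [i0, ← h]; ring
  have hact := fun g => hex_action (hg g) e₁ e₂ θ θ' h₁ h₂ hθ hθ'
  refine (congrArg (GenBy 2 (FixIn ρ K)) ?_).mpr (relGen_hex_cubic hK hBe hsum hprod hact)
  have c0 : ρ c (z 0) = z 1 := hcz 0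
  have c1 : ρ c (z 1) = z 2 := hcz 1
  have c2 : ρ c (z 2) = z 0 := hcz 2
  have hcE : ∀ y ∈ K ⊔ k⟮e₁⟯ ⊔ k⟮e₂⟯ ⊔ k⟮θ⟯, ρ c y = y := by
    refine fix_sup_simple (fix_sup_simple (fix_sup_simple hcK ?_) ?_) ?_
    · rw [h₁, map_add, map_add, c0, c1, c2]; ring
    · simp only [h₂, map_add, map_div₀, c0, c1, c2, map_one]; ring
    · simp only [hθ, map_add, map_div₀, c0, c1, c2]; ring
  have hz2L : z 2 ∈ K ⊔ k⟮z 0⟯ ⊔ k⟮z 1⟯ := by rw [j2]; exact fmem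
  refine fixIn_eq_of_conj_three (θ := z 0) ?_ ?_ e₁ (-e₂) 1 fmem fmem fmem ?_ c (c * c) hcE ?_ ?_ ?_ ?_
  · simp only [sup_simple_le]
    refine ⟨⟨⟨le_sup_left.trans le_sup_left, ?_⟩, ?_⟩, ?_⟩
    · rw [h₁]; exact fmem
    · rw [h₂]; exact fmem
    · rw [hθ]; exact fmem
  · simp only [sup_simple_le]
    refine ⟨⟨le_sup_left.trans (le_sup_left.trans (le_sup_left.trans le_sup_left)), mem_right _ _⟩, ?_⟩
    have hE : ∀ y ∈ K ⊔ k⟮e₁⟯ ⊔ k⟮e₂⟯ ⊔ k⟮θ⟯, y ∈ K ⊔ k⟮e₁⟯ ⊔ k⟮e₂⟯ ⊔ k⟮θ⟯ ⊔ k⟮z 0⟯ :=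
      fun y hy => mem_left hy
    have m1 := hE e₁ fmem
    have m2 := hE e₂ fmem
    have m3 := hE θ fmem
    refine mem_of_eq ((θ - z 0 * (e₁ - z 0) ^ 2 + 1) / (z 0 ^ 2 + 1 / z 0 - z 0 * (e₁ - z 0))) ?_
    rw [eq_div_iff, i0, hθ2, h₁]
    · linear_combination hz
    · rw [i0, h₁]
      intro h
      have : (z 0 - z 1) * (z 0 - z 2) = 0 := by linear_combination h
      rcases mul_eq_zero.1 this with h | h
      · exact n10 (by linear_combination -h)
      · exact n20 (by linear_combination -h)
  · linear_combination hcub (z 0) (by ring)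
  · intro y hy
    rw [map_mul, AlgEquiv.mul_apply, hcE y hy, hcE y hy]
  · rwa [c0]
  · rw [map_mul, AlgEquiv.mul_apply, c0, c1]; exact n20
  · rw [map_mul, AlgEquiv.mul_apply, c0, c1]; exact n12

theorem sup_two_eq {x y u v : Ω} (hx : x ∈ K ⊔ k⟮u⟯ ⊔ k⟮v⟯) (hy : y ∈ K ⊔ k⟮u⟯ ⊔ k⟮v⟯)
    (hu : u ∈ K ⊔ k⟮x⟯ ⊔ k⟮y⟯) (hv : v ∈ K ⊔ k⟮x⟯ ⊔ k⟮y⟯) : K ⊔ k⟮x⟯ ⊔ k⟮y⟯ = K ⊔ k⟮u⟯ ⊔ k⟮v⟯ := by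
  refine le_antisymm ?_ ?_ <;> simp only [sup_simple_le]
  · exact ⟨⟨le_sup_left.trans le_sup_left, hx⟩, hy⟩
  · exact ⟨⟨le_sup_left.trans le_sup_left, hu⟩, hv⟩

/-- `f` permutes `x`, `y` up to inversion. -/
def InvPerm (f : Ω ≃ₐ[k] Ω) (x y : Ω) : Prop :=
  ((f x = x ∨ f x = 1 / x) ∧ (f y = y ∨ f y = 1 / y)) ∨
    ((f x = y ∨ f x = 1 / y) ∧ (f y = x ∨ f y = 1 / x))

/-- `f` permutes `x`, `y` up to sign. -/
def NegPerm (f : Ω ≃ₐ[k] Ω) (x y : Ω) : Prop :=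
  ((f x = x ∨ f x = -x) ∧ (f y = y ∨ f y = -y)) ∨
    ((f x = y ∨ f x = -y) ∧ (f y = x ∨ f y = -x))

/-- The coordinate turning inversion into negation. -/
def cay (x : Ω) : Ω := (1 - x) / (1 + x)

theorem cay_cay (h2 : (2 : Ω) ≠ 0) (hx : 1 + x ≠ 0) : cay (cay x) = x := by
  unfold cay
  have h3 : 1 + (1 - x) / (1 + x) ≠ 0 := by
    intro h
    apply h2
    field_simp at h
    linear_combination h
  rw [div_eq_iff h3]
  field_simp
  ring

theorem cay_inv (hx : x ≠ 0) : cay (1 / x) = -cay x := by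
  unfold cay
  by_cases h : 1 + x = 0
  · have : 1 + 1 / x = 0 := by field_simp; linear_combination h
    simp [h]
    right
    simpa using this
  · have : 1 + 1 / x ≠ 0 := by
      intro h'; apply h; field_simp at h'; linear_combination h'
    rw [← neg_div, div_eq_div_iff this h]
    field_simp
    ring

theorem map_cay (f : Ω ≃ₐ[k] Ω) (x : Ω) : f (cay x) = cay (f x) := by
  simp [cay]

theorem InvPerm.negPerm_cay {f : Ω ≃ₐ[k] Ω} (hx : x ≠ 0) (hy : y ≠ 0) (h : InvPerm f x y) :
    NegPerm f (cay x) (cay y) := by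
  have aux : ∀ {s t : Ω}, t ≠ 0 → (f s = t ∨ f s = 1 / t) → (f (cay s) = cay t ∨ f (cay s) = -cay t) := by
    rintro s t ht (h | h)
    · left; rw [map_cay, h]
    · right; rw [map_cay, h, cay_inv ht]
  rcases h with ⟨h1, h2⟩ | ⟨h1, h2⟩
  · exact Or.inl ⟨aux hx h1, aux hy h2⟩
  · exact Or.inr ⟨aux hy h1, aux hx h2⟩

theorem cay_mem (h : x ∈ K) : cay x ∈ K := by
  unfold cay; exact fmem

theorem one_add_ne_zero_of_not_mem (hx : x ∉ acl K) : 1 + x ≠ 0 := fun h => ne_of_not_mem hx (y := -1) fmem (by linear_combination h)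

theorem sup_cay_cay (h2 : (2 : Ω) ≠ 0) (hx : 1 + x ≠ 0) (hy : 1 + y ≠ 0) :
    K ⊔ k⟮x⟯ ⊔ k⟮y⟯ = K ⊔ k⟮cay x⟯ ⊔ k⟮cay y⟯ := by
  refine sup_two_eq ?_ ?_ ?_ ?_
  · have h := cay_mem (K := K ⊔ k⟮cay x⟯ ⊔ k⟮cay y⟯) (mem_left (mem_right K (cay x)))
    rwa [cay_cay h2 hx] at h
  · have h := cay_mem (mem_right (K ⊔ k⟮cay x⟯) (cay y))
    rwa [cay_cay h2 hy] at h
  · exact cay_mem (mem_left (mem_right K x))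
  · exact cay_mem (mem_right _ y)

theorem NegPerm.map_div {f : Ω ≃ₐ[k] Ω} {u v : Ω} (h : NegPerm f u v) :
    f (u / v) = u / v ∨ f (u / v) = -(u / v) ∨ f (u / v) = 1 / (u / v) ∨
      f (u / v) = -(1 / (u / v)) := by
  rw [map_div₀]
  rcases h with ⟨h1 | h1, h2 | h2⟩ | ⟨h1 | h1, h2 | h2⟩ <;> rw [h1, h2]
  · left; rfl
  · right; left; ring
  · right; left; ring
  · left; ring
  · right; right; left; simp
  · right; right; right; simp [div_neg]
  · right; right; right; simp [neg_div]
  · right; right; left; simp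

theorem RelGen.of_negPerm [Finite G] (hK : Stable ρ K) {u v : Ω} (hB : Big 2 K (K ⊔ k⟮u⟯ ⊔ k⟮v⟯))
    (hg : ∀ g, NegPerm (ρ g) u v) :
    u / v ∉ acl K ∧ Stable ρ (K ⊔ k⟮u / v⟯) ∧ RelGen ρ 1 (K ⊔ k⟮u / v⟯) (K ⊔ k⟮u⟯ ⊔ k⟮v⟯) := by
  have hv0 : v ≠ 0 := ne_of_not_mem (hB.two (le_acl _)).2 fmem
  have hu0 : u ≠ 0 := ne_of_not_mem (hB.two (le_acl _)).1 fmem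
  have heq : K ⊔ k⟮u⟯ ⊔ k⟮v⟯ = K ⊔ k⟮u / v⟯ ⊔ k⟮v⟯ :=
    sup_two_eq (mem_of_eq (u / v * v) (by field_simp)) fmem fmem fmem
  rw [heq] at hB ⊢
  obtain ⟨h1, h2⟩ := hB.two (le_acl _)
  have hst : Stable ρ (K ⊔ k⟮u / v⟯) := by
    refine hK.sup_simple fun g => ?_
    obtain h | h | h | h := (hg g).map_div <;> rw [h] <;> exact fmem
  refine ⟨h1, hst, RelGen.affine hst h2 fun g => ?_⟩
  obtain ⟨-, h | h⟩ | ⟨-, h | h⟩ := hg g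
  · exact ⟨1, fmem, 0, fmem, by rw [h]; ring⟩
  · exact ⟨-1, fmem, 0, fmem, by rw [h]; ring⟩
  · exact ⟨u / v, fmem, 0, fmem, by rw [h]; field_simp; ring⟩
  · exact ⟨-(u / v), fmem, 0, fmem, by rw [h]; field_simp; ring⟩

theorem RelGen.of_invPerm_of_two_eq_zero [Finite G] (hK : Stable ρ K) (h2 : (2 : Ω) = 0)
    (hB : Big 2 K (K ⊔ k⟮x⟯ ⊔ k⟮y⟯)) (hg : ∀ g, InvPerm (ρ g) x y) :
    RelGen ρ 2 K (K ⊔ k⟮x⟯ ⊔ k⟮y⟯) := by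
  obtain ⟨hx, hy⟩ := hB.two (le_acl _)
  have hx0 : x ≠ 0 := ne_of_not_mem hx fmem
  have hy0 : y ≠ 0 := ne_of_not_mem hy fmem
  have hx1 := one_add_ne_zero_of_not_mem hx
  have hy1 := one_add_ne_zero_of_not_mem hy
  have hinv : ∀ {s : Ω}, s ≠ 0 → 1 + s ≠ 0 → 1 / (1 + 1 / s) = 1 / (1 + s) + 1 := by
    intro s hs hs1
    have h3 : 1 + 1 / s ≠ 0 := by
      intro h'; apply hs1; field_simp at h'; linear_combination h'
    rw [div_eq_iff h3]
    field_simp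
    linear_combination -(s+1) * h2
  obtain ⟨a, ha⟩ : ∃ a, a = 1 / (1 + x) := ⟨_, rfl⟩
  obtain ⟨b, hb⟩ : ∃ b, b = 1 / (1 + y) := ⟨_, rfl⟩
  have aux : ∀ {s t : Ω} (g : G), t ≠ 0 → 1 + t ≠ 0 → (ρ g s = t ∨ ρ g s = 1 / t) →
      (ρ g (1 / (1 + s)) = 1 / (1 + t) ∨ ρ g (1 / (1 + s)) = 1 / (1 + t) + 1) := by
    rintro s t g ht ht1 (h | h)
    · left; rw [map_div₀, map_add, map_one, h]
    · right; rw [map_div₀, map_add, map_one, h, hinv ht ht1]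
  have heq : K ⊔ k⟮x⟯ ⊔ k⟮y⟯ = K ⊔ k⟮a + b⟯ ⊔ k⟮a⟯ := by
    have ha' : a ∈ K ⊔ k⟮x⟯ ⊔ k⟮y⟯ := by rw [ha]; exact fmem
    have hb' : b ∈ K ⊔ k⟮x⟯ ⊔ k⟮y⟯ := by rw [hb]; exact fmem
    refine sup_two_eq (mem_of_eq (1 / a - 1) ?_) (mem_of_eq (1 / ((a + b) - a) - 1) ?_)
      (add_mem ha' hb') ha'
    · rw [ha]; field_simp; ring
    · rw [add_sub_cancel_left, hb]; field_simp; ring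
  rw [heq] at hB ⊢
  obtain ⟨h1, h3⟩ := hB.two (le_acl _)
  have hact : ∀ g, (ρ g a = a ∨ ρ g a = a + 1) ∧ (ρ g b = b ∨ ρ g b = b + 1) ∨
      (ρ g a = b ∨ ρ g a = b + 1) ∧ (ρ g b = a ∨ ρ g b = a + 1) := by
    intro g
    rw [ha, hb]
    rcases hg g with ⟨h, h'⟩ | ⟨h, h'⟩
    · exact Or.inl ⟨aux g hx0 hx1 h, aux g hy0 hy1 h'⟩
    · exact Or.inr ⟨aux g hy0 hy1 h, aux g hx0 hx1 h'⟩
  refine RelGen.affine_two hK h1 h3 (fun g => ?_) (fun g => ?_)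
  · have : ρ g (a + b) = a + b ∨ ρ g (a + b) = a + b + 1 := by
      rw [map_add]
      rcases hact g with ⟨h | h, h' | h'⟩ | ⟨h | h, h' | h'⟩ <;> rw [h, h']
      · left; ring
      · right; ring
      · right; ring
      · left; linear_combination h2
      · left; ring
      · right; ring
      · right; ring
      · left; linear_combination h2
    rcases this with h | h
    · exact ⟨1, fmem, 0, fmem, by rw [h]; ring⟩
    · exact ⟨1, fmem, 1, fmem, by rw [h]; ring⟩
  · rcases hact g with ⟨h | h, -⟩ | ⟨h | h, -⟩
    · exact ⟨1, fmem, 0, fmem, by rw [h]; ring⟩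
    · exact ⟨1, fmem, 1, fmem, by rw [h]; ring⟩
    · exact ⟨-1, fmem, a + b, fmem, by rw [h]; ring⟩
    · exact ⟨-1, fmem, a + b + 1, fmem, by rw [h]; ring⟩

/-- Two-dimensional signed permutation actions over the ground field. -/
theorem RelGen.of_invPerm [Finite G] (hB : Big 2 ⊥ (⊥ ⊔ k⟮x⟯ ⊔ k⟮y⟯))
    (hg : ∀ g, InvPerm (ρ g) x y) : RelGen ρ 2 ⊥ (⊥ ⊔ k⟮x⟯ ⊔ k⟮y⟯) := by
  by_cases h2 : (2 : Ω) = 0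
  · exact RelGen.of_invPerm_of_two_eq_zero (stable_bot ρ) h2 hB hg
  obtain ⟨hx, hy⟩ := hB.two (le_acl _)
  rw [sup_cay_cay h2 (one_add_ne_zero_of_not_mem hx) (one_add_ne_zero_of_not_mem hy)] at hB ⊢
  obtain ⟨h1, -, h3⟩ := RelGen.of_negPerm (stable_bot ρ) hB fun g =>
    (hg g).negPerm_cay (ne_of_not_mem hx fmem) (ne_of_not_mem hy fmem)
  exact (RelGen.luroth ρ h1).trans h3

theorem RelGen.luroth_affine [Finite G] {w y : Ω} (hB : Big 2 ⊥ (⊥ ⊔ k⟮w⟯ ⊔ k⟮y⟯))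
    (hw : ∀ g, ρ g w ∈ ⊥ ⊔ k⟮w⟯) (hy : ∀ g, ∃ a ∈ ⊥ ⊔ k⟮w⟯, ∃ b ∈ ⊥ ⊔ k⟮w⟯,
      ρ g y = a * y + b) : RelGen ρ 2 ⊥ (⊥ ⊔ k⟮w⟯ ⊔ k⟮y⟯) := by
  obtain ⟨h1, h2⟩ := hB.two (le_acl _)
  exact (RelGen.luroth ρ h1).trans (RelGen.affine ((stable_bot ρ).sup_simple hw) h2 hy)

theorem exists_div_mem_of_ratio {t : Fin 3 → Ω} {w d : Ω} (hw : w ∈ K) (h0 : t 0 - t 1 = w * d)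
    (h1 : t 1 - t 2 = d) (i : Fin 3) : ∃ a ∈ K, t i = t 2 + a * d := by
  fin_cases i
  · exact ⟨w + 1, fmem, by simp only [Fin.zero_eta]; linear_combination h0 + h1⟩
  · exact ⟨1, fmem, by simp only [Fin.mk_one]; linear_combination h1⟩
  · exact ⟨0, fmem, by simp⟩

/-- Projective permutation actions of three letters. -/
theorem RelGen.perm_proj [Finite G] {t : Fin 3 → Ω}
    (hB : Big 2 ⊥ (⊥ ⊔ k⟮t 0 / t 2⟯ ⊔ k⟮t 1 / t 2⟯))
    (hg : ∀ g, ∃ s : Ω, ∃ π : Equiv.Perm (Fin 3), ∀ i, ρ g (t i) = s * t (π i)) :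
    RelGen ρ 2 ⊥ (⊥ ⊔ k⟮t 0 / t 2⟯ ⊔ k⟮t 1 / t 2⟯) := by
  obtain ⟨n1, n2⟩ := hB.two (le_acl _)
  have ht1 : t 1 / t 2 ≠ 0 := ne_of_not_mem n2 fmem
  have ht2 : t 2 ≠ 0 := by intro h; simp [h] at ht1
  obtain ⟨d, hd⟩ : ∃ d, t 1 - t 2 = d := ⟨_, rfl⟩
  have hd0 : d ≠ 0 := by
    rintro rfl
    exact ne_of_not_mem n2 (y := 1) fmem (by field_simp; linear_combination hd)
  obtain ⟨w, hw⟩ : ∃ w, w = (t 0 - t 1) / d := ⟨_, rfl⟩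
  have hw' : t 0 - t 1 = w * d := by rw [hw]; field_simp
  have heq : ⊥ ⊔ k⟮t 0 / t 2⟯ ⊔ k⟮t 1 / t 2⟯ =
      ⊥ ⊔ k⟮w⟯ ⊔ k⟮t 2 / d⟯ := by
    refine sup_two_eq (mem_of_eq (1 + (w + 1) * (1 / (t 2 / d))) ?_)
      (mem_of_eq (1 + 1 / (t 2 / d)) ?_)
      (mem_of_eq ((t 0 / t 2 - t 1 / t 2) / (t 1 / t 2 - 1)) ?_)
      (mem_of_eq (1 / (t 1 / t 2 - 1)) ?_)
    · field_simp
      linear_combination hw' + hd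
    · field_simp
      linear_combination hd
    · rw [hw, ← hd]; rw [← hd] at hd0; field_simp
    · rw [← hd]; rw [← hd] at hd0; field_simp
  rw [heq] at hB ⊢
  have aux := exists_div_mem_of_ratio (mem_right (⊥ : IntermediateField k Ω) w) hw' hd
  have hdiff : ∀ g s (π : Equiv.Perm (Fin 3)), (∀ i, ρ g (t i) = s * t (π i)) → ∀ i j,
      ∃ a ∈ ⊥ ⊔ k⟮w⟯, ρ g (t i - t j) = s * (a * d) := by
    intro g s π h i j
    obtain ⟨a, ha, h1⟩ := aux (π i)
    obtain ⟨b, hb, h2⟩ := aux (π j)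
    exact ⟨a - b, fmem, by rw [map_sub, h, h, h1, h2]; ring⟩
  have hne : ∀ g s (π : Equiv.Perm (Fin 3)), (∀ i, ρ g (t i) = s * t (π i)) → s ≠ 0 := by
    rintro g s π h rfl
    have := h 2
    rw [zero_mul, EmbeddingLike.map_eq_zero_iff] at this
    exact ht2 this
  refine RelGen.luroth_affine hB (fun g => ?_) (fun g => ?_)
  · obtain ⟨s, π, h⟩ := hg g
    have hs := hne g s π h
    obtain ⟨a, ha, h1⟩ := hdiff g s π h 0 1
    obtain ⟨b, hb, h2⟩ := hdiff g s π h 1 2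
    rw [hd] at h2
    refine mem_of_eq (a / b) ?_
    rw [hw, map_div₀, h1, h2, mul_div_mul_left _ _ hs, mul_div_mul_right _ _ hd0]
  · obtain ⟨s, π, h⟩ := hg g
    have hs := hne g s π h
    obtain ⟨b, hb, h2⟩ := hdiff g s π h 1 2
    obtain ⟨a, ha, h1⟩ := aux (π 2)
    rw [hd] at h2
    have hb0 : b ≠ 0 := by
      rintro rfl
      rw [zero_mul, mul_zero, EmbeddingLike.map_eq_zero_iff] at h2
      exact hd0 h2
    refine ⟨1 / b, fmem, a / b, fmem, ?_⟩
    rw [map_div₀, h, h2, h1]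
    field_simp

/-- Affine permutation actions of three letters. -/
theorem RelGen.perm_affine [Finite G] {t : Fin 3 → Ω}
    (hB : Big 3 ⊥ (⊥ ⊔ k⟮t 0⟯ ⊔ k⟮t 1⟯ ⊔ k⟮t 2⟯))
    (hg : ∀ g, ∃ s ∈ (⊥ : IntermediateField k Ω), ∃ c ∈ (⊥ : IntermediateField k Ω),
      ∃ π : Equiv.Perm (Fin 3), ∀ i, ρ g (t i) = s * t (π i) + c) :
    RelGen ρ 3 ⊥ (⊥ ⊔ k⟮t 0⟯ ⊔ k⟮t 1⟯ ⊔ k⟮t 2⟯) := by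
  obtain ⟨n0, n1, n2⟩ := hB.three (le_acl _)
  obtain ⟨d, hd⟩ : ∃ d, t 1 - t 2 = d := ⟨_, rfl⟩
  have hd0 : d ≠ 0 := by
    rintro rfl
    exact ne_of_not_mem n2 (y := t 1) fmem (by linear_combination -hd)
  obtain ⟨w, hw⟩ : ∃ w, w = (t 0 - t 1) / d := ⟨_, rfl⟩
  have hw' : t 0 - t 1 = w * d := by rw [hw]; field_simp
  have heq : ⊥ ⊔ k⟮t 0⟯ ⊔ k⟮t 1⟯ ⊔ k⟮t 2⟯ =
      ⊥ ⊔ k⟮w⟯ ⊔ k⟮d⟯ ⊔ k⟮t 2⟯ := by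
    have h1 : t 1 ∈ ⊥ ⊔ k⟮w⟯ ⊔ k⟮d⟯ ⊔ k⟮t 2⟯ :=
      mem_of_eq (t 2 + d) (by linear_combination hd)
    have h2 : d ∈ ⊥ ⊔ k⟮t 0⟯ ⊔ k⟮t 1⟯ ⊔ k⟮t 2⟯ :=
      mem_of_eq (t 1 - t 2) hd.symm
    refine le_antisymm ?_ ?_ <;> simp only [sup_simple_le]
    · refine ⟨⟨⟨bot_le, ?_⟩, h1⟩, fmem⟩
      exact mem_of_eq (t 1 + w * d) (by linear_combination hw')
    · refine ⟨⟨⟨bot_le, ?_⟩, h2⟩, fmem⟩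
      exact mem_of_eq ((t 0 - t 1) / d) hw
  rw [heq] at hB ⊢
  obtain ⟨m0, m1, m2⟩ := hB.three (le_acl _)
  have aux := exists_div_mem_of_ratio (mem_right (⊥ : IntermediateField k Ω) w) hw' hd
  have hdiff : ∀ g s c (π : Equiv.Perm (Fin 3)), (∀ i, ρ g (t i) = s * t (π i) + c) → ∀ i j,
      ∃ a ∈ ⊥ ⊔ k⟮w⟯, ρ g (t i - t j) = s * (a * d) := by
    intro g s c π h i j
    obtain ⟨a, ha, h1⟩ := aux (π i)
    obtain ⟨b, hb, h2⟩ := aux (π j)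
    exact ⟨a - b, fmem, by rw [map_sub, h, h, h1, h2]; ring⟩
  have hwst : ∀ g, ρ g w ∈ ⊥ ⊔ k⟮w⟯ := by
    intro g
    obtain ⟨s, hs, c, hc, π, h⟩ := hg g
    obtain ⟨a, ha, h1⟩ := hdiff g s c π h 0 1
    obtain ⟨b, hb, h2⟩ := hdiff g s c π h 1 2
    rw [hd] at h2
    have hs0 : s ≠ 0 := by
      rintro rfl
      rw [zero_mul, EmbeddingLike.map_eq_zero_iff] at h2
      exact hd0 h2
    refine mem_of_eq (a / b) ?_
    rw [hw, map_div₀, h1, h2, mul_div_mul_left _ _ hs0, mul_div_mul_right _ _ hd0]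
  have hst := (stable_bot ρ).sup_simple hwst
  refine (RelGen.luroth ρ m0).trans (RelGen.affine_two (x := d) (y := t 2) hst m1 m2
    (fun g => ?_) fun g => ?_)
  · obtain ⟨s, hs, c, hc, π, h⟩ := hg g
    obtain ⟨b, hb, h2⟩ := hdiff g s c π h 1 2
    rw [hd] at h2
    exact ⟨s * b, fmem, 0, fmem, by rw [h2]; ring⟩
  · obtain ⟨s, hs, c, hc, π, h⟩ := hg g
    obtain ⟨a, ha, h1⟩ := aux (π 2)
    exact ⟨s, fmem, s * (a * d) + c, fmem, by rw [h, h1]; ring⟩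

theorem quadratic_eq_zero_of_three_roots {F : Type*} [Field F] {v₀ v₁ v₂ x y z : F}
    (h01 : v₀ ≠ v₁) (h02 : v₀ ≠ v₂) (h12 : v₁ ≠ v₂) (e0 : x + y * v₀ + z * v₀ ^ 2 = 0)
    (e1 : x + y * v₁ + z * v₁ ^ 2 = 0) (e2 : x + y * v₂ + z * v₂ ^ 2 = 0) :
    x = 0 ∧ y = 0 ∧ z = 0 := by
  have a1 : (v₀ - v₁) * (y + z * (v₀ + v₁)) = 0 := by linear_combination e0 - e1
  have a2 : (v₀ - v₂) * (y + z * (v₀ + v₂)) = 0 := by linear_combination e0 - e2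
  have b1 := (mul_eq_zero.1 a1).resolve_left (sub_ne_zero.2 h01)
  have b2 := (mul_eq_zero.1 a2).resolve_left (sub_ne_zero.2 h02)
  have a3 : (v₁ - v₂) * z = 0 := by linear_combination b1 - b2
  have hz := (mul_eq_zero.1 a3).resolve_left (sub_ne_zero.2 h12)
  subst hz
  have hy : y = 0 := by linear_combination b1
  subst hy
  exact ⟨by linear_combination e0, rfl, rfl⟩

set_option maxHeartbeats 1000000 in
/-- Projective permutation actions of three letters twisted by scalars, over a base containing
three points on the affine line that are permuted in the same way. -/
theorem RelGen.perm_twisted [Finite G] (hK : Stable ρ K) {D V : Fin 3 → Ω}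
    (hB : Big 2 K (K ⊔ k⟮D 0 / D 2⟯ ⊔ k⟮D 1 / D 2⟯)) (hV : ∀ i, V i ∈ K)
    (hinj : Function.Injective V)
    (hg : ∀ g, ∃ s : Ω, ∃ π : Equiv.Perm (Fin 3), (∀ i, ρ g (D i) = s * D (π i)) ∧
      ((∀ i, ρ g (V i) = V (π i)) ∨ (∀ i, ρ g (V i) = 1 - V (π i)))) :
    RelGen ρ 2 K (K ⊔ k⟮D 0 / D 2⟯ ⊔ k⟮D 1 / D 2⟯) := by
  obtain ⟨n1, n2⟩ := hB.two (le_acl _)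
  have ht1 : D 1 / D 2 ≠ 0 := ne_of_not_mem n2 fmem
  have hD2 : D 2 ≠ 0 := by intro h; simp [h] at ht1
  have h01 : V 0 ≠ V 1 := hinj.ne (by decide)
  have h02 : V 0 ≠ V 2 := hinj.ne (by decide)
  have h12 : V 1 ≠ V 2 := hinj.ne (by decide)
  have p01 : V 0 - V 1 ≠ 0 := sub_ne_zero.2 h01
  have p02 : V 0 - V 2 ≠ 0 := sub_ne_zero.2 h02
  have p12 : V 1 - V 2 ≠ 0 := sub_ne_zero.2 h12
  have hV0 := hV 0
  have hV1 := hV 1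
  have hV2 := hV 2
  obtain ⟨C, hC⟩ : ∃ C, C = D 0 / ((V 0 - V 1) * (V 0 - V 2)) - D 1 / ((V 0 - V 1) * (V 1 - V 2)) +
    D 2 / ((V 0 - V 2) * (V 1 - V 2)) := ⟨_, rfl⟩
  obtain ⟨B, hBB⟩ : ∃ B, B = (D 0 - D 1) / (V 0 - V 1) - C * (V 0 + V 1) := ⟨_, rfl⟩
  obtain ⟨A, hA⟩ : ∃ A, A = D 0 - B * V 0 - C * V 0 ^ 2 := ⟨_, rfl⟩
  have hD : ∀ i, D i = A + B * V i + C * V i ^ 2 := by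
    intro i
    fin_cases i
    · simp only [Fin.zero_eta]; rw [hA]; ring
    · simp only [Fin.mk_one]; rw [hA, hBB]; field_simp; ring
    · simp only [Fin.reduceFinMk]; rw [hA, hBB, hC]; field_simp; ring
  have hC0 : C ≠ 0 := by
    intro h
    refine ne_of_not_mem n2 (y := ((D 0 / D 2) / ((V 0 - V 1) * (V 0 - V 2)) +
      1 / ((V 0 - V 2) * (V 1 - V 2))) * ((V 0 - V 1) * (V 1 - V 2))) fmem ?_
    have h1 : D 1 / ((V 0 - V 1) * (V 1 - V 2)) = D 0 / ((V 0 - V 1) * (V 0 - V 2)) +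
        D 2 / ((V 0 - V 2) * (V 1 - V 2)) := by linear_combination hC - h
    rw [div_eq_iff (mul_ne_zero p01 p12)] at h1
    rw [h1]
    field_simp
  obtain ⟨α, hα⟩ : ∃ α, α = A / C := ⟨_, rfl⟩
  obtain ⟨β, hβ⟩ : ∃ β, β = B / C := ⟨_, rfl⟩
  have hDα : ∀ i, D i = C * (α + β * V i + V i ^ 2) := by
    intro i; rw [hD, hα, hβ]; field_simp
  have heq : K ⊔ k⟮D 0 / D 2⟯ ⊔ k⟮D 1 / D 2⟯ = K ⊔ k⟮β⟯ ⊔ k⟮α⟯ := by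
    have c1 : C / D 2 ∈ K ⊔ k⟮D 0 / D 2⟯ ⊔ k⟮D 1 / D 2⟯ := by
      refine mem_of_eq ((D 0 / D 2) / ((V 0 - V 1) * (V 0 - V 2)) -
        (D 1 / D 2) / ((V 0 - V 1) * (V 1 - V 2)) + 1 / ((V 0 - V 2) * (V 1 - V 2))) ?_
      rw [hC]; field_simp
    have c2 : B / D 2 ∈ K ⊔ k⟮D 0 / D 2⟯ ⊔ k⟮D 1 / D 2⟯ := by
      refine mem_of_eq ((D 0 / D 2 - D 1 / D 2) / (V 0 - V 1) - (C / D 2) * (V 0 + V 1)) ?_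
      rw [hBB]; field_simp
    have c3 : A / D 2 ∈ K ⊔ k⟮D 0 / D 2⟯ ⊔ k⟮D 1 / D 2⟯ := by
      refine mem_of_eq (D 0 / D 2 - (B / D 2) * V 0 - (C / D 2) * V 0 ^ 2) ?_
      rw [hA]; field_simp
    refine sup_two_eq ?_ ?_ ?_ ?_
    · refine mem_of_eq ((α + β * V 0 + V 0 ^ 2) / (α + β * V 2 + V 2 ^ 2)) ?_
      rw [hDα 0, hDα 2, mul_div_mul_left _ _ hC0]
    · refine mem_of_eq ((α + β * V 1 + V 1 ^ 2) / (α + β * V 2 + V 2 ^ 2)) ?_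
      rw [hDα 1, hDα 2, mul_div_mul_left _ _ hC0]
    · refine mem_of_eq ((B / D 2) / (C / D 2)) ?_
      rw [hβ]; field_simp
    · refine mem_of_eq ((A / D 2) / (C / D 2)) ?_
      rw [hα]; field_simp
  rw [heq] at hB ⊢
  obtain ⟨m1, m2⟩ := hB.two (le_acl _)
  have hact : ∀ g, (ρ g β = β ∧ ρ g α = α) ∨ (ρ g β = -β - 2 ∧ ρ g α = α + β + 1) := by
    intro g
    obtain ⟨s, π, h1, h2⟩ := hg g
    have hne : ∀ {i j : Fin 3}, i ≠ j → V (π i) ≠ V (π j) := fun h => (hinj.comp π.injective).ne h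
    have hs : s ≠ 0 := by
      rintro rfl
      have := h1 2
      rw [zero_mul, EmbeddingLike.map_eq_zero_iff] at this
      exact hD2 this
    rcases h2 with h2 | h2
    · have key : ∀ i, (ρ g A - s * A) + (ρ g B - s * B) * V (π i) +
          (ρ g C - s * C) * V (π i) ^ 2 = 0 := by
        intro i
        have := h1 i
        rw [hD i, hD (π i)] at this
        simp only [map_add, map_mul, map_pow, h2] at this
        linear_combination this
      obtain ⟨e1, e2, e3⟩ := quadratic_eq_zero_of_three_roots (hne (i := 0) (j := 1) (by decide))
        (hne (i := 0) (j := 2) (by decide)) (hne (i := 1) (j := 2) (by decide)) (key 0) (key 1) (key 2)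
      rw [sub_eq_zero] at e1 e2 e3
      left
      rw [hα, hβ, map_div₀, map_div₀, e1, e2, e3]
      constructor <;> field_simp
    · have key : ∀ i, (ρ g A + ρ g B + ρ g C - s * A) + (-ρ g B - 2 * ρ g C - s * B) * V (π i) +
          (ρ g C - s * C) * V (π i) ^ 2 = 0 := by
        intro i
        have := h1 i
        rw [hD i, hD (π i)] at this
        simp only [map_add, map_mul, map_pow, h2] at this
        linear_combination this
      obtain ⟨e1, e2, e3⟩ := quadratic_eq_zero_of_three_roots (hne (i := 0) (j := 1) (by decide))
        (hne (i := 0) (j := 2) (by decide)) (hne (i := 1) (j := 2) (by decide)) (key 0) (key 1) (key 2)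
      have e3' : ρ g C = s * C := by linear_combination e3
      have e2' : ρ g B = s * (-B - 2 * C) := by linear_combination -e2 - 2 * e3
      have e1' : ρ g A = s * (A + B + C) := by linear_combination e1 + e2 + e3
      right
      rw [hα, hβ, map_div₀, map_div₀, e1', e2', e3']
      constructor <;> field_simp
  refine RelGen.affine_two hK m1 m2 (fun g => ?_) (fun g => ?_)
  · rcases hact g with ⟨h, -⟩ | ⟨h, -⟩
    · exact ⟨1, fmem, 0, fmem, by rw [h]; ring⟩
    · exact ⟨-1, fmem, -2, fmem, by rw [h]; ring⟩
  · rcases hact g with ⟨-, h⟩ | ⟨-, h⟩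
    · exact ⟨1, fmem, 0, fmem, by rw [h]; ring⟩
    · exact ⟨1, fmem, β + 1, fmem, by rw [h]; ring⟩

theorem Big.hex_pair {z : Fin 3 → Ω} (hz : z 0 * z 1 * z 2 = 1)
    (hB : Big 2 K (K ⊔ k⟮z 0⟯ ⊔ k⟮z 1⟯)) (i : Fin 3) : Big 2 K (K ⊔ k⟮z i⟯ ⊔ k⟮z (i + 1)⟯) := by
  have hz0 : z 0 ≠ 0 := by intro h; simp [h] at hz
  have hz1 : z 1 ≠ 0 := by intro h; simp [h] at hz
  have hz2 : z 2 ≠ 0 := by intro h; simp [h] at hz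
  have i0 : z 0 = 1 / (z 1 * z 2) := by field_simp; linear_combination hz
  have i1 : z 1 = 1 / (z 2 * z 0) := by field_simp; linear_combination hz
  fin_cases i
  · exact hB
  · change Big 2 K (K ⊔ k⟮z 1⟯ ⊔ k⟮z 2⟯)
    refine hB.mono le_rfl (le_acl _) (sup_simple_le.2 ⟨sup_simple_le.2 ⟨?_, ?_⟩, ?_⟩)
    · exact le_sup_left.trans le_sup_left
    · exact mem_of_eq _ i0
    · exact fmem
  · change Big 2 K (K ⊔ k⟮z 2⟯ ⊔ k⟮z 0⟯)
    refine hB.mono le_rfl (le_acl _) (sup_simple_le.2 ⟨sup_simple_le.2 ⟨?_, ?_⟩, ?_⟩)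
    · exact le_sup_left.trans le_sup_left
    · exact fmem
    · exact mem_of_eq _ i1

theorem one_div_one_sub_inv (hx : x ≠ 0) (hx1 : x ≠ 1) : 1 / (1 - 1 / x) = 1 - 1 / (1 - x) := by
  have h1 : 1 - x ≠ 0 := sub_ne_zero.2 hx1.symm
  have h2 : 1 - 1 / x ≠ 0 := by
    intro h; field_simp at h; exact hx1 (by linear_combination h)
  rw [div_eq_iff h2]
  field_simp
  ring

theorem map_one_div_one_sub {f : Ω ≃ₐ[k] Ω} {e : ℤˣ} (hy : y ≠ 0) (hy1 : y ≠ 1)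
    (h : f x = y ^ (e : ℤ)) : f (1 / (1 - x)) = if e = 1 then 1 / (1 - y) else 1 - 1 / (1 - y) := by
  rw [map_div₀, map_sub, map_one, h]
  rcases Int.units_eq_one_or e with rfl | rfl
  · simp
  · rw [if_neg (by decide), ← one_div_one_sub_inv hy hy1]
    simp

set_option maxHeartbeats 1000000 in
/-- A hexagonal pair over a base containing a point of the same kind. -/
theorem relGen_hex_of_point [Finite G] (hK : Stable ρ K) {z W : Fin 3 → Ω}
    (hz : z 0 * z 1 * z 2 = 1) (hB : Big 2 K (K ⊔ k⟮z 0⟯ ⊔ k⟮z 1⟯)) (hW : W 0 * W 1 * W 2 = 1)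
    (hWK : ∀ i, W i ∈ K) (hW1 : ∀ i, W i ≠ 1) (hinj : Function.Injective W)
    (hg : ∀ g, ∃ π : Equiv.Perm (Fin 3), ∃ e : ℤˣ,
      (∀ i, ρ g (z i) = z (π i) ^ (e : ℤ)) ∧ (∀ i, ρ g (W i) = W (π i) ^ (e : ℤ))) :
    RelGen ρ 2 K (K ⊔ k⟮z 0⟯ ⊔ k⟮z 1⟯) := by
  have hzn : ∀ i, z i ∉ acl K := fun i => ((hB.hex_pair hz i).two (le_acl _)).1
  have hz0 : ∀ i, z i ≠ 0 := fun i => ne_of_not_mem (hzn i) fmem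
  have hz1 : ∀ i, z i ≠ 1 := fun i => ne_of_not_mem (hzn i) fmem
  have hs : ∀ i, 1 - z i ≠ 0 := fun i => sub_ne_zero.2 (hz1 i).symm
  have hW0 : ∀ i, W i ≠ 0 := by
    intro i h
    fin_cases i
    · simp [show W 0 = 0 from h] at hW
    · simp [show W 1 = 0 from h] at hW
    · simp [show W 2 = 0 from h] at hW
  have hWs : ∀ i, 1 - W i ≠ 0 := fun i => sub_ne_zero.2 (hW1 i).symm
  obtain ⟨v, hv⟩ : ∃ v : Fin 3 → Ω, ∀ i, v i = 1 / (1 - z i) := ⟨_, fun i => rfl⟩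
  obtain ⟨V, hV⟩ : ∃ V : Fin 3 → Ω, ∀ i, V i = 1 / (1 - W i) := ⟨_, fun i => rfl⟩
  have hVK : ∀ i, V i ∈ K := by
    intro i
    have := hWK i
    rw [hV]; exact fmem
  have hV0 := hVK 0
  have hV1 := hVK 1
  have hV2 := hVK 2
  have hzv : ∀ i, z i = 1 - 1 / v i := by
    intro i; have := hs i; rw [hv]; field_simp; ring
  have hWV : ∀ i, W i = 1 - 1 / V i := by
    intro i; have := hWs i; rw [hV]; field_simp; ring
  have hv0 : ∀ i, v i ≠ 0 := by
    intro i; rw [hv]; exact one_div_ne_zero (hs i)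
  have hVn0 : ∀ i, V i ≠ 0 := by
    intro i; rw [hV]; exact one_div_ne_zero (hWs i)
  have hVinj : Function.Injective V := by
    intro i j h
    apply hinj
    rw [hWV, hWV, h]
  have q1 : v 0 * v 1 + v 1 * v 2 + v 2 * v 0 - (v 0 + v 1 + v 2) + 1 = 0 := by
    have := hz
    rw [hzv 0, hzv 1, hzv 2] at this
    have a0 := hv0 0
    have a1 := hv0 1
    have a2 := hv0 2
    field_simp at this
    linear_combination -this
  have q2 : V 0 * V 1 + V 1 * V 2 + V 2 * V 0 - (V 0 + V 1 + V 2) + 1 = 0 := by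
    have := hW
    rw [hWV 0, hWV 1, hWV 2] at this
    have a0 := hVn0 0
    have a1 := hVn0 1
    have a2 := hVn0 2
    field_simp at this
    linear_combination -this
  obtain ⟨D, hD⟩ : ∃ D : Fin 3 → Ω, ∀ i, D i = v i - V i := ⟨_, fun i => rfl⟩
  have hvn : ∀ i, v i ∉ acl K := by
    intro i
    refine not_mem_acl_of_sup (hzn i) (mem_of_eq _ (hzv i))
  have hD2 : D 2 ≠ 0 := by
    rw [hD]; exact sub_ne_zero.2 (ne_of_not_mem (hvn 2) hV2)
  obtain ⟨s, hs'⟩ : ∃ s, s = D 0 / D 2 := ⟨_, rfl⟩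
  obtain ⟨t, ht⟩ : ∃ t, t = D 1 / D 2 := ⟨_, rfl⟩
  have d0 : v 0 = V 0 + s * D 2 := by rw [hs', div_mul_cancel₀ _ hD2, hD]; ring
  have d1 : v 1 = V 1 + t * D 2 := by rw [ht, div_mul_cancel₀ _ hD2, hD]; ring
  have d2 : v 2 = V 2 + D 2 := by rw [hD]; ring
  obtain ⟨d, hd⟩ : ∃ d, d = D 2 := ⟨_, rfl⟩
  rw [← hd] at d0 d1 d2 hD2
  have hrel : d * (s * t + s + t) + (s * (V 1 + V 2 - 1) + t * (V 0 + V 2 - 1) + (V 0 + V 1 - 1)) = 0 := by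
    have : d * (d * (s * t + s + t) + (s * (V 1 + V 2 - 1) + t * (V 0 + V 2 - 1) + (V 0 + V 1 - 1))) = 0 := by
      rw [d0, d1, d2] at q1
      linear_combination q1 - q2
    exact (mul_eq_zero.1 this).resolve_left hD2
  have hzmem : ∀ {L : IntermediateField k Ω}, K ≤ L → s ∈ L → t ∈ L → d ∈ L → z 0 ∈ L ∧ z 1 ∈ L := by
    intro L hKL hs hd ht
    have := hKL hV0
    have := hKL hV1
    rw [hzv 0, hzv 1, d0, d1]
    exact ⟨fmem, fmem⟩
  have hne : s * t + s + t ≠ 0 := by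
    intro h0
    have hs1 : s + 1 ≠ 0 := by
      intro h
      have : (1 : Ω) = 0 := by linear_combination (t + 1) * h - h0
      exact one_ne_zero this
    have ht' : t = -s / (s + 1) := by field_simp; linear_combination h0
    have hs_alg : s ∈ acl K := by
      have e1 : (V 0 + V 1 - 1) + (V 1 + V 2 - 1 - (V 0 + V 2 - 1) + (V 0 + V 1 - 1)) * s
          + (V 1 + V 2 - 1) * s ^ 2 = 0 := by
        linear_combination (s + 1) * hrel - ((V 0 + V 2 - 1) + d * (s + 1)) * h0
      by_cases ha : V 1 + V 2 - 1 = 0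
      · by_cases hb : V 0 + V 1 - 1 = 0
        · by_cases hc : V 0 + V 2 - 1 = 0
          · exact absurd (hVinj (by linear_combination ha - hc : V 1 = V 0)) (by decide)
          · have : s = 0 := by
              rw [ha, hb] at e1
              have : (V 0 + V 2 - 1) * s = 0 := by linear_combination -e1
              exact (mul_eq_zero.1 this).resolve_left hc
            rw [this]; exact zero_mem _
        · by_cases hc : (V 1 + V 2 - 1 - (V 0 + V 2 - 1) + (V 0 + V 1 - 1)) = 0
          · exact absurd (by linear_combination e1 - hc * s - ha * s ^ 2) hb
          · apply le_acl
            refine mem_of_eq (-(V 0 + V 1 - 1) / (V 1 + V 2 - 1 - (V 0 + V 2 - 1) + (V 0 + V 1 - 1))) ?_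
            rw [eq_div_iff hc]
            linear_combination e1 - ha * s ^ 2
      · refine mem_acl_quadratic
          (a := (V 1 + V 2 - 1 - (V 0 + V 2 - 1) + (V 0 + V 1 - 1)) / (V 1 + V 2 - 1))
          (b := (V 0 + V 1 - 1) / (V 1 + V 2 - 1)) fmem fmem ?_
        obtain ⟨A, hA⟩ : ∃ A, A = V 1 + V 2 - 1 := ⟨_, rfl⟩
        rw [← hA] at ha e1 ⊢
        field_simp
        linear_combination e1
    have : K ⊔ k⟮z 0⟯ ⊔ k⟮z 1⟯ ≤ acl (K ⊔ k⟮d⟯) := by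
      have hs2 : s ∈ acl (K ⊔ k⟮d⟯) := acl_mono le_sup_left hs_alg
      obtain ⟨m0, m1⟩ := hzmem (L := acl (K ⊔ k⟮d⟯)) (le_sup_left.trans (le_acl _)) hs2
        (by rw [ht']; exact fmem) (le_acl _ (mem_right _ _))
      exact sup_simple_le.2 ⟨sup_simple_le.2 ⟨le_sup_left.trans (le_acl _), m0⟩, m1⟩
    have := hB {d} (by simpa using this)
    simp at this
  have heq : K ⊔ k⟮z 0⟯ ⊔ k⟮z 1⟯ = K ⊔ k⟮D 0 / D 2⟯ ⊔ k⟮D 1 / D 2⟯ := by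
    rw [← hs', ← ht]
    have hd' : d ∈ K ⊔ k⟮s⟯ ⊔ k⟮t⟯ := by
      have m0 : V 0 ∈ K ⊔ k⟮s⟯ ⊔ k⟮t⟯ := mem_left (mem_left hV0)
      have m1 : V 1 ∈ K ⊔ k⟮s⟯ ⊔ k⟮t⟯ := mem_left (mem_left hV1)
      have m2 : V 2 ∈ K ⊔ k⟮s⟯ ⊔ k⟮t⟯ := mem_left (mem_left hV2)
      refine mem_of_eq (-(s * (V 1 + V 2 - 1) + t * (V 0 + V 2 - 1) + (V 0 + V 1 - 1)) / (s * t + s + t)) ?_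
      rw [eq_div_iff hne]
      linear_combination hrel
    obtain ⟨m0, m1⟩ := hzmem (le_sup_left.trans le_sup_left) (by exact fmem) (by exact fmem) hd'
    have hz2 : z 2 ∈ K ⊔ k⟮z 0⟯ ⊔ k⟮z 1⟯ := by
      refine mem_of_eq (1 / (z 0 * z 1)) ?_
      rw [eq_div_iff (mul_ne_zero (hz0 0) (hz0 1))]
      linear_combination hz
    have n0 : V 0 ∈ K ⊔ k⟮z 0⟯ ⊔ k⟮z 1⟯ := mem_left (mem_left hV0)
    have n1 : V 1 ∈ K ⊔ k⟮z 0⟯ ⊔ k⟮z 1⟯ := mem_left (mem_left hV1)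
    have n2 : V 2 ∈ K ⊔ k⟮z 0⟯ ⊔ k⟮z 1⟯ := mem_left (mem_left hV2)
    refine sup_two_eq m0 m1 ?_ ?_
    · rw [hs', hD, hD, hv, hv]; exact fmem
    · rw [ht, hD, hD, hv, hv]; exact fmem
  rw [heq] at hB ⊢
  refine RelGen.perm_twisted hK hB hVK hVinj fun g => ?_
  obtain ⟨π, e, h1, h2⟩ := hg g
  have hv' : ∀ i, ρ g (v i) = if e = 1 then v (π i) else 1 - v (π i) := by
    intro i
    rw [hv, hv]
    exact map_one_div_one_sub (hz0 _) (hz1 _) (h1 i)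
  have hV' : ∀ i, ρ g (V i) = if e = 1 then V (π i) else 1 - V (π i) := by
    intro i
    rw [hV, hV]
    exact map_one_div_one_sub (hW0 _) (hW1 _) (h2 i)
  rcases Int.units_eq_one_or e with rfl | rfl
  · refine ⟨1, π, fun i => ?_, Or.inl fun i => ?_⟩
    · rw [hD, hD, map_sub, hv', hV']; simp
    · rw [hV']; simp
  · refine ⟨-1, π, fun i => ?_, Or.inr fun i => ?_⟩
    · rw [hD, hD, map_sub, hv', hV', if_neg (by decide), if_neg (by decide)]; ring
    · rw [hV', if_neg (by decide)]

theorem sq_div_inv (hx : x ≠ 0) : (1 / x - 1) ^ 2 / (1 / x) = (x - 1) ^ 2 / x := by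
  field_simp
  ring

theorem map_sq_div {f : Ω ≃ₐ[k] Ω} {e : ℤˣ} (hy : y ≠ 0) (h : f x = y ^ (e : ℤ)) :
    f ((x - 1) ^ 2 / x) = (y - 1) ^ 2 / y := by
  rw [map_div₀, map_pow, map_sub, map_one, h]
  rcases Int.units_eq_one_or e with rfl | rfl
  · simp
  · rw [← sq_div_inv hy]
    simp

set_option maxHeartbeats 1000000 in
/-- A hexagonal pair on which the central inversion acts while fixing the base. -/
theorem relGen_hex_of_neg [Finite G] (hK : Stable ρ K) {z V : Fin 3 → Ω}
    (hz : z 0 * z 1 * z 2 = 1) (hB : Big 2 K (K ⊔ k⟮z 0⟯ ⊔ k⟮z 1⟯)) (hV : ∀ i, V i ∈ K)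
    (hinj : Function.Injective V)
    (hg : ∀ g, ∃ π : Equiv.Perm (Fin 3), ∃ e : ℤˣ, (∀ i, ρ g (z i) = z (π i) ^ (e : ℤ)) ∧
      ((∀ i, ρ g (V i) = V (π i)) ∨ (∀ i, ρ g (V i) = 1 - V (π i)))) (ι : G)
    (hιK : ∀ y ∈ K, ρ ι y = y) (hιz : ∀ i, ρ ι (z i) = 1 / z i) :
    RelGen ρ 2 K (K ⊔ k⟮z 0⟯ ⊔ k⟮z 1⟯) := by
  have hzn : ∀ i, z i ∉ acl K := fun i => ((hB.hex_pair hz i).two (le_acl _)).1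
  have hz0 : ∀ i, z i ≠ 0 := fun i => ne_of_not_mem (hzn i) fmem
  have hz1 : ∀ i, z i - 1 ≠ 0 := fun i => sub_ne_zero.2 (ne_of_not_mem (hzn i) fmem)
  have hz2 : ∀ i, z i + 1 ≠ 0 := fun i h =>
    ne_of_not_mem (hzn i) (y := -1) fmem (by linear_combination h)
  obtain ⟨s, hs⟩ : ∃ s : Fin 3 → Ω, ∀ i, s i = (z i - 1) ^ 2 / z i := ⟨_, fun i => rfl⟩
  have hs0 : ∀ i, s i ≠ 0 := by
    intro i; rw [hs]; exact div_ne_zero (pow_ne_zero _ (hz1 i)) (hz0 i)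
  have hsz : ∀ i, z i ^ 2 = (2 + s i) * z i + (-1) := by
    intro i; have := hz0 i; rw [hs]; field_simp; ring
  have hg' : ∀ g, ∃ s' : Ω, ∃ π : Equiv.Perm (Fin 3), (∀ i, ρ g (s i) = s' * s (π i)) ∧
      ((∀ i, ρ g (V i) = V (π i)) ∨ (∀ i, ρ g (V i) = 1 - V (π i))) := by
    intro g
    obtain ⟨π, e, h1, h2⟩ := hg g
    refine ⟨1, π, fun i => ?_, h2⟩
    rw [hs, hs, one_mul]
    exact map_sq_div (hz0 _) (h1 i)
  have p2 : z 2 = 1 / (z 0 * z 1) := by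
    have := hz0 0
    have := hz0 1
    field_simp; linear_combination hz
  have hrel : s 0 * s 1 * s 2 = (s 0 + s 1 + s 2) ^ 2 - 4 * (s 0 * s 1 + s 1 * s 2 + s 2 * s 0) := by
    have a0 := hz0 0
    have a1 := hz0 1
    rw [hs, hs, hs, p2]
    field_simp
    ring
  obtain ⟨a, ha⟩ : ∃ a, a = s 0 / s 2 := ⟨_, rfl⟩
  obtain ⟨b, hb⟩ : ∃ b, b = s 1 / s 2 := ⟨_, rfl⟩
  have h20 := hs0 2
  have ea : s 0 = a * s 2 := by rw [ha]; field_simp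
  have eb : s 1 = b * s 2 := by rw [hb]; field_simp
  have ha0 : a ≠ 0 := by rw [ha]; exact div_ne_zero (hs0 0) h20
  have hb0 : b ≠ 0 := by rw [hb]; exact div_ne_zero (hs0 1) h20
  have e2 : s 2 = ((a + b + 1) ^ 2 - 4 * (a * b + b + a)) / (a * b) := by
    rw [eq_div_iff (mul_ne_zero ha0 hb0)]
    have h3 : s 2 ^ 2 * (s 2 * (a * b)) = s 2 ^ 2 * ((a + b + 1) ^ 2 - 4 * (a * b + b + a)) := by
      rw [ea, eb] at hrel
      linear_combination hrel
    exact mul_left_cancel₀ (pow_ne_zero 2 h20) h3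
  have m2 : s 2 ∈ K ⊔ k⟮a⟯ ⊔ k⟮b⟯ := mem_of_eq _ e2
  have m0 : s 0 ∈ K ⊔ k⟮a⟯ ⊔ k⟮b⟯ := mem_of_eq _ ea
  have m1 : s 1 ∈ K ⊔ k⟮a⟯ ⊔ k⟮b⟯ := mem_of_eq _ eb
  have n2 : z 2 ∈ K ⊔ k⟮z 0⟯ ⊔ k⟮z 1⟯ := mem_of_eq _ p2
  have hEL : K ⊔ k⟮a⟯ ⊔ k⟮b⟯ ≤ K ⊔ k⟮z 0⟯ ⊔ k⟮z 1⟯ := by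
    refine sup_simple_le.2 ⟨sup_simple_le.2 ⟨le_sup_left.trans le_sup_left, ?_⟩, ?_⟩
    · rw [ha, hs, hs]; exact fmem
    · rw [hb, hs, hs]; exact fmem
  have hLE : K ⊔ k⟮z 0⟯ ⊔ k⟮z 1⟯ ≤ K ⊔ k⟮a⟯ ⊔ k⟮b⟯ ⊔ k⟮z 0⟯ := by
    refine sup_simple_le.2 ⟨sup_simple_le.2 ⟨le_sup_left.trans (le_sup_left.trans le_sup_left), mem_right _ _⟩, ?_⟩
    have a0 := hz0 0
    have a1 := hz0 1
    have a2 := hz1 0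
    have a3 := hz2 0
    refine mem_of_eq ((s 2 + 2 - (s 1 + 2) / z 0) / (z 0 - 1 / z 0)) ?_
    have a4 : z 0 - 1 / z 0 ≠ 0 := by
      intro h
      field_simp at h
      have : (z 0 - 1) * (z 0 + 1) = 0 := by linear_combination h
      exact mul_ne_zero a2 a3 this
    rw [eq_div_iff a4, hs, hs, p2]
    field_simp
    ring
  have hBE : Big 2 K (K ⊔ k⟮a⟯ ⊔ k⟮b⟯) := by
    refine hB.acl_right (hLE.trans (sup_simple_le.2 ⟨le_acl _, ?_⟩))
    exact mem_acl_quadratic (a := -(2 + s 0)) (b := 1) fmem fmem (by linear_combination hsz 0)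
  have hfix : FixIn ρ (K ⊔ k⟮z 0⟯ ⊔ k⟮z 1⟯) = FixIn ρ (K ⊔ k⟮a⟯ ⊔ k⟮b⟯) := by
    refine fixIn_eq_of_conj_two hEL hLE (2 + s 0) (-1) fmem fmem (hsz 0) ι ?_ ?_
    · have hιs : ∀ i, ρ ι (s i) = s i := by
        intro i
        rw [hs]
        exact map_sq_div (e := -1) (hz0 i) (by rw [hιz]; simp)
      refine fix_sup_simple (fix_sup_simple hιK ?_) ?_
      · rw [ha, map_div₀, hιs, hιs]
      · rw [hb, map_div₀, hιs, hιs]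
    · rw [hιz]
      intro h
      have a0 := hz0 0
      field_simp at h
      have : (z 0 - 1) * (z 0 + 1) = 0 := by linear_combination -h
      exact mul_ne_zero (hz1 0) (hz2 0) this
  unfold RelGen
  rw [hfix, ha, hb]
  rw [ha, hb] at hBE
  exact RelGen.perm_twisted hK hBE hV hinj hg'

theorem perm_three_sign (π : Equiv.Perm (Fin 3)) (i : Fin 3) :
    (Equiv.Perm.sign π = 1 ∧ π (i + 1) = π i + 1 ∧ π (i + 2) = π i + 2) ∨
      (Equiv.Perm.sign π = -1 ∧ π (i + 1) = π i + 2 ∧ π (i + 2) = π i + 1) := by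
  revert π i; decide

theorem map_ratio {f : Ω ≃ₐ[k] Ω} {t : Fin 3 → Ω} {π : Equiv.Perm (Fin 3)} {e : ℤˣ}
    (h : ∀ i, f (t i) = t (π i) ^ (e : ℤ)) (i : Fin 3) :
    f (t (i + 1) / t (i + 2)) =
      (t (π i + 1) / t (π i + 2)) ^ ((Equiv.Perm.sign π * e : ℤˣ) : ℤ) := by
  rw [map_div₀, h, h, ← div_zpow]
  obtain ⟨h1, h2, h3⟩ | ⟨h1, h2, h3⟩ := perm_three_sign π i
  · rw [h1, h2, h3, one_mul]
  · rw [h1, h2, h3, neg_mul, one_mul, Units.val_neg, zpow_neg, ← inv_zpow, inv_div]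

theorem injective_of_succ_ne {α : Type*} {W : Fin 3 → α} (h : ∀ i, W i ≠ W (i + 1)) :
    Function.Injective W := by
  intro i j hij
  have h3 : i = j ∨ j = i + 1 ∨ i = j + 1 := by clear hij; revert i j; decide
  rcases h3 with h' | rfl | rfl
  · exact h'
  · exact absurd hij (h _)
  · exact absurd hij.symm (h _)

theorem fin_three_add (i : Fin 3) : i + 1 + 1 = i + 2 ∧ i + 1 + 2 = i ∧ i + 2 + 1 = i := by
  revert i; decide

/-- The ratios of consecutive members of a cyclic triple. -/
theorem ratio_props {t : Fin 3 → Ω} (h0 : ∀ i, t i ≠ 0) (h1 : ∀ i, t i ≠ t (i + 1))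
    (h2 : ∀ i, t i * t (i + 1) ≠ t (i + 2) ^ 2) :
    (t (0 + 1) / t (0 + 2)) * (t (1 + 1) / t (1 + 2)) * (t (2 + 1) / t (2 + 2)) = 1 ∧
      (∀ i, t (i + 1) / t (i + 2) ≠ 1) ∧ Function.Injective fun i => t (i + 1) / t (i + 2) := by
  refine ⟨?_, fun i h => ?_, injective_of_succ_ne fun i h => ?_⟩
  · change (t 1 / t 2) * (t 2 / t 0) * (t 0 / t 1) = 1
    have := h0 0
    have := h0 1
    have := h0 2
    field_simp
  · apply h1 (i + 1)
    rw [div_eq_one_iff_eq (h0 _)] at h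
    rw [h, (fin_three_add i).1]
  · apply h2 i
    obtain ⟨e1, e2, -⟩ := fin_three_add i
    simp only [e1, e2] at h
    rw [div_eq_div_iff (h0 _) (h0 _)] at h
    linear_combination h

theorem mem_acl_of_sq_div (hx : x ≠ 0) (h : (x - 1) ^ 2 / x ∈ acl K) : x ∈ acl K := by
  rw [← acl_sup_simple h]
  refine mem_acl_quadratic (a := -(2 + (x - 1) ^ 2 / x)) (b := 1) fmem fmem ?_
  field_simp
  ring

/-- Points defined over the function field of a hexagonal pair, for the characters that are
products of powers of the sign of the permutation and of the sign of the pair. -/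
theorem exists_hex_point {F : IntermediateField k Ω} {Z : Fin 3 → Ω} (hZ : Z 0 * Z 1 * Z 2 = 1)
    (hB : Big 2 F (F ⊔ k⟮Z 0⟯ ⊔ k⟮Z 1⟯)) (p q : Bool) :
    ∃ W : Fin 3 → Ω, W 0 * W 1 * W 2 = 1 ∧ (∀ i, W i ∈ F ⊔ k⟮Z 0⟯ ⊔ k⟮Z 1⟯) ∧ (∀ i, W i ≠ 1) ∧
      Function.Injective W ∧ ∀ (f : Ω ≃ₐ[k] Ω) (π : Equiv.Perm (Fin 3)) (e : ℤˣ),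
        (∀ i, f (Z i) = Z (π i) ^ (e : ℤ)) →
        ∀ i, f (W i) = W (π i) ^ ((cond p (Equiv.Perm.sign π) 1 * cond q e 1 : ℤˣ) : ℤ) := by
  have hZn : ∀ i, Z i ∉ acl F := fun i => ((hB.hex_pair hZ i).two (le_acl _)).1
  have hZn' : ∀ i, Z (i + 1) ∉ acl (F ⊔ k⟮Z i⟯) := fun i => ((hB.hex_pair hZ i).two (le_acl _)).2
  have hZ0 : ∀ i, Z i ≠ 0 := fun i => ne_of_not_mem (hZn i) fmem
  have hZ1 : ∀ i, Z i ≠ 1 := fun i => ne_of_not_mem (hZn i) fmem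
  have hZi : ∀ i, Z i * Z (i + 1) * Z (i + 2) = 1 := by
    intro i
    fin_cases i
    · exact hZ
    · change Z 1 * Z 2 * Z 0 = 1; linear_combination hZ
    · change Z 2 * Z 0 * Z 1 = 1; linear_combination hZ
  have hne : ∀ i, Z i ≠ Z (i + 1) := fun i => (ne_of_not_mem (hZn' i) (mem_right _ _)).symm
  have hZm : ∀ i, Z i ∈ F ⊔ k⟮Z 0⟯ ⊔ k⟮Z 1⟯ := by
    intro i
    fin_cases i
    · exact mem_left (mem_right _ _)
    · exact mem_right _ _
    · refine mem_of_eq (1 / (Z 0 * Z 1)) ?_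
      rw [eq_div_iff (mul_ne_zero (hZ0 0) (hZ0 1))]
      change Z 2 * _ = 1
      linear_combination hZ
  obtain ⟨s, hs⟩ : ∃ s : Fin 3 → Ω, ∀ i, s i = (Z i - 1) ^ 2 / Z i := ⟨_, fun i => rfl⟩
  have hs0 : ∀ i, s i ≠ 0 := by
    intro i; rw [hs]; exact div_ne_zero (pow_ne_zero _ (sub_ne_zero.2 (hZ1 i))) (hZ0 i)
  have hsm : ∀ i, s i ∈ F ⊔ k⟮Z 0⟯ ⊔ k⟮Z 1⟯ := by
    intro i; have := hZm i; rw [hs]; exact fmem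
  have hsF : ∀ i, s i ∈ F ⊔ k⟮Z i⟯ := by
    intro i; rw [hs]; exact fmem
  have hs3 : ∀ i, s i ^ 3 ≠ s (i + 1) ^ 3 := by
    intro i h
    have h' : s (i + 1) ∈ acl (F ⊔ k⟮Z i⟯) := by
      have := hsF i
      exact mem_acl_cubic (a := 0) (b := 0) (c := -s i ^ 3) fmem fmem fmem
        (by linear_combination -h)
    rw [hs] at h'
    exact hZn' i (mem_acl_of_sq_div (hZ0 _) h')
  have hs1 : ∀ i, s i ≠ s (i + 1) := fun i h => hs3 i (by rw [h])
  have hs2 : ∀ i, s i * s (i + 1) ≠ s (i + 2) ^ 2 := by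
    intro i h
    have hx := hZ0 i
    have hy := hZ0 (i + 1)
    have hp : Z (i + 2) = 1 / (Z i * Z (i + 1)) := by
      rw [eq_div_iff (mul_ne_zero hx hy)]; linear_combination hZi i
    rw [hs, hs, hs, hp] at h
    refine hZn' i ?_
    generalize Z i = x at *
    generalize Z (i + 1) = y at *
    refine mem_acl_quartic (a := (-4 * x ^ 3 - (x - 1) ^ 2 * x) / x ^ 4)
      (b := (6 * x ^ 2 + 2 * (x - 1) ^ 2 * x) / x ^ 4) (c := (-4 * x - (x - 1) ^ 2 * x) / x ^ 4)
      (d := 1 / x ^ 4) fmem fmem fmem fmem ?_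
    field_simp at h ⊢
    linear_combination -h
  have hsf : ∀ (f : Ω ≃ₐ[k] Ω) (π : Equiv.Perm (Fin 3)) (e : ℤˣ),
      (∀ i, f (Z i) = Z (π i) ^ (e : ℤ)) → ∀ i, f (s i) = s (π i) ^ ((1 : ℤˣ) : ℤ) := by
    intro f π e h i
    rw [hs, hs, Units.val_one, zpow_one]
    exact map_sq_div (hZ0 _) (h i)
  obtain ⟨h1, h2, h3⟩ := ratio_props hs0 hs1 hs2
  cases p
  · cases q
    · obtain ⟨W, hW⟩ : ∃ W : Fin 3 → Ω, ∀ i, W i = s (i + 1) / s (i + 2) := ⟨_, fun i => rfl⟩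
      have hW0 : ∀ i, W i ≠ 0 := fun i => by rw [hW]; exact div_ne_zero (hs0 _) (hs0 _)
      have hW1 : ∀ i, W i ≠ W (i + 1) := fun i h => by
        have := h3 (a₁ := i) (a₂ := i + 1) (by simpa only [hW] using h)
        revert this; clear h; revert i; decide
      obtain ⟨h1, h2, h3⟩ := ratio_props hW0 hW1 (by
        intro i h
        obtain ⟨e1, e2, e3⟩ := fin_three_add i
        have e4 : i + 2 + 2 = i + 1 := by clear h e1 e2 e3; revert i; decide
        have a0 := hs0 i
        have a1 := hs0 (i + 1)
        have a2 := hs0 (i + 2)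
        rw [hW, hW, hW, e1, e2, e3, e4] at h
        field_simp at h
        apply hs3 i
        linear_combination -h)
      refine ⟨fun i => W (i + 1) / W (i + 2), h1, fun i => ?_, h2, h3, fun f π e h i => ?_⟩
      · simp only [hW]
        exact div_mem (div_mem (hsm _) (hsm _)) (div_mem (hsm _) (hsm _))
      · have h5 : ∀ i, f (W i) = W (π i) ^ ((Equiv.Perm.sign π * 1 : ℤˣ) : ℤ) := by
          intro i
          rw [hW, hW]
          exact map_ratio (hsf f π e h) i
        rw [map_ratio h5 i]
        congr 2
        rcases Int.units_eq_one_or (Equiv.Perm.sign π) with h | h <;> rw [h] <;> rfl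
    · refine ⟨Z, hZ, hZm, hZ1, injective_of_succ_ne hne, fun f π e h i => ?_⟩
      rw [h, cond_false, cond_true, one_mul]
  · cases q
    · refine ⟨fun i => s (i + 1) / s (i + 2), h1, fun i => ?_, h2, h3, fun f π e h i => ?_⟩
      · exact div_mem (hsm _) (hsm _)
      · exact map_ratio (hsf f π e h) i
    · obtain ⟨h1, h2, h3⟩ := ratio_props hZ0 hne (by
        intro i h
        refine hZn (i + 2) (mem_acl_cubic (a := 0) (b := 0) (c := -1) fmem fmem fmem ?_)
        linear_combination hZi i - Z (i + 2) * h)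
      refine ⟨fun i => Z (i + 1) / Z (i + 2), h1, fun i => ?_, h2, h3, fun f π e h i => ?_⟩
      · exact div_mem (hZm _) (hZm _)
      · exact map_ratio h i

theorem Big.of_genBy_right {m n : ℕ} {F K L : IntermediateField k Ω} (h : Big (m + n) F L)
    (hL : GenBy n K L) : Big m F K := by
  classical
  obtain ⟨t, ht, rfl⟩ := hL
  intro s hs
  have := h (s ∪ t) (by
    rw [Finset.coe_union, adjoin_union, ← sup_assoc]
    exact sup_le (hs.trans (acl_mono le_sup_left)) (le_sup_right.trans (le_acl _)))
  have h2 := Finset.card_union_le s t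
  omega

theorem GenBy.two (F : IntermediateField k Ω) (x y : Ω) : GenBy 2 F (F ⊔ k⟮x⟯ ⊔ k⟮y⟯) :=
  (GenBy.one F x).trans (GenBy.one _ y)

theorem Big.two_split {F : IntermediateField k Ω} {x y z w : Ω}
    (h : Big 4 F (F ⊔ k⟮x⟯ ⊔ k⟮y⟯ ⊔ k⟮z⟯ ⊔ k⟮w⟯)) :
    Big 2 F (F ⊔ k⟮x⟯ ⊔ k⟮y⟯) ∧
      Big 2 (F ⊔ k⟮x⟯ ⊔ k⟮y⟯) (F ⊔ k⟮x⟯ ⊔ k⟮y⟯ ⊔ k⟮z⟯ ⊔ k⟮w⟯) :=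
  ⟨Big.of_genBy_right (m := 2) (n := 2) h (GenBy.two _ _ _),
    Big.of_genBy (m := 2) (n := 2) h (GenBy.two _ _ _)⟩

theorem signs_span : ∀ a c a' c' a'' c'' a₃ c₃ : ℤˣ, ∃ p q r s : Bool,
    cond p (a, -1, c) 1 * cond q (a', -a', c') 1 * cond r (a'', -c'', c'') 1 *
      cond s (a₃, -(a₃ * c₃), c₃) 1 = ((1, -1, 1) : ℤˣ × ℤˣ × ℤˣ) := by
  intro a c
  rcases Int.units_eq_one_or a with rfl | rfl <;>
    rcases Int.units_eq_one_or c with rfl | rfl <;> decide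

theorem neg_of_ne {a b : ℤˣ} (h : a ≠ b) : a = -b := by
  revert a b; decide

/-- On a group of triples of signs, either the second sign is independent of the other two or
it is a product of some of them. -/
theorem sign_dichotomy (S : Submonoid (ℤˣ × ℤˣ × ℤˣ)) (hS : (1, -1, 1) ∉ S) :
    ∃ p q : Bool, ∀ x ∈ S, x.2.1 = cond p x.1 1 * cond q x.2.2 1 := by
  by_contra! h
  obtain ⟨⟨a, b, c⟩, hx, hx'⟩ := h false false
  obtain ⟨⟨a', b', c'⟩, hy, hy'⟩ := h true false
  obtain ⟨⟨a'', b'', c''⟩, hz, hz'⟩ := h false true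
  obtain ⟨⟨a₃, b₃, c₃⟩, hw, hw'⟩ := h true true
  simp only [cond_true, cond_false, mul_one, one_mul] at hx' hy' hz' hw'
  obtain rfl := neg_of_ne hx'
  obtain rfl := neg_of_ne hy'
  obtain rfl := neg_of_ne hz'
  obtain rfl := neg_of_ne hw'
  obtain ⟨p, q, r, s, e⟩ := signs_span a c a' c' a'' c'' a₃ c₃
  apply hS
  rw [← e]
  have aux : ∀ {x} (p : Bool), x ∈ S → cond p x 1 ∈ S := by
    rintro x (_ | _) hx
    · exact S.one_mem
    · exact hx
  exact mul_mem (mul_mem (mul_mem (aux p hx) (aux q hy)) (aux r hz)) (aux s hw)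

/-- `f` permutes the triple `z` by `π`, up to inversion according to the sign `e`. -/
def HexAct (f : Ω ≃ₐ[k] Ω) (z : Fin 3 → Ω) (π : Equiv.Perm (Fin 3)) (e : ℤˣ) : Prop :=
  ∀ i, f (z i) = z (π i) ^ (e : ℤ)

theorem HexAct.mul {f g : Ω ≃ₐ[k] Ω} {z : Fin 3 → Ω} {π τ : Equiv.Perm (Fin 3)} {e d : ℤˣ}
    (hf : HexAct f z π e) (hg : HexAct g z τ d) : HexAct (f * g) z (π * τ) (e * d) := by
  intro i
  rw [AlgEquiv.mul_apply, hg, map_zpow₀, hf, ← zpow_mul, Units.val_mul, Equiv.Perm.mul_apply]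

theorem HexAct.one (z : Fin 3 → Ω) : HexAct (1 : Ω ≃ₐ[k] Ω) z 1 1 := by
  intro i; simp

theorem HexAct.mem {f : Ω ≃ₐ[k] Ω} {z : Fin 3 → Ω} {π : Equiv.Perm (Fin 3)} {e : ℤˣ}
    {L : IntermediateField k Ω} (h : HexAct f z π e) (hL : ∀ i, z i ∈ L) (i : Fin 3) :
    f (z i) ∈ L := by
  rw [h]; exact zpow_mem (hL _) _

theorem HexAct.or {f : Ω ≃ₐ[k] Ω} {z : Fin 3 → Ω} {π : Equiv.Perm (Fin 3)} {e : ℤˣ}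
    (h : HexAct f z π e) : (∀ i, f (z i) = z (π i)) ∨ (∀ i, f (z i) = 1 / z (π i)) := by
  rcases Int.units_eq_one_or e with rfl | rfl
  · left; intro i; rw [h]; simp
  · right; intro i; rw [h]; simp

theorem hex_mem {z : Fin 3 → Ω} (hz : z 0 * z 1 * z 2 = 1) (i : Fin 3) :
    z i ∈ K ⊔ k⟮z 0⟯ ⊔ k⟮z 1⟯ := by
  have hz0 : z 0 ≠ 0 := by intro h; simp [h] at hz
  have hz1 : z 1 ≠ 0 := by intro h; simp [h] at hz
  fin_cases i
  · exact mem_left (mem_right _ _)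
  · exact mem_right _ _
  · refine mem_of_eq (1 / (z 0 * z 1)) ?_
    rw [eq_div_iff (mul_ne_zero hz0 hz1)]
    change z 2 * _ = 1
    linear_combination hz

theorem Stable.hex (hK : Stable ρ K) {z : Fin 3 → Ω} (hz : z 0 * z 1 * z 2 = 1)
    (hg : ∀ g, ∃ π e, HexAct (ρ g) z π e) : Stable ρ (K ⊔ k⟮z 0⟯ ⊔ k⟮z 1⟯) := by
  intro g
  obtain ⟨π, e, h⟩ := hg g
  have h1 := h.mem (L := K ⊔ k⟮z 0⟯ ⊔ k⟮z 1⟯) (hex_mem hz)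
  have h2 : ∀ y ∈ K ⊔ k⟮z 0⟯, ρ g y ∈ K ⊔ k⟮z 0⟯ ⊔ k⟮z 1⟯ :=
    map_mem_sup_adjoin _ (fun y hy => mem_left (mem_left (hK g y hy))) (by simpa using h1 0)
  exact map_mem_sup_adjoin _ h2 (by simpa using h1 1)

theorem fix_bot (f : Ω ≃ₐ[k] Ω) : ∀ y ∈ (⊥ : IntermediateField k Ω), f y = y := by
  intro y hy
  obtain ⟨a, rfl⟩ := mem_bot.1 hy
  exact f.commutes a

/-- Two hexagonal pairs whose rotations are coupled. -/
theorem relGen_hex_hex [Finite G] {Z z : Fin 3 → Ω} (hZ : Z 0 * Z 1 * Z 2 = 1)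
    (hz : z 0 * z 1 * z 2 = 1) (hB : Big 4 ⊥ (⊥ ⊔ k⟮Z 0⟯ ⊔ k⟮Z 1⟯ ⊔ k⟮z 0⟯ ⊔ k⟮z 1⟯))
    (hg : ∀ g, ∃ π e d, HexAct (ρ g) Z π e ∧ HexAct (ρ g) z π d) (c : G)
    (hc : ∀ i, ρ c (Z i) = Z (i + 1)) : RelGen ρ 4 ⊥ (⊥ ⊔ k⟮Z 0⟯ ⊔ k⟮Z 1⟯ ⊔ k⟮z 0⟯ ⊔ k⟮z 1⟯) := by
  obtain ⟨hB1, hB2⟩ := hB.two_split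
  have hK : Stable ρ (⊥ ⊔ k⟮Z 0⟯ ⊔ k⟮Z 1⟯) :=
    (stable_bot ρ).hex hZ fun g => by obtain ⟨π, e, d, h, -⟩ := hg g; exact ⟨π, e, h⟩
  refine RelGen.trans (m := 2) (n := 2) (relGen_hex (stable_bot ρ) hZ hB1 (fun g => ?_) c (fix_bot _) hc) ?_
  · obtain ⟨π, e, d, h, -⟩ := hg g
    exact ⟨π, h.or⟩
  let S : Submonoid (ℤˣ × ℤˣ × ℤˣ) :=
    { carrier := {x | ∃ g π, HexAct (ρ g) Z π x.2.2 ∧ HexAct (ρ g) z π x.2.1 ∧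
        Equiv.Perm.sign π = x.1}
      one_mem' := ⟨1, 1, by rw [map_one]; exact HexAct.one Z, by rw [map_one]; exact HexAct.one z, by simp⟩
      mul_mem' := by
        rintro x y ⟨g, π, h1, h2, h3⟩ ⟨g', π', h1', h2', h3'⟩
        exact ⟨g * g', π * π', by rw [map_mul]; exact h1.mul h1', by rw [map_mul]; exact h2.mul h2',
          by rw [map_mul, h3, h3', Prod.fst_mul]⟩ }
  by_cases hS : (1, -1, 1) ∈ S
  · obtain ⟨g, π, h1, h2, h3⟩ := hS
    have hπ : π * π * π = 1 := by
      simp only at h3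
      clear h1 h2; revert π; decide
    have f1 : HexAct (ρ (g * g * g)) Z 1 1 := by
      have := (h1.mul h1).mul h1
      rwa [← map_mul, ← map_mul, hπ] at this
    have f2 : HexAct (ρ (g * g * g)) z 1 (-1) := by
      have := (h2.mul h2).mul h2
      rwa [← map_mul, ← map_mul, hπ] at this
    have hZn : ∀ i, Z i ≠ 1 := fun i => ne_of_not_mem ((hB1.hex_pair hZ i).two (le_acl _)).1 fmem
    have hZ0 : ∀ i, Z i ≠ 0 := fun i => ne_of_not_mem ((hB1.hex_pair hZ i).two (le_acl _)).1 fmem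
    have hZi : Function.Injective Z := injective_of_succ_ne fun i =>
      (ne_of_not_mem ((hB1.hex_pair hZ i).two (le_acl _)).2 (mem_right _ _)).symm
    have hm := hex_mem (K := (⊥ : IntermediateField k Ω)) hZ
    refine relGen_hex_of_neg hK (V := fun i => 1 / (1 - Z i)) hz hB2 (fun i => ?_) (fun i j h => ?_)
      (fun g => ?_) (g * g * g) (fix_sup_simple (fix_sup_simple (fix_bot _) ?_) ?_) (fun i => ?_)
    · have := hm i
      exact fmem
    · have := hm i
      simp only [one_div, inv_inj] at h
      exact hZi (by linear_combination -h)
    · obtain ⟨π, e, d, h, h'⟩ := hg g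
      refine ⟨π, d, h', ?_⟩
      have := fun i => map_one_div_one_sub (hZ0 _) (hZn _) (h i)
      rcases Int.units_eq_one_or e with rfl | rfl
      · left; intro i; rw [this]; simp
      · right; intro i; rw [this, if_neg (by decide)]
    · rw [f1]; simp
    · rw [f1]; simp
    · rw [f2]; simp
  · obtain ⟨p, q, hpq⟩ := sign_dichotomy S hS
    obtain ⟨W, w1, w2, w3, w4, w5⟩ := exists_hex_point hZ hB1 p q
    refine relGen_hex_of_point hK hz hB2 w1 w2 w3 w4 fun g => ?_
    obtain ⟨π, e, d, h, h'⟩ := hg g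
    refine ⟨π, d, h', fun i => ?_⟩
    have hd : d = _ := hpq (Equiv.Perm.sign π, d, e) ⟨g, π, h, h', rfl⟩
    rw [w5 _ π e h, hd]

/-- `f` maps `w` to `± w` or `± 1 / w` according to a pair of signs. -/
def NegAct (f : Ω ≃ₐ[k] Ω) (w : Ω) (v : ℤˣ × ℤˣ) : Prop :=
  f w = ((v.1 : ℤ) : Ω) * w ^ (v.2 : ℤ)

theorem NegAct.mul {f g : Ω ≃ₐ[k] Ω} {w : Ω} {v v' : ℤˣ × ℤˣ} (hf : NegAct f w v)
    (hg : NegAct g w v') : NegAct (f * g) w (v * v') := by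
  unfold NegAct at *
  rw [AlgEquiv.mul_apply, hg, map_mul, map_intCast, map_zpow₀, hf, mul_zpow, ← zpow_mul]
  obtain ⟨a, b⟩ := v
  obtain ⟨a', b'⟩ := v'
  rcases Int.units_eq_one_or a with rfl | rfl <;> rcases Int.units_eq_one_or a' with rfl | rfl <;>
    rcases Int.units_eq_one_or b with rfl | rfl <;> rcases Int.units_eq_one_or b' with rfl | rfl <;>
    simp

theorem NegAct.one (w : Ω) : NegAct (1 : Ω ≃ₐ[k] Ω) w 1 := by
  simp [NegAct]

theorem NegAct.mem {f : Ω ≃ₐ[k] Ω} {w : Ω} {v : ℤˣ × ℤˣ} (h : NegAct f w v) (hw : w ∈ K) :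
    f w ∈ K := by
  rw [h]; exact mul_mem (intCast_mem K _) (zpow_mem hw _)

theorem NegAct.cases {f : Ω ≃ₐ[k] Ω} {w : Ω} {v : ℤˣ × ℤˣ} (h : NegAct f w v) :
    (v = (1, 1) ∧ f w = w) ∨ (v = (-1, 1) ∧ f w = -w) ∨ (v = (1, -1) ∧ f w = 1 / w) ∨
      (v = (-1, -1) ∧ f w = -(1 / w)) := by
  unfold NegAct at h
  obtain ⟨a, b⟩ := v
  rcases Int.units_eq_one_or a with rfl | rfl <;> rcases Int.units_eq_one_or b with rfl | rfl <;>
    simp_all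

theorem NegAct.cay {f : Ω ≃ₐ[k] Ω} {w : Ω} {v : ℤˣ × ℤˣ} (h : NegAct f w v) (hw : w ≠ 0) :
    NegAct f (cay w) v.swap := by
  unfold NegAct
  rw [map_cay]
  have e1 : _root_.cay (-w) = 1 / _root_.cay w := by
    unfold _root_.cay
    rw [one_div_div]
    congr 1 <;> ring
  obtain ⟨rfl, h'⟩ | ⟨rfl, h'⟩ | ⟨rfl, h'⟩ | ⟨rfl, h'⟩ := h.cases
  · rw [h']; simp
  · rw [h', e1]; simp
  · rw [h', cay_inv hw]; simp
  · rw [h', ← one_div_neg_eq_neg_one_div, cay_inv (neg_ne_zero.2 hw), e1]; simp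

theorem Stable.negAct (hK : Stable ρ K) {w : Ω} (hg : ∀ g, ∃ v, NegAct (ρ g) w v) :
    Stable ρ (K ⊔ k⟮w⟯) :=
  hK.sup_simple fun g => by obtain ⟨v, h⟩ := hg g; exact h.mem (mem_right _ _)

theorem relGen_neg_of_fix [Finite G] (h2 : (2 : Ω) ≠ 0) (hK : Stable ρ K) {w : Ω} (hw : w ∉ acl K)
    (hg : ∀ g, ∃ v, NegAct (ρ g) w v) (c : G) (hc : ∀ y ∈ K, ρ c y = y) {v : ℤˣ × ℤˣ}
    (hcv : NegAct (ρ c) w v) (hv : v ≠ 1) : RelGen ρ 1 K (K ⊔ k⟮w⟯) := by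
  have hw0 : w ≠ 0 := ne_of_not_mem hw fmem
  have key : ∀ θ a b : Ω, θ ∈ K ⊔ k⟮w⟯ → a ∈ K ⊔ k⟮θ⟯ → b ∈ K ⊔ k⟮θ⟯ → w ^ 2 = a * w + b →
      ρ c θ = θ → ρ c w ≠ w → (θ ∉ acl K → RelGen ρ 1 K (K ⊔ k⟮θ⟯)) → RelGen ρ 1 K (K ⊔ k⟮w⟯) := by
    intro θ a b hθ ha hb hq hcθ hcw hR
    have h1 : FixIn ρ (K ⊔ k⟮w⟯) = FixIn ρ (K ⊔ k⟮θ⟯) :=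
      fixIn_eq_of_conj_two (sup_simple_le.2 ⟨le_sup_left, hθ⟩)
        (sup_simple_le.2 ⟨le_sup_left.trans le_sup_left, mem_right _ _⟩) a b ha hb hq c
        (fix_sup_simple hc hcθ) hcw
    unfold RelGen
    rw [h1]
    refine hR fun h => hw ?_
    rw [← acl_sup_simple h]
    exact mem_acl_quadratic (neg_mem ha) (neg_mem hb) (by linear_combination hq)
  obtain ⟨rfl, h⟩ | ⟨rfl, h⟩ | ⟨rfl, h⟩ | ⟨rfl, h⟩ := hcv.cases
  · exact absurd rfl hv
  · refine key (w ^ 2) 0 (w ^ 2) fmem fmem fmem (by ring) (by rw [map_pow, h]; ring) ?_ ?_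
    · intro e
      rw [h] at e
      exact hw0 ((mul_eq_zero.1 (by linear_combination -e : 2 * w = 0)).resolve_left h2)
    · intro hθ
      refine RelGen.inv hK hθ fun g => ?_
      obtain ⟨v, h⟩ := hg g
      rw [map_pow]
      obtain ⟨-, h⟩ | ⟨-, h⟩ | ⟨-, h⟩ | ⟨-, h⟩ := h.cases <;> rw [h]
      · simp
      · simp
      · right; field_simp
      · right; field_simp
  · refine key (w + 1 / w) (w + 1 / w) (-1) fmem fmem fmem (by field_simp; ring)
      (by rw [map_add, map_div₀, map_one, h]; field_simp; ring) ?_ ?_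
    · intro e
      rw [h] at e
      field_simp at e
      exact hw (mem_acl_quadratic (a := 0) (b := -1) fmem fmem (by linear_combination -e))
    · intro hθ
      refine RelGen.affine hK hθ fun g => ?_
      obtain ⟨v, h⟩ := hg g
      rw [map_add, map_div₀, map_one]
      obtain ⟨-, h⟩ | ⟨-, h⟩ | ⟨-, h⟩ | ⟨-, h⟩ := h.cases <;> rw [h]
      · exact ⟨1, fmem, 0, fmem, by ring⟩
      · exact ⟨-1, fmem, 0, fmem, by field_simp; ring⟩
      · exact ⟨1, fmem, 0, fmem, by field_simp; ring⟩
      · exact ⟨-1, fmem, 0, fmem, by field_simp; ring⟩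
  · refine key (w - 1 / w) (w - 1 / w) 1 fmem fmem fmem (by field_simp; ring)
      (by rw [map_sub, map_div₀, map_one, h]; field_simp; ring) ?_ ?_
    · intro e
      rw [h] at e
      field_simp at e
      exact hw (mem_acl_quadratic (a := 0) (b := 1) fmem fmem (by linear_combination -e))
    · intro hθ
      refine RelGen.affine hK hθ fun g => ?_
      obtain ⟨v, h⟩ := hg g
      rw [map_sub, map_div₀, map_one]
      obtain ⟨-, h⟩ | ⟨-, h⟩ | ⟨-, h⟩ | ⟨-, h⟩ := h.cases <;> rw [h]
      · exact ⟨1, fmem, 0, fmem, by ring⟩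
      · exact ⟨-1, fmem, 0, fmem, by field_simp; ring⟩
      · exact ⟨-1, fmem, 0, fmem, by field_simp; ring⟩
      · exact ⟨1, fmem, 0, fmem, by field_simp; ring⟩

set_option maxHeartbeats 1000000 in
/-- The twisted action of the four-group on two variables. -/
theorem relGen_neg_twist [Finite G] (h2 : (2 : Ω) ≠ 0) {w₁ w₂ : Ω}
    (hB : Big 2 ⊥ (⊥ ⊔ k⟮w₁⟯ ⊔ k⟮w₂⟯))
    (hg : ∀ g, (ρ g w₁ = w₁ ∧ ρ g w₂ = w₂) ∨ (ρ g w₁ = -(1 / w₁) ∧ ρ g w₂ = -w₂) ∨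
      (ρ g w₁ = -w₁ ∧ ρ g w₂ = -(1 / w₂)) ∨ (ρ g w₁ = 1 / w₁ ∧ ρ g w₂ = 1 / w₂)) (c : G)
    (hc1 : ρ c w₁ = -w₁) (hc2 : ρ c w₂ = -(1 / w₂)) : RelGen ρ 2 ⊥ (⊥ ⊔ k⟮w₁⟯ ⊔ k⟮w₂⟯) := by
  have hB' := hB
  rw [sup_right_comm] at hB'
  obtain ⟨n1, -⟩ := hB.two (le_acl _)
  obtain ⟨n2, n12⟩ := hB'.two (le_acl _)
  have z1 : w₁ ≠ 0 := ne_of_not_mem n1 fmem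
  have z2 : w₂ ≠ 0 := ne_of_not_mem n2 fmem
  have z3 : w₂ ^ 2 + 1 ≠ 0 := fun h =>
    n2 (mem_acl_quadratic (a := 0) (b := 1) fmem fmem (by linear_combination h))
  have z4 : w₂ ^ 2 - 1 ≠ 0 := fun h =>
    n2 (mem_acl_quadratic (a := 0) (b := -1) fmem fmem (by linear_combination h))
  obtain ⟨s, hs⟩ : ∃ s, s = w₂ - 1 / w₂ := ⟨_, rfl⟩
  obtain ⟨t, ht⟩ : ∃ t, t = w₁ * (w₂ + 1 / w₂) := ⟨_, rfl⟩
  obtain ⟨t', ht'⟩ : ∃ t', t' = (w₂ + 1 / w₂) / w₁ := ⟨_, rfl⟩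
  have z5 : w₂ + 1 / w₂ ≠ 0 := by
    intro h; field_simp at h; exact z3 (by linear_combination h)
  have s0 : s ≠ 0 := by
    intro h; rw [hs] at h; field_simp at h; exact z4 (by linear_combination h)
  have t0 : t ≠ 0 := by rw [ht]; exact mul_ne_zero z1 z5
  have htt : t * t' = s ^ 2 + 4 := by
    rw [ht, ht', hs]; field_simp; ring
  have q : w₂ ^ 2 = s * w₂ + 1 := by rw [hs]; field_simp; ring
  have hEL : ⊥ ⊔ k⟮s⟯ ⊔ k⟮t⟯ ≤ ⊥ ⊔ k⟮w₁⟯ ⊔ k⟮w₂⟯ := by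
    refine sup_simple_le.2 ⟨sup_simple_le.2 ⟨bot_le, ?_⟩, ?_⟩
    · rw [hs]; exact fmem
    · rw [ht]; exact fmem
  have hLE : ⊥ ⊔ k⟮w₁⟯ ⊔ k⟮w₂⟯ ≤ ⊥ ⊔ k⟮s⟯ ⊔ k⟮t⟯ ⊔ k⟮w₂⟯ := by
    refine sup_simple_le.2 ⟨sup_simple_le.2 ⟨bot_le, ?_⟩, mem_right _ _⟩
    refine mem_of_eq (t / (w₂ + 1 / w₂)) ?_
    rw [eq_div_iff z5, ht]
  have hBE : Big 2 ⊥ (⊥ ⊔ k⟮s⟯ ⊔ k⟮t⟯) := by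
    refine hB.acl_right (hLE.trans (sup_simple_le.2 ⟨le_acl _, ?_⟩))
    exact mem_acl_quadratic (a := -s) (b := -1) fmem fmem (by linear_combination q)
  have hfix : FixIn ρ (⊥ ⊔ k⟮w₁⟯ ⊔ k⟮w₂⟯) =
      FixIn ρ (⊥ ⊔ k⟮s⟯ ⊔ k⟮t⟯) := by
    refine fixIn_eq_of_conj_two hEL hLE s 1 fmem fmem q c
      (fix_sup_simple (fix_sup_simple (fix_bot _) ?_) ?_) ?_
    · rw [hs, map_sub, map_div₀, map_one, hc2]; field_simp; ring
    · rw [ht, map_mul, map_add, map_div₀, map_one, hc1, hc2]; field_simp; ring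
    · rw [hc2]; intro h; field_simp at h; exact z3 (by linear_combination -h)
  unfold RelGen
  rw [hfix]
  obtain ⟨A, hA⟩ : ∃ A, A = (t - 2) / s := ⟨_, rfl⟩
  obtain ⟨B, hBd⟩ : ∃ B, B = (t' - 2) / s := ⟨_, rfl⟩
  have et : t = A * s + 2 := by rw [hA]; field_simp; ring
  have et' : t' = B * s + 2 := by rw [hBd]; field_simp; ring
  have e1 : s * (1 - A * B) = 2 * (A + B) := by
    rw [et, et'] at htt
    apply mul_left_cancel₀ s0
    linear_combination -htt
  have hAB : 1 - A * B ≠ 0 := by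
    intro h
    rw [h, mul_zero] at e1
    have hAB : A + B = 0 := (mul_eq_zero.1 e1.symm).resolve_left h2
    refine (hBE.two (le_acl _)).2
      (mem_acl_quadratic (a := -4) (b := s ^ 2 + 4) fmem fmem ?_)
    have : t' = 4 - t := by rw [et, et']; linear_combination s * hAB
    rw [this] at htt
    linear_combination -htt
  have es : s = 2 * (A + B) / (1 - A * B) := by rw [eq_div_iff hAB, e1]
  have mt' : t' ∈ ⊥ ⊔ k⟮s⟯ ⊔ k⟮t⟯ := by
    refine mem_of_eq ((s ^ 2 + 4) / t) ?_
    rw [eq_div_iff t0]; linear_combination htt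
  have heq : ⊥ ⊔ k⟮s⟯ ⊔ k⟮t⟯ = ⊥ ⊔ k⟮A + B⟯ ⊔ k⟮A⟯ := by
    have mB : B ∈ ⊥ ⊔ k⟮A + B⟯ ⊔ k⟮A⟯ := mem_of_eq (A + B - A) (by ring)
    have ms : s ∈ ⊥ ⊔ k⟮A + B⟯ ⊔ k⟮A⟯ := mem_of_eq _ es
    refine sup_two_eq ms (mem_of_eq _ et) ?_ ?_
    · rw [hA, hBd]; exact fmem
    · rw [hA]; exact fmem
  rw [heq] at hBE ⊢
  obtain ⟨m1, m2⟩ := hBE.two (le_acl _)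
  have hact : ∀ g, (ρ g A = A ∧ ρ g B = B) ∨ (ρ g A = -B ∧ ρ g B = -A) := by
    intro g
    have a1 : ρ g A = (ρ g w₁ * (ρ g w₂ + 1 / ρ g w₂) - 2) / (ρ g w₂ - 1 / ρ g w₂) := by
      rw [hA, ht, hs]; simp only [map_div₀, map_sub, map_mul, map_add, map_one, map_ofNat]
    have a2 : ρ g B = ((ρ g w₂ + 1 / ρ g w₂) / ρ g w₁ - 2) / (ρ g w₂ - 1 / ρ g w₂) := by
      rw [hBd, ht', hs]; simp only [map_div₀, map_sub, map_add, map_one, map_ofNat]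
    rw [a1, a2]
    have e3 : -s ≠ 0 := neg_ne_zero.2 s0
    rcases hg g with ⟨h1, h2⟩ | ⟨h1, h2⟩ | ⟨h1, h2⟩ | ⟨h1, h2⟩ <;> rw [h1, h2]
    · left
      exact ⟨by rw [hA, ht, hs], by rw [hBd, ht', hs]⟩
    · right
      have i1 : -w₂ - 1 / -w₂ = -s := by rw [hs]; field_simp; ring
      have i2 : -(1 / w₁) * (-w₂ + 1 / -w₂) = t' := by rw [ht']; field_simp; ring
      have i3 : (-w₂ + 1 / -w₂) / -(1 / w₁) = t := by rw [ht]; field_simp; ring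
      rw [i1, i2, i3, hA, hBd, div_neg, div_neg]
      exact ⟨rfl, rfl⟩
    · left
      have i1 : -(1 / w₂) - 1 / -(1 / w₂) = s := by rw [hs]; field_simp; ring
      have i2 : -w₁ * (-(1 / w₂) + 1 / -(1 / w₂)) = t := by rw [ht]; field_simp; ring
      have i3 : (-(1 / w₂) + 1 / -(1 / w₂)) / -w₁ = t' := by rw [ht']; field_simp; ring
      rw [i1, i2, i3, hA, hBd]
      exact ⟨rfl, rfl⟩
    · right
      have i1 : (1 / w₂) - 1 / (1 / w₂) = -s := by rw [hs]; field_simp; ring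
      have i2 : 1 / w₁ * ((1 / w₂) + 1 / (1 / w₂)) = t' := by rw [ht']; field_simp; ring
      have i3 : ((1 / w₂) + 1 / (1 / w₂)) / (1 / w₁) = t := by rw [ht]; field_simp; ring
      rw [i1, i2, i3, hA, hBd, div_neg, div_neg]
      exact ⟨rfl, rfl⟩
  refine RelGen.affine_two (stable_bot ρ) m1 m2 (fun g => ?_) (fun g => ?_)
  · rw [map_add]
    obtain ⟨h, h'⟩ | ⟨h, h'⟩ := hact g <;> rw [h, h']
    · exact ⟨1, fmem, 0, fmem, by ring⟩
    · exact ⟨-1, fmem, 0, fmem, by ring⟩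
  · obtain ⟨h, h'⟩ | ⟨h, h'⟩ := hact g <;> rw [h]
    · exact ⟨1, fmem, 0, fmem, by ring⟩
    · exact ⟨1, fmem, -(A + B), fmem, by ring⟩

/-- Interchange the two signs if the flag is set. -/
def swapIf (b : Bool) (v : ℤˣ × ℤˣ) : ℤˣ × ℤˣ := cond b v.swap v

/-- The pairs in the twisted four-group. -/
def IsTwisted (u v : ℤˣ × ℤˣ) : Prop :=
  (u = 1 ∧ v = 1) ∨ (u = (-1, -1) ∧ v = (-1, 1)) ∨ (u = (-1, 1) ∧ v = (-1, -1)) ∨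
    (u = (1, -1) ∧ v = (1, -1))

instance (u v : ℤˣ × ℤˣ) : Decidable (IsTwisted u v) := by
  unfold IsTwisted; infer_instance

set_option synthInstance.maxSize 1000 in
set_option synthInstance.maxHeartbeats 400000 in
theorem sign_pair_full_cases : ∀ p q : ℤˣ × ℤˣ, p ≠ 1 → q ≠ 1 → p ≠ q →
    (p = (-1, 1) ∧ q = (1, -1)) ∨ (p = (1, -1) ∧ q = (-1, 1)) ∨
      ∃ a b : Bool, IsTwisted (swapIf a (-1, 1)) (swapIf b p) ∧
        IsTwisted (swapIf a (1, -1)) (swapIf b q) ∧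
        IsTwisted (swapIf a (-1, -1)) (swapIf b (p * q)) ∧
        ((swapIf a (-1, 1) = (-1, 1) ∧ swapIf b p = (-1, -1)) ∨
          (swapIf a (1, -1) = (-1, 1) ∧ swapIf b q = (-1, -1))) := by
  decide

theorem sign_pair_cases (S : Submonoid ((ℤˣ × ℤˣ) × (ℤˣ × ℤˣ))) :
    (∀ s ∈ S, s.1.1 = 1) ∨ (∀ s ∈ S, s.2.1 = 1) ∨ (∀ s ∈ S, s.1.2 = 1) ∨ (∀ s ∈ S, s.2.2 = 1) ∨
      (∃ s ∈ S, s.1 = 1 ∧ s.2 ≠ 1) ∨ (∃ s ∈ S, s.2 = 1 ∧ s.1 ≠ 1) ∨ (∀ s ∈ S, s.1 = s.2) ∨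
      (∀ s ∈ S, s.1 = s.2.swap) ∨
      ∃ a b : Bool, (∀ s ∈ S, IsTwisted (swapIf a s.1) (swapIf b s.2)) ∧
        ∃ s ∈ S, swapIf a s.1 = (-1, 1) ∧ swapIf b s.2 = (-1, -1) := by
  by_cases hB : ∃ s ∈ S, s.1 = 1 ∧ s.2 ≠ 1
  · exact .inr <| .inr <| .inr <| .inr <| .inl hB
  by_cases hB' : ∃ s ∈ S, s.2 = 1 ∧ s.1 ≠ 1
  · exact .inr <| .inr <| .inr <| .inr <| .inr <| .inl hB'
  have sq : ∀ u v : ℤˣ × ℤˣ, u * v = 1 ↔ u = v := by decide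
  have inj : ∀ s ∈ S, ∀ t ∈ S, s.1 = t.1 → s = t := by
    intro s hs t ht h
    by_contra hne
    exact hB ⟨s * t, mul_mem hs ht, (sq _ _).2 h, fun e => hne (Prod.ext h ((sq _ _).1 e))⟩
  have h1 : ((1, 1) : (ℤˣ × ℤˣ) × (ℤˣ × ℤˣ)) ∈ S := one_mem S
  by_cases hg : ∃ p, ((-1, 1), p) ∈ S
  · obtain ⟨p, hp⟩ := hg
    by_cases h3 : ∀ s ∈ S, s.1.2 = 1
    · exact .inr <| .inr <| .inl h3
    have ht : ∃ q, ((1, -1), q) ∈ S := by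
      push Not at h3
      obtain ⟨⟨⟨x, y⟩, q⟩, ht, hty⟩ := h3
      obtain rfl : y = -1 := neg_of_ne hty
      rcases Int.units_eq_one_or x with rfl | rfl
      · exact ⟨q, ht⟩
      · exact ⟨_, mul_mem hp ht⟩
    obtain ⟨q, hq⟩ := ht
    have hpq : ((-1, -1), p * q) ∈ S := mul_mem hp hq
    have hall : ∀ s ∈ S, s = (1, 1) ∨ s = ((-1, 1), p) ∨ s = ((1, -1), q) ∨
        s = ((-1, -1), p * q) := by
      rintro ⟨⟨x, y⟩, r⟩ hs
      rcases Int.units_eq_one_or x with rfl | rfl <;> rcases Int.units_eq_one_or y with rfl | rfl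
      · left; exact inj _ hs _ h1 rfl
      · right; right; left; exact inj _ hs _ hq rfl
      · right; left; exact inj _ hs _ hp rfl
      · right; right; right; exact inj _ hs _ hpq rfl
    have p1 : p ≠ 1 := fun h => hB' ⟨_, hp, h, (by decide : ((-1, 1) : ℤˣ × ℤˣ) ≠ 1)⟩
    have q1 : q ≠ 1 := fun h => hB' ⟨_, hq, h, (by decide : ((1, -1) : ℤˣ × ℤˣ) ≠ 1)⟩
    have pq : p ≠ q := fun h => hB' ⟨_, hpq, (sq _ _).2 h, (by decide : ((-1, -1) : ℤˣ × ℤˣ) ≠ 1)⟩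
    obtain ⟨rfl, rfl⟩ | ⟨rfl, rfl⟩ | ⟨a, b, i1, i2, i3, i4⟩ := sign_pair_full_cases p q p1 q1 pq
    · have : ∀ s ∈ S, s.1 = s.2 := by
        intro s hs
        obtain rfl | rfl | rfl | rfl := hall s hs <;> decide
      exact .inr <| .inr <| .inr <| .inr <| .inr <| .inr <| .inl this
    · have : ∀ s ∈ S, s.1 = s.2.swap := by
        intro s hs
        obtain rfl | rfl | rfl | rfl := hall s hs <;> decide
      exact .inr <| .inr <| .inr <| .inr <| .inr <| .inr <| .inr <| .inl this
    · iterate 8 right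
      refine ⟨a, b, ?_, ?_⟩
      · intro s hs
        obtain rfl | rfl | rfl | rfl := hall s hs
        · clear i1 i2 i3 i4; revert a b; decide
        · exact i1
        · exact i2
        · exact i3
      · rcases i4 with h | h
        · exact ⟨_, hp, h⟩
        · exact ⟨_, hq, h⟩
  · by_cases h3 : ∀ s ∈ S, s.1.1 = 1
    · exact .inl h3
    have hg' : ∃ p, ((-1, -1), p) ∈ S := by
      push Not at h3
      obtain ⟨⟨⟨x, y⟩, q⟩, ht, hty⟩ := h3
      obtain rfl : x = -1 := neg_of_ne hty
      rcases Int.units_eq_one_or y with rfl | rfl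
      · exact absurd ⟨q, ht⟩ hg
      · exact ⟨_, ht⟩
    obtain ⟨p, hp⟩ := hg'
    have hall : ∀ s ∈ S, s = (1, 1) ∨ s = ((-1, -1), p) := by
      rintro ⟨⟨x, y⟩, r⟩ hs
      rcases Int.units_eq_one_or x with rfl | rfl <;> rcases Int.units_eq_one_or y with rfl | rfl
      · left; exact inj _ hs _ h1 rfl
      · exact absurd ⟨_, mul_mem hp hs⟩ hg
      · exact absurd ⟨_, hs⟩ hg
      · right; exact inj _ hs _ hp rfl
    have : p.1 = 1 ∨ p.2 = 1 ∨ p = (-1, -1) := by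
      exact (by decide : ∀ p : ℤˣ × ℤˣ, p.1 = 1 ∨ p.2 = 1 ∨ p = (-1, -1)) p
    obtain h | h | rfl := this
    · have : ∀ s ∈ S, s.2.1 = 1 := by
        intro s hs
        obtain rfl | rfl := hall s hs
        · rfl
        · exact h
      exact .inr <| .inl this
    · have : ∀ s ∈ S, s.2.2 = 1 := by
        intro s hs
        obtain rfl | rfl := hall s hs
        · rfl
        · exact h
      exact .inr <| .inr <| .inr <| .inl this
    · have : ∀ s ∈ S, s.1 = s.2 := by
        intro s hs
        obtain rfl | rfl := hall s hs <;> rfl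
      exact .inr <| .inr <| .inr <| .inr <| .inr <| .inr <| .inl this

theorem RelGen.neg_pair_of_half [Finite G] {w₁ w₂ : Ω} (hB : Big 2 ⊥ (⊥ ⊔ k⟮w₁⟯ ⊔ k⟮w₂⟯))
    (hg₁ : ∀ g, ∃ v, NegAct (ρ g) w₁ v)
    (hg : (∀ g, ∃ v, NegAct (ρ g) w₂ (1, v)) ∨ ∀ g, ∃ v, NegAct (ρ g) w₂ (v, 1)) :
    RelGen ρ 2 ⊥ (⊥ ⊔ k⟮w₁⟯ ⊔ k⟮w₂⟯) := by
  obtain ⟨h1, h2⟩ := hB.two (le_acl _)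
  have hs := (stable_bot ρ).negAct hg₁
  refine RelGen.trans (m := 1) (n := 1) (RelGen.luroth ρ h1) ?_
  rcases hg with hg | hg
  · refine RelGen.inv hs h2 fun g => ?_
    obtain ⟨v, h⟩ := hg g
    obtain ⟨-, h⟩ | ⟨h', h⟩ | ⟨-, h⟩ | ⟨h', h⟩ := h.cases
    · exact .inl h
    · simp at h'
    · exact .inr h
    · simp at h'
  · refine RelGen.affine hs h2 fun g => ?_
    obtain ⟨v, h⟩ := hg g
    obtain ⟨-, h⟩ | ⟨h', h⟩ | ⟨h', h⟩ | ⟨h', h⟩ := h.cases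
    · exact ⟨1, fmem, 0, fmem, by rw [h]; ring⟩
    · exact ⟨-1, fmem, 0, fmem, by rw [h]; ring⟩
    · simp at h'
    · simp at h'

theorem RelGen.neg_pair_of_same [Finite G] {w₁ w₂ : Ω} (hB : Big 2 ⊥ (⊥ ⊔ k⟮w₁⟯ ⊔ k⟮w₂⟯))
    (hg : ∀ g, ∃ v, NegAct (ρ g) w₁ v ∧ NegAct (ρ g) w₂ v) : RelGen ρ 2 ⊥ (⊥ ⊔ k⟮w₁⟯ ⊔ k⟮w₂⟯) := by
  obtain ⟨h1, h2⟩ := hB.two (le_acl _)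
  have z1 : w₁ ≠ 0 := ne_of_not_mem h1 fmem
  have z2 : w₂ ≠ 0 := ne_of_not_mem h2 fmem
  have z3 : w₂ - w₁ ≠ 0 := sub_ne_zero.2 (ne_of_not_mem h2 fmem)
  have z4 : w₁ - w₂ ≠ 0 := sub_ne_zero.2 (ne_of_not_mem h2 fmem).symm
  have heq : ⊥ ⊔ k⟮w₁⟯ ⊔ k⟮w₂⟯ = ⊥ ⊔ k⟮w₁⟯ ⊔ k⟮1 / (w₂ - w₁)⟯ := by
    refine sup_simple_eq (mem_of_eq (w₁ + 1 / (1 / (w₂ - w₁))) ?_) fmem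
    field_simp; ring
  have h3 : 1 / (w₂ - w₁) ∉ acl (⊥ ⊔ k⟮w₁⟯) :=
    not_mem_acl_of_sup h2 (mem_of_eq (w₁ + 1 / (1 / (w₂ - w₁))) (by field_simp; ring))
  rw [heq]
  refine (RelGen.luroth ρ h1).trans (RelGen.affine ((stable_bot ρ).negAct fun g => ?_) h3
    fun g => ?_)
  · obtain ⟨v, h, -⟩ := hg g; exact ⟨v, h⟩
  obtain ⟨v, hv, hv'⟩ := hg g
  rw [map_div₀, map_sub, map_one]
  obtain ⟨rfl, h⟩ | ⟨rfl, h⟩ | ⟨rfl, h⟩ | ⟨rfl, h⟩ := hv.cases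
  · obtain ⟨-, h'⟩ | ⟨e, -⟩ | ⟨e, -⟩ | ⟨e, -⟩ := hv'.cases <;> try exact absurd e (by decide)
    exact ⟨1, fmem, 0, fmem, by rw [h, h']; ring⟩
  · obtain ⟨e, -⟩ | ⟨-, h'⟩ | ⟨e, -⟩ | ⟨e, -⟩ := hv'.cases <;> try exact absurd e (by decide)
    refine ⟨-1, fmem, 0, fmem, ?_⟩
    rw [h, h', show -w₂ - -w₁ = -(w₂ - w₁) by ring, div_neg]; ring
  · obtain ⟨e, -⟩ | ⟨e, -⟩ | ⟨-, h'⟩ | ⟨e, -⟩ := hv'.cases <;> try exact absurd e (by decide)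
    refine ⟨-w₁ ^ 2, fmem, -w₁, fmem, ?_⟩
    rw [h, h', show 1 / w₂ - 1 / w₁ = -(w₂ - w₁) / (w₁ * w₂) by field_simp; ring]
    field_simp; ring
  · obtain ⟨e, -⟩ | ⟨e, -⟩ | ⟨e, -⟩ | ⟨-, h'⟩ := hv'.cases <;> try exact absurd e (by decide)
    refine ⟨w₁ ^ 2, fmem, w₁, fmem, ?_⟩
    rw [h, h', show -(1 / w₂) - -(1 / w₁) = (w₂ - w₁) / (w₁ * w₂) by field_simp; ring]
    field_simp; ring

theorem sup_cay (h2 : (2 : Ω) ≠ 0) (hx : 1 + x ≠ 0) : K ⊔ k⟮x⟯ = K ⊔ k⟮cay x⟯ := by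
  refine sup_simple_eq ?_ (cay_mem fmem)
  have h := cay_mem (mem_right K (cay x))
  rwa [cay_cay h2 hx] at h

/-- Apply the Cayley coordinate change if the flag is set. -/
def cayIf (b : Bool) (w : Ω) : Ω := cond b (cay w) w

theorem sup_cayIf (h2 : (2 : Ω) ≠ 0) (hx : x ∉ acl K) (b : Bool) : K ⊔ k⟮x⟯ = K ⊔ k⟮cayIf b x⟯ := by
  cases b
  · rfl
  · exact sup_cay h2 (one_add_ne_zero_of_not_mem hx)

theorem NegAct.cayIf {f : Ω ≃ₐ[k] Ω} {w : Ω} {v : ℤˣ × ℤˣ} (h : NegAct f w v) (hw : w ≠ 0)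
    (b : Bool) : NegAct f (cayIf b w) (swapIf b v) := by
  cases b
  · exact h
  · exact h.cay hw

theorem NegAct.unique {f : Ω ≃ₐ[k] Ω} {w : Ω} {a b : ℤˣ} (h : NegAct f w (a, b)) :
    ((a = 1 ∧ b = 1) → f w = w) ∧ ((a = -1 ∧ b = 1) → f w = -w) ∧
      ((a = 1 ∧ b = -1) → f w = 1 / w) ∧ ((a = -1 ∧ b = -1) → f w = -(1 / w)) := by
  refine ⟨?_, ?_, ?_, ?_⟩ <;> rintro ⟨rfl, rfl⟩ <;> simp_all [NegAct]

theorem RelGen.neg_pair [Finite G] (h2 : (2 : Ω) ≠ 0) {w₁ w₂ : Ω}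
    (hB : Big 2 ⊥ (⊥ ⊔ k⟮w₁⟯ ⊔ k⟮w₂⟯))
    (hg : ∀ g, ∃ v₁ v₂, NegAct (ρ g) w₁ v₁ ∧ NegAct (ρ g) w₂ v₂) :
    RelGen ρ 2 ⊥ (⊥ ⊔ k⟮w₁⟯ ⊔ k⟮w₂⟯) := by
  have hB' := hB
  rw [sup_right_comm] at hB'
  obtain ⟨n1, n12⟩ := hB.two (le_acl _)
  obtain ⟨n2, n21⟩ := hB'.two (le_acl _)
  have z1 : w₁ ≠ 0 := ne_of_not_mem n1 fmem
  have z2 : w₂ ≠ 0 := ne_of_not_mem n2 fmem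
  have hg1 : ∀ g, ∃ v, NegAct (ρ g) w₁ v := fun g => by
    obtain ⟨v, _, h, -⟩ := hg g; exact ⟨v, h⟩
  have hg2 : ∀ g, ∃ v, NegAct (ρ g) w₂ v := fun g => by
    obtain ⟨_, v, -, h⟩ := hg g; exact ⟨v, h⟩
  let S : Submonoid ((ℤˣ × ℤˣ) × (ℤˣ × ℤˣ)) :=
    { carrier := {s | ∃ g, NegAct (ρ g) w₁ s.1 ∧ NegAct (ρ g) w₂ s.2}
      one_mem' := ⟨1, by rw [map_one]; exact .one _, by rw [map_one]; exact .one _⟩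
      mul_mem' := by
        rintro s t ⟨g, h, h'⟩ ⟨g', i, i'⟩
        exact ⟨g * g', by rw [map_mul]; exact h.mul i, by rw [map_mul]; exact h'.mul i'⟩ }
  have hS : ∀ g, ∃ s ∈ S, NegAct (ρ g) w₁ s.1 ∧ NegAct (ρ g) w₂ s.2 := fun g => by
    obtain ⟨v, v', h⟩ := hg g; exact ⟨(v, v'), ⟨g, h⟩, h⟩
  obtain h | h | h | h | ⟨⟨_, v⟩, ⟨c, hc, hc'⟩, rfl, hv⟩ | ⟨⟨v, _⟩, ⟨c, hc, hc'⟩, rfl, hv⟩ | h | h |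
    ⟨a, b, h, ⟨v₁, v₂⟩, ⟨c, hc, hc'⟩, e1, e2⟩ := sign_pair_cases S
  · rw [sup_right_comm]
    refine RelGen.neg_pair_of_half hB' hg2 (.inl fun g => ?_)
    obtain ⟨⟨⟨x, y⟩, _⟩, hs, h', -⟩ := hS g
    obtain rfl : x = 1 := h _ hs
    exact ⟨y, h'⟩
  · refine RelGen.neg_pair_of_half hB hg1 (.inl fun g => ?_)
    obtain ⟨⟨_, x, y⟩, hs, -, h'⟩ := hS g
    obtain rfl : x = 1 := h _ hs
    exact ⟨y, h'⟩
  · rw [sup_right_comm]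
    refine RelGen.neg_pair_of_half hB' hg2 (.inr fun g => ?_)
    obtain ⟨⟨⟨x, y⟩, _⟩, hs, h', -⟩ := hS g
    obtain rfl : y = 1 := h _ hs
    exact ⟨x, h'⟩
  · refine RelGen.neg_pair_of_half hB hg1 (.inr fun g => ?_)
    obtain ⟨⟨_, x, y⟩, hs, -, h'⟩ := hS g
    obtain rfl : y = 1 := h _ hs
    exact ⟨x, h'⟩
  · refine (RelGen.luroth ρ n1).trans (relGen_neg_of_fix h2 ((stable_bot ρ).negAct hg1) n12 hg2 c
      (fix_sup_simple (fix_bot _) ?_) hc' hv)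
    simpa [NegAct] using hc
  · rw [sup_right_comm]
    refine (RelGen.luroth ρ n2).trans (relGen_neg_of_fix h2 ((stable_bot ρ).negAct hg2) n21 hg1 c
      (fix_sup_simple (fix_bot _) ?_) hc hv)
    simpa [NegAct] using hc'
  · refine RelGen.neg_pair_of_same hB fun g => ?_
    obtain ⟨⟨v, v'⟩, hs, h', h''⟩ := hS g
    obtain rfl : v = v' := h _ hs
    exact ⟨v, h', h''⟩
  · rw [sup_cay h2 (one_add_ne_zero_of_not_mem n12)] at hB ⊢
    refine RelGen.neg_pair_of_same hB fun g => ?_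
    obtain ⟨⟨v, v'⟩, hs, h', h''⟩ := hS g
    obtain rfl : v = v'.swap := h _ hs
    exact ⟨_, h', h''.cay z2⟩
  · rw [sup_cayIf h2 n12 b, sup_right_comm, sup_cayIf h2 (?_ : w₁ ∉ acl _) a,
      sup_right_comm] at hB ⊢
    · have hc1 := hc.cayIf z1 a
      have hc2 := hc'.cayIf z2 b
      change swapIf a v₁ = _ at e1
      change swapIf b v₂ = _ at e2
      dsimp only at hc1 hc2
      rw [e1] at hc1
      rw [e2] at hc2
      refine relGen_neg_twist h2 hB (fun g => ?_) c (hc1.unique.2.1 ⟨rfl, rfl⟩)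
        (hc2.unique.2.2.2 ⟨rfl, rfl⟩)
      obtain ⟨⟨v, v'⟩, hs, h', h''⟩ := hS g
      have i1 := h'.cayIf z1 a
      have i2 := h''.cayIf z2 b
      dsimp only at i1 i2
      obtain ⟨j1, j2⟩ | ⟨j1, j2⟩ | ⟨j1, j2⟩ | ⟨j1, j2⟩ := h _ hs <;> dsimp only at j1 j2 <;>
        rw [j1] at i1 <;> rw [j2] at i2
      · exact .inl ⟨i1.unique.1 ⟨rfl, rfl⟩, i2.unique.1 ⟨rfl, rfl⟩⟩
      · exact .inr (.inl ⟨i1.unique.2.2.2 ⟨rfl, rfl⟩, i2.unique.2.1 ⟨rfl, rfl⟩⟩)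
      · exact .inr (.inr (.inl ⟨i1.unique.2.1 ⟨rfl, rfl⟩, i2.unique.2.2.2 ⟨rfl, rfl⟩⟩))
      · exact .inr (.inr (.inr ⟨i1.unique.2.2.1 ⟨rfl, rfl⟩, i2.unique.2.2.1 ⟨rfl, rfl⟩⟩))
    all_goals
      intro hh
      rw [sup_right_comm] at hB
      rw [← sup_cayIf h2 n2 b] at hh
      exact n21 hh

theorem NegPerm.negAct_div {f : Ω ≃ₐ[k] Ω} {u v : Ω} (h : NegPerm f u v) :
    ∃ e, NegAct f (u / v) e := by
  obtain h | h | h | h := h.map_div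
  · exact ⟨(1, 1), by simp [NegAct, h]⟩
  · exact ⟨(-1, 1), by simp [NegAct, h]⟩
  · exact ⟨(1, -1), by simp [NegAct, h]⟩
  · exact ⟨(-1, -1), by simp [NegAct, h]⟩

theorem Stable.sup_two (hK : Stable ρ K) {u v : Ω} (hu : ∀ g, ρ g u ∈ K ⊔ k⟮u⟯ ⊔ k⟮v⟯)
    (hv : ∀ g, ρ g v ∈ K ⊔ k⟮u⟯ ⊔ k⟮v⟯) : Stable ρ (K ⊔ k⟮u⟯ ⊔ k⟮v⟯) := fun g =>
  map_mem_sup_adjoin _ (map_mem_sup_adjoin _ (fun y hy => mem_left (mem_left (hK g y hy)))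
    (by simpa using hu g)) (by simpa using hv g)

theorem Stable.negPerm (hK : Stable ρ K) {u v : Ω} (hg : ∀ g, NegPerm (ρ g) u v) :
    Stable ρ (K ⊔ k⟮u⟯ ⊔ k⟮v⟯) := by
  refine hK.sup_two (fun g => ?_) fun g => ?_
  · obtain ⟨h | h, -⟩ | ⟨h | h, -⟩ := hg g <;> rw [h] <;> exact fmem
  · obtain ⟨-, h | h⟩ | ⟨-, h | h⟩ := hg g <;> rw [h] <;> exact fmem

theorem Stable.invPerm (hK : Stable ρ K) {u v : Ω} (hg : ∀ g, InvPerm (ρ g) u v) :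
    Stable ρ (K ⊔ k⟮u⟯ ⊔ k⟮v⟯) := by
  refine hK.sup_two (fun g => ?_) fun g => ?_
  · obtain ⟨h | h, -⟩ | ⟨h | h, -⟩ := hg g <;> rw [h] <;> exact fmem
  · obtain ⟨-, h | h⟩ | ⟨-, h | h⟩ := hg g <;> rw [h] <;> exact fmem

theorem RelGen.of_negPerm_negPerm [Finite G] (h2 : (2 : Ω) ≠ 0) {u v z w : Ω}
    (hB : Big 4 ⊥ (⊥ ⊔ k⟮u⟯ ⊔ k⟮v⟯ ⊔ k⟮z⟯ ⊔ k⟮w⟯)) (hg : ∀ g, NegPerm (ρ g) u v)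
    (hg' : ∀ g, NegPerm (ρ g) z w) : RelGen ρ 4 ⊥ (⊥ ⊔ k⟮u⟯ ⊔ k⟮v⟯ ⊔ k⟮z⟯ ⊔ k⟮w⟯) := by
  obtain ⟨hB1, hB2⟩ := hB.two_split
  obtain ⟨-, -, h3⟩ := RelGen.of_negPerm ((stable_bot ρ).negPerm hg) hB2 hg'
  have hv : v ≠ 0 := ne_of_not_mem (hB1.two (le_acl _)).2 fmem
  have hw : w ≠ 0 := ne_of_not_mem (hB2.two (le_acl _)).2 fmem
  have e1 : ⊥ ⊔ k⟮u⟯ ⊔ k⟮v⟯ ⊔ k⟮z⟯ ⊔ k⟮w⟯ =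
      ⊥ ⊔ k⟮u⟯ ⊔ k⟮v⟯ ⊔ k⟮z / w⟯ ⊔ k⟮w⟯ :=
    sup_two_eq (mem_of_eq (z / w * w) (by field_simp)) fmem fmem fmem
  have e2 : ⊥ ⊔ k⟮u⟯ ⊔ k⟮v⟯ ⊔ k⟮z / w⟯ = ⊥ ⊔ k⟮z / w⟯ ⊔ k⟮u⟯ ⊔ k⟮v⟯ := by
    rw [sup_right_comm, sup_right_comm ⊥]
  have e3 : ⊥ ⊔ k⟮z / w⟯ ⊔ k⟮u⟯ ⊔ k⟮v⟯ =
      ⊥ ⊔ k⟮z / w⟯ ⊔ k⟮u / v⟯ ⊔ k⟮v⟯ :=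
    sup_two_eq (mem_of_eq (u / v * v) (by field_simp)) fmem fmem fmem
  have hB3 : Big 3 ⊥ (⊥ ⊔ k⟮z / w⟯ ⊔ k⟮u⟯ ⊔ k⟮v⟯) := by
    rw [e1] at hB
    rw [← e2]
    exact Big.of_genBy_right (m := 3) (n := 1) hB (GenBy.one _ _)
  have hB4 : Big 2 ⊥ (⊥ ⊔ k⟮z / w⟯ ⊔ k⟮u / v⟯) := by
    rw [e3] at hB3
    exact Big.of_genBy_right (m := 2) (n := 1) hB3 (GenBy.one _ _)
  have hst := (stable_bot ρ).negAct fun g => (hg' g).negAct_div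
  obtain ⟨-, -, h4⟩ := RelGen.of_negPerm hst
    (Big.of_genBy (m := 1) (n := 2) hB3 (GenBy.one _ _)) hg
  have h5 := RelGen.neg_pair h2 hB4 fun g => by
    obtain ⟨e, he⟩ := (hg' g).negAct_div
    obtain ⟨e', he'⟩ := (hg g).negAct_div
    exact ⟨e, e', he, he'⟩
  rw [e2] at h3
  exact (h5.trans h4).trans h3

/-- Two pairs of variables, each permuted up to inversion. -/
theorem RelGen.of_invPerm_invPerm [Finite G] {u v z w : Ω}
    (hB : Big 4 ⊥ (⊥ ⊔ k⟮u⟯ ⊔ k⟮v⟯ ⊔ k⟮z⟯ ⊔ k⟮w⟯)) (hg : ∀ g, InvPerm (ρ g) u v)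
    (hg' : ∀ g, InvPerm (ρ g) z w) : RelGen ρ 4 ⊥ (⊥ ⊔ k⟮u⟯ ⊔ k⟮v⟯ ⊔ k⟮z⟯ ⊔ k⟮w⟯) := by
  obtain ⟨hB1, hB2⟩ := hB.two_split
  by_cases h2 : (2 : Ω) = 0
  · exact RelGen.trans (m := 2) (n := 2)
      (RelGen.of_invPerm_of_two_eq_zero (stable_bot ρ) h2 hB1 hg)
      (RelGen.of_invPerm_of_two_eq_zero ((stable_bot ρ).invPerm hg) h2 hB2 hg')
  obtain ⟨hu, hv⟩ := hB1.two (le_acl _)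
  obtain ⟨hz, hw⟩ := hB2.two (le_acl _)
  rw [sup_cay_cay h2 (one_add_ne_zero_of_not_mem hz) (one_add_ne_zero_of_not_mem hw),
    sup_cay_cay h2 (one_add_ne_zero_of_not_mem hu) (one_add_ne_zero_of_not_mem hv)] at hB ⊢
  exact RelGen.of_negPerm_negPerm h2 hB
    (fun g => (hg g).negPerm_cay (ne_of_not_mem hu fmem) (ne_of_not_mem hv fmem))
    (fun g => (hg' g).negPerm_cay (ne_of_not_mem hz fmem) (ne_of_not_mem hw fmem))

/-- `f` permutes the `x i` up to inversion. -/
def SignAct (f : Ω ≃ₐ[k] Ω) (x : Fin 3 → Ω) (p : Equiv.Perm (Fin 3) × (Fin 3 → ℤˣ)) : Prop :=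
  ∀ i, f (x i) = x (p.1 i) ^ (p.2 i : ℤ)

/-- Composition of signed permutations. -/
def signMul (p q : Equiv.Perm (Fin 3) × (Fin 3 → ℤˣ)) : Equiv.Perm (Fin 3) × (Fin 3 → ℤˣ) :=
  (p.1 * q.1, fun i => p.2 (q.1 i) * q.2 i)

theorem SignAct.mul {f g : Ω ≃ₐ[k] Ω} {x : Fin 3 → Ω} {p q : Equiv.Perm (Fin 3) × (Fin 3 → ℤˣ)}
    (hf : SignAct f x p) (hg : SignAct g x q) : SignAct (f * g) x (signMul p q) := by
  intro i
  rw [AlgEquiv.mul_apply, hg, map_zpow₀, hf, ← zpow_mul]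
  simp [signMul]

/-- The cyclic shift as a signed permutation. -/
def signShift : Equiv.Perm (Fin 3) × (Fin 3 → ℤˣ) := (Equiv.addRight 1, 1)

/-- Diagonal signs with one exceptional index. -/
def signDiag (m : Fin 3) (s : ℤˣ) : Equiv.Perm (Fin 3) × (Fin 3 → ℤˣ) :=
  (1, fun i => if i = m then -s else s)

set_option maxRecDepth 10000 in
theorem signed_perm_cases : ∀ p : Equiv.Perm (Fin 3) × (Fin 3 → ℤˣ), (∃ e, ∀ i, p.2 i = e) ∨
    ∃ m s, signDiag m s = p ∨ signDiag m s = signMul p signShift ∨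
      signDiag m s = signMul p (signMul signShift signShift) ∨
      signDiag m s = signMul p (signMul signShift (signMul p (signMul p (signMul p signShift)))) := by
  decide

theorem signDiag_shift : ∀ m s, signMul signShift (signMul (signDiag m s)
    (signMul signShift signShift)) = signDiag (m + 1) s := by
  decide

theorem signAct_dichotomy {x : Fin 3 → Ω} (hg : ∀ g, ∃ p, SignAct (ρ g) x p) (c : G)
    (hc : ∀ i, ρ c (x i) = x (i + 1)) :
    (∀ g, ∃ (π : Equiv.Perm (Fin 3)) (e : ℤˣ), ∀ i, ρ g (x i) = x (π i) ^ (e : ℤ)) ∨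
      ∀ m, ∃ g s, SignAct (ρ g) x (signDiag m s) := by
  have hc' : SignAct (ρ c) x signShift := fun i => by simp [signShift, hc]
  have hcc : SignAct (ρ (c * c)) x (signMul signShift signShift) := by
    rw [map_mul]; exact hc'.mul hc'
  by_cases h : ∃ m g s, SignAct (ρ g) x (signDiag m s)
  · right
    have step : ∀ m, (∃ g s, SignAct (ρ g) x (signDiag m s)) →
        ∃ g s, SignAct (ρ g) x (signDiag (m + 1) s) := by
      rintro m ⟨g, s, h⟩
      refine ⟨c * (g * (c * c)), s, ?_⟩
      rw [← signDiag_shift, map_mul, map_mul]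
      exact hc'.mul (h.mul hcc)
    obtain ⟨m, h⟩ := h
    have h1 := step _ h
    have h2 := step _ h1
    intro m'
    obtain rfl | rfl | rfl : m' = m ∨ m' = m + 1 ∨ m' = m + 1 + 1 := by
      exact (by decide : ∀ m m' : Fin 3, m' = m ∨ m' = m + 1 ∨ m' = m + 1 + 1) m m'
    exacts [h, h1, h2]
  · left
    intro g
    obtain ⟨p, hp⟩ := hg g
    obtain ⟨e, he⟩ | ⟨m, s, e⟩ := signed_perm_cases p
    · exact ⟨p.1, e, fun i => by rw [hp, he]⟩
    · exfalso
      apply h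
      obtain e | e | e | e := e
      · exact ⟨m, g, s, e ▸ hp⟩
      · refine ⟨m, g * c, s, ?_⟩
        rw [e, map_mul]
        exact hp.mul hc'
      · refine ⟨m, g * (c * c), s, ?_⟩
        rw [e, map_mul]
        exact hp.mul hcc
      · refine ⟨m, g * (c * (g * (g * (g * c)))), s, ?_⟩
        rw [e]
        simp only [map_mul]
        exact hp.mul (hc'.mul (hp.mul (hp.mul (hp.mul hc'))))

theorem units_mul_self (e : ℤˣ) : ((e : ℤ) : Ω) ^ 2 = 1 := by
  rcases Int.units_eq_one_or e with rfl | rfl <;> simp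

theorem RelGen.of_sign_neg [Finite G] (h2 : (2 : Ω) ≠ 0) {u : Fin 3 → Ω}
    (hB : Big 3 ⊥ (⊥ ⊔ k⟮u 0⟯ ⊔ k⟮u 1⟯ ⊔ k⟮u 2⟯))
    (hg : ∀ g, ∃ (π : Equiv.Perm (Fin 3)) (e : Fin 3 → ℤˣ), ∀ i, ρ g (u i) = (e i : ℤ) * u (π i))
    (hd : (∀ g, ∃ (π : Equiv.Perm (Fin 3)) (e : ℤˣ), ∀ i, ρ g (u i) = (e : ℤ) * u (π i)) ∨
      ∀ m, ∃ g, ∃ s : ℤˣ, ∀ i, ρ g (u i) = ((if i = m then -s else s : ℤˣ) : ℤ) * u i) :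
    RelGen ρ 3 ⊥ (⊥ ⊔ k⟮u 0⟯ ⊔ k⟮u 1⟯ ⊔ k⟮u 2⟯) := by
  obtain ⟨n0, n1, n2⟩ := hB.three (le_acl _)
  have z0 : u 0 ≠ 0 := ne_of_not_mem n0 fmem
  have z1 : u 1 ≠ 0 := ne_of_not_mem n1 fmem
  have z2 : u 2 ≠ 0 := ne_of_not_mem n2 fmem
  have heq : ⊥ ⊔ k⟮u 0⟯ ⊔ k⟮u 1⟯ ⊔ k⟮u 2⟯ =
      ⊥ ⊔ k⟮u 0 / u 2⟯ ⊔ k⟮u 1 / u 2⟯ ⊔ k⟮u 2⟯ := by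
    refine le_antisymm ?_ ?_ <;> simp only [sup_simple_le]
    · exact ⟨⟨⟨bot_le, mem_of_eq (u 0 / u 2 * u 2) (by field_simp)⟩,
        mem_of_eq (u 1 / u 2 * u 2) (by field_simp)⟩, fmem⟩
    · exact ⟨⟨⟨bot_le, fmem⟩, fmem⟩, fmem⟩
  rw [heq] at hB ⊢
  obtain ⟨-, -, m2⟩ := hB.three (le_acl _)
  have hB' : Big 2 ⊥ (⊥ ⊔ k⟮u 0 / u 2⟯ ⊔ k⟮u 1 / u 2⟯) :=
    Big.of_genBy_right (m := 2) (n := 1) hB (GenBy.one _ _)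
  have hmem : ∀ i, u i / u 2 ∈ ⊥ ⊔ k⟮u 0 / u 2⟯ ⊔ k⟮u 1 / u 2⟯ := by
    intro i
    fin_cases i
    · exact mem_left (mem_right _ _)
    · exact mem_right _ _
    · exact mem_of_eq 1 (div_self z2)
  have hst : Stable ρ (⊥ ⊔ k⟮u 0 / u 2⟯ ⊔ k⟮u 1 / u 2⟯) := by
    have : ∀ g i, ρ g (u i / u 2) ∈
        ⊥ ⊔ k⟮u 0 / u 2⟯ ⊔ k⟮u 1 / u 2⟯ := by
      intro g i
      obtain ⟨π, e, h⟩ := hg g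
      rw [map_div₀, h, h]
      refine mem_of_eq (((e i : ℤ) * (u (π i) / u 2)) / ((e 2 : ℤ) * (u (π 2) / u 2))) ?_ ?_
      · field_simp
      · exact div_mem (mul_mem (intCast_mem _ _) (hmem _)) (mul_mem (intCast_mem _ _) (hmem _))
    exact (stable_bot ρ).sup_two (fun g => this g 0) fun g => this g 1
  refine RelGen.trans (m := 2) (n := 1) ?_ (RelGen.affine hst m2 fun g => ?_)
  · obtain hd | hd := hd
    · exact RelGen.perm_proj hB' fun g => by
        obtain ⟨π, e, h⟩ := hd g
        exact ⟨_, π, h⟩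
    · obtain ⟨g0, s0, h0⟩ := hd 0
      obtain ⟨g1, s1, h1⟩ := hd 1
      obtain ⟨k1, k2⟩ := hB'.two (le_acl _)
      have y0 : ((s0 : ℤ) : Ω) ≠ 0 := fun h => by simpa [h] using units_mul_self (Ω := Ω) s0
      have y1 : ((s1 : ℤ) : Ω) ≠ 0 := fun h => by simpa [h] using units_mul_self (Ω := Ω) s1
      have a0 : ρ g0 (u 0 / u 2) = -(u 0 / u 2) := by
        rw [map_div₀, h0, h0]; simp; field_simp
      have a1 : ρ g0 (u 1 / u 2) = u 1 / u 2 := by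
        rw [map_div₀, h0, h0]; simp; field_simp
      have b0 : ρ g1 (u 0 / u 2) = u 0 / u 2 := by
        rw [map_div₀, h1, h1]; simp; field_simp
      have b1 : ρ g1 (u 1 / u 2) = -(u 1 / u 2) := by
        rw [map_div₀, h1, h1]; simp; field_simp
      have ne : ∀ x : Ω, x ≠ 0 → -x ≠ x := fun x hx h =>
        hx ((mul_eq_zero.1 (by linear_combination -h : 2 * x = 0)).resolve_left h2)
      have e0 : FixIn ρ (⊥ ⊔ k⟮u 0 / u 2⟯ ⊔ k⟮u 1 / u 2⟯) =
          FixIn ρ (⊥ ⊔ k⟮u 0 ^ 2 / u 2 ^ 2⟯ ⊔ k⟮u 1 / u 2⟯) := by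
        refine fixIn_eq_of_conj_two (θ := u 0 / u 2) ?_ ?_ 0 (u 0 ^ 2 / u 2 ^ 2) fmem fmem
          (by ring) g0 (fix_sup_simple (fix_sup_simple (fix_bot _) ?_) a1) ?_
        · simp only [sup_simple_le]
          exact ⟨⟨bot_le, mem_of_eq ((u 0 / u 2) ^ 2) (by ring)⟩, fmem⟩
        · simp only [sup_simple_le]
          exact ⟨⟨bot_le, fmem⟩, fmem⟩
        · rw [← div_pow, map_pow, a0]; ring
        · rw [a0]; exact ne _ (by positivity)
      have e1 : FixIn ρ (⊥ ⊔ k⟮u 0 ^ 2 / u 2 ^ 2⟯ ⊔ k⟮u 1 / u 2⟯) =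
          FixIn ρ (⊥ ⊔ k⟮u 0 ^ 2 / u 2 ^ 2⟯ ⊔ k⟮u 1 ^ 2 / u 2 ^ 2⟯) := by
        refine fixIn_eq_of_conj_two (θ := u 1 / u 2) ?_ ?_ 0 (u 1 ^ 2 / u 2 ^ 2) fmem fmem
          (by ring) g1 (fix_sup_simple (fix_sup_simple (fix_bot _) ?_) ?_) ?_
        · simp only [sup_simple_le]
          exact ⟨⟨bot_le, fmem⟩, mem_of_eq ((u 1 / u 2) ^ 2) (by ring)⟩
        · simp only [sup_simple_le]
          exact ⟨⟨bot_le, fmem⟩, fmem⟩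
        · rw [← div_pow, map_pow, b0]
        · rw [← div_pow, map_pow, b1]; ring
        · rw [b1]; exact ne _ (by positivity)
      unfold RelGen
      rw [e0, e1]
      refine RelGen.perm_proj (t := fun i => u i ^ 2) (hB'.acl_right ?_) fun g => ?_
      · simp only [sup_simple_le]
        refine ⟨⟨bot_le, ?_⟩, ?_⟩
        · exact mem_acl_quadratic (a := 0) (b := -(u 0 ^ 2 / u 2 ^ 2)) fmem fmem (by ring)
        · exact mem_acl_quadratic (a := 0) (b := -(u 1 ^ 2 / u 2 ^ 2)) fmem fmem (by ring)
      · obtain ⟨π, e, h⟩ := hg g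
        refine ⟨1, π, fun i => ?_⟩
        rw [map_pow, h, mul_pow, units_mul_self]
  · obtain ⟨π, e, h⟩ := hg g
    refine ⟨(e 2 : ℤ) * (u (π 2) / u 2), mul_mem (intCast_mem _ _) (hmem _), 0, fmem, ?_⟩
    rw [h]; field_simp; ring

theorem RelGen.perm_sum_zero [Finite G] {t : Fin 3 → Ω} (ht : t 0 + t 1 + t 2 = 0)
    (hB : Big 2 ⊥ (⊥ ⊔ k⟮t 0⟯ ⊔ k⟮t 1⟯))
    (hg : ∀ g, ∃ π : Equiv.Perm (Fin 3), ∀ i, ρ g (t i) = t (π i)) :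
    RelGen ρ 2 ⊥ (⊥ ⊔ k⟮t 0⟯ ⊔ k⟮t 1⟯) := by
  have z1 : t 1 ≠ 0 := ne_of_not_mem (hB.two (le_acl _)).2 fmem
  have heq : ⊥ ⊔ k⟮t 0⟯ ⊔ k⟮t 1⟯ = ⊥ ⊔ k⟮t 0 / t 1⟯ ⊔ k⟮t 1⟯ :=
    sup_two_eq (mem_of_eq (t 0 / t 1 * t 1) (by field_simp)) fmem fmem fmem
  have hmem : ∀ i, t i / t 1 ∈ ⊥ ⊔ k⟮t 0 / t 1⟯ := by
    intro i
    fin_cases i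
    · exact mem_right _ _
    · exact mem_of_eq 1 (div_self z1)
    · refine mem_of_eq (-(t 0 / t 1) - 1) ?_
      change t 2 / t 1 = _
      rw [show t 2 = -t 0 - t 1 by linear_combination ht]
      field_simp
  rw [heq] at hB ⊢
  refine RelGen.luroth_affine hB (fun g => ?_) fun g => ?_ <;> obtain ⟨π, h⟩ := hg g
  · rw [map_div₀, h, h]
    refine mem_of_eq ((t (π 0) / t 1) / (t (π 1) / t 1)) (by field_simp)
      (div_mem (hmem _) (hmem _))
  · exact ⟨_, hmem (π 1), 0, fmem, by rw [h]; field_simp; ring⟩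

set_option maxHeartbeats 1000000 in
theorem RelGen.of_translation [Finite G] (h2 : (2 : Ω) = 0) {v : Fin 3 → Ω}
    (hB : Big 3 ⊥ (⊥ ⊔ k⟮v 0⟯ ⊔ k⟮v 1⟯ ⊔ k⟮v 2⟯))
    (hg : ∀ g, ∃ (π : Equiv.Perm (Fin 3)) (d : Fin 3 → Ω), (∀ i, d i = 0 ∨ d i = 1) ∧
      ∀ i, ρ g (v i) = v (π i) + d i)
    (hd : (∀ g, ∃ (π : Equiv.Perm (Fin 3)) (d : Ω), ∀ i, ρ g (v i) = v (π i) + d) ∨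
      ∀ m, ∃ g, ∃ d : Ω, ∀ i, ρ g (v i) = v i + (if i = m then d + 1 else d)) :
    RelGen ρ 3 ⊥ (⊥ ⊔ k⟮v 0⟯ ⊔ k⟮v 1⟯ ⊔ k⟮v 2⟯) := by
  obtain ⟨r, hr⟩ : ∃ r : Fin 3 → Ω, ∀ i, r i = v 0 + v 1 + v 2 + v i := ⟨_, fun i => rfl⟩
  have hsum : r 0 + r 1 + r 2 = 0 := by
    rw [hr, hr, hr]; linear_combination 2 * (v 0 + v 1 + v 2) * h2
  have hvr : ∀ i, v i = r 0 + r i + v 0 := fun i => by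
    rw [hr, hr]; linear_combination (-(v 0 * 2) - v 1 - v 2) * h2
  have heq : ⊥ ⊔ k⟮v 0⟯ ⊔ k⟮v 1⟯ ⊔ k⟮v 2⟯ =
      ⊥ ⊔ k⟮r 0⟯ ⊔ k⟮r 1⟯ ⊔ k⟮v 0⟯ := by
    refine le_antisymm ?_ ?_ <;> simp only [sup_simple_le]
    · refine ⟨⟨⟨bot_le, fmem⟩, mem_of_eq _ (hvr 1)⟩, mem_of_eq (-r 1 + v 0) ?_⟩
      rw [hvr 2]; linear_combination hsum
    · refine ⟨⟨⟨bot_le, ?_⟩, ?_⟩, fmem⟩ <;> rw [hr] <;> exact fmem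
  rw [heq] at hB ⊢
  obtain ⟨k0, k1, m2⟩ := hB.three (le_acl _)
  have hB' : Big 2 ⊥ (⊥ ⊔ k⟮r 0⟯ ⊔ k⟮r 1⟯) :=
    Big.of_genBy_right (m := 2) (n := 1) hB (GenBy.one _ _)
  have hmem : ∀ i, r i ∈ ⊥ ⊔ k⟮r 0⟯ ⊔ k⟮r 1⟯ := by
    intro i
    fin_cases i
    · exact mem_left (mem_right _ _)
    · exact mem_right _ _
    · change r 2 ∈ _
      exact mem_of_eq (-r 0 - r 1) (by linear_combination hsum)
  have hrg : ∀ g (π : Equiv.Perm (Fin 3)) (d : Fin 3 → Ω), (∀ i, ρ g (v i) = v (π i) + d i) →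
      ∀ i, ρ g (r i) = r (π i) + (d 0 + d 1 + d 2 + d i) := by
    intro g π d h i
    have e := Equiv.sum_comp π v
    simp only [Fin.sum_univ_three] at e
    rw [hr, hr, map_add, map_add, map_add, h, h, h, h]
    linear_combination e
  have hd01 : ∀ d : Fin 3 → Ω, (∀ i, d i = 0 ∨ d i = 1) → ∀ i, d 0 + d 1 + d 2 + d i = 0 ∨
      d 0 + d 1 + d 2 + d i = 1 := by
    have add : ∀ a b : Ω, (a = 0 ∨ a = 1) → (b = 0 ∨ b = 1) → (a + b = 0 ∨ a + b = 1) := by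
      rintro a b (rfl | rfl) (rfl | rfl)
      · simp
      · simp
      · simp
      · left; linear_combination h2
    intro d h i
    exact add _ _ (add _ _ (add _ _ (h _) (h _)) (h _)) (h _)
  have hst : Stable ρ (⊥ ⊔ k⟮r 0⟯ ⊔ k⟮r 1⟯) := by
    have : ∀ g i, ρ g (r i) ∈ ⊥ ⊔ k⟮r 0⟯ ⊔ k⟮r 1⟯ := by
      intro g i
      obtain ⟨π, d, hd, h⟩ := hg g
      rw [hrg g π d h]
      refine add_mem (hmem _) ?_
      obtain h | h := hd01 d hd i <;> rw [h] <;> exact fmem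
    exact (stable_bot ρ).sup_two (fun g => this g 0) fun g => this g 1
  refine RelGen.trans (m := 2) (n := 1) ?_ (RelGen.affine hst m2 fun g => ?_)
  · obtain hd | hd := hd
    · refine RelGen.perm_sum_zero hsum hB' fun g => ?_
      obtain ⟨π, d, h⟩ := hd g
      refine ⟨π, fun i => ?_⟩
      rw [hrg g π (fun _ => d) h]
      linear_combination 2 * d * h2
    · obtain ⟨g0, d0, h0⟩ := hd 0
      obtain ⟨g1, d1, h1⟩ := hd 1
      have a0 := hrg g0 1 _ h0
      have a1 := hrg g1 1 _ h1
      obtain ⟨a, ha⟩ : ∃ a : Fin 3 → Ω, ∀ i, a i = r i ^ 2 + r i := ⟨_, fun i => rfl⟩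
      have g00 : ρ g0 (r 0) = r 0 := by
        rw [a0]; simp; linear_combination (2 * d0 + 1) * h2
      have g01 : ρ g0 (r 1) = r 1 + 1 := by
        rw [a0]; simp; linear_combination (2 * d0) * h2
      have g10 : ρ g1 (r 0) = r 0 + 1 := by
        rw [a1]; simp; linear_combination (2 * d1) * h2
      have g11 : ρ g1 (r 1) = r 1 := by
        rw [a1]; simp; linear_combination (2 * d1 + 1) * h2
      have e0 : FixIn ρ (⊥ ⊔ k⟮r 0⟯ ⊔ k⟮r 1⟯) =
          FixIn ρ (⊥ ⊔ k⟮a 0⟯ ⊔ k⟮r 1⟯) := by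
        refine fixIn_eq_of_conj_two (θ := r 0) ?_ ?_ (-1) (a 0) fmem fmem
          (by rw [ha]; ring) g1 (fix_sup_simple (fix_sup_simple (fix_bot _) ?_) g11) ?_
        · simp only [sup_simple_le]
          exact ⟨⟨bot_le, mem_of_eq (r 0 ^ 2 + r 0) (ha 0)⟩, fmem⟩
        · simp only [sup_simple_le]
          exact ⟨⟨bot_le, fmem⟩, fmem⟩
        · rw [ha, map_add, map_pow, g10]; linear_combination (r 0 + 1) * h2
        · rw [g10]; simp
      have e1 : FixIn ρ (⊥ ⊔ k⟮a 0⟯ ⊔ k⟮r 1⟯) =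
          FixIn ρ (⊥ ⊔ k⟮a 0⟯ ⊔ k⟮a 1⟯) := by
        refine fixIn_eq_of_conj_two (θ := r 1) ?_ ?_ (-1) (a 1) fmem fmem
          (by rw [ha]; ring) g0 (fix_sup_simple (fix_sup_simple (fix_bot _) ?_) ?_) ?_
        · simp only [sup_simple_le]
          exact ⟨⟨bot_le, fmem⟩, mem_of_eq (r 1 ^ 2 + r 1) (ha 1)⟩
        · simp only [sup_simple_le]
          exact ⟨⟨bot_le, fmem⟩, fmem⟩
        · rw [ha, map_add, map_pow, g00]
        · rw [ha, map_add, map_pow, g01]; linear_combination (r 1 + 1) * h2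
        · rw [g01]; simp
      unfold RelGen
      rw [e0, e1]
      refine RelGen.perm_sum_zero (t := a) ?_ (hB'.acl_right ?_) fun g => ?_
      · simp only [ha]
        have : r 2 = -r 0 - r 1 := by linear_combination hsum
        rw [this]
        linear_combination (r 0 ^ 2 + r 1 ^ 2 + r 0 * r 1) * h2
      · simp only [sup_simple_le]
        refine ⟨⟨bot_le, ?_⟩, ?_⟩
        · exact mem_acl_quadratic (a := 1) (b := -a 0) fmem fmem (by rw [ha]; ring)
        · exact mem_acl_quadratic (a := 1) (b := -a 1) fmem fmem (by rw [ha]; ring)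
      · obtain ⟨π, d, hd, h⟩ := hg g
        refine ⟨π, fun i => ?_⟩
        rw [ha, ha, map_add, map_pow, hrg g π d h]
        obtain h | h := hd01 d hd i <;> rw [h]
        · ring
        · linear_combination (r (π i) + 1) * h2
  · obtain ⟨π, d, hd, h⟩ := hg g
    refine ⟨1, fmem, r 0 + r (π 0) + d 0, add_mem (add_mem (hmem _) (hmem _)) ?_, ?_⟩
    · obtain h | h := hd 0 <;> rw [h] <;> exact fmem
    · rw [h, hvr (π 0)]; ring

/-- Three variables permuted up to inversion, one of the permutations being cyclic. -/
theorem RelGen.of_signAct [Finite G] {x : Fin 3 → Ω} (hB : Big 3 ⊥ (⊥ ⊔ k⟮x 0⟯ ⊔ k⟮x 1⟯ ⊔ k⟮x 2⟯))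
    (hg : ∀ g, ∃ p, SignAct (ρ g) x p) (c : G) (hc : ∀ i, ρ c (x i) = x (i + 1)) :
    RelGen ρ 3 ⊥ (⊥ ⊔ k⟮x 0⟯ ⊔ k⟮x 1⟯ ⊔ k⟮x 2⟯) := by
  obtain ⟨n0, n1, n2⟩ := hB.three (le_acl _)
  have hx : ∀ i, x i ∉ acl (⊥ : IntermediateField k Ω) := by
    intro i
    fin_cases i
    · exact n0
    · exact fun h => n1 (acl_mono bot_le h)
    · exact fun h => n2 (acl_mono bot_le h)
  have hx0 : ∀ i, x i ≠ 0 := fun i => ne_of_not_mem (hx i) fmem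
  have hx1 : ∀ i, 1 + x i ≠ 0 := fun i => one_add_ne_zero_of_not_mem (hx i)
  have hdich := signAct_dichotomy hg c hc
  by_cases h2 : (2 : Ω) = 0
  · obtain ⟨v, hv⟩ : ∃ v : Fin 3 → Ω, ∀ i, v i = 1 / (1 + x i) := ⟨_, fun i => rfl⟩
    have hxv : ∀ i, x i = 1 / v i - 1 := fun i => by rw [hv]; simp
    obtain ⟨d, hd1, hd2⟩ : ∃ d : ℤˣ → Ω, d 1 = 0 ∧ d (-1) = 1 :=
      ⟨fun e => if e = 1 then 0 else 1, by simp, by simp⟩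
    have hact : ∀ (f : Ω ≃ₐ[k] Ω) i j (e : ℤˣ), f (x i) = x j ^ (e : ℤ) →
        f (v i) = v j + d e := by
      intro f i j e h
      rw [hv, hv, map_div₀, map_add, map_one, h]
      have a := hx0 j
      have b := hx1 j
      obtain rfl | rfl := Int.units_eq_one_or e
      · rw [hd1]; simp
      · have b' : x j + 1 ≠ 0 := by rwa [add_comm]
        have e : 1 + (x j)⁻¹ = (1 + x j) / x j := by field_simp; ring
        rw [hd2]
        simp only [Units.val_neg, Units.val_one, zpow_neg, zpow_one]
        rw [e]
        field_simp
        linear_combination -h2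
    have heq : ⊥ ⊔ k⟮x 0⟯ ⊔ k⟮x 1⟯ ⊔ k⟮x 2⟯ =
        ⊥ ⊔ k⟮v 0⟯ ⊔ k⟮v 1⟯ ⊔ k⟮v 2⟯ := by
      refine le_antisymm ?_ ?_ <;> simp only [sup_simple_le]
      · exact ⟨⟨⟨bot_le, mem_of_eq _ (hxv 0)⟩, mem_of_eq _ (hxv 1)⟩, mem_of_eq _ (hxv 2)⟩
      · exact ⟨⟨⟨bot_le, mem_of_eq _ (hv 0)⟩, mem_of_eq _ (hv 1)⟩, mem_of_eq _ (hv 2)⟩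
    rw [heq] at hB ⊢
    refine RelGen.of_translation h2 hB (fun g => ?_) ?_
    · obtain ⟨p, hp⟩ := hg g
      refine ⟨p.1, fun i => d (p.2 i), fun i => ?_, fun i => hact _ _ _ _ (hp i)⟩
      obtain h | h := Int.units_eq_one_or (p.2 i)
      · exact .inl (by simp only [h, hd1])
      · exact .inr (by simp only [h, hd2])
    · obtain h | h := hdich
      · left
        intro g
        obtain ⟨π, e, h⟩ := h g
        exact ⟨π, d e, fun i => hact _ _ _ _ (h i)⟩
      · right
        intro m
        obtain ⟨g, s, h⟩ := h m
        refine ⟨g, d s, fun i => ?_⟩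
        have e : v i + d (if i = m then -s else s) = v i + if i = m then d s + 1 else d s := by
          split_ifs
          · obtain rfl | rfl := Int.units_eq_one_or s
            · rw [hd1, hd2]; ring
            · rw [neg_neg, hd1, hd2]; linear_combination -h2
          · rfl
        exact (hact _ _ _ _ (h i)).trans e
  · have hact : ∀ (f : Ω ≃ₐ[k] Ω) i j (e : ℤˣ), f (x i) = x j ^ (e : ℤ) →
        f (cay (x i)) = (e : ℤ) * cay (x j) := by
      intro f i j e h
      rw [map_cay, h]
      obtain rfl | rfl := Int.units_eq_one_or e
      · simp
      · have := cay_inv (hx0 j)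
        simp only [one_div] at this
        simp [this]
    have heq : ⊥ ⊔ k⟮x 0⟯ ⊔ k⟮x 1⟯ ⊔ k⟮x 2⟯ =
        ⊥ ⊔ k⟮cay (x 0)⟯ ⊔ k⟮cay (x 1)⟯ ⊔ k⟮cay (x 2)⟯ := by
      have back : ∀ {K : IntermediateField k Ω} i, cay (x i) ∈ K → x i ∈ K := fun i h => by
        have := cay_mem h
        rwa [cay_cay h2 (hx1 i)] at this
      refine le_antisymm ?_ ?_ <;> simp only [sup_simple_le]
      · exact ⟨⟨⟨bot_le, back _ fmem⟩, back _ fmem⟩, back _ fmem⟩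
      · exact ⟨⟨⟨bot_le, cay_mem fmem⟩, cay_mem fmem⟩, cay_mem fmem⟩
    rw [heq] at hB ⊢
    refine RelGen.of_sign_neg (u := fun i => cay (x i)) h2 hB (fun g => ?_) ?_
    · obtain ⟨p, hp⟩ := hg g
      exact ⟨p.1, p.2, fun i => hact _ _ _ _ (hp i)⟩
    · obtain h | h := hdich
      · left
        intro g
        obtain ⟨π, e, h⟩ := h g
        exact ⟨π, e, fun i => hact _ _ _ _ (h i)⟩
      · right
        intro m
        obtain ⟨g, s, h⟩ := h m
        exact ⟨g, s, fun i => hact _ _ _ _ (h i)⟩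

/-- The `i`-th partition of `{0, 1, 2, 3}` into two pairs, listed as a word starting with `0`. -/
def pairing (i : Fin 3) : Fin 4 → Fin 4 :=
  ![![0, 1, 2, 3], ![0, 2, 1, 3], ![0, 3, 1, 2]] i

def quadN (v : Fin 4 → Ω) (i : Fin 3) : Ω :=
  v (pairing i 0) * v (pairing i 1) - v (pairing i 2) * v (pairing i 3)

def quadD (v : Fin 4 → Ω) (i : Fin 3) : Ω :=
  v (pairing i 0) + v (pairing i 1) - v (pairing i 2) - v (pairing i 3)

def quadM (v : Fin 4 → Ω) (i : Fin 3) : Ω :=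
  v (pairing i 0) * v (pairing i 1) * (v (pairing i 2) + v (pairing i 3)) -
    v (pairing i 2) * v (pairing i 3) * (v (pairing i 0) + v (pairing i 1))

/-- Two words describe the same partition into two pairs. -/
def SamePairing (a b : Fin 4 → Fin 4) : Prop :=
  (((a 0 = b 0 ∧ a 1 = b 1) ∨ (a 0 = b 1 ∧ a 1 = b 0)) ∧
      ((a 2 = b 2 ∧ a 3 = b 3) ∨ (a 2 = b 3 ∧ a 3 = b 2))) ∨
    (((a 0 = b 2 ∧ a 1 = b 3) ∨ (a 0 = b 3 ∧ a 1 = b 2)) ∧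
      ((a 2 = b 0 ∧ a 3 = b 1) ∨ (a 2 = b 1 ∧ a 3 = b 0)))

instance (a b : Fin 4 → Fin 4) : Decidable (SamePairing a b) := by
  unfold SamePairing; infer_instance

set_option maxRecDepth 10000 in
theorem exists_perm_pairing : ∀ π : Equiv.Perm (Fin 4), ∃ π' : Equiv.Perm (Fin 3),
    ∀ i, SamePairing (fun j => π (pairing i j)) (pairing (π' i)) := by
  decide

theorem quad_of_samePairing {π : Fin 4 → Fin 4} {i i' : Fin 3}
    (h : SamePairing (fun j => π (pairing i j)) (pairing i')) : ∃ e : ℤˣ,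
    ∀ v : Fin 4 → Ω, quadN (fun j => v (π j)) i = (e : ℤ) * quadN v i' ∧
      quadD (fun j => v (π j)) i = (e : ℤ) * quadD v i' ∧
      quadM (fun j => v (π j)) i = (e : ℤ) * quadM v i' := by
  obtain ⟨⟨h1, h2⟩ | ⟨h1, h2⟩, ⟨h3, h4⟩ | ⟨h3, h4⟩⟩ | ⟨⟨h1, h2⟩ | ⟨h1, h2⟩, ⟨h3, h4⟩ | ⟨h3, h4⟩⟩ := h
  · refine ⟨1, fun v => ?_⟩
    simp only [quadN, quadD, quadM, h1, h2, h3, h4, Units.val_one, Int.cast_one]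
    refine ⟨?_, ?_, ?_⟩ <;> ring
  · refine ⟨1, fun v => ?_⟩
    simp only [quadN, quadD, quadM, h1, h2, h3, h4, Units.val_one, Int.cast_one]
    refine ⟨?_, ?_, ?_⟩ <;> ring
  · refine ⟨1, fun v => ?_⟩
    simp only [quadN, quadD, quadM, h1, h2, h3, h4, Units.val_one, Int.cast_one]
    refine ⟨?_, ?_, ?_⟩ <;> ring
  · refine ⟨1, fun v => ?_⟩
    simp only [quadN, quadD, quadM, h1, h2, h3, h4, Units.val_one, Int.cast_one]
    refine ⟨?_, ?_, ?_⟩ <;> ring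
  · refine ⟨-1, fun v => ?_⟩
    simp only [quadN, quadD, quadM, h1, h2, h3, h4, Units.val_neg, Units.val_one, Int.cast_neg, Int.cast_one]
    refine ⟨?_, ?_, ?_⟩ <;> ring
  · refine ⟨-1, fun v => ?_⟩
    simp only [quadN, quadD, quadM, h1, h2, h3, h4, Units.val_neg, Units.val_one, Int.cast_neg, Int.cast_one]
    refine ⟨?_, ?_, ?_⟩ <;> ring
  · refine ⟨-1, fun v => ?_⟩
    simp only [quadN, quadD, quadM, h1, h2, h3, h4, Units.val_neg, Units.val_one, Int.cast_neg, Int.cast_one]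
    refine ⟨?_, ?_, ?_⟩ <;> ring
  · refine ⟨-1, fun v => ?_⟩
    simp only [quadN, quadD, quadM, h1, h2, h3, h4, Units.val_neg, Units.val_one, Int.cast_neg, Int.cast_one]
    refine ⟨?_, ?_, ?_⟩ <;> ring

theorem units_cast_ne_zero (e : ℤˣ) : ((e : ℤ) : Ω) ≠ 0 := by
  rcases Int.units_eq_one_or e with rfl | rfl <;> simp

theorem map_quad (f : Ω ≃ₐ[k] Ω) (v : Fin 4 → Ω) (i : Fin 3) :
    f (quadN v i) = quadN (fun j => f (v j)) i ∧ f (quadD v i) = quadD (fun j => f (v j)) i ∧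
      f (quadM v i) = quadM (fun j => f (v j)) i := by
  simp [quadN, quadD, quadM]

/-- The slope `1 / h` of the chord relation `x + y = f + g x y` through the two pairs. -/
def chordG (v : Fin 4 → Ω) (i : Fin 3) : Ω := quadD v i / quadN v i

def chordF (v : Fin 4 → Ω) (i : Fin 3) : Ω := quadM v i / quadN v i

theorem chord_of_samePairing {π : Fin 4 → Fin 4} {i i' : Fin 3}
    (h : SamePairing (fun j => π (pairing i j)) (pairing i')) (v : Fin 4 → Ω) :
    chordG (fun j => v (π j)) i = chordG v i' ∧ chordF (fun j => v (π j)) i = chordF v i' := by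
  obtain ⟨e, h⟩ := quad_of_samePairing (Ω := Ω) h
  obtain ⟨h1, h2, h3⟩ := h v
  have := units_cast_ne_zero (Ω := Ω) e
  rw [chordG, chordG, chordF, chordF, h1, h2, h3, mul_div_mul_left _ _ this,
    mul_div_mul_left _ _ this]
  exact ⟨rfl, rfl⟩

/-- The Klein four-group of permutations of `{0, 1, 2, 3}`. -/
def klein (m : Fin 4) : Fin 4 → Fin 4 :=
  ![![0, 1, 2, 3], ![1, 0, 3, 2], ![2, 3, 0, 1], ![3, 2, 1, 0]] m

theorem klein_zero : ∀ m, klein m 0 = m := by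
  decide

theorem klein_pairing : ∀ m i, SamePairing (fun j => klein m (pairing i j)) (pairing i) := by
  decide

theorem prod_klein (v : Fin 4 → Ω) (m : Fin 4) : v (klein m 0) * v (klein m 1) * v (klein m 2) *
    v (klein m 3) = v 0 * v 1 * v 2 * v 3 := by
  fin_cases m <;> simp [klein] <;> ring

theorem map_chordG (f : Ω ≃ₐ[k] Ω) (v : Fin 4 → Ω) (i : Fin 3) :
    f (chordG v i) = chordG (fun j => f (v j)) i := by
  rw [chordG, map_div₀, (map_quad f v i).1, (map_quad f v i).2.1, chordG]

theorem map_chordF (f : Ω ≃ₐ[k] Ω) (v : Fin 4 → Ω) (i : Fin 3) :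
    f (chordF v i) = chordF (fun j => f (v j)) i := by
  rw [chordF, map_div₀, (map_quad f v i).1, (map_quad f v i).2.2, chordF]

/-- The chord data and the product of the variables determine the elementary symmetric functions. -/
theorem chord_identities {v : Fin 4 → Ω} (hN : ∀ i, quadN v i ≠ 0) (hD : ∀ i, quadD v i ≠ 0) :
    (∀ i, chordG v i ≠ 0) ∧
    chordF v 0 = (chordG v 1 + chordG v 2 - chordG v 0) / (chordG v 1 * chordG v 2) ∧
    chordF v 1 = (chordG v 2 + chordG v 0 - chordG v 1) / (chordG v 2 * chordG v 0) ∧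
    chordF v 2 = (chordG v 0 + chordG v 1 - chordG v 2) / (chordG v 0 * chordG v 1) ∧
    v 0 + v 1 + v 2 + v 3 = chordF v 0 * chordF v 1 * chordG v 2 +
      chordF v 1 * chordF v 2 * chordG v 0 + chordF v 2 * chordF v 0 * chordG v 1 +
      v 0 * v 1 * v 2 * v 3 * (chordG v 0 * chordG v 1 * chordG v 2) ∧
    v 0 * v 1 + v 2 * v 3 + v 0 * v 2 + v 1 * v 3 + v 0 * v 3 + v 1 * v 2 =
      chordF v 0 * chordF v 1 + chordF v 1 * chordF v 2 + chordF v 2 * chordF v 0 +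
      v 0 * v 1 * v 2 * v 3 * (chordG v 0 * chordG v 1 + chordG v 1 * chordG v 2 +
        chordG v 2 * chordG v 0) ∧
    v 0 * v 1 * v 2 + v 0 * v 1 * v 3 + v 0 * v 2 * v 3 + v 1 * v 2 * v 3 =
      chordF v 0 * chordF v 1 * chordF v 2 +
      v 0 * v 1 * v 2 * v 3 * (chordF v 0 * chordG v 1 * chordG v 2 +
        chordF v 1 * chordG v 2 * chordG v 0 + chordF v 2 * chordG v 0 * chordG v 1) := by
  have n0 := hN 0
  have n1 := hN 1
  have n2 := hN 2
  have d0 := hD 0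
  have d1 := hD 1
  have d2 := hD 2
  simp only [chordG, chordF]
  refine ⟨fun i => div_ne_zero (hD i) (hN i), ?_, ?_, ?_, ?_, ?_, ?_⟩ <;> field_simp <;>
    simp [quadN, quadD, quadM, pairing] <;> ring

theorem pairing_props : ∀ i, pairing i 0 = 0 ∧ 0 ≠ pairing i 2 ∧ 0 ≠ pairing i 3 := by
  decide

theorem chord_line {v : Fin 4 → Ω} (hN : ∀ i, quadN v i ≠ 0) (i : Fin 3) :
    v 0 + v (pairing i 1) = chordF v i + chordG v i * v 0 * v (pairing i 1) := by
  have n0 := hN i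
  have e := (pairing_props i).1
  rw [chordG, chordF]
  field_simp
  rw [quadN, quadD, quadM, e]
  ring

theorem klein_quartic {v : Fin 4 → Ω} (hv : Function.Injective v) (hN : ∀ i, quadN v i ≠ 0)
    (hD : ∀ i, quadD v i ≠ 0) (hL : L ≤ E ⊔ k⟮v 0⟯ ⊔ k⟮v 1⟯ ⊔ k⟮v 2⟯ ⊔ k⟮v 3⟯)
    (hgE : ∀ i, chordG v i ∈ E) (hpE : v 0 * v 1 * v 2 * v 3 ∈ E) :
    L ≤ E ⊔ k⟮v 0⟯ ∧ ∃ a ∈ E, ∃ b ∈ E, ∃ c ∈ E, ∃ d ∈ E,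
      v 0 ^ 4 = a * v 0 ^ 3 + b * v 0 ^ 2 + c * v 0 + d := by
  obtain ⟨-, f0, f1, f2, e1, e2, e3⟩ := chord_identities hN hD
  have g0 := hgE 0
  have g1 := hgE 1
  have g2 := hgE 2
  have hfE : ∀ i, chordF v i ∈ E := by
    intro i
    fin_cases i
    · exact mem_of_eq _ f0
    · exact mem_of_eq _ f1
    · exact mem_of_eq _ f2
  have f0' := hfE 0
  have f1' := hfE 1
  have f2' := hfE 2
  refine ⟨?_, _, mem_of_eq _ e1, _, neg_mem (mem_of_eq _ e2), _, mem_of_eq _ e3,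
    -(v 0 * v 1 * v 2 * v 3), fmem, by ring⟩
  have key : ∀ i, v (pairing i 1) ∈ E ⊔ k⟮v 0⟯ := by
    intro i
    have h := chord_line hN i
    have hne : 1 - chordG v i * v 0 ≠ 0 := by
      have n0 := hN i
      obtain ⟨e, h2, h3⟩ := pairing_props i
      intro h'
      apply mul_ne_zero (sub_ne_zero.2 (hv.ne h2)) (sub_ne_zero.2 (hv.ne h3))
      rw [chordG] at h'
      field_simp at h'
      rw [quadN, quadD, e] at h'
      linear_combination -h'
    refine mem_of_eq ((chordF v i - v 0) / (1 - chordG v i * v 0)) ?_ ?_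
    · rw [eq_div_iff hne]; linear_combination h
    · exact div_mem (sub_mem (mem_left (hfE i)) fmem)
        (sub_mem fmem (mul_mem (mem_left (hgE i)) fmem))
  refine hL.trans ?_
  simp only [sup_simple_le]
  exact ⟨⟨⟨⟨le_sup_left, fmem⟩, key 0⟩, key 1⟩, key 2⟩

/-- The Klein four-group permuting four variables. -/
theorem fixIn_eq_of_klein {v : Fin 4 → Ω} (hv : Function.Injective v) (hN : ∀ i, quadN v i ≠ 0)
    (hD : ∀ i, quadD v i ≠ 0) (hEL : E ≤ L) (hL : L ≤ E ⊔ k⟮v 0⟯ ⊔ k⟮v 1⟯ ⊔ k⟮v 2⟯ ⊔ k⟮v 3⟯)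
    (hgE : ∀ i, chordG v i ∈ E) (hpE : v 0 * v 1 * v 2 * v 3 ∈ E)
    (hV : ∀ m, ∃ g, ρ g (v 0) = v m ∧ ∀ y ∈ E, ρ g y = y) : FixIn ρ L = FixIn ρ E ∧ L ≤ acl E := by
  obtain ⟨hL', a, ha, b, hb, c, hc, d, hd, h⟩ := klein_quartic hv hN hD hL hgE hpE
  choose τ hτ hτE using hV
  refine ⟨fixIn_eq_of_conj_four hEL hL' a b c d ha hb hc hd h τ hτE (by simpa only [hτ] using hv),
    hL'.trans (sup_simple_le.2 ⟨le_acl _, ?_⟩)⟩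
  exact mem_acl_quartic (neg_mem ha) (neg_mem hb) (neg_mem hc) (neg_mem hd)
    (by linear_combination h)

theorem quad_reciprocal_formula (hx : 1 + x ≠ 0) (hy : 1 + y ≠ 0) (hz : 1 + z ≠ 0)
    (hq : 1 + x * y * z ≠ 0) :
    (1 / (1 + x) * (1 / (1 + y)) - 1 / (1 + z) * (x * y * z / (1 + x * y * z))) *
        ((1 + x) * (1 + y) * (1 + z) * (1 + x * y * z)) =
      x * y * z ^ 2 + (1 - x * y * (x * y + x + y)) * z + 1 ∧
    (1 / (1 + x) + 1 / (1 + y) - 1 / (1 + z) - x * y * z / (1 + x * y * z)) *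
        ((1 + x) * (1 + y) * (1 + z) * (1 + x * y * z)) =
      x * y * (1 - x * y) * z ^ 2 + (2 + x + y - x * y * (2 * (x * y) + x + y)) * z + 1 - x * y := by
  constructor <;> field_simp <;> ring

theorem quad_reciprocal_ne_zero (hx : x ∉ acl K) (hy : y ∉ acl (K ⊔ k⟮x⟯))
    (hz : z ∉ acl (K ⊔ k⟮x⟯ ⊔ k⟮y⟯)) :
    1 / (1 + x) * (1 / (1 + y)) - 1 / (1 + z) * (x * y * z / (1 + x * y * z)) ≠ 0 ∧
    1 / (1 + x) + 1 / (1 + y) - 1 / (1 + z) - x * y * z / (1 + x * y * z) ≠ 0 := by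
  have x0 : x ≠ 0 := ne_of_not_mem hx fmem
  have y0 : y ≠ 0 := ne_of_not_mem hy fmem
  have hx1 := one_add_ne_zero_of_not_mem hx
  have hy1 := one_add_ne_zero_of_not_mem hy
  have hz1 := one_add_ne_zero_of_not_mem hz
  have hq : 1 + x * y * z ≠ 0 := fun h =>
    ne_of_not_mem hz (y := -1 / (x * y)) fmem (by field_simp; linear_combination h)
  have hxy : 1 - x * y ≠ 0 := fun h =>
    ne_of_not_mem hy (y := 1 / x) fmem (by field_simp; linear_combination -h)
  obtain ⟨e1, e2⟩ := quad_reciprocal_formula hx1 hy1 hz1 hq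
  constructor <;> intro h
  · rw [h, zero_mul] at e1
    refine hz (mem_acl_quadratic (a := (1 - x * y * (x * y + x + y)) / (x * y))
      (b := 1 / (x * y)) fmem fmem ?_)
    field_simp
    linear_combination -e1
  · rw [h, zero_mul] at e2
    refine hz (mem_acl_quadratic (a := (2 + x + y - x * y * (2 * (x * y) + x + y)) /
      (x * y * (1 - x * y))) (b := 1 / (x * y)) fmem fmem ?_)
    field_simp
    linear_combination -e2

theorem quad_resolvent {v : Fin 4 → Ω} (hx : 1 + x ≠ 0) (hy : 1 + y ≠ 0) (hz : 1 + z ≠ 0)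
    (hq : 1 + x * y * z ≠ 0) (v0 : v 0 = 1 / (1 + x)) (v1 : v 1 = 1 / (1 + y))
    (v2 : v 2 = 1 / (1 + z)) (v3 : v 3 = x * y * z / (1 + x * y * z)) :
    ((quadN v 0 - quadD v 0) * (quadN v 1 - quadD v 1) * (quadN v 2 - quadD v 2) -
        quadN v 0 * quadN v 1 * quadN v 2) *
        ((1 + x) * (1 + y) * (1 + z) * (1 + x * y * z)) ^ 2 =
      -((x * y - 1) * (y * z - 1) * (x * z - 1) * (x * y + 1) * (1 + x * z) * (1 + y * z)) := by
  have hd : ((1 + x) * (1 + y) * (1 + z) * (1 + x * y * z)) ≠ 0 := by positivity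
  obtain ⟨a0, b0⟩ := quad_reciprocal_formula hx hy hz hq
  obtain ⟨a1, b1⟩ := quad_reciprocal_formula hx hz hy (by rwa [mul_right_comm])
  obtain ⟨a2, b2⟩ := quad_reciprocal_formula hy hz hx (by rwa [mul_comm, ← mul_assoc])
  rw [← eq_div_iff (by simpa [mul_comm, mul_left_comm, mul_assoc] using hd)] at a0 b0 a1 b1 a2 b2
  have v3' : v 3 = x * z * y / (1 + x * z * y) := by rw [v3, mul_right_comm]
  have v3'' : v 3 = y * z * x / (1 + y * z * x) := by rw [v3, mul_assoc, mul_comm]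
  rw [← v0, ← v1, ← v2, ← v3] at a0 b0
  rw [← v0, ← v1, ← v2, ← v3'] at a1 b1
  rw [← v0, ← v1, ← v2, ← v3''] at a2 b2
  have A0 : quadN v 0 = _ := a0
  have B0 : quadD v 0 = _ := b0
  have A1 : quadN v 1 = _ := a1
  have B1 : quadD v 1 = _ := b1
  have A2 : -quadN v 2 = _ := Eq.trans (neg_sub (v 0 * v 3) (v 1 * v 2)) a2
  have B2 : -quadD v 2 = _ :=
    Eq.trans (show -(v 0 + v 3 - v 1 - v 2) = v 1 + v 2 - v 0 - v 3 by ring) b2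
  rw [neg_eq_iff_eq_neg] at A2 B2
  have e1 : (1 + x) * (1 + z) * (1 + y) * (1 + x * z * y) =
      (1 + x) * (1 + y) * (1 + z) * (1 + x * y * z) := by ring
  have e2 : (1 + y) * (1 + z) * (1 + x) * (1 + y * z * x) =
      (1 + x) * (1 + y) * (1 + z) * (1 + x * y * z) := by ring
  rw [A0, B0, A1, B1, A2, B2, e1, e2]
  obtain ⟨d, hd'⟩ : ∃ d, d = (1 + x) * (1 + y) * (1 + z) * (1 + x * y * z) := ⟨_, rfl⟩
  rw [← hd'] at hd ⊢
  field_simp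
  rw [hd']
  ring

set_option maxHeartbeats 1000000 in
/-- Four variables with product one, permuted up to a simultaneous inversion by a group
containing the Klein four-group. -/
theorem RelGen.of_klein [Finite G] {x : Fin 4 → Ω} (hx : x 0 * x 1 * x 2 * x 3 = 1)
    (hB : Big 3 ⊥ (⊥ ⊔ k⟮x 0⟯ ⊔ k⟮x 1⟯ ⊔ k⟮x 2⟯)) (hg : ∀ g, ∃ π : Equiv.Perm (Fin 4),
      (∀ i, ρ g (x i) = x (π i)) ∨ ∀ i, ρ g (x i) = 1 / x (π i))
    (hV : ∀ m, ∃ g, ∀ i, ρ g (x i) = x (klein m i)) :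
    RelGen ρ 3 ⊥ (⊥ ⊔ k⟮x 0⟯ ⊔ k⟮x 1⟯ ⊔ k⟮x 2⟯) := by
  obtain ⟨n0, n1, n2⟩ := hB.three (le_acl _)
  obtain ⟨m0, m2, m1⟩ := hB.three (x := x 0) (y := x 2) (z := x 1)
    (le_trans (by rw [sup_right_comm]) (le_acl _))
  obtain ⟨l1, l2, l0⟩ := hB.three (x := x 1) (y := x 2) (z := x 0)
    (le_trans (by rw [sup_right_comm ⊥, sup_right_comm _ k⟮x 0⟯]) (le_acl _))
  have z0 : x 0 ≠ 0 := ne_of_not_mem n0 fmem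
  have z1 : x 1 ≠ 0 := ne_of_not_mem n1 fmem
  have z2 : x 2 ≠ 0 := ne_of_not_mem n2 fmem
  have hx3 : x 3 = 1 / (x 0 * x 1 * x 2) := by field_simp; linear_combination hx
  have z3 : x 3 ≠ 0 := fun h => by simp [h] at hx
  have hy0 := one_add_ne_zero_of_not_mem n0
  have hy1 := one_add_ne_zero_of_not_mem n1
  have hy2 := one_add_ne_zero_of_not_mem n2
  have hq : 1 + x 0 * x 1 * x 2 ≠ 0 := fun h =>
    ne_of_not_mem n2 (y := -1 / (x 0 * x 1)) fmem (by field_simp; linear_combination h)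
  have hy3 : 1 + x 3 ≠ 0 := fun h => hq (by linear_combination (x 0 * x 1 * x 2) * h - hx)
  have hy : ∀ i, 1 + x i ≠ 0 := by
    intro i; fin_cases i <;> assumption
  have hz : ∀ i, x i ≠ 0 := by
    intro i; fin_cases i <;> assumption
  obtain ⟨v, hv⟩ : ∃ v : Fin 4 → Ω, ∀ i, v i = 1 / (1 + x i) := ⟨_, fun i => rfl⟩
  have hxv : ∀ i, x i = 1 / v i - 1 := fun i => by rw [hv]; simp
  have v3 : v 3 = x 0 * x 1 * x 2 / (1 + x 0 * x 1 * x 2) := by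
    rw [hv]; field_simp; linear_combination -hx
  have v3' : v 3 = x 0 * x 2 * x 1 / (1 + x 0 * x 2 * x 1) := by rw [v3, mul_right_comm]
  have v3'' : v 3 = x 1 * x 2 * x 0 / (1 + x 1 * x 2 * x 0) := by rw [v3, mul_assoc, mul_comm]
  obtain ⟨a0, b0⟩ := quad_reciprocal_ne_zero n0 n1 n2
  obtain ⟨a1, b1⟩ := quad_reciprocal_ne_zero m0 m2 m1
  obtain ⟨a2, b2⟩ := quad_reciprocal_ne_zero l1 l2 l0
  rw [← hv 0, ← hv 1, ← hv 2, ← v3] at a0 b0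
  rw [← hv 0, ← hv 1, ← hv 2, ← v3'] at a1 b1
  rw [← hv 0, ← hv 1, ← hv 2, ← v3''] at a2 b2
  have hN : ∀ i, quadN v i ≠ 0 := by
    intro i
    fin_cases i
    · exact a0
    · exact a1
    · exact fun h : v 0 * v 3 - v 1 * v 2 = 0 => a2 (by linear_combination -h)
  have hD : ∀ i, quadD v i ≠ 0 := by
    intro i
    fin_cases i
    · exact b0
    · exact b1
    · exact fun h : v 0 + v 3 - v 1 - v 2 = 0 => b2 (by linear_combination -h)
  have hinj : Function.Injective v := by
    have h01 : x 0 ≠ x 1 := (ne_of_not_mem n1 fmem).symm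
    have h02 : x 0 ≠ x 2 := (ne_of_not_mem n2 fmem).symm
    have h12 : x 1 ≠ x 2 := (ne_of_not_mem n2 fmem).symm
    have h03 : x 0 ≠ x 3 := fun h => ne_of_not_mem n2 (y := 1 / (x 0 ^ 2 * x 1)) fmem
      (by field_simp; rw [← h] at hx; linear_combination hx)
    have h13 : x 1 ≠ x 3 := fun h => ne_of_not_mem n2 (y := 1 / (x 0 * x 1 ^ 2)) fmem
      (by field_simp; rw [← h] at hx; linear_combination hx)
    have h23 : x 2 ≠ x 3 := fun h => n2 (mem_acl_quadratic (a := 0) (b := -1 / (x 0 * x 1)) fmem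
      fmem (by field_simp; rw [← h] at hx; linear_combination hx))
    intro i j hij
    have : x i = x j := by rw [hxv, hxv, hij]
    clear hij
    fin_cases i <;> fin_cases j <;>
      first | rfl | exact absurd this ‹_› | exact absurd this.symm ‹_›
  obtain ⟨hG, f0, f1, f2, e1, e2, e3⟩ := chord_identities hN hD
  obtain ⟨h, hh⟩ : ∃ h : Fin 3 → Ω, ∀ i, h i = 1 / chordG v i := ⟨_, fun i => rfl⟩
  obtain ⟨E, hE⟩ : ∃ E, E = ⊥ ⊔ k⟮h 0⟯ ⊔ k⟮h 1⟯ ⊔ k⟮h 2⟯ := ⟨_, rfl⟩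
  have hgE : ∀ i, chordG v i ∈ E := by
    have : ∀ i, h i ∈ E := by
      intro i; rw [hE]; fin_cases i
      · exact mem_left (mem_left (mem_right _ _))
      · exact mem_left (mem_right _ _)
      · exact mem_right _ _
    intro i
    have := this i
    exact mem_of_eq (1 / h i) (by rw [hh, one_div_one_div])
  have hpE : v 0 * v 1 * v 2 * v 3 ∈ E := by
    have hrel : (1 - v 0) * (1 - v 1) * (1 - v 2) * (1 - v 3) = v 0 * v 1 * v 2 * v 3 := by
      have : ∀ i, 1 - v i = x i * v i := fun i => by
        have := hy i
        rw [hv]; field_simp; ring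
      rw [this, this, this, this]
      linear_combination (v 0 * v 1 * v 2 * v 3) * hx
    have g0 := hgE 0
    have g1 := hgE 1
    have g2 := hgE 2
    have f0' : chordF v 0 ∈ E := mem_of_eq _ f0
    have f1' : chordF v 1 ∈ E := mem_of_eq _ f1
    have f2' : chordF v 2 ∈ E := mem_of_eq _ f2
    have hsum : chordF v 0 * chordG v 1 * chordG v 2 + chordF v 1 * chordG v 2 * chordG v 0 +
        chordF v 2 * chordG v 0 * chordG v 1 = chordG v 0 + chordG v 1 + chordG v 2 := by
      have := hG 0
      have := hG 1
      have := hG 2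
      rw [f0, f1, f2]
      field_simp
      ring
    obtain ⟨C, hC⟩ : ∃ C, C = chordG v 0 * chordG v 1 + chordG v 1 * chordG v 2 +
      chordG v 2 * chordG v 0 - chordG v 0 * chordG v 1 * chordG v 2 -
      (chordG v 0 + chordG v 1 + chordG v 2) := ⟨_, rfl⟩
    have hCE : C ∈ E := mem_of_eq _ hC
    have hC0 : C ≠ 0 := by
      have key := quad_resolvent hy0 hy1 hy2 hq (hv 0) (hv 1) (hv 2) v3
      have hCN : C * (quadN v 0 * quadN v 1 * quadN v 2) =
          (quadN v 0 - quadD v 0) * (quadN v 1 - quadD v 1) * (quadN v 2 - quadD v 2) -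
            quadN v 0 * quadN v 1 * quadN v 2 := by
        have := hN 0
        have := hN 1
        have := hN 2
        rw [hC]
        simp only [chordG]
        field_simp
        ring
      intro h0
      rw [← hCN, h0, zero_mul, zero_mul, eq_comm, neg_eq_zero] at key
      have c1 : x 0 * x 1 - 1 ≠ 0 := fun h =>
        ne_of_not_mem n1 (y := 1 / x 0) fmem (by field_simp; linear_combination h)
      have c2 : x 1 * x 2 - 1 ≠ 0 := fun h =>
        ne_of_not_mem n2 (y := 1 / x 1) fmem (by field_simp; linear_combination h)
      have c3 : x 0 * x 2 - 1 ≠ 0 := fun h =>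
        ne_of_not_mem n2 (y := 1 / x 0) fmem (by field_simp; linear_combination h)
      have c4 : x 0 * x 1 + 1 ≠ 0 := fun h =>
        ne_of_not_mem n1 (y := -1 / x 0) fmem (by field_simp; linear_combination h)
      have c5 : 1 + x 0 * x 2 ≠ 0 := fun h =>
        ne_of_not_mem n2 (y := -1 / x 0) fmem (by field_simp; linear_combination h)
      have c6 : 1 + x 1 * x 2 ≠ 0 := fun h =>
        ne_of_not_mem n2 (y := -1 / x 1) fmem (by field_simp; linear_combination h)
      exact (mul_ne_zero (mul_ne_zero (mul_ne_zero (mul_ne_zero (mul_ne_zero c1 c2) c3) c4) c5) c6)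
        key
    refine mem_of_eq (-(1 - (chordF v 0 * chordF v 1 * chordG v 2 +
      chordF v 1 * chordF v 2 * chordG v 0 + chordF v 2 * chordF v 0 * chordG v 1) +
      (chordF v 0 * chordF v 1 + chordF v 1 * chordF v 2 + chordF v 2 * chordF v 0) -
      chordF v 0 * chordF v 1 * chordF v 2) / C) ?_
    rw [eq_div_iff hC0, hC]
    linear_combination hrel - e2 + e1 + e3 + (v 0 * v 1 * v 2 * v 3) * hsum
  have hEL : E ≤ ⊥ ⊔ k⟮x 0⟯ ⊔ k⟮x 1⟯ ⊔ k⟮x 2⟯ := by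
    have hvL : ∀ i, v i ∈ ⊥ ⊔ k⟮x 0⟯ ⊔ k⟮x 1⟯ ⊔ k⟮x 2⟯ := by
      intro i
      refine mem_of_eq _ (hv i) ?_
      fin_cases i
      · change 1 / (1 + x 0) ∈ _; exact fmem
      · change 1 / (1 + x 1) ∈ _; exact fmem
      · change 1 / (1 + x 2) ∈ _; exact fmem
      · change 1 / (1 + x 3) ∈ _; rw [hx3]; exact fmem
    have hhL : ∀ i, h i ∈ ⊥ ⊔ k⟮x 0⟯ ⊔ k⟮x 1⟯ ⊔ k⟮x 2⟯ := by
      intro i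
      rw [hh, chordG, quadN, quadD]
      exact div_mem (one_mem _) (div_mem (sub_mem (sub_mem (add_mem (hvL _) (hvL _)) (hvL _))
        (hvL _)) (sub_mem (mul_mem (hvL _) (hvL _)) (mul_mem (hvL _) (hvL _))))
    rw [hE]
    simp only [sup_simple_le]
    exact ⟨⟨⟨bot_le, hhL 0⟩, hhL 1⟩, hhL 2⟩
  have hact : ∀ (f : Ω ≃ₐ[k] Ω) (π : Fin 4 → Fin 4), (∀ i, f (x i) = x (π i)) →
      ∀ i, f (v i) = v (π i) := fun f π h i => by
    rw [hv, hv, map_div₀, map_add, map_one, h]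
  obtain ⟨hfix, hacl⟩ := fixIn_eq_of_klein (ρ := ρ) hinj hN hD hEL
    (by
      have q0 : v 0 ∈ E ⊔ k⟮v 0⟯ ⊔ k⟮v 1⟯ ⊔ k⟮v 2⟯ ⊔ k⟮v 3⟯ :=
        mem_left (mem_left (mem_left (mem_right _ _)))
      simp only [sup_simple_le]
      exact ⟨⟨⟨bot_le, mem_of_eq _ (hxv 0)⟩, mem_of_eq _ (hxv 1)⟩, mem_of_eq _ (hxv 2)⟩)
    hgE hpE fun m => by
      obtain ⟨g, hg⟩ := hV m
      have hgv := hact _ _ hg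
      refine ⟨g, by rw [hgv, klein_zero], ?_⟩
      have hgh : ∀ i, ρ g (h i) = h i := fun i => by
        rw [hh, map_div₀, map_one, map_chordG]
        simp only [hgv]
        rw [(chord_of_samePairing (klein_pairing m i) v).1]
      rw [hE]
      exact fix_sup_simple (fix_sup_simple (fix_sup_simple (fix_bot _) (hgh 0)) (hgh 1)) (hgh 2)
  unfold RelGen
  rw [hfix]
  rw [hE] at hacl ⊢
  refine RelGen.perm_affine (hB.acl_right hacl) fun g => ?_
  obtain ⟨π, h'⟩ := hg g
  obtain ⟨π', hπ⟩ := exists_perm_pairing π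
  obtain h' | h' := h'
  · refine ⟨1, fmem, 0, fmem, π', fun i => ?_⟩
    rw [hh, hh, map_div₀, map_one, map_chordG]
    simp only [hact _ _ h']
    rw [(chord_of_samePairing (hπ i) v).1]
    ring
  · refine ⟨-1, fmem, 1, fmem, π', fun i => ?_⟩
    have hgv : ∀ i, ρ g (v i) = 1 - v (π i) := fun i => by
      have := hy (π i)
      have h1 := hz (π i)
      have e : 1 + 1 / x (π i) = (1 + x (π i)) / x (π i) := by field_simp; ring
      rw [hv, hv, map_div₀, map_add, map_one, h', e]
      field_simp
      ring
    have e : ∀ (w : Fin 4 → Ω) i, quadD w i ≠ 0 →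
        1 / chordG (fun j => 1 - w j) i = 1 - 1 / chordG w i := fun w i h => by
      have e1 : quadD (fun j => 1 - w j) i = -quadD w i := by simp only [quadD]; ring
      have e2 : quadN (fun j => 1 - w j) i = quadN w i - quadD w i := by
        simp only [quadD, quadN]; ring
      rw [chordG, e1, e2, chordG]
      simp only [one_div_div]
      field_simp
      ring
    rw [hh, hh, map_div₀, map_one, map_chordG]
    simp only [hgv]
    have hc := (chord_of_samePairing (hπ i) v).1
    rw [← hc, e (fun j => v (π j))]
    · ring
    · intro h0
      apply hG (π' i)
      rw [← hc, chordG, h0, zero_div]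

set_option maxHeartbeats 1000000 in
theorem chord_affine_ne_zero {t : Fin 4 → Ω} (h3 : t 3 = 1) (n0 : t 0 ∉ acl K)
    (n1 : t 1 ∉ acl (K ⊔ k⟮t 0⟯)) (n2 : t 2 ∉ acl (K ⊔ k⟮t 0⟯ ⊔ k⟮t 1⟯)) :
    (∀ i, quadN t i ≠ 0) ∧ (∀ i, quadD t i ≠ 0) ∧ chordG t 0 + chordG t 1 + chordG t 2 ≠ 0 := by
  have z0 : t 0 ≠ 0 := ne_of_not_mem n0 fmem
  have z1 : t 1 ≠ 0 := ne_of_not_mem n1 fmem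
  have hN : ∀ i, quadN t i ≠ 0 := by
    intro i
    fin_cases i
    · exact fun h : t 0 * t 1 - t 2 * t 3 = 0 => ne_of_not_mem n2 (y := t 0 * t 1) fmem
        (by rw [h3] at h; linear_combination -h)
    · exact fun h : t 0 * t 2 - t 1 * t 3 = 0 => ne_of_not_mem n2 (y := t 1 / t 0) fmem
        (by rw [h3] at h; field_simp; linear_combination h)
    · exact fun h : t 0 * t 3 - t 1 * t 2 = 0 => ne_of_not_mem n2 (y := t 0 / t 1) fmem
        (by rw [h3] at h; field_simp; linear_combination -h)
  have hD : ∀ i, quadD t i ≠ 0 := by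
    intro i
    fin_cases i
    · exact fun h : t 0 + t 1 - t 2 - t 3 = 0 => ne_of_not_mem n2 (y := t 0 + t 1 - 1) fmem
        (by rw [h3] at h; linear_combination -h)
    · exact fun h : t 0 + t 2 - t 1 - t 3 = 0 => ne_of_not_mem n2 (y := t 1 + 1 - t 0) fmem
        (by rw [h3] at h; linear_combination h)
    · exact fun h : t 0 + t 3 - t 1 - t 2 = 0 => ne_of_not_mem n2 (y := t 0 + 1 - t 1) fmem
        (by rw [h3] at h; linear_combination -h)
  refine ⟨hN, hD, fun h => n2 ?_⟩
  have hone : t 0 + 1 ≠ 0 := fun h => ne_of_not_mem n0 (y := -1) fmem (by linear_combination h)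
  obtain ⟨p, hp⟩ : ∃ p, p = t 0 * t 1 + t 0 + t 1 := ⟨_, rfl⟩
  have hp0 : p ≠ 0 := fun h => ne_of_not_mem n1 (y := -t 0 / (t 0 + 1)) fmem
    (by field_simp; linear_combination h - hp)
  have hpm : p ∈ K ⊔ k⟮t 0⟯ ⊔ k⟮t 1⟯ := mem_of_eq _ hp
  have hS : quadD t 0 * quadN t 1 * quadN t 2 + quadD t 1 * quadN t 0 * quadN t 2 +
      quadD t 2 * quadN t 0 * quadN t 1 = 0 := by
    have := hN 0
    have := hN 1
    have := hN 2
    simp only [chordG] at h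
    field_simp at h
    linear_combination h
  simp only [quadN, quadD] at hS
  change (t 0 + t 1 - t 2 - t 3) * (t 0 * t 2 - t 1 * t 3) * (t 0 * t 3 - t 1 * t 2) +
    (t 0 + t 2 - t 1 - t 3) * (t 0 * t 1 - t 2 * t 3) * (t 0 * t 3 - t 1 * t 2) +
    (t 0 + t 3 - t 1 - t 2) * (t 0 * t 1 - t 2 * t 3) * (t 0 * t 2 - t 1 * t 3) = 0 at hS
  rw [h3] at hS
  generalize t 0 = a at *
  generalize t 1 = b at *
  refine mem_acl_cubic
    (a := (-2 * a ^ 2 * b - 2 * a ^ 2 - 2 * a * b ^ 2 + 3 * a * b - 2 * a - 2 * b ^ 2 - 2 * b) / p)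
    (b := (a ^ 3 * b + a ^ 3 - 2 * a ^ 2 * b ^ 2 + 3 * a ^ 2 * b - 2 * a ^ 2 + a * b ^ 3 +
      3 * a * b ^ 2 + 3 * a * b + a + b ^ 3 - 2 * b ^ 2 + b) / p)
    (c := (a ^ 3 * b - 2 * a ^ 2 * b ^ 2 - 2 * a ^ 2 * b + a * b ^ 3 - 2 * a * b ^ 2 + a * b) / p)
    fmem fmem fmem ?_
  field_simp
  rw [hp]
  linear_combination hS

theorem quad_inv {v : Fin 4 → Ω} (hv : ∀ i, v i ≠ 0) {s : Ω} (hs : s ≠ 0) (i : Fin 3) :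
    chordG (fun j => s / v j) i = chordF v i / s ∧ chordF (fun j => s / v j) i = s * chordG v i := by
  obtain ⟨p, hp⟩ : ∃ p, p = v (pairing i 0) * v (pairing i 1) * v (pairing i 2) *
    v (pairing i 3) := ⟨_, rfl⟩
  have h0 := hv (pairing i 0)
  have h1 := hv (pairing i 1)
  have h2 := hv (pairing i 2)
  have h3 := hv (pairing i 3)
  have hp0 : p ≠ 0 := by rw [hp]; positivity
  have e1 : quadN (fun j => s / v j) i = -s ^ 2 * quadN v i / p := by
    rw [hp, quadN, quadN]; field_simp; ring
  have e2 : quadD (fun j => s / v j) i = -s * quadM v i / p := by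
    rw [hp, quadD, quadM]; field_simp; ring
  have e3 : quadM (fun j => s / v j) i = -s ^ 3 * quadD v i / p := by
    rw [hp, quadD, quadM]; field_simp; ring
  rw [chordG, chordF, chordF, chordG, e1, e2, e3]
  constructor
  · by_cases h : quadN v i = 0
    · simp [h]
    · field_simp
  · by_cases h : quadN v i = 0
    · simp [h]
    · field_simp

theorem quad_mul (v : Fin 4 → Ω) {s : Ω} (hs : s ≠ 0) (i : Fin 3) :
    quadN (fun j => s * v j) i = s ^ 2 * quadN v i ∧ quadD (fun j => s * v j) i = s * quadD v i ∧
    chordG (fun j => s * v j) i = chordG v i / s ∧ chordF (fun j => s * v j) i = s * chordF v i := by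
  have e1 : quadN (fun j => s * v j) i = s ^ 2 * quadN v i := by simp only [quadN]; ring
  have e2 : quadD (fun j => s * v j) i = s * quadD v i := by simp only [quadD]; ring
  have e3 : quadM (fun j => s * v j) i = s ^ 3 * quadM v i := by simp only [quadM]; ring
  rw [chordG, chordG, chordF, chordF, e1, e2, e3]
  refine ⟨rfl, rfl, ?_, ?_⟩
  · by_cases h : quadN v i = 0
    · simp [h]
    · field_simp
  · by_cases h : quadN v i = 0
    · simp [h]
    · field_simp

/-- The sum of the three chord invariants of a word is invariant under permutations. -/
theorem chord_sum_perm (π : Equiv.Perm (Fin 4)) (v : Fin 4 → Ω) :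
    ∑ i, chordG (fun j => v (π j)) i = ∑ i, chordG v i ∧
      ∑ i, chordF (fun j => v (π j)) i = ∑ i, chordF v i := by
  obtain ⟨π', h⟩ := exists_perm_pairing π
  rw [← Equiv.sum_comp π' (chordG v), ← Equiv.sum_comp π' (chordF v)]
  exact ⟨Finset.sum_congr rfl fun i _ => (chord_of_samePairing (h i) v).1,
    Finset.sum_congr rfl fun i _ => (chord_of_samePairing (h i) v).2⟩

theorem div_perm_three (H : Fin 3 → Ω) (π : Equiv.Perm (Fin 3)) :
    (∀ i, H (π (i + 1)) / H (π (i + 2)) = H (π i + 1) / H (π i + 2)) ∨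
      ∀ i, H (π (i + 1)) / H (π (i + 2)) = 1 / (H (π i + 1) / H (π i + 2)) := by
  rcases Int.units_eq_one_or (Equiv.Perm.sign π) with hs | hs
  · refine Or.inl fun i => ?_
    obtain ⟨h1, h2, h3⟩ | ⟨h1, h2, h3⟩ := perm_three_sign π i
    · rw [h2, h3]
    · rw [hs] at h1; exact absurd h1 (by decide)
  · refine Or.inr fun i => ?_
    obtain ⟨h1, h2, h3⟩ | ⟨h1, h2, h3⟩ := perm_three_sign π i
    · rw [hs] at h1; exact absurd h1 (by decide)
    · rw [h2, h3, one_div_div]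

theorem sum_fin_three_eq (f : Fin 3 → Ω) (i : Fin 3) :
    ∑ j, f j = f i + f (i + 1) + f (i + 2) := by
  rw [Fin.sum_univ_three]
  fin_cases i
  · rfl
  · change _ = f 1 + f 2 + f 0; ring
  · change _ = f 2 + f 0 + f 1; ring

set_option maxHeartbeats 1000000 in
/-- Three variables with sum one, permuted up to the quadratic Cremona involution
`g ↦ s * g * (1 - 2 * g)`. -/
theorem RelGen.of_cremona [Finite G] {g : Fin 3 → Ω} (hsum : ∑ i, g i = 1)
    (hB : Big 2 ⊥ (⊥ ⊔ k⟮g 0⟯ ⊔ k⟮g 1⟯))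
    (hg : ∀ σ, ∃ π : Equiv.Perm (Fin 3), (∀ i, ρ σ (g i) = g (π i)) ∨
      ∃ s, ∀ i, ρ σ (g i) = s * (g (π i) * (1 - 2 * g (π i)))) (c : G)
    (hc : ∀ i, ρ c (g i) = g (i + 1)) : RelGen ρ 2 ⊥ (⊥ ⊔ k⟮g 0⟯ ⊔ k⟮g 1⟯) := by
  obtain ⟨n0, n1⟩ := hB.two (le_acl _)
  have hg2 : g 2 = 1 - g 0 - g 1 := by rw [Fin.sum_univ_three] at hsum; linear_combination hsum
  have z0 : g 0 ≠ 0 := ne_of_not_mem n0 fmem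
  have z1 : g 1 ≠ 0 := ne_of_not_mem n1 fmem
  have z2 : g 2 ≠ 0 := fun h => ne_of_not_mem n1 (y := 1 - g 0) fmem
    (by linear_combination hg2 - h)
  by_cases h2 : (2 : Ω) = 0
  · have hE : ⊥ ⊔ k⟮g 0⟯ ⊔ k⟮g 1⟯ = ⊥ ⊔ k⟮g 0 / g 2⟯ ⊔ k⟮g 1 / g 2⟯ := by
      have e : g 0 / g 2 + g 1 / g 2 + 1 = 1 / g 2 := by
        field_simp; linear_combination hg2
      have hd : g 0 / g 2 + g 1 / g 2 + 1 ≠ 0 := by rw [e]; exact one_div_ne_zero z2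
      have hm : g 2 ∈ ⊥ ⊔ k⟮g 0⟯ ⊔ k⟮g 1⟯ := mem_of_eq _ hg2
      refine sup_two_eq
        (mem_of_eq ((g 0 / g 2) / (g 0 / g 2 + g 1 / g 2 + 1)) (by rw [e]; field_simp))
        (mem_of_eq ((g 1 / g 2) / (g 0 / g 2 + g 1 / g 2 + 1)) (by rw [e]; field_simp))
        fmem fmem
    rw [hE] at hB ⊢
    refine RelGen.perm_proj hB fun σ => ?_
    obtain ⟨π, h | ⟨s, h⟩⟩ := hg σ
    · exact ⟨1, π, fun i => by rw [h, one_mul]⟩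
    · exact ⟨s, π, fun i => by rw [h]; linear_combination -s * g (π i) ^ 2 * h2⟩
  · obtain ⟨H, hH⟩ : ∃ H : Fin 3 → Ω, ∀ i, H i = 1 - 2 * g i := ⟨_, fun i => rfl⟩
    have y0 : H 0 ≠ 0 := fun h => ne_of_not_mem n0 (y := 1 / 2) fmem
      (by field_simp; linear_combination -h + hH 0)
    have y1 : H 1 ≠ 0 := fun h => ne_of_not_mem n1 (y := 1 / 2) fmem
      (by field_simp; linear_combination -h + hH 1)
    have y2 : H 2 ≠ 0 := fun h => ne_of_not_mem n1 (y := 1 - g 0 - 1 / 2) fmem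
      (by field_simp; linear_combination h - hH 2 + 2 * hg2)
    have hH0 : ∀ i, H i ≠ 0 := by intro i; fin_cases i <;> assumption
    obtain ⟨z, hz⟩ : ∃ z : Fin 3 → Ω, ∀ i, z i = H (i + 1) / H (i + 2) := ⟨_, fun i => rfl⟩
    have e0 : z 0 = H 1 / H 2 := hz 0
    have e1 : z 1 = H 2 / H 0 := hz 1
    have e2 : z 2 = H 0 / H 1 := hz 2
    have hHs : H 0 + H 1 + H 2 = 1 := by rw [hH, hH, hH]; linear_combination -2 * hg2
    have hE : ⊥ ⊔ k⟮g 0⟯ ⊔ k⟮g 1⟯ = ⊥ ⊔ k⟮z 0⟯ ⊔ k⟮z 1⟯ := by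
      have e : 1 + z 0 * z 1 + z 1 = 1 / H 0 := by
        rw [e0, e1]; field_simp; linear_combination hHs
      have hd : 1 + z 0 * z 1 + z 1 ≠ 0 := by rw [e]; exact one_div_ne_zero y0
      have hm2 : g 2 ∈ ⊥ ⊔ k⟮g 0⟯ ⊔ k⟮g 1⟯ := mem_of_eq _ hg2
      have hm : ∀ i, H i ∈ ⊥ ⊔ k⟮g 0⟯ ⊔ k⟮g 1⟯ := by
        intro i; refine mem_of_eq _ (hH i) ?_; fin_cases i
        · change 1 - 2 * g 0 ∈ _; exact fmem
        · change 1 - 2 * g 1 ∈ _; exact fmem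
        · change 1 - 2 * g 2 ∈ _; exact fmem
      refine sup_two_eq
        (mem_of_eq ((1 - 1 / (1 + z 0 * z 1 + z 1)) / 2)
          (by rw [e, one_div_one_div, hH]; field_simp; ring))
        (mem_of_eq ((1 - z 0 * z 1 / (1 + z 0 * z 1 + z 1)) / 2) ?_)
        (mem_of_eq _ e0 (div_mem (hm _) (hm _))) (mem_of_eq _ e1 (div_mem (hm _) (hm _)))
      have : z 0 * z 1 / (1 + z 0 * z 1 + z 1) = H 1 := by rw [e, e0, e1]; field_simp
      rw [this, hH]; field_simp; ring
    rw [hE] at hB ⊢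
    refine relGen_hex (stable_bot ρ) (by rw [e0, e1, e2]; field_simp) hB (fun σ => ?_) c
      (fix_bot _) (fun i => ?_)
    · obtain ⟨π, h⟩ := hg σ
      have hπ := div_perm_three H π
      refine ⟨π, ?_⟩
      simp only [hz]
      obtain h | ⟨s, h⟩ := h
      · have h' : ∀ i, ρ σ (H (i + 1) / H (i + 2)) = H (π (i + 1)) / H (π (i + 2)) := fun i => by
          simp only [hH, map_div₀, map_sub, map_mul, map_one, map_ofNat, h]
        simpa only [h'] using hπ
      · have key : ∀ i, ρ σ (H i) = s * (H 0 * H 1 * H 2) / H (π i) := by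
          have hs1 : ∑ i, s * (g (π i) * (1 - 2 * g (π i))) = 1 := by
            simp only [← h]
            rw [← map_sum, hsum, map_one]
          rw [Equiv.sum_comp π (fun i => s * (g i * (1 - 2 * g i)))] at hs1
          intro i
          have hP : H 0 * H 1 * H 2 = H (π i) * H (π i + 1) * H (π i + 2) := by
            generalize π i = j
            fin_cases j
            · rfl
            · change _ = H 1 * H 2 * H 0; ring
            · change _ = H 2 * H 0 * H 1; ring
          rw [eq_div_iff (hH0 _), hP, hH i, map_sub, map_mul, map_one, h, map_ofNat]
          generalize π i = j at *
          have ej := hsum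
          rw [sum_fin_three_eq _ j] at hs1 ej
          rw [hH, hH, hH]
          have ej' : g (j + 2) = 1 - g j - g (j + 1) := by linear_combination ej
          rw [ej'] at hs1 ⊢
          linear_combination -(1 - 2 * g j) * hs1
        have hs : s ≠ 0 := by
          rintro rfl
          have := key 0
          simp only [zero_mul, zero_div, map_eq_zero] at this
          exact y0 this
        have h' : ∀ i, ρ σ (H (i + 1) / H (i + 2)) = 1 / (H (π (i + 1)) / H (π (i + 2))) := fun i => by
          have := hH0 (π (i + 1))
          have := hH0 (π (i + 2))
          rw [map_div₀, key, key]
          field_simp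
        simp only [h']
        refine hπ.symm.imp (fun hπ i => ?_) fun hπ i => ?_
        · rw [hπ, one_div_one_div]
        · rw [hπ]
    · rw [hz, hz, map_div₀]
      simp only [hH, map_sub, map_mul, map_one, map_ofNat, hc]
      obtain ⟨f1, f2, f3⟩ := fin_three_add i
      rw [f1, f2, f3]

theorem exists_perm_klein : ∀ j, ∃ π : Equiv.Perm (Fin 4), ∀ i, π i = klein j i := by
  decide

theorem exists_perm_pairing_succ : ∃ π : Equiv.Perm (Fin 4), π 0 = 2 ∧ π 1 = 0 ∧ π 2 = 1 ∧
    π 3 = 3 ∧ ∀ i : Fin 3, SamePairing (fun j => π (pairing i j)) (pairing (i + 1)) := by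
  decide

set_option maxHeartbeats 4000000 in
/-- Ratios of four variables, permuted up to a simultaneous inversion by a group containing the
alternating group. -/
theorem RelGen.of_ratios [Finite G] {t : Fin 4 → Ω} (h3 : t 3 = 1)
    (hB : Big 3 ⊥ (⊥ ⊔ k⟮t 0⟯ ⊔ k⟮t 1⟯ ⊔ k⟮t 2⟯)) (hg : ∀ σ, ∃ π : Equiv.Perm (Fin 4),
      (∀ i, ρ σ (t i) = t (π i) / t (π 3)) ∨ ∀ i, ρ σ (t i) = t (π 3) / t (π i))
    (hV : ∀ m, ∃ σ, ∀ i, ρ σ (t i) = t (klein m i) / t (klein m 3)) (c : G) (h0 : ρ c (t 0) = t 1)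
    (h1 : ρ c (t 1) = t 2) (h2 : ρ c (t 2) = t 0) :
    RelGen ρ 3 ⊥ (⊥ ⊔ k⟮t 0⟯ ⊔ k⟮t 1⟯ ⊔ k⟮t 2⟯) := by
  obtain ⟨n0, n1, n2⟩ := hB.three (le_acl _)
  have z0 : t 0 ≠ 0 := ne_of_not_mem n0 fmem
  have z1 : t 1 ≠ 0 := ne_of_not_mem n1 fmem
  have z2 : t 2 ≠ 0 := ne_of_not_mem n2 fmem
  have hz : ∀ i, t i ≠ 0 := by
    intro i; fin_cases i
    · exact z0
    · exact z1
    · exact z2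
    · change t 3 ≠ 0; rw [h3]; exact one_ne_zero
  obtain ⟨hN, hD, hL⟩ := chord_affine_ne_zero h3 n0 n1 n2
  have hM : ∑ i, chordF t i ≠ 0 := by
    have hE : ⊥ ⊔ k⟮t 0⟯ ⊔ k⟮t 1⟯ ⊔ k⟮t 2⟯ ≤
        ⊥ ⊔ k⟮1 / t 0⟯ ⊔ k⟮1 / t 1⟯ ⊔ k⟮1 / t 2⟯ := by
      simp only [sup_simple_le]
      refine ⟨⟨⟨bot_le, ?_⟩, ?_⟩, ?_⟩
      · exact mem_of_eq (1 / (1 / t 0)) (by rw [one_div_one_div])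
          (div_mem (one_mem _) (mem_left (mem_left (mem_right _ _))))
      · exact mem_of_eq (1 / (1 / t 1)) (by rw [one_div_one_div])
          (div_mem (one_mem _) (mem_left (mem_right _ _)))
      · exact mem_of_eq (1 / (1 / t 2)) (by rw [one_div_one_div])
          (div_mem (one_mem _) (mem_right _ _))
    obtain ⟨m0, m1, m2⟩ := hB.three (hE.trans (le_acl _))
    have := (chord_affine_ne_zero (t := fun i => 1 / t i) (by simp [h3]) m0 m1 m2).2.2
    simp only [(quad_inv hz one_ne_zero _).1, div_one] at this
    rwa [Fin.sum_univ_three]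
  rw [← Fin.sum_univ_three] at hL
  obtain ⟨l, hl⟩ : ∃ l, l = ∑ i, chordG t i := ⟨_, rfl⟩
  obtain ⟨m, hm⟩ : ∃ m, m = ∑ i, chordF t i := ⟨_, rfl⟩
  rw [← hl] at hL
  rw [← hm] at hM
  obtain ⟨w, hw⟩ : ∃ w : Fin 4 → Ω, ∀ i, w i = l * t i := ⟨_, fun i => rfl⟩
  have hw' : w = fun i => l * t i := funext hw
  have hw0 : ∀ i, w i ≠ 0 := fun i => by rw [hw]; exact mul_ne_zero hL (hz i)
  have htw : ∀ i, t i = w i / w 3 := fun i => by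
    rw [hw, hw, h3]; field_simp
  obtain ⟨S, hS⟩ : ∃ S, S = l * m := ⟨_, rfl⟩
  have hS0 : S ≠ 0 := hS ▸ mul_ne_zero hL hM
  have hGs : ∑ i, chordG w i = 1 := by
    simp only [hw', (quad_mul t hL _).2.2.1]
    rw [← Finset.sum_div, ← hl, div_self hL]
  have hFs : ∑ i, chordF w i = S := by
    simp only [hw', (quad_mul t hL _).2.2.2]
    rw [← Finset.mul_sum, ← hm, hS]
  have hNw : ∀ i, quadN w i ≠ 0 := fun i => by
    rw [hw', (quad_mul t hL _).1]; exact mul_ne_zero (pow_ne_zero _ hL) (hN i)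
  have hDw : ∀ i, quadD w i ≠ 0 := fun i => by
    rw [hw', (quad_mul t hL _).2.1]; exact mul_ne_zero hL (hD i)
  have hinj : Function.Injective w := by
    have h01 : t 0 ≠ t 1 := (ne_of_not_mem n1 fmem).symm
    have h02 : t 0 ≠ t 2 := (ne_of_not_mem n2 fmem).symm
    have h12 : t 1 ≠ t 2 := (ne_of_not_mem n2 fmem).symm
    have h03 : t 0 ≠ t 3 := by rw [h3]; exact ne_of_not_mem n0 fmem
    have h13 : t 1 ≠ t 3 := by rw [h3]; exact ne_of_not_mem n1 fmem
    have h23 : t 2 ≠ t 3 := by rw [h3]; exact ne_of_not_mem n2 fmem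
    intro i j hij
    have : t i = t j := by rw [htw, htw, hij]
    clear hij
    fin_cases i <;> fin_cases j <;>
      first | rfl | exact absurd this ‹_› | exact absurd this.symm ‹_›
  obtain ⟨hG, f0, f1, f2, -, -, -⟩ := chord_identities hNw hDw
  -- the two kinds of elements
  have hperm : ∀ (f : Ω ≃ₐ[k] Ω) (π : Equiv.Perm (Fin 4)),
      (∀ i, f (t i) = t (π i) / t (π 3)) → ∀ i, f (w i) = w (π i) := fun f π h i => by
    have hp := hz (π 3)
    have e : f l = l / (1 / t (π 3)) := by
      rw [hl, map_sum]
      simp only [map_chordG, h]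
      rw [← (chord_sum_perm π t).1, Finset.sum_div]
      refine Finset.sum_congr rfl fun j _ => ?_
      rw [← (quad_mul _ (one_div_ne_zero hp) j).2.2.1]
      congr 1
      funext j; field_simp
    rw [hw, hw, map_mul, e, h]
    field_simp
  have hinv : ∀ (f : Ω ≃ₐ[k] Ω) (π : Equiv.Perm (Fin 4)),
      (∀ i, f (t i) = t (π 3) / t (π i)) → ∀ i, f (w i) = S / w (π i) := fun f π h i => by
    have hp := hz (π 3)
    have hp' := hz (π i)
    have e : f l = m / t (π 3) := by
      rw [hl, map_sum]
      simp only [map_chordG, h]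
      rw [hm, ← (chord_sum_perm π t).2, Finset.sum_div]
      exact Finset.sum_congr rfl fun j _ => (quad_inv (fun i => hz (π i)) hp j).1
    rw [hw, hw, map_mul, e, h, hS]
    field_simp
  obtain ⟨g, hgd⟩ : ∃ g : Fin 3 → Ω, ∀ i, g i = chordG w i := ⟨_, fun i => rfl⟩
  obtain ⟨e, he⟩ : ∃ e, e = w 0 * w 1 * w 2 * w 3 / S ^ 2 := ⟨_, rfl⟩
  obtain ⟨K, hK⟩ : ∃ K, K = ⊥ ⊔ k⟮g 0⟯ ⊔ k⟮g 1⟯ := ⟨_, rfl⟩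
  have hgs : ∑ i, g i = 1 := by simpa only [hgd] using hGs
  have hg2 : g 2 = 1 - g 0 - g 1 := by rw [Fin.sum_univ_three] at hgs; linear_combination hgs
  have hgK : ∀ i, g i ∈ K := by
    intro i
    rw [hK]; fin_cases i
    · exact mem_left (mem_right _ _)
    · exact mem_right _ _
    · exact mem_of_eq _ hg2
  have hSK : S ∈ K := by
    have g0 := hgK 0
    have g1 := hgK 1
    have g2 := hgK 2
    rw [← hgd, ← hgd, ← hgd] at f0 f1 f2
    rw [← hFs, Fin.sum_univ_three, f0, f1, f2]
    exact fmem
  have hpK : w 0 * w 1 * w 2 * w 3 ∈ K ⊔ k⟮e⟯ := by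
    have : S ∈ K ⊔ k⟮e⟯ := mem_left hSK
    exact mem_of_eq (e * S ^ 2) (by rw [he]; field_simp)
  have hwL : ∀ i, w i ∈ ⊥ ⊔ k⟮t 0⟯ ⊔ k⟮t 1⟯ ⊔ k⟮t 2⟯ := by
    have q0 : t 0 ∈ ⊥ ⊔ k⟮t 0⟯ ⊔ k⟮t 1⟯ ⊔ k⟮t 2⟯ :=
      mem_left (mem_left (mem_right _ _))
    have ht : ∀ i, t i ∈ ⊥ ⊔ k⟮t 0⟯ ⊔ k⟮t 1⟯ ⊔ k⟮t 2⟯ := by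
      intro i; fin_cases i
      · exact q0
      · exact mem_left (mem_right _ _)
      · exact mem_right _ _
      · change t 3 ∈ _; rw [h3]; exact one_mem _
    intro i
    rw [hw, hl]
    refine mul_mem (sum_mem fun j _ => ?_) (ht i)
    rw [chordG, quadN, quadD]
    exact div_mem (sub_mem (sub_mem (add_mem (ht _) (ht _)) (ht _)) (ht _))
      (sub_mem (mul_mem (ht _) (ht _)) (mul_mem (ht _) (ht _)))
  have hgL : ∀ i, g i ∈ ⊥ ⊔ k⟮t 0⟯ ⊔ k⟮t 1⟯ ⊔ k⟮t 2⟯ := fun i => by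
    rw [hgd, chordG, quadN, quadD]
    exact div_mem (sub_mem (sub_mem (add_mem (hwL _) (hwL _)) (hwL _)) (hwL _))
      (sub_mem (mul_mem (hwL _) (hwL _)) (mul_mem (hwL _) (hwL _)))
  have hKL : K ≤ ⊥ ⊔ k⟮t 0⟯ ⊔ k⟮t 1⟯ ⊔ k⟮t 2⟯ := by
    rw [hK]
    simp only [sup_simple_le]
    exact ⟨⟨bot_le, hgL 0⟩, hgL 1⟩
  have hEL : K ⊔ k⟮e⟯ ≤ ⊥ ⊔ k⟮t 0⟯ ⊔ k⟮t 1⟯ ⊔ k⟮t 2⟯ := by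
    refine sup_simple_le.2 ⟨hKL, ?_⟩
    rw [he]
    exact div_mem (mul_mem (mul_mem (mul_mem (hwL 0) (hwL 1)) (hwL 2)) (hwL 3))
      (pow_mem (hKL hSK) 2)
  have hgperm : ∀ (f : Ω ≃ₐ[k] Ω) (π : Fin 4 → Fin 4) (i i' : Fin 3),
      SamePairing (fun j => π (pairing i j)) (pairing i') →
      (∀ i, f (w i) = w (π i)) → f (g i) = g i' := fun f π i i' h h' => by
    rw [hgd, hgd, map_chordG]
    simp only [h']
    rw [(chord_of_samePairing h w).1]
  have hSperm : ∀ f : Ω ≃ₐ[k] Ω, (∀ i, f (g i) = g i) → f S = S := fun f h => by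
    refine fix_sup_simple (fix_sup_simple (fix_bot f) (h 0)) (h 1) S ?_
    rw [← hK]; exact hSK
  obtain ⟨hfix, hacl⟩ := fixIn_eq_of_klein (ρ := ρ) hinj hNw hDw hEL
    (by
      have q : ∀ i, w i ∈ K ⊔ k⟮e⟯ ⊔ k⟮w 0⟯ ⊔ k⟮w 1⟯ ⊔ k⟮w 2⟯ ⊔ k⟮w 3⟯ := by
        intro i; fin_cases i
        · exact mem_left (mem_left (mem_left (mem_right _ _)))
        · exact mem_left (mem_left (mem_right _ _))
        · exact mem_left (mem_right _ _)
        · exact mem_right _ _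
      have q' : ∀ i, t i ∈ K ⊔ k⟮e⟯ ⊔ k⟮w 0⟯ ⊔ k⟮w 1⟯ ⊔ k⟮w 2⟯ ⊔ k⟮w 3⟯ := fun i =>
        mem_of_eq _ (htw i) (div_mem (q _) (q _))
      simp only [sup_simple_le]
      exact ⟨⟨⟨bot_le, q' 0⟩, q' 1⟩, q' 2⟩)
    (fun i => mem_left (hgd i ▸ hgK i)) hpK fun j => by
      obtain ⟨σ, hσ⟩ := hV j
      obtain ⟨π, hπ⟩ := exists_perm_klein j
      simp only [← hπ] at hσ
      have hσw := hperm _ _ hσ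
      simp only [hπ] at hσw
      have hσg : ∀ i, ρ σ (g i) = g i := fun i =>
        hgperm _ _ i i (klein_pairing j i) hσw
      refine ⟨σ, by rw [hσw, klein_zero], ?_⟩
      refine fix_sup_simple ?_ ?_
      · rw [hK]
        exact fix_sup_simple (fix_sup_simple (fix_bot _) (hσg 0)) (hσg 1)
      · rw [he, map_div₀, map_pow, hSperm _ hσg]
        simp only [map_mul, hσw]
        rw [prod_klein]
  unfold RelGen
  rw [hfix]
  have hB' := hB.acl_right hacl
  rw [hK] at hB'
  have hprod : ∀ (v : Fin 4 → Ω) (π : Equiv.Perm (Fin 4)),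
      v (π 0) * v (π 1) * v (π 2) * v (π 3) = v 0 * v 1 * v 2 * v 3 := fun v π => by
    rw [← Fin.prod_univ_four, ← Fin.prod_univ_four (fun i => v (π i)), Equiv.prod_comp]
  have hact : ∀ σ, ∃ π : Equiv.Perm (Fin 3), ((∀ i, ρ σ (g i) = g (π i)) ∧ ρ σ e = e) ∨
      ((∀ i, ρ σ (g i) = chordF w (π i) / S) ∧ ρ σ e = 1 / e) := by
    intro σ
    obtain ⟨π, h⟩ := hg σ
    obtain ⟨π', hπ⟩ := exists_perm_pairing π
    refine ⟨π', h.imp (fun h => ?_) fun h => ?_⟩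
    · have hσw := hperm _ _ h
      refine ⟨fun i => hgperm _ _ i _ (hπ i) hσw, ?_⟩
      have : ρ σ S = S := by
        rw [← hFs, map_sum]
        simp only [map_chordF, hσw]
        rw [(chord_sum_perm π w).2]
      rw [he, map_div₀, map_pow, this]
      simp only [map_mul, hσw]
      rw [hprod]
    · have hσw := hinv _ _ h
      have hw1 : ∀ i, w (π i) ≠ 0 := fun i => hw0 _
      refine ⟨fun i => ?_, ?_⟩
      · rw [hgd, map_chordG]
        simp only [hσw]
        rw [(quad_inv hw1 hS0 i).1, (chord_of_samePairing (hπ i) w).2]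
      · have : ρ σ S = S := by
          rw [← hFs, map_sum]
          simp only [map_chordF, hσw, (quad_inv hw1 hS0 _).2]
          rw [← Finset.mul_sum, (chord_sum_perm π w).1, hGs, mul_one, hFs]
        have := hw0 0
        have := hw0 1
        have := hw0 2
        have := hw0 3
        have := hw1 0
        have := hw1 1
        have := hw1 2
        have := hw1 3
        rw [he, map_div₀, map_pow, ‹ρ σ S = S›]
        simp only [map_mul, hσw]
        have hp := hprod w π
        field_simp
        rw [hp]
  have hFK : ∀ i, chordF w i ∈ K := by
    have g0 := hgK 0
    have g1 := hgK 1
    have g2 := hgK 2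
    rw [← hgd, ← hgd, ← hgd] at f0 f1 f2
    intro i; fin_cases i
    · exact mem_of_eq _ f0
    · exact mem_of_eq _ f1
    · exact mem_of_eq _ f2
  have hst : Stable ρ K := by
    rw [hK]
    refine (stable_bot ρ).sup_two (fun σ => ?_) fun σ => ?_
    all_goals
      rw [← hK]
      obtain ⟨π, ⟨h, -⟩ | ⟨h, -⟩⟩ := hact σ
      · rw [h]; exact hgK _
      · rw [h]; exact div_mem (hFK _) hSK
  obtain ⟨-, -, ne⟩ := hB'.three (le_acl _)
  rw [← hK] at ne
  refine RelGen.trans (m := 2) (n := 1) ?_ (RelGen.inv hst ne fun σ => ?_)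
  · rw [hK]
    refine RelGen.of_cremona hgs ?_ (fun σ => ?_) (c * c) fun i => ?_
    · exact Big.of_genBy_right (m := 2) (n := 1) hB' (GenBy.one _ _)
    · obtain ⟨π, ⟨h, -⟩ | ⟨h, -⟩⟩ := hact σ
      · exact ⟨π, Or.inl h⟩
      · refine ⟨π, Or.inr ⟨1 / (g 0 * g 1 * g 2 * S), fun i => ?_⟩⟩
        rw [h]
        generalize π i = j
        have q0 := hG 0
        have q1 := hG 1
        have q2 := hG 2
        rw [← hgd] at q0 q1 q2
        rw [← hgd, ← hgd, ← hgd] at f0 f1 f2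
        fin_cases j
        · change chordF w 0 / S = 1 / (g 0 * g 1 * g 2 * S) * (g 0 * (1 - 2 * g 0))
          rw [f0]; field_simp; linear_combination hg2
        · change chordF w 1 / S = 1 / (g 0 * g 1 * g 2 * S) * (g 1 * (1 - 2 * g 1))
          rw [f1]; field_simp; linear_combination hg2
        · change chordF w 2 / S = 1 / (g 0 * g 1 * g 2 * S) * (g 2 * (1 - 2 * g 2))
          rw [f2]; field_simp; linear_combination hg2
    · obtain ⟨π, p0, p1, p2, p3, hπ⟩ := exists_perm_pairing_succ
      refine hgperm _ _ i _ (hπ i) (hperm _ _ fun j => ?_)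
      rw [p3, h3, div_one]
      fin_cases j
      · change ρ (c * c) (t 0) = t (π 0); rw [p0, map_mul, AlgEquiv.mul_apply, h0, h1]
      · change ρ (c * c) (t 1) = t (π 1); rw [p1, map_mul, AlgEquiv.mul_apply, h1, h2]
      · change ρ (c * c) (t 2) = t (π 2); rw [p2, map_mul, AlgEquiv.mul_apply, h2, h0]
      · change ρ (c * c) (t 3) = t (π 3); rw [p3, h3, map_one]
  · obtain ⟨π, ⟨-, h⟩ | ⟨-, h⟩⟩ := hact σ
    · exact Or.inl h
    · exact Or.inr h

/-- An action on the body-centred lattice generated by `y`, `z` and `w = (x + y + z) / 2`,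
preserving the `x`-axis: `sw` tells whether the `y`- and `z`-axes are exchanged, and `ep` whether
`x` is fixed. -/
def TetAct (f : Ω ≃ₐ[k] Ω) (y z w : Ω) (sw ep : Bool) : Prop :=
  ∃ a b : ℤ, (a = 0 ∨ a = 1) ∧ (b = 0 ∨ b = 1) ∧
    (if sw then f y = z ^ (1 - 2 * b) ∧ f z = y ^ (1 - 2 * a)
      else f y = y ^ (1 - 2 * a) ∧ f z = z ^ (1 - 2 * b)) ∧
    (if ep then f w = w * y ^ (-a) * z ^ (-b) else f w = y ^ (1 - a) * z ^ (1 - b) / w)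

theorem TetAct.normalized {f : Ω ≃ₐ[k] Ω} {y z w : Ω} {sw ep : Bool} (h : TetAct f y z w sw ep)
    (hy : y ≠ 0) (hz : z ≠ 0) (hy1 : 1 + y ≠ 0) (hz1 : 1 + z ≠ 0) :
    InvPerm f y z ∧
    (f (w / ((1 + y) * (1 + z))) = if ep then w / ((1 + y) * (1 + z))
      else y * z / ((1 + y) * (1 + z)) ^ 2 / (w / ((1 + y) * (1 + z)))) ∧
    (f (y / (1 + y) ^ 2) = if sw then y * z / ((1 + y) * (1 + z)) ^ 2 / (y / (1 + y) ^ 2)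
      else y / (1 + y) ^ 2) := by
  have hy2 : y + 1 ≠ 0 := add_comm 1 y ▸ hy1
  have hz2 : z + 1 ≠ 0 := add_comm 1 z ▸ hz1
  have hyi : 1 + 1 / y = (1 + y) / y := by field_simp; ring
  have hzi : 1 + 1 / z = (1 + z) / z := by field_simp; ring
  obtain ⟨a, b, ha, hb, h1, h2⟩ := h
  rcases ha with rfl | rfl <;> rcases hb with rfl | rfl <;> cases sw <;> cases ep <;>
    simp only [Bool.false_eq_true, if_false, if_true, mul_zero, sub_zero, mul_one, zpow_one,
      zpow_zero, neg_zero, (by norm_num : (1 : ℤ) - 2 = -1), zpow_neg, sub_self, inv_eq_one_div]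
      at h1 h2 <;> obtain ⟨h1, h3⟩ := h1 <;>
    refine ⟨by simp only [InvPerm, h1, h3, true_or, or_true, and_self], ?_, ?_⟩ <;>
    simp only [map_div₀, map_mul, map_add, map_one, map_pow, h1, h2, h3, hyi, hzi,
      Bool.false_eq_true, if_false, if_true] <;>
    field_simp

set_option maxHeartbeats 1000000 in
theorem RelGen.of_tetAct [Finite G] {y z w : Ω} (hB : Big 3 ⊥ (⊥ ⊔ k⟮y⟯ ⊔ k⟮z⟯ ⊔ k⟮w⟯))
    (hg : ∀ g, ∃ sw ep, TetAct (ρ g) y z w sw ep)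
    (hd : (∃ r, TetAct (ρ r) y z w false false ∧ ρ r y = y ∧ ρ r z = z) ∨
      (∀ g, ∃ sw, TetAct (ρ g) y z w sw true) ∨
      ∀ g, ∃ ep, TetAct (ρ g) y z w (!ep) ep) : RelGen ρ 3 ⊥ (⊥ ⊔ k⟮y⟯ ⊔ k⟮z⟯ ⊔ k⟮w⟯) := by
  obtain ⟨n0, n1, n2⟩ := hB.three (le_acl _)
  have hy : y ≠ 0 := ne_of_not_mem n0 fmem
  have hz : z ≠ 0 := ne_of_not_mem n1 fmem
  have hw : w ≠ 0 := ne_of_not_mem n2 fmem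
  have hy1 := one_add_ne_zero_of_not_mem n0
  have hz1 := one_add_ne_zero_of_not_mem n1
  obtain ⟨K, hK⟩ : ∃ K, K = ⊥ ⊔ k⟮y⟯ ⊔ k⟮z⟯ := ⟨_, rfl⟩
  have hyK : y ∈ K := by rw [hK]; exact fmem
  have hzK : z ∈ K := by rw [hK]; exact fmem
  obtain ⟨v, hv⟩ : ∃ v, v = w / ((1 + y) * (1 + z)) := ⟨_, rfl⟩
  obtain ⟨A, hA⟩ : ∃ A, A = y * z / ((1 + y) * (1 + z)) ^ 2 := ⟨_, rfl⟩
  obtain ⟨e, he⟩ : ∃ e, e = y / (1 + y) ^ 2 := ⟨_, rfl⟩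
  have hAK : A ∈ K := mem_of_eq _ hA
  have heK : e ∈ K := mem_of_eq _ he
  have he0 : e ≠ 0 := by rw [he]; positivity
  have hA0 : A ≠ 0 := by rw [hA]; positivity
  have hv0 : v ≠ 0 := by rw [hv]; positivity
  have hact : ∀ {f : Ω ≃ₐ[k] Ω} {sw ep}, TetAct f y z w sw ep → InvPerm f y z ∧
      (f v = if ep then v else A / v) ∧ f e = if sw then A / e else e := fun h => by
    rw [hv, hA, he]; exact h.normalized hy hz hy1 hz1
  have hinv : ∀ g, InvPerm (ρ g) y z := fun g => by
    obtain ⟨sw, ep, h⟩ := hg g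
    exact (hact h).1
  have hst : Stable ρ K := by rw [hK]; exact (stable_bot ρ).invPerm hinv
  have hLv : ⊥ ⊔ k⟮y⟯ ⊔ k⟮z⟯ ⊔ k⟮w⟯ = K ⊔ k⟮v⟯ := by
    rw [← hK]
    exact sup_simple_eq (mem_of_eq (v * ((1 + y) * (1 + z))) (by rw [hv]; field_simp))
      (mem_of_eq _ hv)
  have hKr : RelGen ρ 2 ⊥ K := by
    rw [hK]
    exact RelGen.of_invPerm (Big.of_genBy_right (m := 2) (n := 1) hB (GenBy.one _ _)) hinv
  have hvK : v ∉ acl K := by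
    rw [← hK] at n2
    exact not_mem_acl_of_sup n2 (mem_of_eq (v * ((1 + y) * (1 + z))) (by rw [hv]; field_simp))
  rw [hLv]
  obtain ⟨r, hr, hry, hrz⟩ | hd | hd := hd
  · have hrv : ρ r v = A / v := by simpa using (hact hr).2.1
    obtain ⟨u, hu⟩ : ∃ u, u = v + A / v := ⟨_, rfl⟩
    have hvu : v ^ 2 = u * v + -A := by rw [hu]; field_simp; ring
    have huK : u ∉ acl K := fun h => hvK
      (acl_le le_rfl (mem_acl_quadratic (a := -u) (b := A) (neg_mem h) (le_acl _ hAK)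
        (by linear_combination hvu)))
    have hrK : ∀ y ∈ K, ρ r y = y := by
      rw [hK]; exact fix_sup_simple (fix_sup_simple (fix_bot _) hry) hrz
    have hrA := hrK A hAK
    have hfix : FixIn ρ (K ⊔ k⟮v⟯) = FixIn ρ (K ⊔ k⟮u⟯) := by
      refine fixIn_eq_of_conj_two (sup_simple_le.2 ⟨le_sup_left, mem_of_eq _ hu⟩)
        (sup_simple_le.2 ⟨le_sup_left.trans le_sup_left, mem_right _ _⟩) u (-A) (mem_right _ _)
        (mem_left (neg_mem hAK)) hvu r
        (fix_sup_simple hrK (by rw [hu, map_add, map_div₀, hrv, hrA]; field_simp; ring)) ?_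
      rw [hrv]
      intro h
      refine hvK (mem_acl_quadratic (a := 0) (b := -A) (zero_mem _) (neg_mem hAK) ?_)
      field_simp at h
      linear_combination -h
    unfold RelGen
    rw [hfix]
    refine RelGen.trans (m := 2) (n := 1) hKr (RelGen.affine hst huK fun g => ?_)
    refine ⟨1, one_mem _, 0, zero_mem _, ?_⟩
    obtain ⟨sw, ep, h⟩ := hg g
    have hAf : ρ g A = A := by
      obtain ⟨⟨h1 | h1, h2 | h2⟩ | ⟨h1 | h1, h2 | h2⟩, -⟩ := hact h <;>
        rw [hA] <;> simp only [map_div₀, map_mul, map_add, map_one, map_pow, h1, h2]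
      all_goals
        have hy2 : y + 1 ≠ 0 := add_comm 1 y ▸ hy1
        have hz2 : z + 1 ≠ 0 := add_comm 1 z ▸ hz1
        have hyi : 1 + 1 / y = (1 + y) / y := by field_simp; ring
        have hzi : 1 + 1 / z = (1 + z) / z := by field_simp; ring
        try simp only [hyi, hzi]
        field_simp
    have h2 := (hact h).2.1
    rw [hu, map_add, map_div₀, hAf, h2]
    cases ep
    · simp only [Bool.false_eq_true, if_false]; field_simp; ring
    · simp
  · refine RelGen.trans (m := 2) (n := 1) hKr (RelGen.affine hst hvK fun g => ?_)
    obtain ⟨sw, h⟩ := hd g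
    exact ⟨1, one_mem _, 0, zero_mem _, by rw [(hact h).2.1]; simp⟩
  · obtain ⟨f, hf⟩ := fixIn_sup_of_norm hst hvK heK he0 hA0 fun g => by
      obtain ⟨ep, h⟩ := hd g
      obtain ⟨-, h1, h2⟩ := hact h
      cases ep
      · exact Or.inr ⟨by simpa using h1, by simpa using h2⟩
      · exact Or.inl ⟨by simpa using h1, by simpa using h2⟩
    exact RelGen.trans (m := 2) (n := 1) hKr (GenBy.of_eq hf)

end

section

variable {k Ω : Type*} [Field k] [Field Ω] [Algebra k Ω] {G : Type*} [Group G]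
  {M : Type*} [AddCommGroup M]

/-- `mon` embeds a lattice as a group of monomials, equivariantly for `r` and `ρ`. -/
structure MonAct (ρ : G →* (Ω ≃ₐ[k] Ω)) (r : Representation ℤ G M) (mon : M → Ω) : Prop where
  map_add : ∀ v w, mon (v + w) = mon v * mon w
  ne_zero : ∀ v, mon v ≠ 0
  equivariant : ∀ g v, ρ g (mon v) = mon (r g v)

namespace MonAct

variable {ρ : G →* (Ω ≃ₐ[k] Ω)} {r : Representation ℤ G M} {mon : M → Ω}

theorem map_zero (h : MonAct ρ r mon) : mon 0 = 1 := by
  have := h.map_add 0 0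
  rw [add_zero] at this
  exact (mul_eq_left₀ (h.ne_zero 0)).1 this.symm

theorem map_neg (h : MonAct ρ r mon) (v : M) : mon (-v) = 1 / mon v := by
  rw [eq_div_iff (h.ne_zero v), ← h.map_add, neg_add_cancel, h.map_zero]

theorem map_sub (h : MonAct ρ r mon) (v w : M) : mon (v - w) = mon v / mon w := by
  rw [sub_eq_add_neg, h.map_add, h.map_neg, mul_one_div]

theorem map_zsmul (h : MonAct ρ r mon) (n : ℤ) (v : M) : mon (n • v) = mon v ^ n := by
  induction n using Int.induction_on with
  | zero => simp [h.map_zero]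
  | succ n ih => rw [add_smul, one_smul, h.map_add, ih, zpow_add_one₀ (h.ne_zero v)]
  | pred n ih => rw [sub_smul, one_smul, h.map_sub, ih, zpow_sub_one₀ (h.ne_zero v), div_eq_mul_inv]

theorem map_units_smul (h : MonAct ρ r mon) (e : ℤˣ) (v : M) :
    mon ((e : ℤ) • v) = mon v ^ (e : ℤ) :=
  h.map_zsmul _ _

end MonAct

variable (k) in
/-- The field generated by the monomials with exponent in `Λ`. -/
def monField (mon : M → Ω) (Λ : Submodule ℤ M) : IntermediateField k Ω :=
  adjoin k (mon '' (Λ : Set M))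

theorem monField_le {mon : M → Ω} {Λ : Submodule ℤ M} {K : IntermediateField k Ω} :
    monField k mon Λ ≤ K ↔ ∀ v ∈ Λ, mon v ∈ K := by
  rw [monField, adjoin_le_iff]
  exact ⟨fun h v hv => h ⟨v, hv, rfl⟩, fun h => by rintro _ ⟨v, hv, rfl⟩; exact h v hv⟩

theorem mon_mem_monField (mon : M → Ω) {Λ : Submodule ℤ M} {v : M} (hv : v ∈ Λ) :
    mon v ∈ monField k mon Λ :=
  monField_le.1 le_rfl v hv

variable {ρ : G →* (Ω ≃ₐ[k] Ω)} {r : Representation ℤ G M} {mon : M → Ω}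

theorem MonAct.monField_sup (h : MonAct ρ r mon) (Λ Λ' : Submodule ℤ M) :
    monField k mon (Λ ⊔ Λ') = monField k mon Λ ⊔ monField k mon Λ' := by
  refine le_antisymm (monField_le.2 fun v hv => ?_) (sup_le ?_ ?_)
  · obtain ⟨x, hx, y, hy, rfl⟩ := Submodule.mem_sup.1 hv
    rw [h.map_add]
    exact mul_mem ((le_sup_left : monField k mon Λ ≤ _) (mon_mem_monField mon hx))
      ((le_sup_right : monField k mon Λ' ≤ _) (mon_mem_monField mon hy))
  · exact monField_le.2 fun v hv => mon_mem_monField mon (Submodule.mem_sup_left hv)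
  · exact monField_le.2 fun v hv => mon_mem_monField mon (Submodule.mem_sup_right hv)

theorem MonAct.monField_singleton (h : MonAct ρ r mon) (v : M) :
    monField k mon (span ℤ {v}) = k⟮mon v⟯ := by
  refine le_antisymm (monField_le.2 fun w hw => ?_) ?_
  · obtain ⟨n, rfl⟩ := Submodule.mem_span_singleton.1 hw
    rw [h.map_zsmul]
    exact zpow_mem (mem_adjoin_simple_self k _) n
  · rw [adjoin_simple_le_iff]
    exact mon_mem_monField mon (Submodule.mem_span_singleton_self v)

theorem MonAct.monField_pair (h : MonAct ρ r mon) (v w : M) :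
    monField k mon (span ℤ {v, w}) = ⊥ ⊔ k⟮mon v⟯ ⊔ k⟮mon w⟯ := by
  rw [Submodule.span_insert, h.monField_sup, h.monField_singleton, h.monField_singleton, bot_sup_eq]

theorem MonAct.monField_triple (h : MonAct ρ r mon) (u v w : M) :
    monField k mon (span ℤ {u, v, w}) = ⊥ ⊔ k⟮mon u⟯ ⊔ k⟮mon v⟯ ⊔ k⟮mon w⟯ := by
  rw [Submodule.span_insert, h.monField_sup, h.monField_singleton, h.monField_pair, bot_sup_eq,
    bot_sup_eq, sup_assoc]

theorem MonAct.stable (h : MonAct ρ r mon) {Λ : Submodule ℤ M} (hΛ : ∀ g, ∀ v ∈ Λ, r g v ∈ Λ) :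
    Stable ρ (monField k mon Λ) := by
  intro g
  change monField k mon Λ ≤ (monField k mon Λ).comap (ρ g).toAlgHom
  exact monField_le.2 fun v hv => by
    change ρ g (mon v) ∈ monField k mon Λ
    rw [h.equivariant]
    exact mon_mem_monField mon (hΛ g v hv)

/-- A positive definite invariant form. -/
structure InvForm (r : Representation ℤ G M) (B : M →ₗ[ℤ] M →ₗ[ℤ] ℤ) : Prop where
  symm : ∀ v w, B v w = B w v
  pos : ∀ v, v ≠ 0 → 0 < B v v
  invariant : ∀ g v w, B (r g v) (r g w) = B v w

theorem exists_invForm [Finite G] [Module.Free ℤ M] [Module.Finite ℤ M]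
    (r : Representation ℤ G M) : ∃ B, InvForm r B := by
  classical
  have := Fintype.ofFinite G
  let b := Module.Free.chooseBasis ℤ M
  let B : M →ₗ[ℤ] M →ₗ[ℤ] ℤ := ∑ g : G, ∑ i,
    (LinearMap.mul ℤ ℤ).compl₁₂ (b.coord i ∘ₗ r g) (b.coord i ∘ₗ r g)
  have hB : ∀ v w, B v w = ∑ g : G, ∑ i, b.coord i (r g v) * b.coord i (r g w) := fun v w => by
    simp [B, LinearMap.sum_apply]
  refine ⟨B, fun v w => ?_, fun v hv => ?_, fun g v w => ?_⟩
  · simp only [hB, mul_comm]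
  · rw [hB]
    refine Finset.sum_pos' (fun g _ => Finset.sum_nonneg fun i _ => mul_self_nonneg _)
      ⟨1, Finset.mem_univ _, ?_⟩
    have : ∃ i, b.coord i v ≠ 0 := by
      by_contra! h
      exact hv (b.ext_elem fun i => by simpa using h i)
    obtain ⟨i, hi⟩ := this
    refine Finset.sum_pos' (fun i _ => mul_self_nonneg _) ⟨i, Finset.mem_univ _, ?_⟩
    rw [map_one, Module.End.one_apply]
    exact mul_self_pos.2 hi
  · rw [hB, hB, ← Equiv.sum_comp (Equiv.mulRight g)
      fun x => ∑ i, b.coord i (r x v) * b.coord i (r x w)]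
    simp [map_mul, Module.End.mul_apply]

end

section

variable {G : Type*} [Group G] {M : Type*} [AddCommGroup M]

/-- `v`, `w` are linearly independent over `ℤ`. -/
def Indep (v w : M) : Prop := ∀ m n : ℤ, m • v + n • w = 0 → m = 0 ∧ n = 0

theorem Indep.symm {v w : M} (h : Indep v w) : Indep w v := fun m n e =>
  (h n m (by rw [add_comm, e])).symm

theorem Indep.add_smul {v w : M} (h : Indep v w) (e : ℤ) : Indep v (w + e • v) := fun m n q => by
  have := h (m + n * e) n (by rw [← q]; module)
  grind

theorem Indep.neg_right {v w : M} (h : Indep v w) : Indep v (-w) := fun m n q => by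
  have := h m (-n) (by rw [← q]; module)
  grind

theorem Indep.ne_zero_left {v w : M} (h : Indep v w) : v ≠ 0 := fun q => by
  have := h 1 0 (by simp [q])
  grind

theorem span_pair_le {v w x y : M} (hv : ∃ a b : ℤ, a • x + b • y = v)
    (hw : ∃ a b : ℤ, a • x + b • y = w) :
    span ℤ {v, w} ≤ span ℤ {x, y} := by
  rw [Submodule.span_le, Set.insert_subset_iff, Set.singleton_subset_iff]
  exact ⟨Submodule.mem_span_pair.2 hv, Submodule.mem_span_pair.2 hw⟩

theorem span_pair_neg_right (v w : M) :
    span ℤ {v, -w} = span ℤ {v, w} :=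
  le_antisymm (span_pair_le ⟨1, 0, by module⟩ ⟨0, -1, by module⟩)
    (span_pair_le ⟨1, 0, by module⟩ ⟨0, -1, by module⟩)

theorem span_pair_add_smul (v w : M) (e : ℤ) :
    span ℤ {v, w + e • v} = span ℤ {v, w} :=
  le_antisymm (span_pair_le ⟨1, 0, by module⟩ ⟨e, 1, by module⟩)
    (span_pair_le ⟨1, 0, by module⟩ ⟨-e, 1, by module⟩)

variable {r : Representation ℤ G M} {B : M →ₗ[ℤ] M →ₗ[ℤ] ℤ}

theorem InvForm.exists_reduced (hB : InvForm r B) {x y : M} (h : Indep x y) :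
    ∃ v w, span ℤ {v, w} = span ℤ {x, y} ∧ Indep v w ∧ B v v ≤ B w w ∧
      2 * B v w ≤ 0 ∧ -(B v v) ≤ 2 * B v w := by
  obtain ⟨P, hP⟩ : ∃ P : M → M → Prop, P = fun v w =>
    span ℤ {v, w} = span ℤ {x, y} ∧ Indep v w := ⟨_, rfl⟩
  have hsymm : ∀ v w, P v w → P w v := by
    rw [hP]
    exact fun v w h => ⟨Set.pair_comm v w ▸ h.1, h.2.symm⟩
  have hadd : ∀ v w (e : ℤ), P v w → P v (w + e • v) := by
    rw [hP]
    exact fun v w e h => ⟨(span_pair_add_smul v w e).trans h.1, h.2.add_smul e⟩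
  have hneg : ∀ v w, P v w → P v (-w) := by
    rw [hP]
    exact fun v w h => ⟨(span_pair_neg_right v w).trans h.1, h.2.neg_right⟩
  have hnn : ∀ v, 0 ≤ B v v := fun v => by
    rcases eq_or_ne v 0 with rfl | hv
    · simp
    · exact (hB.pos v hv).le
  obtain ⟨v, w, hvw, hmin⟩ : ∃ v w, P v w ∧ ∀ v' w', P v' w' → B v v + B w w ≤ B v' v' + B w' w' := by
    classical
    have hex : ∃ n : ℕ, ∃ v w, P v w ∧ B v v + B w w = n := by
      refine ⟨(B x x + B y y).toNat, x, y, ?_, ?_⟩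
      · rw [hP]; exact ⟨rfl, h⟩
      · have := hnn x; have := hnn y; omega
    obtain ⟨v, w, hvw, hn⟩ := Nat.find_spec hex
    refine ⟨v, w, hvw, fun v' w' h' => ?_⟩
    have := hnn v'
    have := hnn w'
    have := Nat.find_min' hex ⟨v', w', h', (Int.toNat_of_nonneg (by omega)).symm⟩
    omega
  have key : ∀ v w, P v w → (∀ v' w', P v' w' → B v v + B w w ≤ B v' v' + B w' w') →
      2 * B v w ≤ B v v ∧ -(B v v) ≤ 2 * B v w := fun v w h hmin => by
    have h1 := hmin _ _ (hadd v w 1 h)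
    have h2 := hmin _ _ (hadd v w (-1) h)
    simp only [map_add, map_smul, LinearMap.add_apply, LinearMap.smul_apply, smul_eq_mul,
      hB.symm w v] at h1 h2
    omega
  have key' : ∀ v w, P v w → (∀ v' w', P v' w' → B v v + B w w ≤ B v' v' + B w' w') →
      B v v ≤ B w w → ∃ v w, P v w ∧ B v v ≤ B w w ∧ 2 * B v w ≤ 0 ∧ -(B v v) ≤ 2 * B v w :=
    fun v w h hmin hle => by
      have := key v w h hmin
      rcases le_total (2 * B v w) 0 with hs | hs
      · exact ⟨v, w, h, hle, hs, this.2⟩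
      · refine ⟨v, -w, hneg v w h, ?_, ?_, ?_⟩ <;> simp only [map_neg, LinearMap.neg_apply] <;>
        omega
  have : ∃ v w, P v w ∧ B v v ≤ B w w ∧ 2 * B v w ≤ 0 ∧ -(B v v) ≤ 2 * B v w := by
    rcases le_total (B v v) (B w w) with hle | hle
    · exact key' v w hvw hmin hle
    · exact key' w v (hsymm v w hvw) (fun v' w' h' => by rw [add_comm]; exact hmin v' w' h') hle
  rw [hP] at this
  simpa only [and_assoc] using this

/-- `f` permutes `v`, `w` up to sign. -/
def SignPerm (f : M → M) (v w : M) : Prop :=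
  ((f v = v ∨ f v = -v) ∧ (f w = w ∨ f w = -w)) ∨ ((f v = w ∨ f v = -w) ∧ (f w = v ∨ f w = -v))

/-- `f` permutes the `z i` up to a common sign. -/
def HexPerm (f : M → M) (z : Fin 3 → M) : Prop :=
  ∃ (π : Equiv.Perm (Fin 3)) (e : ℤˣ), ∀ i, f (z i) = (e : ℤ) • z (π i)

theorem Indep.map_eq_smul {v w : M} (h : Indep v w) (g : G) (hw : r g⁻¹ v ∈ span ℤ {v, w})
    {m : ℤ} (hm : r g w = m • v) : m = 1 ∨ m = -1 := by
  obtain ⟨p, q, hpq⟩ := Submodule.mem_span_pair.1 hw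
  have h1 : w = m • r g⁻¹ v := by
    rw [← map_smul, ← hm, ← Module.End.mul_apply, ← map_mul, inv_mul_cancel, map_one,
      Module.End.one_apply]
  rw [← hpq] at h1
  have := h (m * p) (m * q - 1) (by
    rw [show (m * p) • v + (m * q - 1) • w = m • (p • v + q • w) - w by module, ← h1, sub_self])
  exact Int.isUnit_iff.1 (IsUnit.of_mul_eq_one q (by linarith))

theorem abs_le_one_of_sq_lt {n : ℤ} (h : n ^ 2 < 4) : n = 0 ∨ n = 1 ∨ n = -1 := by
  have h1 : n < 2 := by nlinarith
  have h2 : -2 < n := by nlinarith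
  omega

theorem lt_of_ne_zero_of_ne_zero {a t m n : ℤ} (h1 : -a < t) (h2 : t ≤ 0) (hm : m ≠ 0)
    (hn : n ≠ 0) : a < a * (m ^ 2 + n ^ 2) + t * (m * n) := by
  obtain ⟨p, hp⟩ : ∃ p, p = m * n := ⟨_, rfl⟩
  have hp0 : p ≠ 0 := hp ▸ mul_ne_zero hm hn
  have h3 : 2 * p ≤ m ^ 2 + n ^ 2 := by nlinarith [sq_nonneg (m - n)]
  have h4 : -2 * p ≤ m ^ 2 + n ^ 2 := by nlinarith [sq_nonneg (m + n)]
  rw [← hp]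
  rcases lt_or_gt_of_ne hp0 with h | h
  · nlinarith [mul_nonneg_of_nonpos_of_nonpos h2 h.le]
  · have : (1 - a) * p ≤ t * p := by nlinarith
    nlinarith

theorem cases_of_sq_le {a b m n : ℤ} (ha : 0 < a) (hab : a ≤ b)
    (h : a * (m ^ 2 - m * n) + b * n ^ 2 = b) :
    n = 0 ∨ n = 1 ∧ (m = 0 ∨ m = 1) ∨ n = -1 ∧ (m = 0 ∨ m = -1) := by
  have h1 : n ^ 2 < 4 ∨ 4 ≤ n ^ 2 := lt_or_ge _ _
  rcases h1 with h1 | h1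
  · rcases abs_le_one_of_sq_lt h1 with rfl | rfl | rfl
    · exact Or.inl rfl
    · have : a * (m * (m - 1)) = 0 := by linarith
      have := (mul_eq_zero.1 this).resolve_left ha.ne'
      rcases mul_eq_zero.1 this with h | h <;> omega
    · have : a * (m * (m + 1)) = 0 := by linarith
      have := (mul_eq_zero.1 this).resolve_left ha.ne'
      rcases mul_eq_zero.1 this with h | h <;> omega
  · have : 0 ≤ a * (2 * m - n) ^ 2 := by positivity
    nlinarith [mul_le_mul_of_nonneg_right hab (show 0 ≤ n ^ 2 - 1 by linarith)]

theorem Indep.signPerm {v w : M} (h : Indep v w) (g : G)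
    (hv : r g v = v ∨ r g v = -v ∨ r g v = w ∨ r g v = -w)
    (hw : r g w = v ∨ r g w = -v ∨ r g w = w ∨ r g w = -w) : SignPerm (r g) v w := by
  have hinj : Function.Injective (r g) := (r.apply_bijective g).1
  have h1 : r g v ≠ r g w := fun q => by
    have := h 1 (-1) (by rw [hinj q]; module)
    omega
  have h2 : r g v ≠ -r g w := fun q => by
    rw [← map_neg] at q
    have := h 1 1 (by rw [hinj q]; module)
    omega
  unfold SignPerm
  rcases hv with hv | hv | hv | hv <;> rcases hw with hw | hw | hw | hw <;>
    simp [hv, hw] at h1 h2 ⊢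

theorem InvForm.exists_signPerm_or_hexPerm (hB : InvForm r B) {x y : M} (h : Indep x y)
    (hst : ∀ g, ∀ v ∈ span ℤ {x, y}, r g v ∈ span ℤ {x, y}) :
    ∃ v w, span ℤ {v, w} = span ℤ {x, y} ∧ Indep v w ∧
      ((∀ g, SignPerm (r g) v w) ∨ ∀ g, HexPerm (r g) ![v, w, -v - w]) := by
  obtain ⟨v, w, hspan, hvw, hab, ht0, hta⟩ := hB.exists_reduced h
  rw [← hspan] at hst
  have hmem : ∀ p q : ℤ, p • v + q • w ∈ span ℤ {v, w} := fun p q =>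
    Submodule.mem_span_pair.2 ⟨p, q, rfl⟩
  have hv : v ∈ span ℤ {v, w} := Submodule.mem_span_pair.2 ⟨1, 0, by module⟩
  have hw : w ∈ span ℤ {v, w} := Submodule.mem_span_pair.2 ⟨0, 1, by module⟩
  have ha := hB.pos v hvw.ne_zero_left
  obtain ⟨a, hva⟩ : ∃ a, a = B v v := ⟨_, rfl⟩
  obtain ⟨b, hwb⟩ : ∃ b, b = B w w := ⟨_, rfl⟩
  obtain ⟨t, htt⟩ : ∃ t, t = 2 * B v w := ⟨_, rfl⟩
  rw [← hva] at ha hab hta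
  rw [← hwb] at hab
  rw [← htt] at ht0 hta
  have hq : ∀ m n : ℤ, B (m • v + n • w) (m • v + n • w) = a * m ^ 2 + t * (m * n) + b * n ^ 2 :=
    fun m n => by
      simp only [map_add, map_smul, LinearMap.add_apply, LinearMap.smul_apply, smul_eq_mul,
        hB.symm w v, hva, hwb, htt]
      ring
  have hone : ∀ m : ℤ, ∀ c > 0, c * m ^ 2 = c → m = 1 ∨ m = -1 := fun m c hc q => by
    have : c * ((m - 1) * (m + 1)) = 0 := by linarith
    have := (mul_eq_zero.1 this).resolve_left hc.ne'
    rcases mul_eq_zero.1 this with h | h <;> omega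
  rcases hta.lt_or_eq with hta | hta
  · refine ⟨v, w, hspan, hvw, Or.inl fun g => hvw.signPerm g ?_ ?_⟩
    · obtain ⟨m, n, q⟩ := Submodule.mem_span_pair.1 (hst g v hv)
      have hn := hq m n
      rw [q, hB.invariant, ← hva] at hn
      rcases eq_or_ne n 0 with rfl | hn0
      · rw [← q]
        rcases hone m a ha (by linarith) with rfl | rfl <;> simp
      · rcases eq_or_ne m 0 with rfl | hm0
        · rw [zero_smul, zero_add] at q
          rcases hvw.symm.map_eq_smul g (by rw [Set.pair_comm]; exact hst _ _ hw) q.symm with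
            rfl | rfl <;> simp [← q]
        · have := lt_of_ne_zero_of_ne_zero hta ht0 hm0 hn0
          nlinarith [sq_nonneg n]
    · obtain ⟨m, n, q⟩ := Submodule.mem_span_pair.1 (hst g w hw)
      have hn := hq m n
      rw [q, hB.invariant, ← hwb] at hn
      rcases eq_or_ne n 0 with rfl | hn0
      · rw [zero_smul, add_zero] at q
        rcases hvw.map_eq_smul g (hst _ _ hv) q.symm with rfl | rfl <;> simp [← q]
      · rcases eq_or_ne m 0 with rfl | hm0
        · rw [← q]
          rcases hone n b (by omega) (by linarith) with rfl | rfl <;> simp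
        · have := lt_of_ne_zero_of_ne_zero hta ht0 hm0 hn0
          have : 1 ≤ n ^ 2 := by have := sq_pos_of_ne_zero hn0; omega
          nlinarith
  rcases hab.lt_or_eq with hab | hab
  · have hlem : ∀ g u, B u u = b → u ∈ span ℤ {v, w} →
        (∀ m : ℤ, r g u = m • v → m = 1 ∨ m = -1) →
        r g u = w ∨ r g u = -w ∨ r g u = v + (1 : ℤ) • w ∨ r g u = -(v + (1 : ℤ) • w) :=
      fun g u hu humem hprim => by
        obtain ⟨m, n, q⟩ := Submodule.mem_span_pair.1 (hst g u humem)
        have hn := hq m n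
        rw [q, hB.invariant, hu] at hn
        rcases cases_of_sq_le (m := m) (n := n) ha hab.le (by rw [← hta] at hn; linarith) with
          rfl | ⟨rfl, rfl | rfl⟩ | ⟨rfl, rfl | rfl⟩
        · rcases hprim m (by rw [← q]; module) with rfl | rfl <;> omega
        · refine Or.inl (by rw [← q]; module)
        · refine Or.inr (Or.inr (Or.inl (by rw [← q]; module)))
        · refine Or.inr (Or.inl (by rw [← q]; module))
        · refine Or.inr (Or.inr (Or.inr (by rw [← q]; module)))
    have hvw' := hvw.symm.add_smul 1
    refine ⟨w, v + (1 : ℤ) • w, (span_pair_add_smul w v 1).trans (Set.pair_comm v w ▸ hspan),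
      hvw', Or.inl fun g => hvw'.signPerm g ?_ ?_⟩
    · exact hlem g w hwb.symm hw fun m hm => hvw.map_eq_smul g (hst _ _ hv) hm
    · refine hlem g _ ?_ ?_ fun m hm => (hvw.add_smul 1).map_eq_smul (r := r) g ?_ ?_
      · have := hq 1 1
        rw [one_smul] at this
        rw [this, ← hta]
        ring
      · exact Submodule.mem_span_pair.2 ⟨1, 1, by module⟩
      · rw [span_pair_add_smul]
        exact hst _ _ hv
      · rw [← hm]
        congr 1
        module
  · subst hab
    refine ⟨v, w, hspan, hvw, Or.inr fun g => ?_⟩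
    obtain ⟨z, hz⟩ : ∃ z, z = ![v, w, -v - w] := ⟨_, rfl⟩
    have hzz : ∀ i j, 2 * B (z i) (z j) = if i = j then 2 * a else -a := fun i j => by
      fin_cases i <;> fin_cases j <;> simp [hz, ← hva, ← hwb, hB.symm w v] <;> omega
    have hzmem : ∀ i, z i ∈ span ℤ {v, w} := fun i => by
      have := hmem (![1, 0, -1] i) (![0, 1, -1] i)
      convert this using 1
      fin_cases i <;> simp [hz, sub_eq_add_neg]
    have hex : ∀ i, ∃ (e : ℤˣ) (j : Fin 3), r g (z i) = (e : ℤ) • z j := fun i => by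
      obtain ⟨m, n, q⟩ := Submodule.mem_span_pair.1 (hst g _ (hzmem i))
      have hn := hq m n
      have := hzz i i
      rw [if_pos rfl] at this
      rw [q, hB.invariant] at hn
      rcases cases_of_sq_le ha le_rfl (show a * (m ^ 2 - m * n) + a * n ^ 2 = a by
          rw [← hta] at hn; linarith) with
          rfl | ⟨rfl, rfl | rfl⟩ | ⟨rfl, rfl | rfl⟩
      · rcases hone m a ha (by linarith) with rfl | rfl
        · exact ⟨1, 0, by rw [← q]; simp [hz]⟩
        · exact ⟨-1, 0, by rw [← q]; simp [hz]⟩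
      · exact ⟨1, 1, by rw [← q]; simp [hz]⟩
      · exact ⟨-1, 2, by rw [← q]; simp only [hz, Units.val_neg, Units.val_one, Matrix.cons_val]; module⟩
      · exact ⟨-1, 1, by rw [← q]; simp [hz]⟩
      · exact ⟨1, 2, by rw [← q]; simp only [hz, Units.val_one, Matrix.cons_val]; module⟩
    choose e f hef using hex
    have hee : ∀ i j, 2 * B (z i) (z j) = (e i * e j) * (2 * B (z (f i)) (z (f j))) := fun i j => by
      rw [← hB.invariant g, hef, hef]
      simp only [map_smul, LinearMap.smul_apply, smul_eq_mul]
      ring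
    have hinj : ∀ i j, i ≠ j → f i ≠ f j ∧ e i = e j := fun i j hij => by
      have := hee i j
      rw [hzz, hzz, if_neg hij] at this
      split_ifs at this with hf
      · rcases Int.units_eq_one_or (e i) with h1 | h1 <;>
          rcases Int.units_eq_one_or (e j) with h2 | h2 <;> simp [h1, h2] at this <;> omega
      · rcases Int.units_eq_one_or (e i) with h1 | h1 <;>
          rcases Int.units_eq_one_or (e j) with h2 | h2 <;> simp [h1, h2] at this ⊢ <;>
            first | exact hf | omega
    have hbij : Function.Injective f := fun i j q => by
      by_contra hij
      exact (hinj i j hij).1 q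
    rw [← hz]
    refine ⟨Equiv.ofBijective f (Finite.injective_iff_bijective.1 hbij), e 0, fun i => ?_⟩
    rw [hef, Equiv.ofBijective_apply]
    rcases eq_or_ne i 0 with rfl | h0
    · rfl
    · rw [(hinj i 0 h0).2]

end

section

variable {G : Type*} [Group G] {M : Type*} [AddCommGroup M]

theorem hex_pair {z : Fin 3 → M} (hz : z 0 + z 1 + z 2 = 0) (h : Indep (z 0) (z 1)) {i j : Fin 3}
    (hij : i ≠ j) : Indep (z i) (z j) ∧
      span ℤ {z i, z j} = span ℤ {z 0, z 1} := by
  have h2 : z 2 = -(z 0 + (1 : ℤ) • z 1) := by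
    rw [one_smul]; exact eq_neg_of_add_eq_zero_right hz
  have h2' : z 2 = -(z 1 + (1 : ℤ) • z 0) := by rw [h2]; module
  have e1 : span ℤ {z 0, z 2} = span ℤ {z 0, z 1} := by
    rw [h2', span_pair_neg_right, span_pair_add_smul]
  have e2 : span ℤ {z 1, z 2} = span ℤ {z 0, z 1} := by
    rw [h2, span_pair_neg_right, span_pair_add_smul, Set.pair_comm]
  have i1 : Indep (z 0) (z 2) := h2' ▸ (h.add_smul 1).neg_right
  have i2 : Indep (z 1) (z 2) := h2 ▸ (h.symm.add_smul 1).neg_right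
  fin_cases i <;> fin_cases j
  · exact absurd rfl hij
  · exact ⟨h, rfl⟩
  · exact ⟨i1, e1⟩
  · exact ⟨h.symm, congrArg _ (Set.pair_comm _ _)⟩
  · exact absurd rfl hij
  · exact ⟨i2, e2⟩
  · exact ⟨i1.symm, (congrArg _ (Set.pair_comm _ _)).trans e1⟩
  · exact ⟨i2.symm, (congrArg _ (Set.pair_comm _ _)).trans e2⟩
  · exact absurd rfl hij

theorem Indep.units_smul_ne {v w : M} (h : Indep v w) (e d : ℤˣ) :
    (e : ℤ) • v ≠ (d : ℤ) • w := fun q => by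
  have := (h e (-d) (by rw [q]; module)).1
  exact e.ne_zero this

theorem derangement_of_fixed {p q : Equiv.Perm (Fin 3)} {k a j : Fin 3} (ha : p a ≠ a)
    (hk : p k = k) (hk' : q k ≠ k) (hj : q j = j) (i : Fin 3) : q (p i) ≠ i := by
  revert p q k a j i
  decide

theorem rotation_of_derangement : ∀ p : Equiv.Perm (Fin 3), (∀ i, p i ≠ i) →
    (∀ i, p i = i + 1) ∨ ∀ i, p i = i + 2 := by decide

variable {r : Representation ℤ G M}

theorem exists_rotation_or_signPerm {z : Fin 3 → M} (hz : z 0 + z 1 + z 2 = 0)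
    (h : Indep (z 0) (z 1)) (hg : ∀ g, HexPerm (r g) z) :
    (∃ c, ∀ i, r c (z i) = z (i + 1)) ∨ ∃ i j, i ≠ j ∧ ∀ g, SignPerm (r g) (z i) (z j) := by
  choose p e hpe using hg
  have hmul : ∀ g g' i, r (g * g') (z i) = ((e g * e g' : ℤˣ) : ℤ) • z (p g (p g' i)) :=
    fun g g' i => by
      rw [map_mul, Module.End.mul_apply, hpe, map_smul, hpe, smul_smul, mul_comm (e g),
        Units.val_mul]
  have hsq : ∀ g i, r (g * g) (z i) = z (p g (p g i)) := fun g i => by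
    rw [hmul, Int.units_mul_self, Units.val_one, one_smul]
  by_cases hd : ∃ g, ∀ i, p g i ≠ i
  · obtain ⟨g, hgd⟩ := hd
    refine Or.inl ?_
    rcases rotation_of_derangement _ hgd with h1 | h1
    · refine ⟨(g * g) * (g * g), fun i => ?_⟩
      rw [map_mul, Module.End.mul_apply, hsq, hsq]
      simp only [h1]
      congr 1
      revert i; decide
    · refine ⟨g * g, fun i => ?_⟩
      rw [hsq]
      simp only [h1]
      congr 1
      revert i; decide
  push Not at hd
  refine Or.inr ?_
  have : ∃ k, ∀ g, p g k = k := by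
    by_cases h1 : ∀ g a, p g a = a
    · exact ⟨0, fun g => h1 g 0⟩
    · push Not at h1
      obtain ⟨g, a, hg1⟩ := h1
      obtain ⟨k, hk⟩ := hd g
      refine ⟨k, fun g' => ?_⟩
      by_contra hk'
      obtain ⟨j, hj⟩ := hd g'
      have hder := derangement_of_fixed hg1 hk hk' hj
      obtain ⟨m, hm⟩ := hd (g' * g)
      have := hmul g' g m
      rw [hpe, hm] at this
      exact (hex_pair hz h (hder m).symm).1.units_smul_ne _ _ this
  obtain ⟨k, hk⟩ := this
  have hkk : ∀ k : Fin 3, k + 1 ≠ k + 2 := by decide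
  refine ⟨k + 1, k + 2, hkk k, fun g => ?_⟩
  have hcase : ∀ (q : Equiv.Perm (Fin 3)) (k : Fin 3), q k = k →
    (q (k + 1) = k + 1 ∧ q (k + 2) = k + 2) ∨ (q (k + 1) = k + 2 ∧ q (k + 2) = k + 1) := by decide
  unfold SignPerm
  rw [hpe, hpe]
  rcases hcase _ _ (hk g) with ⟨h1, h2⟩ | ⟨h1, h2⟩ <;>
    rcases Int.units_eq_one_or (e g) with h3 | h3 <;> simp [h1, h2, h3]

/-- Rank two lattices: signed permutations, or a hexagonal lattice with a rotation. -/
theorem InvForm.rank_two_cases {B : M →ₗ[ℤ] M →ₗ[ℤ] ℤ} (hB : InvForm r B) {x y : M} (h : Indep x y)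
    (hst : ∀ g, ∀ v ∈ span ℤ {x, y}, r g v ∈ span ℤ {x, y}) :
    (∃ v w, span ℤ {v, w} = span ℤ {x, y} ∧ Indep v w ∧
      ∀ g, SignPerm (r g) v w) ∨
    ∃ z : Fin 3 → M, z 0 + z 1 + z 2 = 0 ∧ span ℤ {z 0, z 1} = span ℤ {x, y} ∧
      Indep (z 0) (z 1) ∧ (∀ g, HexPerm (r g) z) ∧ ∃ c, ∀ i, r c (z i) = z (i + 1) := by
  obtain ⟨v, w, hs, hvw, h1 | h1⟩ := hB.exists_signPerm_or_hexPerm h hst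
  · exact Or.inl ⟨v, w, hs, hvw, h1⟩
  · have hz : ![v, w, -v - w] 0 + ![v, w, -v - w] 1 + ![v, w, -v - w] 2 = 0 := by simp
    rcases exists_rotation_or_signPerm hz hvw h1 with h2 | ⟨i, j, hij, h2⟩
    · exact Or.inr ⟨_, hz, hs, hvw, h1, h2⟩
    · have := hex_pair hz hvw hij
      exact Or.inl ⟨_, _, this.2.trans hs, this.1, h2⟩

variable {k Ω : Type*} [Field k] [Field Ω] [Algebra k Ω] {ρ : G →* (Ω ≃ₐ[k] Ω)} {mon : M → Ω}

theorem MonAct.invPerm (h : MonAct ρ r mon) {g : G} {v w : M} (hg : SignPerm (r g) v w) :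
    InvPerm (ρ g) (mon v) (mon w) := by
  unfold InvPerm
  simp only [h.equivariant, ← h.map_neg]
  rcases hg with ⟨h1 | h1, h2 | h2⟩ | ⟨h1 | h1, h2 | h2⟩ <;> simp [h1, h2]

theorem MonAct.hexPerm (h : MonAct ρ r mon) {g : G} {z : Fin 3 → M} (hg : HexPerm (r g) z) :
    ∃ π : Equiv.Perm (Fin 3), (∀ i, ρ g (mon (z i)) = mon (z (π i))) ∨
      ∀ i, ρ g (mon (z i)) = 1 / mon (z (π i)) := by
  obtain ⟨π, e, hπ⟩ := hg
  refine ⟨π, ?_⟩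
  simp only [h.equivariant, hπ]
  rcases Int.units_eq_one_or e with rfl | rfl
  · left; simp
  · right; simp [h.map_neg]

theorem MonAct.prod_eq_one (h : MonAct ρ r mon) {z : Fin 3 → M} (hz : z 0 + z 1 + z 2 = 0) :
    mon (z 0) * mon (z 1) * mon (z 2) = 1 := by
  rw [← h.map_add, ← h.map_add, hz, h.map_zero]

theorem MonAct.relGen_two [Finite G] (h : MonAct ρ r mon) {B : M →ₗ[ℤ] M →ₗ[ℤ] ℤ} (hB : InvForm r B) {x y : M}
    (hxy : Indep x y)
    (hst : ∀ g, ∀ v ∈ span ℤ {x, y}, r g v ∈ span ℤ {x, y})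
    (hBig : Big 2 ⊥ (monField k mon (span ℤ {x, y}))) :
    RelGen ρ 2 ⊥ (monField k mon (span ℤ {x, y})) := by
  rcases hB.rank_two_cases hxy hst with ⟨v, w, hs, -, hg⟩ | ⟨z, hz, hs, -, hg, c, hc⟩
  · rw [← hs, h.monField_pair] at hBig ⊢
    exact RelGen.of_invPerm hBig fun g => h.invPerm (hg g)
  · rw [← hs, h.monField_pair] at hBig ⊢
    exact relGen_hex (z := fun i => mon (z i)) (stable_bot ρ) (h.prod_eq_one hz) hBig
      (fun g => h.hexPerm (hg g)) c (fix_bot _)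
      fun i => by rw [h.equivariant, hc]

end

section

variable {k Ω : Type*} [Field k] [Field Ω] [Algebra k Ω] {G : Type*} [Group G]
  {M : Type*} [AddCommGroup M] {r : Representation ℤ G M} {ρ : G →* (Ω ≃ₐ[k] Ω)} {mon : M → Ω}
  {B : M →ₗ[ℤ] M →ₗ[ℤ] ℤ}

theorem bot_sup_four (a b c d : Ω) : ⊥ ⊔ k⟮a⟯ ⊔ k⟮b⟯ ⊔ k⟮c⟯ ⊔ k⟮d⟯ =
    (⊥ ⊔ k⟮a⟯ ⊔ k⟮b⟯) ⊔ (⊥ ⊔ k⟮c⟯ ⊔ k⟮d⟯) := by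
  simp only [bot_sup_eq, sup_assoc]

theorem MonAct.relGen_hex_over [Finite G] (h : MonAct ρ r mon) (hB : InvForm r B) {x y : M}
    (hxy : Indep x y)
    (hst : ∀ g, ∀ v ∈ span ℤ {x, y}, r g v ∈ span ℤ {x, y})
    {z : Fin 3 → M} (hz : z 0 + z 1 + z 2 = 0) (hg : ∀ g, HexPerm (r g) z) (c : G)
    (hc : ∀ i, r c (z i) = z (i + 1)) (hx : r c x = x) (hy : r c y = y)
    (hBig : Big 4 ⊥ (monField k mon (span ℤ {x, y}) ⊔
      monField k mon (span ℤ {z 0, z 1}))) :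
    RelGen ρ 4 ⊥ (monField k mon (span ℤ {x, y}) ⊔
      monField k mon (span ℤ {z 0, z 1})) := by
  obtain ⟨K, hK⟩ : ∃ K, K = monField k mon (span ℤ {x, y}) := ⟨_, rfl⟩
  have hfield : K ⊔ monField k mon (span ℤ {z 0, z 1}) =
      K ⊔ k⟮mon (z 0)⟯ ⊔ k⟮mon (z 1)⟯ := by
    rw [h.monField_pair, bot_sup_eq, sup_assoc]
  have hKpair : K = ⊥ ⊔ k⟮mon x⟯ ⊔ k⟮mon y⟯ := by rw [hK, h.monField_pair]
  rw [← hK, hfield] at hBig ⊢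
  have hsplit := hBig
  rw [hKpair] at hsplit
  obtain ⟨hB1, hB2⟩ := hsplit.two_split
  rw [← hKpair] at hB1 hB2
  refine RelGen.trans (m := 2) (n := 2) ?_ (relGen_hex (z := fun i => mon (z i)) ?_
    (h.prod_eq_one hz) hB2 (fun g => h.hexPerm (hg g)) c ?_ fun i => by rw [h.equivariant, hc])
  · rw [hK] at hB1 ⊢
    exact h.relGen_two hB hxy hst hB1
  · rw [hK]
    exact h.stable hst
  · intro u hu
    rw [hKpair] at hu
    exact fix_sup_simple (fix_sup_simple (fix_bot _) (by rw [h.equivariant, hx]))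
      (by rw [h.equivariant, hy]) u hu

/-- `g` permutes the `z i` by `p` and the `w i` by `q`, up to signs. -/
def HexPair (r : Representation ℤ G M) (z w : Fin 3 → M) (g : G) (p q : Equiv.Perm (Fin 3)) : Prop :=
  ∃ e d : ℤˣ, (∀ i, r g (z i) = (e : ℤ) • z (p i)) ∧ ∀ i, r g (w i) = (d : ℤ) • w (q i)

theorem HexPair.mul {z w : Fin 3 → M} {g g' : G} {p q p' q' : Equiv.Perm (Fin 3)}
    (h : HexPair r z w g p q) (h' : HexPair r z w g' p' q') :
    HexPair r z w (g * g') (p * p') (q * q') := by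
  obtain ⟨e, d, h1, h2⟩ := h
  obtain ⟨e', d', h1', h2'⟩ := h'
  refine ⟨e * e', d * d', fun i => ?_, fun i => ?_⟩
  · rw [map_mul, Module.End.mul_apply, h1', map_smul, h1, smul_smul, mul_comm, Units.val_mul,
      Equiv.Perm.mul_apply]
  · rw [map_mul, Module.End.mul_apply, h2', map_smul, h2, smul_smul, mul_comm, Units.val_mul,
      Equiv.Perm.mul_apply]

theorem HexPair.swap {z w : Fin 3 → M} {g : G} {p q : Equiv.Perm (Fin 3)}
    (h : HexPair r z w g p q) : HexPair r w z g q p := by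
  obtain ⟨e, d, h1, h2⟩ := h
  exact ⟨d, e, h2, h1⟩

theorem HexPair.exists_rotation {z w : Fin 3 → M} {g : G} {p q : Equiv.Perm (Fin 3)}
    (h : HexPair r z w g p q) (hp : ∀ i, p i ≠ i) (hq : ∀ i, q i = i) :
    ∃ c, (∀ i, r c (z i) = z (i + 1)) ∧ ∀ i, r c (w i) = w i := by
  obtain ⟨e, d, h1, h2⟩ := h
  have h1' : ∀ i, r (g * g) (z i) = z (p (p i)) := fun i => by
    rw [map_mul, Module.End.mul_apply, h1, map_smul, h1, smul_smul, ← Units.val_mul,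
      Int.units_mul_self, Units.val_one, one_smul]
  have h2' : ∀ i, r (g * g) (w i) = w i := fun i => by
    rw [map_mul, Module.End.mul_apply, h2, map_smul, h2, smul_smul, ← Units.val_mul,
      Int.units_mul_self, Units.val_one, one_smul, hq, hq]
  rcases rotation_of_derangement p hp with hr | hr
  · refine ⟨(g * g) * (g * g), fun i => ?_, fun i => ?_⟩
    · rw [map_mul, Module.End.mul_apply, h1', h1']
      simp only [hr]
      congr 1
      revert i; decide
    · rw [map_mul, Module.End.mul_apply, h2', h2']
  · refine ⟨g * g, fun i => ?_, h2'⟩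
    rw [h1']
    simp only [hr]
    congr 1
    revert i; decide

/-- The translation `i ↦ i + 1`. -/
def rot : Equiv.Perm (Fin 3) := Equiv.addRight 1

def Decoupled (p q : Equiv.Perm (Fin 3)) : Prop :=
  ((∀ i, p i ≠ i) ∧ ∀ i, q i = i) ∨ ((∀ i, q i ≠ i) ∧ ∀ i, p i = i)

instance (p q : Equiv.Perm (Fin 3)) : Decidable (Decoupled p q) := by
  unfold Decoupled; infer_instance

theorem exists_shift_or_decoupled : ∀ p q : Equiv.Perm (Fin 3),
    (∃ δ, ∀ i, q (i + δ) = p i + δ) ∨ Decoupled (p * p * p * p) (q * q * q * q) ∨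
    Decoupled (p * p * p * p * rot) (q * q * q * q * rot) ∨
    Decoupled (p * p * p * p * rot * rot) (q * q * q * q * rot * rot) ∨
    Decoupled (p * rot * p * p * p * p * p * rot) (q * rot * q * q * q * q * q * rot) := by
  decide

theorem shift_unique : ∀ (p p' : Equiv.Perm (Fin 3)) (δ δ' ε : Fin 3), ¬ (∃ s, ∀ i, p i = i + s) →
    (∀ i, p (p' (i + ε - δ') + δ' - δ) + δ = p (p' i) + ε) → ∀ i, p' (i + δ - δ') + δ' = p' i + δ := by
  decide

theorem shift_of_rotation : ∀ (p : Equiv.Perm (Fin 3)) (δ : Fin 3), (∃ s, ∀ i, p i = i + s) →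
    ∀ i, p (i - δ) + δ = p i := by decide

theorem rot_ne : ∀ i, rot i ≠ i := by decide

theorem rot_pow_four : rot * rot * rot * rot = rot := by decide

theorem pow_four_ne : ∀ q : Equiv.Perm (Fin 3), (∀ i, q i ≠ i) → ∀ i, (q * q * q * q) i ≠ i := by
  decide

theorem rotation_or_fixed : ∀ p : Equiv.Perm (Fin 3), (∀ i, p (p (p (p i))) = i) ∨ ∀ i, p i ≠ i := by
  decide

theorem SignPerm.pow_four {v w : M} {g : G} (h : SignPerm (r g) v w) :
    r (g * g * g * g) v = v ∧ r (g * g * g * g) w = w := by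
  simp only [map_mul, Module.End.mul_apply]
  rcases h with ⟨h1 | h1, h2 | h2⟩ | ⟨h1 | h1, h2 | h2⟩ <;> simp [h1, h2]

theorem MonAct.relGen_of_decoupled [Finite G] (h : MonAct ρ r mon) (hB : InvForm r B)
    {z w : Fin 3 → M} (hz : z 0 + z 1 + z 2 = 0) (hw : w 0 + w 1 + w 2 = 0)
    (hz2 : Indep (z 0) (z 1)) (hw2 : Indep (w 0) (w 1))
    (hzst : ∀ g, ∀ v ∈ span ℤ {z 0, z 1}, r g v ∈ span ℤ {z 0, z 1})
    (hwst : ∀ g, ∀ v ∈ span ℤ {w 0, w 1}, r g v ∈ span ℤ {w 0, w 1})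
    (hzg : ∀ g, HexPerm (r g) z) (hwg : ∀ g, HexPerm (r g) w)
    {g : G} {p q : Equiv.Perm (Fin 3)} (hp : HexPair r z w g p q) (hd : Decoupled p q)
    (hBig : Big 4 ⊥ (monField k mon (span ℤ {z 0, z 1}) ⊔
      monField k mon (span ℤ {w 0, w 1}))) :
    RelGen ρ 4 ⊥ (monField k mon (span ℤ {z 0, z 1}) ⊔
      monField k mon (span ℤ {w 0, w 1})) := by
  rcases hd with ⟨h1, h2⟩ | ⟨h1, h2⟩
  · obtain ⟨c, hc, hc'⟩ := hp.exists_rotation h1 h2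
    rw [sup_comm] at hBig ⊢
    exact h.relGen_hex_over hB hw2 hwst hz hzg c hc (hc' 0) (hc' 1) hBig
  · obtain ⟨c, hc, hc'⟩ := hp.swap.exists_rotation h1 h2
    exact h.relGen_hex_over hB hz2 hzst hw hwg c hc (hc' 0) (hc' 1) hBig

theorem exists_shift_of_not_decoupled {z w : Fin 3 → M}
    (hg : ∀ g, ∃ p q, HexPair r z w g p q) {c : G} (hc : HexPair r z w c rot rot)
    (hnot : ¬ ∃ g p q, HexPair r z w g p q ∧ Decoupled p q) :
    ∃ δ : Fin 3, ∀ g, ∃ p q, HexPair r z w g p q ∧ ∀ i, q (i + δ) = p i + δ := by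
  have hshift : ∀ g p q, HexPair r z w g p q → ∃ δ, ∀ i, q (i + δ) = p i + δ := fun g p q h => by
    have h4 := ((h.mul h).mul h).mul h
    rcases exists_shift_or_decoupled p q with h1 | h1 | h1 | h1 | h1
    · exact h1
    · exact absurd ⟨_, _, _, h4, h1⟩ hnot
    · exact absurd ⟨_, _, _, h4.mul hc, h1⟩ hnot
    · exact absurd ⟨_, _, _, (h4.mul hc).mul hc, h1⟩ hnot
    · exact absurd ⟨_, _, _, ((((((h.mul hc).mul h).mul h).mul h).mul h).mul h).mul hc, h1⟩ hnot
  choose p q hpq using hg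
  by_cases hr : ∀ g, ∃ s, ∀ i, p g i = i + s
  · refine ⟨0, fun g => ⟨p g, q g, hpq g, fun i => ?_⟩⟩
    obtain ⟨δ, hδ⟩ := hshift _ _ _ (hpq g)
    have := hδ (i - δ)
    rw [sub_add_cancel, shift_of_rotation _ _ (hr g)] at this
    rw [add_zero, add_zero, this]
  · push Not at hr
    obtain ⟨g₀, hr⟩ := hr
    obtain ⟨δ, hδ⟩ := hshift _ _ _ (hpq g₀)
    refine ⟨δ, fun g => ⟨p g, q g, hpq g, fun i => ?_⟩⟩
    obtain ⟨δ', hδ'⟩ := hshift _ _ _ (hpq g)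
    obtain ⟨ε, hε⟩ := hshift _ _ _ ((hpq g₀).mul (hpq g))
    have h1 : ∀ i, q g₀ i = p g₀ (i - δ) + δ := fun i => by
      rw [← hδ, sub_add_cancel]
    have h2 : ∀ i, q g i = p g (i - δ') + δ' := fun i => by
      rw [← hδ', sub_add_cancel]
    rw [h2]
    refine shift_unique (p g₀) (p g) δ δ' ε ?_ (fun i => ?_) i
    · push Not
      exact hr
    · have := hε i
      rw [Equiv.Perm.mul_apply, Equiv.Perm.mul_apply, h1, h2] at this
      exact this

theorem MonAct.hexAct (h : MonAct ρ r mon) {g : G} {z : Fin 3 → M} {p : Equiv.Perm (Fin 3)} {e : ℤˣ}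
    (hg : ∀ i, r g (z i) = (e : ℤ) • z (p i)) : HexAct (ρ g) (fun i => mon (z i)) p e := fun i => by
  rw [h.equivariant, hg, h.map_units_smul]

theorem MonAct.relGen_hex_pair [Finite G] (h : MonAct ρ r mon) (hB : InvForm r B)
    {z w : Fin 3 → M} (hz : z 0 + z 1 + z 2 = 0) (hw : w 0 + w 1 + w 2 = 0)
    (hz2 : Indep (z 0) (z 1)) (hw2 : Indep (w 0) (w 1))
    (hzst : ∀ g, ∀ v ∈ span ℤ {z 0, z 1}, r g v ∈ span ℤ {z 0, z 1})
    (hwst : ∀ g, ∀ v ∈ span ℤ {w 0, w 1}, r g v ∈ span ℤ {w 0, w 1})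
    (hzg : ∀ g, HexPerm (r g) z) (hwg : ∀ g, HexPerm (r g) w)
    {c : G} (hc : ∀ i, r c (z i) = z (i + 1))
    (hBig : Big 4 ⊥ (monField k mon (span ℤ {z 0, z 1}) ⊔
      monField k mon (span ℤ {w 0, w 1}))) :
    RelGen ρ 4 ⊥ (monField k mon (span ℤ {z 0, z 1}) ⊔
      monField k mon (span ℤ {w 0, w 1})) := by
  have hg : ∀ g, ∃ p q, HexPair r z w g p q := fun g => by
    obtain ⟨p, e, he⟩ := hzg g
    obtain ⟨q, d, hd⟩ := hwg g
    exact ⟨p, q, e, d, he, hd⟩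
  by_cases hdec : ∃ g p q, HexPair r z w g p q ∧ Decoupled p q
  · obtain ⟨g, p, q, hpq, hd⟩ := hdec
    exact h.relGen_of_decoupled hB hz hw hz2 hw2 hzst hwst hzg hwg hpq hd hBig
  obtain ⟨q, d, hq⟩ := hwg c
  have hc1 : HexPair r z w c rot q := ⟨1, d, fun i => by simp [hc, rot], hq⟩
  have hc4 := ((hc1.mul hc1).mul hc1).mul hc1
  rw [rot_pow_four] at hc4
  have hq4 : ∀ i, (q * q * q * q) i ≠ i := by
    rcases rotation_or_fixed q with h1 | h1
    · exact absurd ⟨_, _, _, hc4, Or.inl ⟨rot_ne, h1⟩⟩ hdec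
    · exact pow_four_ne q h1
  -- both labellings are rotated by `c ^ 4`; relabel so that it rotates them alike
  have key : ∀ τ : Equiv.Perm (Fin 3), (∀ i, (q * q * q * q) (τ i) = τ (i + 1)) →
      RelGen ρ 4 ⊥ (monField k mon (span ℤ {z 0, z 1}) ⊔
        monField k mon (span ℤ {w 0, w 1})) := fun τ hτ => by
    have hconj : ∀ {g p q}, HexPair r z w g p q →
        HexPair r z (fun i => w (τ i)) g p (τ⁻¹ * q * τ) := fun {g p q} hpq => by
      obtain ⟨e, d, h1, h2⟩ := hpq
      exact ⟨e, d, h1, fun i => by simp [h2]⟩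
    have hconj' : ∀ {g p q}, HexPair r z (fun i => w (τ i)) g p q →
        HexPair r z w g p (τ * q * τ⁻¹) := fun {g p q} hpq => by
      obtain ⟨e, d, h1, h2⟩ := hpq
      refine ⟨e, d, h1, fun i => ?_⟩
      have := h2 (τ⁻¹ i)
      simpa using this
    have hdec' : ¬ ∃ g p q, HexPair r z (fun i => w (τ i)) g p q ∧ Decoupled p q := by
      rintro ⟨g, p, q, hpq, h1⟩
      refine hdec ⟨g, p, _, hconj' hpq, ?_⟩
      rcases h1 with ⟨h1, h2⟩ | ⟨h1, h2⟩
      · exact Or.inl ⟨h1, fun i => by simp [h2]⟩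
      · refine Or.inr ⟨fun i => ?_, h2⟩
        exact fun hh => h1 (τ⁻¹ i) (Equiv.Perm.eq_inv_iff_eq.2 hh)
    have hcc : HexPair r z (fun i => w (τ i)) (c * c * c * c) rot rot := by
      have := hconj hc4
      have h1 : τ⁻¹ * (q * q * q * q) * τ = rot := by
        ext1 i
        rw [Equiv.Perm.mul_apply, Equiv.Perm.mul_apply, hτ, Equiv.Perm.inv_eq_iff_eq]
        rfl
      rwa [h1] at this
    obtain ⟨δ, hδ⟩ := exists_shift_of_not_decoupled
      (fun g => by obtain ⟨p, q, hpq⟩ := hg g; exact ⟨_, _, hconj hpq⟩) hcc hdec'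
    obtain ⟨w', hw'⟩ : ∃ w' : Fin 3 → M, w' = fun i => w (τ (i + δ)) := ⟨_, rfl⟩
    have hsum : w' 0 + w' 1 + w' 2 = 0 := by
      have h1 : ∑ i, w' i = ∑ i, w i := by
        rw [hw']
        exact Equiv.sum_comp ((Equiv.addRight δ).trans τ) w
      rwa [Fin.sum_univ_three, Fin.sum_univ_three, hw] at h1
    have hspan : span ℤ {w' 0, w' 1} = span ℤ {w 0, w 1} := by
      rw [hw']
      exact (hex_pair hw hw2 (by rw [Ne, τ.injective.eq_iff, add_left_inj]; decide)).2
    rw [← hspan, h.monField_pair, h.monField_pair, ← bot_sup_four] at hBig ⊢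
    refine relGen_hex_hex (Z := fun i => mon (z i)) (z := fun i => mon (w' i)) (h.prod_eq_one hz)
      (h.prod_eq_one hsum) hBig (fun g => ?_) c fun i => by rw [h.equivariant, hc]
    obtain ⟨p, q, ⟨e, d, h1, h2⟩, h3⟩ := hδ g
    exact ⟨p, e, d, h.hexAct h1, h.hexAct fun i => by rw [hw']; dsimp only; rw [h2, h3]⟩
  rcases rotation_of_derangement _ hq4 with h1 | h1
  · refine key 1 fun i => ?_
    rw [Equiv.Perm.one_apply, Equiv.Perm.one_apply]
    exact h1 i
  · refine key (Equiv.neg (Fin 3)) fun i => ?_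
    rw [h1]
    simp only [Equiv.neg_apply]
    revert i
    decide

/-- Two stable rank two lattices. -/
theorem MonAct.relGen_two_two [Finite G] (h : MonAct ρ r mon) (hB : InvForm r B)
    {x y x' y' : M} (hxy : Indep x y) (hxy' : Indep x' y')
    (hst : ∀ g, ∀ v ∈ span ℤ {x, y}, r g v ∈ span ℤ {x, y})
    (hst' : ∀ g, ∀ v ∈ span ℤ {x', y'}, r g v ∈ span ℤ {x', y'})
    (hBig : Big 4 ⊥ (monField k mon (span ℤ {x, y}) ⊔
      monField k mon (span ℤ {x', y'}))) :
    RelGen ρ 4 ⊥ (monField k mon (span ℤ {x, y}) ⊔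
      monField k mon (span ℤ {x', y'})) := by
  have hpow : ∀ {z : Fin 3 → M} {c : G}, (∀ i, r c (z i) = z (i + 1)) →
      ∀ i, r (c * c * c * c) (z i) = z (i + 1) := fun {z c} hc i => by
    simp only [map_mul, Module.End.mul_apply, hc]
    congr 1
    revert i; decide
  rcases hB.rank_two_cases hxy hst with ⟨v, w, hs, hvw, hg⟩ | ⟨z, hz, hs, hz2, hg, c, hc⟩ <;>
    rcases hB.rank_two_cases hxy' hst' with
      ⟨v', w', hs', hvw', hg'⟩ | ⟨z', hz', hs', hz2', hg', c', hc'⟩ <;>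
    rw [← hs] at hst <;> rw [← hs'] at hst' <;> rw [← hs, ← hs'] at hBig ⊢
  · rw [h.monField_pair, h.monField_pair, ← bot_sup_four] at hBig ⊢
    exact RelGen.of_invPerm_invPerm hBig (fun g => h.invPerm (hg g)) fun g => h.invPerm (hg' g)
  · have := (hg c').pow_four
    exact h.relGen_hex_over hB hvw hst hz' hg' _ (hpow hc') this.1 this.2 hBig
  · have := (hg' c).pow_four
    rw [sup_comm] at hBig ⊢
    exact h.relGen_hex_over hB hvw' hst' hz hg _ (hpow hc) this.1 this.2 hBig
  · exact h.relGen_hex_pair hB hz hz' hz2 hz2' hst hst' hg hg' hc hBig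

end

section

variable {M : Type*} [AddCommGroup M]

/-- `u`, `v`, `w` form a basis of `M`. -/
structure IsBasis (u v w : M) : Prop where
  exists_eq : ∀ x, ∃ a b c : ℤ, a • u + b • v + c • w = x
  indep : ∀ a b c : ℤ, a • u + b • v + c • w = 0 → a = 0 ∧ b = 0 ∧ c = 0

theorem IsBasis.span_eq {u v w : M} (h : IsBasis u v w) : span ℤ {u, v, w} = ⊤ := by
  rw [eq_top_iff]
  intro x _
  obtain ⟨a, b, c, rfl⟩ := h.exists_eq x
  exact Submodule.mem_span_triple.2 ⟨a, b, c, rfl⟩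

theorem IsBasis.indep_right {u v w : M} (h : IsBasis u v w) : Indep v w := fun m n e =>
  (h.indep 0 m n (by rw [← e]; module)).2

theorem IsBasis.cycle {u v w : M} (h : IsBasis u v w) : IsBasis v w u where
  exists_eq x := by
    obtain ⟨a, b, c, rfl⟩ := h.exists_eq x
    exact ⟨b, c, a, by module⟩
  indep a b c e := by
    have := h.indep c a b (by rw [← e]; module)
    tauto

theorem IsBasis.ext {u v w : M} (h : IsBasis u v w) {a b c a' b' c' : ℤ}
    (e : a • u + b • v + c • w = a' • u + b' • v + c' • w) : a = a' ∧ b = b' ∧ c = c' := by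
  have := h.indep (a - a') (b - b') (c - c') (by
    rw [show (a - a') • u + (b - b') • v + (c - c') • w =
      (a • u + b • v + c • w) - (a' • u + b' • v + c' • w) by module, e, sub_self])
  omega

theorem IsBasis.add_left {u v w : M} (h : IsBasis u v w) (m n : ℤ) :
    IsBasis (u + m • v + n • w) v w where
  exists_eq x := by
    obtain ⟨a, b, c, rfl⟩ := h.exists_eq x
    exact ⟨a, b - a * m, c - a * n, by module⟩
  indep a b c e := by
    have := h.indep a (b + a * m) (c + a * n) (by rw [← e]; module)
    grind

theorem IsBasis.of_span_pair {u v w v' w' : M} (h : IsBasis u v w)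
    (hs : span ℤ {v', w'} = span ℤ {v, w}) (hi : Indep v' w') :
    IsBasis u v' w' where
  exists_eq x := by
    obtain ⟨a, b, c, rfl⟩ := h.exists_eq x
    obtain ⟨b', c', e⟩ := Submodule.mem_span_pair.1
      (hs ▸ Submodule.mem_span_pair.2 ⟨b, c, rfl⟩ : b • v + c • w ∈ span ℤ {v', w'})
    exact ⟨a, b', c', by rw [add_assoc, e, add_assoc]⟩
  indep a b c e := by
    obtain ⟨b', c', e'⟩ := Submodule.mem_span_pair.1
      (hs ▸ Submodule.mem_span_pair.2 ⟨b, c, rfl⟩ : b • v' + c • w' ∈ span ℤ {v, w})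
    have ha := (h.indep a b' c' (by rw [add_assoc, e', ← add_assoc, e])).1
    rw [ha, zero_smul, zero_add] at e
    exact ⟨ha, hi b c e⟩

theorem exists_isBasis_of_finrank_ker [Module.Free ℤ M] [Module.Finite ℤ M]
    (hM : Module.finrank ℤ M = 3) (T : M →ₗ[ℤ] M) (hT : Module.finrank ℤ (LinearMap.ker T) = 2) :
    ∃ x u v, IsBasis x u v ∧ ∀ w, T w = 0 ↔ ∃ a b : ℤ, a • u + b • v = w := by
  have hr : Module.finrank ℤ (LinearMap.range T) = 1 := by
    have := (LinearMap.ker T).finrank_quotient_add_finrank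
    rw [T.quotKerEquivRange.finrank_eq] at this
    omega
  let bk := Module.finBasisOfFinrankEq ℤ (LinearMap.ker T) hT
  let br := Module.finBasisOfFinrankEq ℤ (LinearMap.range T) hr
  obtain ⟨x, hx⟩ := (br 0).2
  have hker : ∀ w, T w = 0 ↔ ∃ a b : ℤ, a • (bk 0 : M) + b • (bk 1 : M) = w := fun w => by
    constructor
    · intro hw
      have := bk.sum_repr ⟨w, hw⟩
      rw [Fin.sum_univ_two] at this
      exact ⟨_, _, congrArg Subtype.val this⟩
    · rintro ⟨a, b, rfl⟩
      rw [map_add, map_smul, map_smul, (bk 0).2, (bk 1).2, smul_zero, smul_zero, add_zero]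
  refine ⟨x, bk 0, bk 1, ⟨fun w => ?_, fun a b c e => ?_⟩, hker⟩
  · have := br.sum_repr ⟨T w, w, rfl⟩
    rw [Fin.sum_univ_one] at this
    have h1 := congrArg Subtype.val this
    dsimp only [Submodule.coe_smul] at h1
    rw [← hx, ← map_smul, ← sub_eq_zero, ← map_sub, ← neg_eq_zero, ← map_neg, hker] at h1
    obtain ⟨a, b, e⟩ := h1
    exact ⟨_, a, b, by rw [add_assoc, e]; abel⟩
  · have h1 := congrArg T e
    rw [map_add, map_add, map_smul, map_smul, map_smul, (bk 0).2, (bk 1).2, smul_zero, smul_zero,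
      add_zero, add_zero, hx, T.map_zero] at h1
    have h1 := smul_eq_zero.1 (show a • br 0 = 0 from Subtype.ext h1)
    have ha := h1.resolve_right (br.ne_zero 0)
    rw [ha, zero_smul, zero_add] at e
    have := (LinearIndependent.pair_iff.1 (by
      have := bk.linearIndependent
      convert this using 1
      ext i; fin_cases i <;> rfl : LinearIndependent ℤ ![bk 0, bk 1])) b c (Subtype.ext e)
    exact ⟨ha, this⟩

variable {k Ω : Type*} [Field k] [Field Ω] [Algebra k Ω] {G : Type*} [Group G]
  {r : Representation ℤ G M} {ρ : G →* (Ω ≃ₐ[k] Ω)} {mon : M → Ω} {B : M →ₗ[ℤ] M →ₗ[ℤ] ℤ}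

/-- A stable rank two lattice plus a rank one lattice. -/
theorem MonAct.relGen_one_two [Finite G] (h : MonAct ρ r mon) (hB : InvForm r B) {e x y : M}
    (hb : IsBasis e x y) (he : ∀ g, r g e = e ∨ r g e = -e)
    (hst : ∀ g, ∀ v ∈ span ℤ {x, y}, r g v ∈ span ℤ {x, y})
    (hBig : Big 3 ⊥ (monField k mon ⊤)) : RelGen ρ 3 ⊥ (monField k mon ⊤) := by
  rw [← hb.span_eq, Submodule.span_insert, sup_comm, h.monField_sup, h.monField_singleton] at hBig ⊢
  have hB2 : Big 2 ⊥ (monField k mon (span ℤ {x, y})) :=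
    Big.of_genBy_right (m := 2) (n := 1) hBig (GenBy.one _ _)
  refine RelGen.trans (m := 2) (n := 1) (h.relGen_two hB hb.indep_right hst hB2)
    (RelGen.inv (h.stable hst) ?_ fun g => ?_)
  · rw [h.monField_pair] at hBig ⊢
    exact (Big.of_genBy (m := 2) (n := 1) hBig (GenBy.two _ _ _)).one (le_acl _)
  · rw [h.equivariant, ← h.map_neg]
    exact (he g).imp (congrArg mon) (congrArg mon)

end

section

variable {M : Type*} [AddCommGroup M] {G : Type*} [Group G]
  {r : Representation ℤ G M} {B : M →ₗ[ℤ] M →ₗ[ℤ] ℤ}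

theorem InvForm.comp (hB : InvForm r B) (H : Subgroup G) : InvForm (r.comp H.subtype) B :=
  ⟨hB.symm, hB.pos, fun g => hB.invariant g⟩

theorem finrank_ker_ne_one [Module.Free ℤ M] [Module.Finite ℤ M] {C : Module.End ℤ M}
    (h3 : C ^ 3 = 1) : Module.finrank ℤ (LinearMap.ker (1 + C + C ^ 2)) ≠ 1 := by
  intro h1
  let b := Module.finBasisOfFinrankEq ℤ _ h1
  obtain ⟨v, hv⟩ : ∃ v, v = b 0 := ⟨_, rfl⟩
  have hv0 : (v : M) ≠ 0 := fun e => b.ne_zero 0 (hv ▸ Subtype.ext e)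
  have hN : (v : M) + C v + C (C v) = 0 := v.2
  have hC3 : C (C (C v)) = v := LinearMap.congr_fun h3 (v : M)
  have hmem : C (v : M) ∈ LinearMap.ker (1 + C + C ^ 2) := by
    change C (v : M) + C (C v) + C (C (C v)) = 0
    rw [hC3, ← hN]
    abel
  have := b.sum_repr ⟨C v, hmem⟩
  rw [Fin.sum_univ_one, ← hv] at this
  obtain ⟨n, hn⟩ : ∃ n : ℤ, C (v : M) = n • (v : M) := ⟨_, (congrArg Subtype.val this).symm⟩
  rw [hn, map_smul, hn] at hN
  have : (1 + n + n * n) • (v : M) = 0 := by rw [← hN]; module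
  have := (smul_eq_zero.1 this).resolve_right hv0
  nlinarith

theorem finrank_ker_eq_two [Module.Free ℤ M] [Module.Finite ℤ M]
    (hM : Module.finrank ℤ M = 3) {C : Module.End ℤ M} (h3 : C ^ 3 = 1) (h1 : C ≠ 1) :
    Module.finrank ℤ (LinearMap.ker (1 + C + C ^ 2)) = 2 := by
  have hne := finrank_ker_ne_one h3
  have hle := (LinearMap.ker (1 + C + C ^ 2)).finrank_le
  have h0 : Module.finrank ℤ (LinearMap.ker (1 + C + C ^ 2)) ≠ 0 := by
    intro h0
    rw [Submodule.finrank_eq_zero] at h0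
    refine h1 (LinearMap.ext fun v => sub_eq_zero.1 ?_)
    have : C v - v ∈ LinearMap.ker (1 + C + C ^ 2) := by
      have hC3 : C (C (C v)) = v := LinearMap.congr_fun h3 v
      change C v - v + C (C v - v) + C (C (C v - v)) = 0
      rw [map_sub, map_sub, hC3]
      abel
    rwa [h0] at this
  have h3' : Module.finrank ℤ (LinearMap.ker (1 + C + C ^ 2)) ≠ 3 := by
    intro hr
    have := (LinearMap.ker (1 + C + C ^ 2)).finrank_quotient_add_finrank
    rw [LinearMap.quotKerEquivRange (1 + C + C ^ 2) |>.finrank_eq, hr, hM, Nat.add_eq_right,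
      Submodule.finrank_eq_zero, LinearMap.range_eq_bot] at this
    have hsq : (2 • C + 1) * (2 • C + 1) = (-3 : ℤ) • (1 : Module.End ℤ M) := by
      have : (2 • C + 1) * (2 • C + 1) = 4 • (1 + C + C ^ 2) + (-3 : ℤ) • (1 : Module.End ℤ M) := by
        noncomm_ring
      rw [this, ‹1 + C + C ^ 2 = 0›, smul_zero, zero_add]
    have := congrArg LinearMap.det hsq
    rw [map_mul, LinearMap.det_smul, map_one, hM] at this
    nlinarith
  omega

/-- An automorphism of order three is, in a suitable basis, a cyclic permutation or the sum of
the identity and a hexagonal rotation. -/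
theorem InvForm.exists_threefold [Finite G] [Module.Free ℤ M] [Module.Finite ℤ M]
    (hM : Module.finrank ℤ M = 3) (hB : InvForm r B) {c : G} (h3 : r c ^ 3 = 1) (h1 : r c ≠ 1) :
    (∃ (e : M) (z : Fin 3 → M) (g : G), IsBasis e (z 0) (z 1) ∧ z 0 + z 1 + z 2 = 0 ∧
      (∀ i, r g (z i) = z (i + 1)) ∧ r g e = e) ∨
    ∃ (x : Fin 3 → M) (g : G), IsBasis (x 0) (x 1) (x 2) ∧ ∀ i, r g (x i) = x (i + 1) := by
  obtain ⟨N, hN⟩ : ∃ N, N = 1 + r c + r c ^ 2 := ⟨_, rfl⟩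
  obtain ⟨x, u, v, hb, hker⟩ := exists_isBasis_of_finrank_ker hM N (hN ▸ finrank_ker_eq_two hM h3 h1)
  have hinv : ∀ g ∈ Subgroup.zpowers c, N * r g = N := by
    let S : Subgroup G :=
      { carrier := {g | N * r g = N}
        mul_mem' := fun {a b} ha hb => by
          change N * r a = N at ha
          change N * r b = N at hb
          change N * r (a * b) = N
          rw [map_mul, ← mul_assoc, ha, hb]
        one_mem' := by
          change N * r 1 = N
          rw [map_one, mul_one]
        inv_mem' := fun {a} ha => by
          change N * r a = N at ha
          change N * r a⁻¹ = N
          conv_lhs => rw [← ha]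
          rw [mul_assoc, ← map_mul, mul_inv_cancel, map_one, mul_one] }
    have : Subgroup.zpowers c ≤ S := by
      rw [Subgroup.zpowers_le]
      change N * r c = N
      rw [hN, add_mul, add_mul, ← pow_succ, ← pow_two, h3, one_mul]
      abel
    exact this
  have happ : ∀ g ∈ Subgroup.zpowers c, ∀ w, N (r g w) = N w := fun g hg w =>
    LinearMap.congr_fun (hinv g hg) w
  have hspan : ∀ w, w ∈ span ℤ {u, v} ↔ N w = 0 := fun w =>
    Submodule.mem_span_pair.trans (hker w).symm
  rcases (hB.comp (Subgroup.zpowers c)).rank_two_cases hb.indep_right fun g w hw => by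
    rw [hspan] at hw ⊢
    exact (happ g g.2 w).trans hw with ⟨v', w', hs, hi, hg⟩ | ⟨z, hz, hs, hi, -, ⟨g, hgc⟩, hrot⟩
  · exfalso
    have h4 := (hg ⟨c, Subgroup.mem_zpowers c⟩).pow_four
    have hfix : ∀ w, r c (r c (r c (r c w))) = r c w := fun w =>
      LinearMap.congr_fun h3 (r c w)
    simp only [map_mul, Module.End.mul_apply, MonoidHom.comp_apply, Subgroup.subtype_apply, hfix] at h4
    have hz : ∀ w, N w = 0 → w = 0 := fun w hw => by
      obtain ⟨a, b, rfl⟩ := Submodule.mem_span_pair.1 (hs ▸ (hspan w).2 hw :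
        w ∈ span ℤ {v', w'})
      have : r c (a • v' + b • w') = a • v' + b • w' := by
        rw [map_add, map_smul, map_smul, h4.1, h4.2]
      rw [hN] at hw
      change (a • v' + b • w') + r c (a • v' + b • w') + r c (r c (a • v' + b • w')) = 0 at hw
      rw [this, this] at hw
      have := hi (3 * a) (3 * b) (by rw [← hw]; module)
      rw [show a = 0 by omega, show b = 0 by omega, zero_smul, zero_smul, add_zero]
    exact hb.indep_right.ne_zero_left (hz u ((hspan u).1 (Submodule.subset_span (by simp))))
  · replace hrot : ∀ i, r g (z i) = z (i + 1) := hrot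
    have hz2 : z 2 = -z 0 - z 1 := by
      rw [← sub_eq_zero, ← hz]
      abel
    have h0 : r g (z 0) = z 1 := hrot 0
    have h1 : r g (z 1) = -z 0 - z 1 := (hrot 1).trans hz2
    replace hb := hb.of_span_pair hs hi
    obtain ⟨p, q, hpq⟩ : ∃ p q : ℤ, p • z 0 + q • z 1 = r g x - x := by
      rw [← Submodule.mem_span_pair, hs, hspan, map_sub, happ g hgc, sub_self]
    rw [eq_sub_iff_add_eq] at hpq
    obtain ⟨b, e, hbe, he⟩ : ∃ b e : ℤ, p + q = 3 * b + e ∧ (e = 0 ∨ e = 1 ∨ e = -1) :=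
      ⟨(p + q + 1) / 3, (p + q + 1) % 3 - 1, by omega, by omega⟩
    obtain ⟨y, hy⟩ : ∃ y, y = x + (2 * b - q) • z 0 + b • z 1 := ⟨_, rfl⟩
    have hyb : IsBasis y (z 0) (z 1) := hy ▸ hb.add_left _ _
    have hgy : r g y = y + e • z 0 := by
      rw [hy, map_add, map_add, map_smul, map_smul, h0, h1, ← hpq,
        show p = 3 * b + e - q by omega]
      module
    rcases eq_or_ne e 0 with rfl | he0
    · exact .inl ⟨y, z, g, hyb, hz, hrot, by rw [hgy, zero_smul, add_zero]⟩
    · have he2 : e * e = 1 := by grind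
      refine .inr ⟨![y, y + e • z 0, y + e • z 0 + e • z 1], g, ⟨fun w => ?_, fun a b c h => ?_⟩, ?_⟩
      · obtain ⟨a, b, c, rfl⟩ := hyb.exists_eq w
        refine ⟨a - e * b, e * b - e * c, e * c, ?_⟩
        simp only [Matrix.cons_val]
        have e1 : ∀ w : M, (e * e) • w = w := fun w => by rw [he2, one_smul]
        rw [← e1 (b • z 0), ← e1 (c • z 1)]
        module
      · have := hyb.indep (a + b + c) (e * (b + c)) (e * c) (by
          rw [← h]
          simp only [Matrix.cons_val]
          module)
        grind
      · intro i
        fin_cases i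
        · exact hgy
        · change r g (y + e • z 0) = y + e • z 0 + e • z 1
          rw [map_add, map_smul, hgy, h0]
        · change r g (y + e • z 0 + e • z 1) = y
          rw [map_add, map_add, map_smul, map_smul, hgy, h0, h1]
          module

theorem IsBasis.exists_coeff_ne_zero {e x y : M} (h : IsBasis e x y) (g : G) {m m0 m1 p q p0 q0 p1 q1 : ℤ}
    (he : r g e = m • e + p • x + q • y) (hx : r g x = m0 • e + p0 • x + q0 • y)
    (hy : r g y = m1 • e + p1 • x + q1 • y) : m ≠ 0 ∨ m0 ≠ 0 ∨ m1 ≠ 0 := by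
  by_contra! h0
  obtain ⟨rfl, rfl, rfl⟩ := h0
  obtain ⟨a, b, c, hab⟩ := h.exists_eq (r g⁻¹ e)
  have := congrArg (r g) hab
  rw [← Module.End.mul_apply, ← map_mul, mul_inv_cancel, map_one, Module.End.one_apply, map_add,
    map_add, map_smul, map_smul, map_smul, he, hx, hy] at this
  have := h.ext (a := 0) (b := a * p + b * p0 + c * p1) (c := a * q + b * q0 + c * q1) (a' := 1)
    (b' := 0) (c' := 0) (by
      rw [one_smul, zero_smul, zero_smul, zero_smul, add_zero, add_zero]
      conv_rhs => rw [← this]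
      module)
  omega

theorem InvForm.fixes_axis (hB : InvForm r B) {e : M} {z : Fin 3 → M} {c : G}
    (hb : IsBasis e (z 0) (z 1)) (hz : z 0 + z 1 + z 2 = 0) (hc : ∀ i, r c (z i) = z (i + 1))
    (he : r c e = e) :
    (∀ g, r g e = e ∨ r g e = -e) ∧
      ∀ g, ∀ v ∈ span ℤ {z 0, z 1}, r g v ∈ span ℤ {z 0, z 1} := by
  have hz2 : z 2 = -z 0 - z 1 := by
    rw [← sub_eq_zero, ← hz]
    abel
  obtain ⟨α, hα⟩ : ∃ α, α = B e e := ⟨_, rfl⟩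
  obtain ⟨β, hβ⟩ : ∃ β, β = B (z 0) (z 0) := ⟨_, rfl⟩
  have hcc : ∀ i j, B (z (i + 1)) (z (j + 1)) = B (z i) (z j) := fun i j => by
    rw [← hc, ← hc, hB.invariant]
  have hec : ∀ i, B e (z (i + 1)) = B e (z i) := fun i => by
    conv_lhs => rw [← hc, ← he, hB.invariant]
  have he0 : B e (z 0) = 0 := by
    have h1 : B e (z 1) = B e (z 0) := hec 0
    have h2 : B e (z 2) = B e (z 1) := hec 1
    rw [hz2, map_sub, map_neg] at h2
    omega
  have he1 : B e (z 1) = 0 := (hec 0).trans he0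
  have h11 : B (z 1) (z 1) = β := (hcc 0 0).trans hβ.symm
  have h01 : 2 * B (z 0) (z 1) = -β := by
    have h2 : B (z 1) (z 2) = B (z 0) (z 1) := hcc 0 1
    rw [hz2, map_sub, map_neg, hB.symm _ (z 0), h11] at h2
    omega
  have hα0 : 0 < α := hα ▸ hB.pos e fun h => by
    have := hb.indep 1 0 0 (by rw [h]; module)
    omega
  have hβ0 : 0 < β := hβ ▸ hB.pos (z 0) hb.indep_right.ne_zero_left
  have hnorm : ∀ m p q : ℤ, B (m • e + p • z 0 + q • z 1) (m • e + p • z 0 + q • z 1) =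
      α * (m * m) + β * (p * p - p * q + q * q) := fun m p q => by
    simp only [map_add, map_smul, LinearMap.add_apply, LinearMap.smul_apply, smul_eq_mul,
      hB.symm _ e, hB.symm (z 1) (z 0), he0, he1, h11, ← hα, ← hβ]
    linear_combination p * q * h01
  have hex : ∀ p q : ℤ, 0 ≤ p * p - p * q + q * q := fun p q => by nlinarith [sq_nonneg (p - q), sq_nonneg p, sq_nonneg q]
  have hex0 : ∀ p q : ℤ, p * p - p * q + q * q ≤ 0 → p = 0 ∧ q = 0 := fun p q h => by
    constructor <;> nlinarith [sq_nonneg (p - q), sq_nonneg p, sq_nonneg q, sq_nonneg (2 * p - q), sq_nonneg (2 * q - p)]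
  have hlead : ∀ γ δ m h : ℤ, 0 < γ → 0 < δ → m ≠ 0 → 0 ≤ h → δ ≤ γ → δ = γ * (m * m) + β * h →
      h ≤ 0 ∧ (m = 1 ∨ m = -1) ∧ δ = γ := fun γ δ m h hγ hδ hm hh hle e => by
    have hm1 : 1 ≤ m * m := Int.add_one_le_iff.2 (mul_self_pos.2 hm)
    have h1 : γ * 1 ≤ γ * (m * m) := by gcongr
    have h2 : β * h ≤ 0 := by linarith
    have h3 : 0 ≤ β * h := by positivity
    refine ⟨by nlinarith, ?_, by linarith⟩
    have : γ * (m * m) = γ * 1 := by linarith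
    exact mul_self_eq_one_iff.1 (mul_left_cancel₀ hγ.ne' this)
  have hge : ∀ g, r g e = e ∨ r g e = -e := by
    intro g
    obtain ⟨m, p, q, hg⟩ := hb.exists_eq (r g e)
    obtain ⟨m0, p0, q0, hg0⟩ := hb.exists_eq (r g (z 0))
    obtain ⟨m1, p1, q1, hg1⟩ := hb.exists_eq (r g (z 1))
    have hn := hnorm m p q
    have hn0 := hnorm m0 p0 q0
    have hn1 := hnorm m1 p1 q1
    rw [hg, hB.invariant, ← hα] at hn
    rw [hg0, hB.invariant, ← hβ] at hn0
    rw [hg1, hB.invariant, h11] at hn1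
    by_cases hm : m = 0
    · exfalso
      subst hm
      have hle : β ≤ α := by
        have : 0 < p * p - p * q + q * q := by
          by_contra! h
          obtain ⟨rfl, rfl⟩ := hex0 _ _ h
          linarith
        nlinarith
      have h01' : 2 * B (r g (z 0)) (r g (z 1)) = -β := by rw [hB.invariant, h01]
      rcases hb.exists_coeff_ne_zero g hg.symm hg0.symm hg1.symm with h | h | h
      · exact h rfl
      · obtain ⟨hh, hm, hαβ⟩ := hlead _ _ _ _ hα0 hβ0 h (hex _ _) hle hn0
        obtain ⟨rfl, rfl⟩ := hex0 _ _ hh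
        rw [← hg0, ← hg1] at h01'
        simp only [map_add, map_smul, LinearMap.add_apply, LinearMap.smul_apply, smul_eq_mul,
          he0, he1, ← hα, zero_mul, mul_zero, add_zero, ← hαβ] at h01'
        have : (2 * (m0 * m1) + 1) * β = 0 := by linarith
        rcases mul_eq_zero.1 this with h | h <;> omega
      · obtain ⟨hh, hm, hαβ⟩ := hlead _ _ _ _ hα0 hβ0 h (hex _ _) hle hn1
        obtain ⟨rfl, rfl⟩ := hex0 _ _ hh
        rw [← hg0, ← hg1] at h01'
        simp only [map_add, map_smul, LinearMap.add_apply, LinearMap.smul_apply, smul_eq_mul,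
          hB.symm _ e, he0, he1, ← hα, zero_mul, mul_zero, add_zero, ← hαβ] at h01'
        have : (2 * (m0 * m1) + 1) * β = 0 := by linarith
        rcases mul_eq_zero.1 this with h | h <;> omega
    · obtain ⟨hh, hm, -⟩ := hlead _ _ _ _ hα0 hα0 hm (hex _ _) le_rfl hn
      obtain ⟨rfl, rfl⟩ := hex0 _ _ hh
      rw [← hg]
      rcases hm with rfl | rfl
      · exact .inl (by module)
      · exact .inr (by module)
  refine ⟨hge, fun g v hv => ?_⟩
  obtain ⟨a, b, rfl⟩ := Submodule.mem_span_pair.1 hv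
  obtain ⟨m, p, q, h⟩ := hb.exists_eq (r g (a • z 0 + b • z 1))
  have h1 : B (r g e) (r g (a • z 0 + b • z 1)) = 0 := by
    rw [hB.invariant, map_add, map_smul, map_smul, he0, he1, smul_zero, smul_zero, add_zero]
  have h2 : m * α = 0 := by
    rw [← h] at h1
    rcases hge g with h | h <;> rw [h] at h1 <;>
      simpa [he0, he1, ← hα] using h1
  obtain rfl := (mul_eq_zero.1 h2).resolve_right hα0.ne'
  rw [← h, zero_smul, zero_add]
  exact Submodule.mem_span_pair.2 ⟨p, q, rfl⟩

end

section

/-- The vector with coordinates `p`, `q`, `s` is a basis vector up to sign. -/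
theorem signed_unit_of_sq {p q s : ℤ} (h : p * p + q * q + s * s = 1) :
    (q = 0 ∧ s = 0 ∧ (p = 1 ∨ p = -1)) ∨ (p = 0 ∧ s = 0 ∧ (q = 1 ∨ q = -1)) ∨
      (p = 0 ∧ q = 0 ∧ (s = 1 ∨ s = -1)) := by
  have h1 : -1 ≤ p ∧ p ≤ 1 := by constructor <;> nlinarith
  have h2 : -1 ≤ q ∧ q ≤ 1 := by constructor <;> nlinarith
  have h3 : -1 ≤ s ∧ s ≤ 1 := by constructor <;> nlinarith
  obtain ⟨h1, h1'⟩ := h1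
  obtain ⟨h2, h2'⟩ := h2
  obtain ⟨h3, h3'⟩ := h3
  interval_cases p <;> interval_cases q <;> interval_cases s <;> omega

theorem one_le_mul_self {p : ℤ} (h : p ≠ 0) : 1 ≤ p * p := Int.add_one_le_iff.2 (mul_self_pos.2 h)

theorem sq_sum_cases {p q s : ℤ} (h : p * p + q * q + s * s ≤ 3) :
    (-1 ≤ p ∧ p ≤ 1) ∧ (-1 ≤ q ∧ q ≤ 1) ∧ (-1 ≤ s ∧ s ≤ 1) := by
  refine ⟨⟨?_, ?_⟩, ⟨?_, ?_⟩, ?_, ?_⟩ <;> nlinarith [mul_self_nonneg p, mul_self_nonneg q, mul_self_nonneg s]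

theorem sq_sum_eq_one_of_generic {a b p q s : ℤ} (h1 : b < a) (h2 : -a < 3 * b) (h3 : 2 * b < a)
    (h : (a - b) * (p * p + q * q + s * s) + b * ((p + q + s) * (p + q + s)) = a) :
    p * p + q * q + s * s = 1 := by
  obtain ⟨N, hN⟩ : ∃ N, N = p * p + q * q + s * s := ⟨_, rfl⟩
  have hN' : (p + q + s) * (p + q + s) ≤ 3 * N := by
    rw [hN]; nlinarith [mul_self_nonneg (p - q), mul_self_nonneg (q - s), mul_self_nonneg (p - s)]
  have hNs : 0 ≤ N := by
    rw [hN]; linarith [mul_self_nonneg p, mul_self_nonneg q, mul_self_nonneg s]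
  have hs := mul_self_nonneg (p + q + s)
  have hN3 : N ≤ 2 := by
    rw [← hN] at h
    by_contra! hN3
    rcases le_or_gt 0 b with hb | hb
    · nlinarith
    · nlinarith
  have := sq_sum_cases (p := p) (q := q) (s := s) (by omega)
  obtain ⟨⟨h4, h5⟩, ⟨h6, h7⟩, h8, h9⟩ := this
  interval_cases p <;> interval_cases q <;> interval_cases s <;> omega

theorem sq_sum_eq_one_of_le {a b p q s : ℤ} (h1 : b < a) (hb : 0 ≤ b) (hs : p + q + s ≠ 0)
    (h : (a - b) * (p * p + q * q + s * s) + b * ((p + q + s) * (p + q + s)) = a) :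
    p * p + q * q + s * s = 1 := by
  have := one_le_mul_self hs
  have h0 : 1 ≤ p * p + q * q + s * s := by
    by_contra! h0
    apply hs
    have hp : p = 0 := by nlinarith [mul_self_nonneg p, mul_self_nonneg q, mul_self_nonneg s]
    have hq : q = 0 := by nlinarith [mul_self_nonneg p, mul_self_nonneg q, mul_self_nonneg s]
    have hs : s = 0 := by nlinarith [mul_self_nonneg p, mul_self_nonneg q, mul_self_nonneg s]
    omega
  nlinarith

theorem sum_eq_zero_of_sq_sum {a b p q s : ℤ} (h1 : b < a) (hb : a < 2 * b)
    (h : (a - b) * (p * p + q * q + s * s) + b * ((p + q + s) * (p + q + s)) = 2 * (a - b)) :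
    p + q + s = 0 := by
  by_contra hs
  have := one_le_mul_self hs
  have h0 : 1 ≤ p * p + q * q + s * s := by
    by_contra! h0
    apply hs
    have hp : p = 0 := by nlinarith [mul_self_nonneg p, mul_self_nonneg q, mul_self_nonneg s]
    have hq : q = 0 := by nlinarith [mul_self_nonneg p, mul_self_nonneg q, mul_self_nonneg s]
    have hs : s = 0 := by nlinarith [mul_self_nonneg p, mul_self_nonneg q, mul_self_nonneg s]
    omega
  nlinarith

theorem eq_of_diag_norm {a b p q s : ℤ} (h1 : 0 < a + 2 * b) (hb : 3 * b < -a)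
    (h : (a - b) * (p * p + q * q + s * s) + b * ((p + q + s) * (p + q + s)) = 3 * (a + 2 * b)) :
    (p = 1 ∧ q = 1 ∧ s = 1) ∨ (p = -1 ∧ q = -1 ∧ s = -1) := by
  obtain ⟨N, hN⟩ : ∃ N, N = (p - q) * (p - q) + (q - s) * (q - s) + (p - s) * (p - s) := ⟨_, rfl⟩
  have h3 : (a - b) * N + (a + 2 * b) * ((p + q + s) * (p + q + s)) = 9 * (a + 2 * b) := by
    rw [hN]; linear_combination 3 * h
  have hs0 := mul_self_nonneg (p + q + s)
  by_cases hN0 : N ≤ 0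
  · have hp : p - q = 0 := by
      nlinarith [mul_self_nonneg (p - q), mul_self_nonneg (q - s), mul_self_nonneg (p - s)]
    have hq : q - s = 0 := by
      nlinarith [mul_self_nonneg (p - q), mul_self_nonneg (q - s), mul_self_nonneg (p - s)]
    obtain rfl : p = q := by omega
    obtain rfl : p = s := by omega
    have : p * p = 1 := by
      have : (a + 2 * b) * (p * p) = (a + 2 * b) * 1 := by linarith
      exact mul_left_cancel₀ h1.ne' this
    rcases mul_self_eq_one_iff.1 this with rfl | rfl <;> simp
  · exfalso
    obtain ⟨n, hn⟩ : ∃ n, N = 2 * n := ⟨p * p + q * q + s * s - p * q - q * s - p * s, by rw [hN]; ring⟩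
    by_cases hs : p + q + s = 0
    · have : N = 3 * (p * p + q * q + s * s) := by
        rw [hN]; linear_combination -(p + q + s) * hs
      rw [hs, mul_zero, mul_zero] at h3
      have : 6 ≤ N := by omega
      nlinarith
    · have := one_le_mul_self hs
      have : 2 ≤ N := by omega
      nlinarith

end

section

variable {M : Type*} [AddCommGroup M] {G : Type*} [Group G]
  {r : Representation ℤ G M} {B : M →ₗ[ℤ] M →ₗ[ℤ] ℤ}

/-- A cyclically symmetric basis with Gram matrix having diagonal `a` and off-diagonal `b`. -/
structure CyclicGram (B : M →ₗ[ℤ] M →ₗ[ℤ] ℤ) (x : Fin 3 → M) (a b : ℤ) : Prop where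
  basis : IsBasis (x 0) (x 1) (x 2)
  diag : ∀ i, B (x i) (x i) = a
  off : ∀ i j, i ≠ j → B (x i) (x j) = b

theorem InvForm.cyclicGram (hB : InvForm r B) {x : Fin 3 → M} {c : G}
    (hb : IsBasis (x 0) (x 1) (x 2)) (hc : ∀ i, r c (x i) = x (i + 1)) :
    CyclicGram B x (B (x 0) (x 0)) (B (x 0) (x 1)) := by
  have hcc : ∀ i j, B (x (i + 1)) (x (j + 1)) = B (x i) (x j) := fun i j => by
    rw [← hc, ← hc, hB.invariant]
  have h1 : B (x 1) (x 1) = _ := hcc 0 0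
  have h2 : B (x 2) (x 2) = _ := hcc 1 1
  have h3 : B (x 1) (x 2) = _ := hcc 0 1
  have h4 : B (x 2) (x 0) = _ := hcc 1 2
  refine ⟨hb, fun i => ?_, fun i j hij => ?_⟩
  · fin_cases i
    exacts [rfl, h1, h2.trans h1]
  · fin_cases i <;> fin_cases j
    exacts [absurd rfl hij, rfl, (hB.symm _ _).trans (h4.trans h3), hB.symm _ _, absurd rfl hij, h3,
      h4.trans h3, (hB.symm _ _).trans h3, absurd rfl hij]

section
variable {x : Fin 3 → M} {a b : ℤ}

theorem CyclicGram.apply (h : CyclicGram B x a b) (p q s p' q' s' : ℤ) :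
    B (p • x 0 + q • x 1 + s • x 2) (p' • x 0 + q' • x 1 + s' • x 2) =
      (a - b) * (p * p' + q * q' + s * s') + b * ((p + q + s) * (p' + q' + s')) := by
  simp only [map_add, map_smul, LinearMap.add_apply, LinearMap.smul_apply, smul_eq_mul, h.diag,
    h.off 0 1 (by decide), h.off 0 2 (by decide), h.off 1 2 (by decide), h.off 1 0 (by decide),
    h.off 2 0 (by decide), h.off 2 1 (by decide)]
  ring

theorem CyclicGram.lt (h : CyclicGram B x a b) (hB : InvForm r B) : b < a := by
  have := h.apply 1 (-1) 0 1 (-1) 0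
  have h0 := hB.pos _ fun e => absurd (h.basis.indep 1 (-1) 0 e).1 one_ne_zero
  rw [this] at h0
  omega

theorem CyclicGram.pos (h : CyclicGram B x a b) (hB : InvForm r B) : 0 < a + 2 * b := by
  have := h.apply 1 1 1 1 1 1
  have h0 := hB.pos _ fun e => absurd (h.basis.indep 1 1 1 e).1 one_ne_zero
  rw [this] at h0
  omega

theorem CyclicGram.sum_ne_zero (h : CyclicGram B x a b) (g : G) {P Q S : Fin 3 → ℤ}
    (hg : ∀ i, P i • x 0 + Q i • x 1 + S i • x 2 = r g (x i)) : ∃ i, P i + Q i + S i ≠ 0 := by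
  by_contra! h0
  obtain ⟨a, b, c, hab⟩ := h.basis.exists_eq (r g⁻¹ (x 0))
  have := congrArg (r g) hab
  rw [← Module.End.mul_apply, ← map_mul, mul_inv_cancel, map_one, Module.End.one_apply, map_add,
    map_add, map_smul, map_smul, map_smul, ← hg, ← hg, ← hg] at this
  have := h.basis.ext (a := a * P 0 + b * P 1 + c * P 2) (b := a * Q 0 + b * Q 1 + c * Q 2)
    (c := a * S 0 + b * S 1 + c * S 2) (a' := 1) (b' := 0) (c' := 0) (by
      rw [one_smul, zero_smul, zero_smul, add_zero, add_zero]
      conv_rhs => rw [← this]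
      module)
  have := h0 0
  have := h0 1
  have := h0 2
  grind

theorem CyclicGram.exists_units_smul {p q s : ℤ} (h : p * p + q * q + s * s = 1) :
    ∃ (j : Fin 3) (e : ℤˣ), p • x 0 + q • x 1 + s • x 2 = (e : ℤ) • x j := by
  rcases signed_unit_of_sq h with ⟨rfl, rfl, rfl | rfl⟩ | ⟨rfl, rfl, rfl | rfl⟩ | ⟨rfl, rfl, rfl | rfl⟩
  · exact ⟨0, 1, by simp⟩
  · exact ⟨0, -1, by simp⟩
  · exact ⟨1, 1, by simp⟩
  · exact ⟨1, -1, by simp⟩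
  · exact ⟨2, 1, by simp⟩
  · exact ⟨2, -1, by simp⟩

/-- Away from the two exceptional Gram matrices, every isometry is a signed permutation. -/
theorem CyclicGram.exists_signed (h : CyclicGram B x a b) (hB : InvForm r B) (h2 : a ≠ 2 * b)
    (h3 : 3 * b ≠ -a) (g : G) (i : Fin 3) : ∃ (j : Fin 3) (e : ℤˣ), r g (x i) = (e : ℤ) • x j := by
  have hlt := h.lt hB
  have hpos := h.pos hB
  choose P Q S hg using fun i => h.basis.exists_eq (r g (x i))
  have hn : ∀ i, (a - b) * (P i * P i + Q i * Q i + S i * S i) +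
      b * ((P i + Q i + S i) * (P i + Q i + S i)) = a := fun i => by
    rw [← h.apply, hg, hB.invariant, h.diag]
  rw [← hg]
  refine CyclicGram.exists_units_smul ?_
  rcases lt_or_gt_of_ne h3 with h3 | h3
  · obtain ⟨p, q, s, hs⟩ := h.basis.exists_eq (r g ((1 : ℤ) • x 0 + (1 : ℤ) • x 1 + (1 : ℤ) • x 2))
    have h1 := eq_of_diag_norm (p := p) (q := q) (s := s) hpos h3 (by
      rw [← h.apply, hs, hB.invariant, h.apply]; ring)
    have h4 : B (r g ((1 : ℤ) • x 0 + (1 : ℤ) • x 1 + (1 : ℤ) • x 2)) (r g (x i)) = a + 2 * b := by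
      rw [hB.invariant]
      fin_cases i <;> simp [h.diag, h.off] <;> ring
    rw [← hs, ← hg, h.apply] at h4
    have h5 : (P i + Q i + S i) * (P i + Q i + S i) = 1 := by
      rcases h1 with ⟨rfl, rfl, rfl⟩ | ⟨rfl, rfl, rfl⟩
      · have : (a + 2 * b) * (P i + Q i + S i) = (a + 2 * b) * 1 := by linarith
        rw [mul_left_cancel₀ hpos.ne' this, one_mul]
      · have : (a + 2 * b) * (P i + Q i + S i) = (a + 2 * b) * (-1) := by linarith
        rw [mul_left_cancel₀ hpos.ne' this, neg_mul_neg, one_mul]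
    have h6 := hn i
    rw [h5] at h6
    have : (a - b) * (P i * P i + Q i * Q i + S i * S i) = (a - b) * 1 := by linarith
    exact mul_left_cancel₀ (by omega) this
  · rcases lt_or_gt_of_ne h2 with h2 | h2
    · have h4 : ∀ i j, P i + Q i + S i = P j + Q j + S j := fun i j => by
        rcases eq_or_ne i j with rfl | hij
        · rfl
        have := sum_eq_zero_of_sq_sum (p := P i - P j) (q := Q i - Q j) (s := S i - S j) hlt h2 (by
          rw [← h.apply, show (P i - P j) • x 0 + (Q i - Q j) • x 1 + (S i - S j) • x 2 =
            (P i • x 0 + Q i • x 1 + S i • x 2) - (P j • x 0 + Q j • x 1 + S j • x 2) by module, hg,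
            hg, ← map_sub, hB.invariant]
          simp [h.diag, h.off i j hij, h.off j i hij.symm]
          ring)
        omega
      obtain ⟨j, hj⟩ := h.sum_ne_zero g hg
      exact sq_sum_eq_one_of_le hlt (by omega) (h4 i j ▸ hj) (hn i)
    · exact sq_sum_eq_one_of_generic hlt h3 h2 (hn i)

end

/-- Four vectors with sum zero, built from a basis. -/
def tetra (x : Fin 3 → M) : Fin 4 → M := ![x 0, x 1, x 2, -x 0 - x 1 - x 2]

/-- A basis together with the origin. -/
def simplex (x : Fin 3 → M) : Fin 4 → M := ![x 0, x 1, x 2, 0]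

variable {x : Fin 3 → M} {a b : ℤ}

theorem exists_perm_four : ∀ {a b c : Fin 4}, a ≠ b → a ≠ c → b ≠ c →
    ∃ π : Equiv.Perm (Fin 4), π 0 = a ∧ π 1 = b ∧ π 2 = c := by decide

end

section

theorem Equiv.Perm.eq_apply_three (π : Equiv.Perm (Fin 4)) {j : Fin 4} (h0 : j ≠ π 0) (h1 : j ≠ π 1)
    (h2 : j ≠ π 2) : π 3 = j := by
  obtain ⟨i, rfl⟩ := π.surjective j
  fin_cases i <;> simp_all

/-- Coordinates of the vertices of the simplex. -/
def vertex (j : Fin 4) (i : Fin 4) : ℤ := if j = i then 1 else 0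

theorem exists_vertex_sub {p q s : ℤ}
    (h : p * p + q * q + s * s + (p + q + s) * (p + q + s) = 2) :
    ∃ j k : Fin 4, j ≠ k ∧ p = vertex j 0 - vertex k 0 ∧ q = vertex j 1 - vertex k 1 ∧
      s = vertex j 2 - vertex k 2 := by
  have := sq_sum_cases (p := p) (q := q) (s := s) (by nlinarith [mul_self_nonneg (p + q + s)])
  obtain ⟨⟨h4, h5⟩, ⟨h6, h7⟩, h8, h9⟩ := this
  interval_cases p <;> interval_cases q <;> interval_cases s <;> first | omega | decide

theorem vertex_product : ∀ {j k l m : Fin 4}, j ≠ k → l ≠ m →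
    (vertex j 0 - vertex k 0) * (vertex l 0 - vertex m 0) +
      (vertex j 1 - vertex k 1) * (vertex l 1 - vertex m 1) +
      (vertex j 2 - vertex k 2) * (vertex l 2 - vertex m 2) +
      (vertex j 0 - vertex k 0 + (vertex j 1 - vertex k 1) + (vertex j 2 - vertex k 2)) *
        (vertex l 0 - vertex m 0 + (vertex l 1 - vertex m 1) + (vertex l 2 - vertex m 2)) = 1 →
    (j = l ∧ k ≠ m ∨ k = m ∧ j ≠ l) ∧ j ≠ m ∧ k ≠ l := by decide

theorem exists_sign_of_sq {p q s : ℤ}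
    (h : 4 * (p * p + q * q + s * s) - (p + q + s) * (p + q + s) = 3) :
    ∃ (j : Fin 4) (e : ℤˣ), p = e * (vertex j 0 - vertex j 3) ∧
      q = e * (vertex j 1 - vertex j 3) ∧ s = e * (vertex j 2 - vertex j 3) := by
  have := sq_sum_cases (p := p) (q := q) (s := s)
    (by nlinarith [mul_self_nonneg (p - q), mul_self_nonneg (q - s), mul_self_nonneg (p - s)])
  obtain ⟨⟨h4, h5⟩, ⟨h6, h7⟩, h8, h9⟩ := this
  interval_cases p <;> interval_cases q <;> interval_cases s <;> first | omega | decide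

theorem vertex_product_sign : ∀ {j k : Fin 4} {e d : ℤˣ},
    4 * ((e : ℤ) * (vertex j 0 - vertex j 3) * (d * (vertex k 0 - vertex k 3)) +
      e * (vertex j 1 - vertex j 3) * (d * (vertex k 1 - vertex k 3)) +
      e * (vertex j 2 - vertex j 3) * (d * (vertex k 2 - vertex k 3))) -
    (e * (vertex j 0 - vertex j 3) + e * (vertex j 1 - vertex j 3) + e * (vertex j 2 - vertex j 3)) *
    (d * (vertex k 0 - vertex k 3) + d * (vertex k 1 - vertex k 3) + d * (vertex k 2 - vertex k 3)) =
      -1 → e = d ∧ j ≠ k := by decide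

variable {M : Type*} [AddCommGroup M] {G : Type*} [Group G]
  {r : Representation ℤ G M} {B : M →ₗ[ℤ] M →ₗ[ℤ] ℤ} {x : Fin 3 → M} {a b : ℤ}

theorem simplex_eq (x : Fin 3 → M) (j : Fin 4) :
    simplex x j = vertex j 0 • x 0 + vertex j 1 • x 1 + vertex j 2 • x 2 := by
  fin_cases j <;> simp [simplex, vertex]

theorem tetra_eq (x : Fin 3 → M) (j : Fin 4) :
    tetra x j = (vertex j 0 - vertex j 3) • x 0 + (vertex j 1 - vertex j 3) • x 1 +
      (vertex j 2 - vertex j 3) • x 2 := by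
  fin_cases j <;> simp [tetra, vertex, sub_eq_add_neg]

theorem tetra_sum (x : Fin 3 → M) : tetra x 0 + tetra x 1 + tetra x 2 + tetra x 3 = 0 := by
  simp only [tetra, Matrix.cons_val]
  abel

theorem CyclicGram.exists_simplex (h : CyclicGram B x a b) (hB : InvForm r B) (h2 : a = 2 * b)
    (g : G) : ∃ (π : Equiv.Perm (Fin 4)) (e : ℤˣ),
      ∀ i, r g (simplex x i) = (e : ℤ) • (simplex x (π i) - simplex x (π 3)) := by
  subst h2
  have hb : b ≠ 0 := by have := h.lt hB; omega
  choose P Q S hg using fun i => h.basis.exists_eq (r g (x i))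
  have hn : ∀ i j, b * (P i * P j + Q i * Q j + S i * S j +
      (P i + Q i + S i) * (P j + Q j + S j)) = B (x i) (x j) := fun i j => by
    rw [← hB.invariant g, ← hg, ← hg, h.apply]
    ring
  choose J K hJK hP hQ hS using fun i => exists_vertex_sub (p := P i) (q := Q i) (s := S i)
    (mul_left_cancel₀ hb ((hn i i).trans ((h.diag i).trans (mul_comm _ _))))
  have hv : ∀ i, r g (x i) = simplex x (J i) - simplex x (K i) := fun i => by
    rw [← hg, simplex_eq, simplex_eq, hP, hQ, hS]
    module
  have hprod : ∀ i j, i ≠ j → (J i = J j ∧ K i ≠ K j ∨ K i = K j ∧ J i ≠ J j) ∧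
      J i ≠ K j ∧ K i ≠ J j := fun i j hij => by
    have := mul_left_cancel₀ hb ((hn i j).trans ((h.off i j hij).trans (mul_one b).symm))
    rw [hP, hQ, hS, hP, hQ, hS] at this
    exact vertex_product (hJK i) (hJK j) this
  obtain ⟨h01, h1, h2⟩ := hprod 0 1 (by decide)
  obtain ⟨h02, h3, h4⟩ := hprod 0 2 (by decide)
  obtain ⟨h12, h5, h6⟩ := hprod 1 2 (by decide)
  have h7 := hJK 0
  have h8 := hJK 1
  have h9 := hJK 2
  rcases h01 with ⟨e1, e2⟩ | ⟨e1, e2⟩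
  · have e3 : J 0 = J 2 ∧ K 0 ≠ K 2 := by grind
    have e4 : K 1 ≠ K 2 := by grind
    obtain ⟨π, p0, p1, p2⟩ := exists_perm_four e2 e3.2 e4
    have p3 := π.eq_apply_three (j := J 0) (by grind) (by grind) (by grind)
    refine ⟨π, -1, fun i => ?_⟩
    fin_cases i
    · exact (hv 0).trans (by simp [p0, p3])
    · exact (hv 1).trans (by simp [p1, p3, e1])
    · exact (hv 2).trans (by simp [p2, p3, e3.1])
    · simp [simplex]
  · have e3 : K 0 = K 2 ∧ J 0 ≠ J 2 := by grind
    have e4 : J 1 ≠ J 2 := by grind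
    obtain ⟨π, p0, p1, p2⟩ := exists_perm_four e2 e3.2 e4
    have p3 := π.eq_apply_three (j := K 0) (by grind) (by grind) (by grind)
    refine ⟨π, 1, fun i => ?_⟩
    fin_cases i
    · exact (hv 0).trans (by simp [p0, p3])
    · exact (hv 1).trans (by simp [p1, p3, e1])
    · exact (hv 2).trans (by simp [p2, p3, e3.1])
    · simp [simplex]

theorem CyclicGram.exists_tetra (h : CyclicGram B x a b) (hB : InvForm r B) (h3 : 3 * b = -a)
    (g : G) : ∃ (π : Equiv.Perm (Fin 4)) (e : ℤˣ),
      ∀ i, r g (tetra x i) = (e : ℤ) • tetra x (π i) := by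
  obtain rfl : a = -(3 * b) := by omega
  have hb : b ≠ 0 := by have := h.lt hB; omega
  choose P Q S hg using fun i => h.basis.exists_eq (r g (x i))
  have hn : ∀ i j, b * (4 * (P i * P j + Q i * Q j + S i * S j) -
      (P i + Q i + S i) * (P j + Q j + S j)) = -B (x i) (x j) := fun i j => by
    rw [← hB.invariant g, ← hg, ← hg, h.apply]
    ring
  choose J e hP hQ hS using fun i => exists_sign_of_sq (p := P i) (q := Q i) (s := S i)
    (mul_left_cancel₀ hb ((hn i i).trans (by rw [h.diag]; ring)))
  have hv : ∀ i, r g (x i) = (e i : ℤ) • tetra x (J i) := fun i => by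
    rw [← hg, tetra_eq, hP, hQ, hS]
    module
  have hprod : ∀ i j, i ≠ j → e i = e j ∧ J i ≠ J j := fun i j hij => by
    have := mul_left_cancel₀ hb ((hn i j).trans (show _ = b * -1 by rw [h.off i j hij]; ring))
    rw [hP, hQ, hS, hP, hQ, hS] at this
    exact vertex_product_sign this
  obtain ⟨h1, h2⟩ := hprod 0 1 (by decide)
  obtain ⟨h3, h4⟩ := hprod 0 2 (by decide)
  obtain ⟨π, p0, p1, p2⟩ := exists_perm_four h2 h4 (hprod 1 2 (by decide)).2
  have v0 : r g (tetra x 0) = (e 0 : ℤ) • tetra x (π 0) := (hv 0).trans (by rw [p0])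
  have v1 : r g (tetra x 1) = (e 0 : ℤ) • tetra x (π 1) := (hv 1).trans (by rw [p1, h1])
  have v2 : r g (tetra x 2) = (e 0 : ℤ) • tetra x (π 2) := (hv 2).trans (by rw [p2, h3])
  refine ⟨π, e 0, fun i => ?_⟩
  fin_cases i
  · exact v0
  · exact v1
  · exact v2
  · have hs := (Equiv.sum_comp π (tetra x)).trans (Fin.sum_univ_four _)
    rw [tetra_sum, Fin.sum_univ_four] at hs
    have e3 : tetra x 3 = -(tetra x 0 + tetra x 1 + tetra x 2) := (neg_eq_of_add_eq_zero_right (tetra_sum x)).symm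
    have e4 : tetra x (π 3) = -(tetra x (π 0) + tetra x (π 1) + tetra x (π 2)) :=
      (neg_eq_of_add_eq_zero_right hs).symm
    change r g (tetra x 3) = (e 0 : ℤ) • tetra x (π 3)
    rw [e3, e4, map_neg, map_add, map_add, v0, v1, v2]
    module

end

section

/-- The three-cycle fixing `3`. -/
abbrev threeCycle : Equiv.Perm (Fin 4) := Equiv.swap 0 1 * Equiv.swap 1 2

set_option maxRecDepth 10000 in
theorem exists_klein_word : ∀ {π : Equiv.Perm (Fin 4)}, π 3 ≠ 3 → ∀ {m : Fin 4}, m ≠ 0 →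
    ∃ a b : Fin 3, ∀ i, (threeCycle ^ (b : ℕ) * (threeCycle * (π * threeCycle ^ (a : ℕ) * π⁻¹)) *
      (threeCycle ^ (b : ℕ))⁻¹) i = klein m i := by decide

/-- A group of signed permutations of four letters containing the three-cycle and not fixing `3`
contains the Klein four-group. -/
theorem exists_klein_of_threeCycle {G : Type*} [Group G]
    {A : G → Equiv.Perm (Fin 4) → ℤˣ → Prop}
    (hmul : ∀ g g' π π' e e', A g π e → A g' π' e' → A (g * g') (π * π') (e * e'))
    (hinv : ∀ g π e, A g π e → A g⁻¹ π⁻¹ e) {c : G} (hc : A c threeCycle 1) {g : G}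
    {π : Equiv.Perm (Fin 4)} {e : ℤˣ} (hg : A g π e) (h3 : π 3 ≠ 3) (m : Fin 4) :
    ∃ g κ, (∀ i, κ i = klein m i) ∧ A g κ 1 := by
  have h1 : A 1 1 1 := by
    simpa only [mul_inv_cancel, mul_one] using hmul _ _ _ _ _ _ hc (hinv _ _ _ hc)
  rcases eq_or_ne m 0 with rfl | hm
  · exact ⟨1, 1, by decide, h1⟩
  obtain ⟨a, b, h⟩ := exists_klein_word h3 hm
  have hpow : ∀ n : ℕ, A (c ^ n) (threeCycle ^ n) 1 := fun n => by
    induction n with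
    | zero => simpa using h1
    | succ n ih => simpa only [pow_succ, mul_one] using hmul _ _ _ _ _ _ ih hc
  have := hmul _ _ _ _ _ _ (hmul _ _ _ _ _ _ (hpow b) (hmul _ _ _ _ _ _ hc
    (hmul _ _ _ _ _ _ (hmul _ _ _ _ _ _ hg (hpow a)) (hinv _ _ _ hg)))) (hinv _ _ _ (hpow b))
  simp only [mul_one, Int.units_mul_self] at this
  exact ⟨_, _, h, this⟩

variable {M : Type*} [AddCommGroup M] {k Ω : Type*} [Field k] [Field Ω] [Algebra k Ω]
  {G : Type*} [Group G] {r : Representation ℤ G M} {ρ : G →* (Ω ≃ₐ[k] Ω)} {mon : M → Ω}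
  {B : M →ₗ[ℤ] M →ₗ[ℤ] ℤ} {x : Fin 3 → M}

theorem IsBasis.eq_of_units_smul (hb : IsBasis (x 0) (x 1) (x 2)) {i j : Fin 3} {e d : ℤˣ}
    (h : (e : ℤ) • x i = (d : ℤ) • x j) : i = j := by
  by_contra hij
  have he : (e : ℤ) ≠ 0 := e.ne_zero
  have hd : (d : ℤ) ≠ 0 := d.ne_zero
  have h := sub_eq_zero.2 h
  have key : ∀ p q s : ℤ, (e : ℤ) • x i - (d : ℤ) • x j = p • x 0 + q • x 1 + s • x 2 →
      p = 0 ∧ q = 0 ∧ s = 0 := fun p q s e => hb.indep p q s (e ▸ h)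
  fin_cases i <;> fin_cases j
  · exact hij rfl
  · exact he (key e (-d) 0 (by dsimp only; simp; abel)).1
  · exact he (key e 0 (-d) (by dsimp only; simp; abel)).1
  · exact he (key (-d) e 0 (by dsimp only; simp; abel)).2.1
  · exact hij rfl
  · exact he (key 0 e (-d) (by dsimp only; simp; abel)).2.1
  · exact he (key (-d) 0 e (by dsimp only; simp; abel)).2.2
  · exact he (key 0 (-d) e (by dsimp only; simp; abel)).2.2
  · exact hij rfl

theorem MonAct.relGen_of_signed [Finite G] (h : MonAct ρ r mon) (hb : IsBasis (x 0) (x 1) (x 2)) {c : G}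
    (hc : ∀ i, r c (x i) = x (i + 1))
    (hg : ∀ g i, ∃ (j : Fin 3) (e : ℤˣ), r g (x i) = (e : ℤ) • x j)
    (hBig : Big 3 ⊥ (monField k mon ⊤)) : RelGen ρ 3 ⊥ (monField k mon ⊤) := by
  rw [← hb.span_eq, h.monField_triple] at hBig ⊢
  refine RelGen.of_signAct (x := fun i => mon (x i)) hBig (fun g => ?_) c fun i => by
    rw [h.equivariant, hc]
  choose J e hJ using hg g
  have hinj : Function.Injective J := fun i j hij => by
    refine hb.eq_of_units_smul (e := e j) (d := e i) ?_
    have : r g ((e j : ℤ) • x i) = r g ((e i : ℤ) • x j) := by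
      rw [map_smul, map_smul, hJ, hJ, hij, smul_smul, smul_smul, mul_comm]
    have := congrArg (r g⁻¹) this
    rwa [← Module.End.mul_apply, ← Module.End.mul_apply, ← map_mul, inv_mul_cancel, map_one] at this
  refine ⟨⟨Equiv.ofBijective J (Finite.injective_iff_bijective.1 hinj), e⟩, fun i => ?_⟩
  change ρ g (mon (x i)) = mon (x (J i)) ^ (e i : ℤ)
  rw [h.equivariant, hJ, h.map_units_smul]

theorem ne_three_of_ne {π : Equiv.Perm (Fin 4)} (h : π 3 = 3) {i : Fin 4} (hi : i ≠ 3) : π i ≠ 3 :=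
  fun e => hi (π.injective (e.trans h.symm))

theorem exists_castSucc : ∀ {i : Fin 4}, i ≠ 3 → ∃ j : Fin 3, i = j.castSucc := by decide

theorem simplex_castSucc (x : Fin 3 → M) (i : Fin 3) : simplex x i.castSucc = x i := by
  fin_cases i <;> rfl

theorem tetra_castSucc (x : Fin 3 → M) (i : Fin 3) : tetra x i.castSucc = x i := by
  fin_cases i <;> rfl

theorem MonAct.relGen_of_simplex [Finite G] (h : MonAct ρ r mon) (hb : IsBasis (x 0) (x 1) (x 2)) {c : G}
    (hc : ∀ i, r c (x i) = x (i + 1))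
    (hg : ∀ g, ∃ (π : Equiv.Perm (Fin 4)) (e : ℤˣ),
      ∀ i, r g (simplex x i) = (e : ℤ) • (simplex x (π i) - simplex x (π 3)))
    (hBig : Big 3 ⊥ (monField k mon ⊤)) : RelGen ρ 3 ⊥ (monField k mon ⊤) := by
  by_cases hfix : ∀ g (π : Equiv.Perm (Fin 4)) (e : ℤˣ),
      (∀ i, r g (simplex x i) = (e : ℤ) • (simplex x (π i) - simplex x (π 3))) → π 3 = 3
  · refine h.relGen_of_signed hb hc (fun g i => ?_) hBig
    obtain ⟨π, e, hπ⟩ := hg g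
    have h3 := hfix g π e hπ
    obtain ⟨j, hj⟩ := exists_castSucc (ne_three_of_ne h3 (Fin.castSucc_ne_last i))
    refine ⟨j, e, ?_⟩
    have := hπ i.castSucc
    rw [simplex_castSucc, hj, simplex_castSucc, h3] at this
    exact this.trans (congrArg _ (sub_zero _))
  push Not at hfix
  obtain ⟨g, π, e, hπ, h3⟩ := hfix
  have hcyc : ∀ i, r c (simplex x i) =
      ((1 : ℤˣ) : ℤ) • (simplex x (threeCycle i) - simplex x (threeCycle 3)) := fun i => by
    rw [Units.val_one, one_smul]
    fin_cases i
    · exact (hc 0).trans (sub_zero _).symm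
    · exact (hc 1).trans (sub_zero _).symm
    · exact (hc 2).trans (sub_zero _).symm
    · exact (LinearMap.map_zero _).trans (sub_self _).symm
  have hV := exists_klein_of_threeCycle (A := fun g π e =>
    ∀ i, r g (simplex x i) = (e : ℤ) • (simplex x (π i) - simplex x (π 3)))
    (fun g g' π π' e e' h1 h2 i => by
      rw [map_mul, Module.End.mul_apply, h2, map_smul, LinearMap.map_sub, h1, h1, ← smul_sub,
        sub_sub_sub_cancel_right, smul_smul, mul_comm, Units.val_mul]
      rfl)
    (fun g π e h1 i => by
      have : simplex x i = r g ((e : ℤ) • (simplex x (π⁻¹ i) - simplex x (π⁻¹ 3))) := by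
        rw [map_smul, LinearMap.map_sub, h1, h1, ← smul_sub, sub_sub_sub_cancel_right, smul_smul,
          ← Units.val_mul, Int.units_mul_self, ← Equiv.Perm.mul_apply, ← Equiv.Perm.mul_apply,
          mul_inv_cancel, Equiv.Perm.one_apply, Equiv.Perm.one_apply]
        simp [simplex]
      conv_lhs => rw [this]
      rw [← Module.End.mul_apply, ← map_mul, inv_mul_cancel, map_one, Module.End.one_apply])
    hcyc hπ h3
  rw [← hb.span_eq, h.monField_triple] at hBig ⊢
  refine RelGen.of_ratios (t := fun i => mon (simplex x i)) h.map_zero hBig (fun g => ?_)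
    (fun m => ?_) c ?_ ?_ ?_
  · obtain ⟨π, e, hπ⟩ := hg g
    refine ⟨π, ?_⟩
    rcases Int.units_eq_one_or e with rfl | rfl
    · left; intro i
      rw [h.equivariant, hπ, Units.val_one, one_smul, h.map_sub]
    · right; intro i
      rw [h.equivariant, hπ, Units.val_neg, Units.val_one, neg_one_smul, neg_sub, h.map_sub]
  · obtain ⟨g, κ, hκ, hA⟩ := hV m
    refine ⟨g, fun i => ?_⟩
    rw [h.equivariant, hA, Units.val_one, one_smul, h.map_sub, hκ, hκ]
  · exact (h.equivariant c _).trans (congrArg mon (hc 0))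
  · exact (h.equivariant c _).trans (congrArg mon (hc 1))
  · exact (h.equivariant c _).trans (congrArg mon (hc 2))

theorem MonAct.relGen_of_tetra [Finite G] (h : MonAct ρ r mon) (hb : IsBasis (x 0) (x 1) (x 2)) {c : G}
    (hc : ∀ i, r c (x i) = x (i + 1))
    (hg : ∀ g, ∃ (π : Equiv.Perm (Fin 4)) (e : ℤˣ), ∀ i, r g (tetra x i) = (e : ℤ) • tetra x (π i))
    (hBig : Big 3 ⊥ (monField k mon ⊤)) : RelGen ρ 3 ⊥ (monField k mon ⊤) := by
  by_cases hfix : ∀ g (π : Equiv.Perm (Fin 4)) (e : ℤˣ),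
      (∀ i, r g (tetra x i) = (e : ℤ) • tetra x (π i)) → π 3 = 3
  · refine h.relGen_of_signed hb hc (fun g i => ?_) hBig
    obtain ⟨π, e, hπ⟩ := hg g
    obtain ⟨j, hj⟩ := exists_castSucc (ne_three_of_ne (hfix g π e hπ) (Fin.castSucc_ne_last i))
    refine ⟨j, e, ?_⟩
    have := hπ i.castSucc
    rwa [tetra_castSucc, hj, tetra_castSucc] at this
  push Not at hfix
  obtain ⟨g, π, e, hπ, h3⟩ := hfix
  have hcyc : ∀ i, r c (tetra x i) = ((1 : ℤˣ) : ℤ) • tetra x (threeCycle i) := fun i => by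
    rw [Units.val_one, one_smul]
    fin_cases i
    · exact hc 0
    · exact hc 1
    · exact hc 2
    · have h0 : r c (x 0) = x 1 := hc 0
      have h1 : r c (x 1) = x 2 := hc 1
      have h2 : r c (x 2) = x 0 := hc 2
      change r c (-x 0 - x 1 - x 2) = -x 0 - x 1 - x 2
      rw [LinearMap.map_sub, LinearMap.map_sub, LinearMap.map_neg, h0, h1, h2]
      abel
  have hV := exists_klein_of_threeCycle (A := fun g π e =>
    ∀ i, r g (tetra x i) = (e : ℤ) • tetra x (π i))
    (fun g g' π π' e e' h1 h2 i => by
      rw [map_mul, Module.End.mul_apply, h2, map_smul, h1, smul_smul, mul_comm, Units.val_mul]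
      rfl)
    (fun g π e h1 i => by
      have : tetra x i = r g ((e : ℤ) • tetra x (π⁻¹ i)) := by
        rw [map_smul, h1, smul_smul, ← Units.val_mul, Int.units_mul_self,
          ← Equiv.Perm.mul_apply, mul_inv_cancel, Equiv.Perm.one_apply, Units.val_one, one_smul]
      conv_lhs => rw [this]
      rw [← Module.End.mul_apply, ← map_mul, inv_mul_cancel, map_one, Module.End.one_apply])
    hcyc hπ h3
  rw [← hb.span_eq, h.monField_triple] at hBig ⊢
  refine RelGen.of_klein (x := fun i => mon (tetra x i)) ?_ hBig (fun g => ?_) (fun m => ?_)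
  · rw [← h.map_add, ← h.map_add, ← h.map_add, tetra_sum, h.map_zero]
  · obtain ⟨π, e, hπ⟩ := hg g
    refine ⟨π, ?_⟩
    rcases Int.units_eq_one_or e with rfl | rfl
    · left; intro i
      rw [h.equivariant, hπ, Units.val_one, one_smul]
    · right; intro i
      rw [h.equivariant, hπ, Units.val_neg, Units.val_one, neg_one_smul, h.map_neg]
  · obtain ⟨g, κ, hκ, hA⟩ := hV m
    refine ⟨g, fun i => ?_⟩
    rw [h.equivariant, hA, Units.val_one, one_smul, hκ]

/-- Rank three lattices with an automorphism of order three. -/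
theorem MonAct.relGen_threefold [Finite G] [Module.Free ℤ M] [Module.Finite ℤ M]
    (h : MonAct ρ r mon) (hM : Module.finrank ℤ M = 3) (hB : InvForm r B) {c : G}
    (h3 : r c ^ 3 = 1) (h1 : r c ≠ 1) (hBig : Big 3 ⊥ (monField k mon ⊤)) :
    RelGen ρ 3 ⊥ (monField k mon ⊤) := by
  rcases hB.exists_threefold hM h3 h1 with ⟨e, z, c, hb, hz, hc, he⟩ | ⟨x, c, hb, hc⟩
  · have := hB.fixes_axis hb hz hc he
    exact h.relGen_one_two hB hb this.1 this.2 hBig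
  · have hG := hB.cyclicGram hb hc
    by_cases h2 : B (x 0) (x 0) = 2 * B (x 0) (x 1)
    · exact h.relGen_of_simplex hb hc (hG.exists_simplex hB h2) hBig
    by_cases h3 : 3 * B (x 0) (x 1) = -B (x 0) (x 0)
    · exact h.relGen_of_tetra hb hc (hG.exists_tetra hB h3) hBig
    · exact h.relGen_of_signed hb hc (hG.exists_signed hB h2 h3) hBig

end

section

theorem eq_one_of_pow_prime {A : Matrix (Fin 3) (Fin 3) ℚ} {p : ℕ} (hp : p.Prime) (h5 : 5 ≤ p)
    (hA : A ^ p = 1) : A = 1 := by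
  have hirr := Polynomial.cyclotomic.irreducible_rat hp.pos
  have hd1 : minpoly ℚ A ∣ (Polynomial.X - 1) * Polynomial.cyclotomic p ℚ := by
    have := Fact.mk hp
    refine minpoly.dvd _ _ ?_
    rw [mul_comm, Polynomial.cyclotomic_prime_mul_X_sub_one]
    simp [hA]
  have hd2 : minpoly ℚ A ∣ A.charpoly := minpoly.dvd _ _ (Matrix.aeval_self_charpoly A)
  have hd3 : ¬ Polynomial.cyclotomic p ℚ ∣ minpoly ℚ A := fun h => by
    have := Polynomial.natDegree_le_of_dvd (h.trans hd2) A.charpoly_monic.ne_zero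
    rw [Polynomial.natDegree_cyclotomic, Nat.totient_prime hp, A.charpoly_natDegree_eq_dim,
      Fintype.card_fin] at this
    omega
  obtain ⟨q, hq⟩ := ((hirr.coprime_iff_not_dvd.2 hd3).symm).dvd_of_dvd_mul_right hd1
  have := congrArg (Polynomial.aeval A) hq
  rw [map_mul, minpoly.aeval, zero_mul, map_sub, Polynomial.aeval_X, map_one] at this
  exact sub_eq_zero.1 this

variable {M : Type*} [AddCommGroup M] [Module.Free ℤ M] [Module.Finite ℤ M] {G : Type*} [Group G]
  {r : Representation ℤ G M}

theorem end_eq_one_of_pow_prime (hM : Module.finrank ℤ M = 3) {C : Module.End ℤ M} {p : ℕ}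
    (hp : p.Prime) (h5 : 5 ≤ p) (hC : C ^ p = 1) : C = 1 := by
  let b := Module.finBasisOfFinrankEq ℤ M hM
  let f : Module.End ℤ M →+* Matrix (Fin 3) (Fin 3) ℚ :=
    (Int.castRingHom ℚ).mapMatrix.comp (LinearMap.toMatrixAlgEquiv b).toRingEquiv.toRingHom
  have hf : Function.Injective f := (Matrix.map_injective Int.cast_injective).comp
    (LinearMap.toMatrixAlgEquiv b).injective
  exact hf ((eq_one_of_pow_prime hp h5 (by rw [← map_pow, hC, map_one])).trans (map_one f).symm)

/-- The representation twisted by its determinant. -/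
def detTwist (r : Representation ℤ G M) : G →* (Module.End ℤ M)ˣ :=
  MonoidHom.toHomUnits
    { toFun := fun g => LinearMap.det (r g) • r g
      map_one' := by rw [map_one, map_one, one_smul]
      map_mul' := fun g h => by rw [map_mul, map_mul, smul_mul_smul_comm] }

theorem detTwist_eq (r : Representation ℤ G M) (g : G) :
    (detTwist r g : Module.End ℤ M) = r g ∨ (detTwist r g : Module.End ℤ M) = -r g := by
  have h : (detTwist r g : Module.End ℤ M) = LinearMap.det (r g) • r g := rfl
  have hu : IsUnit (LinearMap.det (r g)) :=
    IsUnit.of_mul_eq_one (LinearMap.det (r g⁻¹)) (by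
      rw [← map_mul, ← map_mul, mul_inv_cancel, map_one, map_one])
  rcases Int.isUnit_iff.1 hu with h1 | h1
  · exact .inl (by rw [h, h1, one_smul])
  · exact .inr (by rw [h, h1, neg_one_smul])

theorem det_detTwist (hM : Module.finrank ℤ M = 3) (r : Representation ℤ G M) (g : G) :
    LinearMap.det (detTwist r g : Module.End ℤ M) = 1 := by
  have h : (detTwist r g : Module.End ℤ M) = LinearMap.det (r g) • r g := rfl
  have hu : IsUnit (LinearMap.det (r g)) :=
    IsUnit.of_mul_eq_one (LinearMap.det (r g⁻¹)) (by
      rw [← map_mul, ← map_mul, mul_inv_cancel, map_one, map_one])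
  rw [h, LinearMap.det_smul, hM]
  rcases Int.isUnit_iff.1 hu with h1 | h1 <;> rw [h1] <;> norm_num

theorem isPGroup_detTwist [Finite G] (hM : Module.finrank ℤ M = 3)
    (hno : ∀ c, r c ^ 3 = 1 → r c = 1) : IsPGroup 2 (detTwist r).range := by
  have : Finite (detTwist r).range := .of_surjective _ (detTwist r).rangeRestrict_surjective
  rcases Nat.eq_two_pow_or_exists_odd_prime_and_dvd (Nat.card (detTwist r).range) with
    ⟨n, hn⟩ | ⟨p, hp, hdvd, hodd⟩
  · exact IsPGroup.of_card hn
  exfalso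
  have := Fact.mk hp
  obtain ⟨⟨_, g, rfl⟩, hh⟩ := exists_prime_orderOf_dvd_card' p hdvd
  rw [← Subgroup.orderOf_coe] at hh
  change orderOf (detTwist r g) = p at hh
  have hsq : (detTwist r g : Module.End ℤ M) ^ 2 = r (g ^ 2) := by
    rw [map_pow]
    rcases detTwist_eq r g with h | h <;> rw [h]
    exact neg_sq _
  have hpow : r (g ^ 2) ^ p = 1 := by
    rw [← hsq, ← pow_mul, mul_comm, pow_mul, ← Units.val_pow_eq_pow_val, ← hh, pow_orderOf_eq_one,
      Units.val_one, one_pow]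
  have h1 : r (g ^ 2) = 1 := by
    have h2 : p ≠ 2 := by rintro rfl; exact absurd hodd (by decide)
    have h4 : p ≠ 4 := by rintro rfl; exact absurd hodd (by decide)
    by_cases h3 : p = 3
    · exact hno _ (h3 ▸ hpow)
    · exact end_eq_one_of_pow_prime hM hp (by have := hp.two_le; omega) hpow
  rw [h1, ← Units.val_pow_eq_pow_val, Units.val_eq_one, ← orderOf_dvd_iff_pow_eq_one, hh,
    Nat.dvd_prime Nat.prime_two] at hsq
  rcases hsq with rfl | rfl
  · exact hp.ne_one rfl
  · exact absurd hodd (by decide)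

theorem exists_central_involution [Finite G] (hM : Module.finrank ℤ M = 3)
    (hno : ∀ c, r c ^ 3 = 1 → r c = 1) :
    (∀ g, r g = 1 ∨ r g = -1) ∨ ∃ z : Module.End ℤ M, z * z = 1 ∧ z ≠ 1 ∧ z ≠ -1 ∧
      (∀ g, z * r g = r g * z) ∧ ∃ g, r g = z ∨ r g = -z := by
  have : Finite (detTwist r).range := .of_surjective _ (detTwist r).rangeRestrict_surjective
  have hP := isPGroup_detTwist hM hno
  rcases subsingleton_or_nontrivial (detTwist r).range with hs | hs
  · left; intro g
    have : detTwist r g = 1 := congrArg Subtype.val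
      (Subsingleton.elim (⟨_, g, rfl⟩ : (detTwist r).range) 1)
    rcases detTwist_eq r g with h | h <;> rw [this, Units.val_one] at h
    · exact .inl h.symm
    · exact .inr (by rw [h, neg_neg])
  · right
    have := Fact.mk Nat.prime_two
    have hc := hP.center_nontrivial
    have h2 : 2 ∣ Nat.card (Subgroup.center (detTwist r).range) := by
      obtain ⟨n, hn0, hn⟩ := (hP.to_subgroup _).nontrivial_iff_card.1 hc
      exact hn ▸ dvd_pow_self 2 hn0.ne'
    obtain ⟨⟨⟨_, g, rfl⟩, hz⟩, ho⟩ := exists_prime_orderOf_dvd_card' 2 h2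
    rw [← Subgroup.orderOf_coe, ← Subgroup.orderOf_coe] at ho
    change orderOf (detTwist r g) = 2 at ho
    refine ⟨detTwist r g, ?_, fun h => ?_, fun h => ?_, fun g' => ?_, g, ?_⟩
    · rw [← Units.val_mul, ← pow_two, ← ho, pow_orderOf_eq_one, Units.val_one]
    · rw [Units.val_eq_one] at h
      rw [h, orderOf_one] at ho
      omega
    · have := det_detTwist hM r g
      rw [h, ← neg_one_smul ℤ (1 : Module.End ℤ M), LinearMap.det_smul, hM, map_one] at this
      norm_num at this
    · have := congrArg (fun x => ((x : (Module.End ℤ M)ˣ) : Module.End ℤ M)) (congrArg Subtype.val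
        (Subgroup.mem_center_iff.1 hz ⟨_, g', rfl⟩))
      change (detTwist r g' : Module.End ℤ M) * detTwist r g = detTwist r g * detTwist r g' at this
      rcases detTwist_eq r g' with h | h <;> rw [h] at this
      · exact this.symm
      · rw [neg_mul, mul_neg, neg_inj] at this
        exact this.symm
    · rcases detTwist_eq r g with h | h <;> rw [h]
      · exact .inl rfl
      · exact .inr (neg_neg _).symm

theorem finrank_ker_of_involution (hM : Module.finrank ℤ M = 3) {z : Module.End ℤ M}
    (hz : z * z = 1) (h1 : z ≠ 1) (h2 : z ≠ -1) :
    Module.finrank ℤ (LinearMap.ker (z + 1)) = 2 ∨ Module.finrank ℤ (LinearMap.ker (-z + 1)) = 2 := by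
  have hzz : ∀ v, z (z v) = v := fun v => LinearMap.congr_fun hz v
  have hnull : ∀ T : Module.End ℤ M, Module.finrank ℤ (LinearMap.range T) +
      Module.finrank ℤ (LinearMap.ker T) = 3 := fun T => by
    rw [← T.quotKerEquivRange.finrank_eq, Submodule.finrank_quotient_add_finrank, hM]
  have hzero : ∀ T : Module.End ℤ M, Module.finrank ℤ (LinearMap.range T) = 0 → T = 0 := fun T hT =>
    LinearMap.range_eq_bot.1 (Submodule.finrank_eq_zero.1 hT)
  have hle1 : LinearMap.range (z + 1) ≤ LinearMap.ker (-z + 1) := by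
    rintro _ ⟨v, rfl⟩
    change -z (z v + v) + (z v + v) = 0
    rw [map_add, hzz]
    abel
  have hle2 : LinearMap.range (-z + 1) ≤ LinearMap.ker (z + 1) := by
    rintro _ ⟨v, rfl⟩
    change z (-z v + v) + (-z v + v) = 0
    rw [map_add, map_neg, hzz]
    abel
  have e1 := Submodule.finrank_mono hle1
  have e2 := Submodule.finrank_mono hle2
  have e3 := hnull (z + 1)
  have e4 := hnull (-z + 1)
  have e5 : Module.finrank ℤ (LinearMap.range (z + 1)) ≠ 0 := fun h =>
    h2 (eq_neg_of_add_eq_zero_left (hzero _ h))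
  have e6 : Module.finrank ℤ (LinearMap.range (-z + 1)) ≠ 0 := fun h =>
    h1 (neg_inj.1 (eq_neg_of_add_eq_zero_left (hzero _ h)))
  omega

end

section

variable {M : Type*} [AddCommGroup M] [Module.Free ℤ M] {G : Type*} [Group G]
  {r : Representation ℤ G M} {B : M →ₗ[ℤ] M →ₗ[ℤ] ℤ}

theorem eq_of_two_smul_eq {v w : M} (h : (2 : ℤ) • v = (2 : ℤ) • w) : v = w :=
  smul_right_injective M (two_ne_zero' ℤ) h

/-- The fixed line of an involution acting as `-1` on a plane is preserved by the centralizer. -/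
theorem InvForm.map_axis (hB : InvForm r B) {x u v : M} (hb : IsBasis x u v)
    {z : Module.End ℤ M} (hz : ∀ g, z * r g = r g * z) {a b : ℤ} (hx : z x = x + a • u + b • v)
    (hu : z u = -u) (hv : z v = -v) (g : G) :
    r g ((2 : ℤ) • x + a • u + b • v) = (2 : ℤ) • x + a • u + b • v ∨
      r g ((2 : ℤ) • x + a • u + b • v) = -((2 : ℤ) • x + a • u + b • v) := by
  obtain ⟨e, he⟩ : ∃ e, e = (2 : ℤ) • x + a • u + b • v := ⟨_, rfl⟩
  rw [← he]
  have he0 : e ≠ 0 := fun h => by have := hb.indep 2 a b (he ▸ h); omega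
  have hze : z (r g e) = r g e := by
    have hze : z e = e := by
      simp only [he, map_add, map_smul, hx, hu, hv]
      module
    rw [← Module.End.mul_apply, hz, Module.End.mul_apply, hze]
  obtain ⟨p, q, s, hp⟩ := hb.exists_eq (r g e)
  have h2 : (2 : ℤ) • r g e = p • e := by
    have : (2 : ℤ) • r g e = r g e + z (r g e) := by rw [hze]; module
    rw [this, ← hp, he]
    simp only [map_add, map_smul, hx, hu, hv]
    module
  have h4 : 4 * B e e = p * p * B e e := by
    have h1 : B ((2 : ℤ) • r g e) ((2 : ℤ) • r g e) = B (p • e) (p • e) := by rw [h2]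
    simp only [map_smul, LinearMap.smul_apply, hB.invariant, smul_eq_mul] at h1
    linarith
  have h5 : (p - 2) * (p + 2) = 0 := by
    linear_combination -mul_right_cancel₀ (hB.pos e he0).ne' h4
  rcases mul_eq_zero.1 h5 with h6 | h6
  · left; rw [show p = 2 by omega] at h2; exact eq_of_two_smul_eq h2
  · right; rw [show p = -2 by omega] at h2; exact eq_of_two_smul_eq (by rw [h2]; module)

/-- Without elements of order three the plane inverted by an involution has signed axes. -/
theorem InvForm.exists_signPerm [Finite G] (hB : InvForm r B) (hno : ∀ c, r c ^ 3 = 1 → r c = 1)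
    {x u v : M} (hb : IsBasis x u v) {z : Module.End ℤ M} (hz : ∀ g, z * r g = r g * z)
    (hker : ∀ w, z w = -w ↔ ∃ a b : ℤ, a • u + b • v = w) {a b : ℤ}
    (hx : z x = x + a • u + b • v) :
    ∃ x' y1 y2, IsBasis x' y1 y2 ∧ z y1 = -y1 ∧ z y2 = -y2 ∧ (∀ g, SignPerm (r g) y1 y2) ∧
      ∃ p q : ℤ, (p = 0 ∨ p = -1) ∧ (q = 0 ∨ q = -1) ∧ z x' = x' + p • y1 + q • y2 := by
  have hzu : z u = -u := (hker u).2 ⟨1, 0, by module⟩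
  have hzv : z v = -v := (hker v).2 ⟨0, 1, by module⟩
  have hst : ∀ g, ∀ w ∈ span ℤ {u, v}, r g w ∈ span ℤ {u, v} := fun g w hw => by
    rw [Submodule.mem_span_pair, ← hker] at hw ⊢
    rw [← Module.End.mul_apply, hz, Module.End.mul_apply, hw, map_neg]
  rcases hB.rank_two_cases hb.indep_right hst with ⟨y1, y2, hs, hi, hp⟩ | ⟨y, hy, hs, hi, -, c, hc⟩
  · have hzy : ∀ w ∈ span ℤ {y1, y2}, z w = -w := fun w hw => by
      rw [hker, ← Submodule.mem_span_pair, ← hs]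
      exact hw
    have hz1 := hzy _ (Submodule.subset_span (.inl rfl))
    have hz2 := hzy _ (Submodule.subset_span (.inr rfl))
    obtain ⟨m, n, e⟩ := Submodule.mem_span_pair.1
      (hs ▸ Submodule.mem_span_pair.2 ⟨a, b, rfl⟩ : a • u + b • v ∈ span ℤ {y1, y2})
    rw [add_assoc, ← e] at hx
    refine ⟨_, y1, y2, (hb.of_span_pair hs hi).add_left ((m + 1) / 2) ((n + 1) / 2), hz1, hz2, hp,
      m - 2 * ((m + 1) / 2), n - 2 * ((n + 1) / 2), by omega, by omega, ?_⟩
    simp only [map_add, map_smul, hx, hz1, hz2]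
    module
  · exfalso
    have hL : ∀ w, z w = -w → r c (r c (r c w)) = w := fun w hw => by
      rw [hker, ← Submodule.mem_span_pair, ← hs, Submodule.mem_span_pair] at hw
      obtain ⟨s, t, rfl⟩ := hw
      simp only [map_add, map_smul, hc]
      rfl
    have he : r c (r c ((2 : ℤ) • x + a • u + b • v)) = (2 : ℤ) • x + a • u + b • v := by
      rcases hB.map_axis hb hz hx hzu hzv c with h | h
      · rw [h, h]
      · rw [h, map_neg, h, neg_neg]
    obtain ⟨e, hed⟩ : ∃ e, e = (2 : ℤ) • x + a • u + b • v := ⟨_, rfl⟩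
    rw [← hed] at he
    have h1 : r (c * c) = 1 := hno _ (LinearMap.ext fun w => by
      change r (c * c) (r (c * c) (r (c * c) w)) = w
      have h6 : ∀ w, r (c * c) w = r c (r c w) := fun w => by rw [map_mul, Module.End.mul_apply]
      simp only [h6]
      obtain ⟨s, t, q, rfl⟩ := hb.exists_eq w
      refine eq_of_two_smul_eq ?_
      rw [← map_smul, ← map_smul, ← map_smul, ← map_smul, ← map_smul, ← map_smul,
        show (2 : ℤ) • (s • x + t • u + q • v) = s • e + ((2 * t - s * a) • u + (2 * q - s * b) • v) by
          rw [hed]; module]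
      have h7 := hL _ ((hker _).2 ⟨2 * t - s * a, 2 * q - s * b, rfl⟩)
      rw [map_add (r c), map_add (r c), map_add (r c), map_add (r c), map_add (r c), map_add (r c),
        h7, h7, map_smul, map_smul, he, map_smul, map_smul, he, map_smul, map_smul, he])
    have h2 : y 2 = y 0 := by
      have := LinearMap.congr_fun h1 (y 0)
      rw [map_mul, Module.End.mul_apply, hc, hc] at this
      exact this
    have := hi 2 1 (by rw [h2] at hy; rw [← hy]; module)
    omega

theorem IsBasis.of_finrank [Module.Finite ℤ M] (hM : Module.finrank ℤ M = 3) :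
    ∃ x y z : M, IsBasis x y z := by
  let b := Module.finBasisOfFinrankEq ℤ M hM
  refine ⟨b 0, b 1, b 2, fun x => ⟨b.repr x 0, b.repr x 1, b.repr x 2, ?_⟩, fun s t q e => ?_⟩
  · rw [← Fin.sum_univ_three (fun i => b.repr x i • b i), b.sum_repr]
  · have := Fintype.linearIndependent_iff.1 b.linearIndependent ![s, t, q]
      (by rw [Fin.sum_univ_three]; exact e)
    exact ⟨this 0, this 1, this 2⟩

end

section

variable {M : Type*} [AddCommGroup M] [Module.Free ℤ M] {G : Type*} [Group G]
  {r : Representation ℤ G M} {B : M →ₗ[ℤ] M →ₗ[ℤ] ℤ}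
  {k Ω : Type*} [Field k] [Field Ω] [Algebra k Ω] {ρ : G →* (Ω ≃ₐ[k] Ω)} {mon : M → Ω}

theorem MonAct.tetAct (h : MonAct ρ r mon) {g : G} {y z w e : M} (he : e = (2 : ℤ) • w - y - z)
    (sw ep : Bool)
    (hsw : if sw then (r g y = z ∨ r g y = -z) ∧ (r g z = y ∨ r g z = -y)
      else (r g y = y ∨ r g y = -y) ∧ (r g z = z ∨ r g z = -z))
    (hep : r g e = if ep then e else -e) : TetAct (ρ g) (mon y) (mon z) (mon w) sw ep := by
  obtain ⟨a, b, ha, hb, hab⟩ : ∃ a b : ℤ, (a = 0 ∨ a = 1) ∧ (b = 0 ∨ b = 1) ∧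
      if sw then r g y = (1 - 2 * b) • z ∧ r g z = (1 - 2 * a) • y
        else r g y = (1 - 2 * a) • y ∧ r g z = (1 - 2 * b) • z := by
    have key : ∀ {u v u' v' : M}, (u = u' ∨ u = -u') → (v = v' ∨ v = -v') →
        ∃ a b : ℤ, (a = 0 ∨ a = 1) ∧ (b = 0 ∨ b = 1) ∧ u = (1 - 2 * a) • u' ∧ v = (1 - 2 * b) • v' := by
      have key1 : ∀ {u u' : M}, (u = u' ∨ u = -u') →
          ∃ a : ℤ, (a = 0 ∨ a = 1) ∧ u = (1 - 2 * a) • u' := by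
        rintro u u' (rfl | rfl)
        · exact ⟨0, .inl rfl, by module⟩
        · exact ⟨1, .inr rfl, by module⟩
      intro u v u' v' h1 h2
      obtain ⟨a, ha, h1⟩ := key1 h1
      obtain ⟨b, hb, h2⟩ := key1 h2
      exact ⟨a, b, ha, hb, h1, h2⟩
    cases sw
    · obtain ⟨a, b, ha, hb, h1, h2⟩ := key hsw.1 hsw.2
      exact ⟨a, b, ha, hb, h1, h2⟩
    · obtain ⟨b, a, hb, ha, h1, h2⟩ := key hsw.1 hsw.2
      exact ⟨a, b, ha, hb, h1, h2⟩
  have hsum : r g y + r g z = (1 - 2 * a) • y + (1 - 2 * b) • z := by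
    cases sw
    · rw [hab.1, hab.2]
    · rw [hab.1, hab.2, add_comm]
  have h2 : (2 : ℤ) • r g w = r g e + (r g y + r g z) := by
    rw [he, LinearMap.map_sub, LinearMap.map_sub, map_smul]
    abel
  rw [hsum, hep] at h2
  refine ⟨a, b, ha, hb, ?_, ?_⟩
  · rw [h.equivariant, h.equivariant]
    cases sw <;> rw [hab.1, hab.2, h.map_zsmul, h.map_zsmul] <;> exact ⟨rfl, rfl⟩
  · rw [h.equivariant]
    cases ep
    · have : r g w = (1 - a) • y + (1 - b) • z - w := eq_of_two_smul_eq (by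
        rw [h2, if_neg (by decide), he]; module)
      rw [if_neg (by decide), this, h.map_sub, h.map_add, h.map_zsmul, h.map_zsmul]
    · have : r g w = w + (-a) • y + (-b) • z := eq_of_two_smul_eq (by
        rw [h2, if_pos rfl, he]; module)
      rw [if_pos rfl, this, h.map_add, h.map_add, h.map_zsmul, h.map_zsmul]

/-- The vertices of a simplex with two opposite edges in the directions `y ± z`. -/
def wedge (w y z : M) : Fin 4 → M := ![w, w - y - z, y - w, z - w]

/-- The coordinates of `wedge`. -/
def wedgeSign : Fin 3 → Fin 4 → ℤˣ := ![![1, 1, -1, -1], ![1, -1, 1, -1], ![1, -1, -1, 1]]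

set_option maxRecDepth 100000 in
theorem exists_wedgeSign_perm : ∀ s t u : ℤˣ, ∃ (d : ℤˣ) (π : Equiv.Perm (Fin 4)), ∀ i,
    wedgeSign 0 i * s = d * wedgeSign 0 (π i) ∧ wedgeSign 1 i * t = d * wedgeSign 1 (π i) ∧
      wedgeSign 2 i * u = d * wedgeSign 2 (π i) := by decide

set_option maxRecDepth 100000 in
theorem exists_wedgeSign_perm_swap : ∀ s t u : ℤˣ, ∃ (d : ℤˣ) (π : Equiv.Perm (Fin 4)), ∀ i,
    wedgeSign 0 i * s = d * wedgeSign 0 (π i) ∧ wedgeSign 1 i * t = d * wedgeSign 2 (π i) ∧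
      wedgeSign 2 i * u = d * wedgeSign 1 (π i) := by decide

theorem two_smul_wedge (w y z : M) (i : Fin 4) : (2 : ℤ) • wedge w y z i =
    (wedgeSign 0 i : ℤ) • ((2 : ℤ) • w - y - z) + (wedgeSign 1 i : ℤ) • y +
      (wedgeSign 2 i : ℤ) • z := by
  fin_cases i <;> simp [wedge, wedgeSign] <;> module

theorem exists_units_smul {v w : M} (h : v = w ∨ v = -w) : ∃ s : ℤˣ, v = (s : ℤ) • w := by
  rcases h with h | h
  · exact ⟨1, by rw [h, Units.val_one, one_smul]⟩
  · exact ⟨-1, by rw [h, Units.val_neg, Units.val_one, neg_one_smul]⟩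

theorem map_wedge {f : Module.End ℤ M} {w y z e : M} (he : e = (2 : ℤ) • w - y - z)
    (hf : SignPerm f y z) (hfe : f e = e ∨ f e = -e) : ∃ (π : Equiv.Perm (Fin 4)) (d : ℤˣ),
      ∀ i, f (wedge w y z i) = (d : ℤ) • wedge w y z (π i) := by
  have hw := two_smul_wedge w y z
  rw [← he] at hw
  obtain ⟨s, hs⟩ := exists_units_smul hfe
  rcases hf with ⟨hy, hz⟩ | ⟨hy, hz⟩
  all_goals
    obtain ⟨t, ht⟩ := exists_units_smul hy
    obtain ⟨u, hu⟩ := exists_units_smul hz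
  · obtain ⟨d, π, h⟩ := exists_wedgeSign_perm s t u
    refine ⟨π, d, fun i => eq_of_two_smul_eq ?_⟩
    obtain ⟨h1, h2, h3⟩ := h i
    rw [← map_smul, hw, smul_comm, hw, map_add, map_add, map_smul, map_smul, map_smul, hs, ht, hu]
    simp only [smul_smul, smul_add, ← Units.val_mul, h1, h2, h3]
  · obtain ⟨d, π, h⟩ := exists_wedgeSign_perm_swap s t u
    refine ⟨π, d, fun i => eq_of_two_smul_eq ?_⟩
    obtain ⟨h1, h2, h3⟩ := h i
    rw [← map_smul, hw, smul_comm, hw, map_add, map_add, map_smul, map_smul, map_smul, hs, ht, hu]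
    simp only [smul_smul, smul_add, ← Units.val_mul, h1, h2, h3]
    abel

theorem map_wedge_of_diag {f : Module.End ℤ M} {w y z e : M} (he : e = (2 : ℤ) • w - y - z)
    {m : Fin 4} (hfe : f e = (wedgeSign 0 m : ℤ) • e) (hy : f y = (wedgeSign 1 m : ℤ) • y)
    (hz : f z = (wedgeSign 2 m : ℤ) • z) (i : Fin 4) :
    f (wedge w y z i) = wedge w y z (klein m i) := by
  have hs : ∀ m i j, wedgeSign j i * wedgeSign j m = wedgeSign j (klein m i) := by decide
  have hw := two_smul_wedge w y z
  rw [← he] at hw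
  refine eq_of_two_smul_eq ?_
  rw [← map_smul, hw, hw, map_add, map_add, map_smul, map_smul, map_smul, hfe, hy, hz]
  simp only [smul_smul, ← Units.val_mul, hs]

theorem IsBasis.wedge {w y z : M} (hb : IsBasis w y z) :
    IsBasis (wedge w y z 0) (wedge w y z 1) (wedge w y z 2) := by
  change IsBasis w (w - y - z) (y - w)
  refine ⟨fun x => ?_, fun a b c e => ?_⟩
  · obtain ⟨a, b, c, rfl⟩ := hb.exists_eq x
    exact ⟨a + b, -c, b - c, by module⟩
  · have := hb.indep (a + b - c) (c - b) (-b) (by rw [← e]; module)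
    omega

theorem MonAct.relGen_of_wedge [Finite G] (h : MonAct ρ r mon) {w y z e : M} (hb : IsBasis w y z)
    (he : e = (2 : ℤ) • w - y - z) (hg : ∀ g, SignPerm (r g) y z)
    (hge : ∀ g, r g e = e ∨ r g e = -e)
    (hV : ∀ m, ∃ g, r g e = (wedgeSign 0 m : ℤ) • e ∧ r g y = (wedgeSign 1 m : ℤ) • y ∧
      r g z = (wedgeSign 2 m : ℤ) • z)
    (hBig : Big 3 ⊥ (monField k mon ⊤)) : RelGen ρ 3 ⊥ (monField k mon ⊤) := by
  rw [← hb.wedge.span_eq, h.monField_triple] at hBig ⊢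
  refine RelGen.of_klein (x := fun i => mon (wedge w y z i)) ?_ hBig (fun g => ?_) (fun m => ?_)
  · rw [← h.map_add, ← h.map_add, ← h.map_add, ← h.map_zero]
    congr 1
    simp only [wedge, Matrix.cons_val]
    abel
  · obtain ⟨π, d, hπ⟩ := map_wedge he (hg g) (hge g)
    refine ⟨π, ?_⟩
    rcases Int.units_eq_one_or d with rfl | rfl
    · left; intro i
      rw [h.equivariant, hπ, Units.val_one, one_smul]
    · right; intro i
      rw [h.equivariant, hπ, Units.val_neg, Units.val_one, neg_one_smul, h.map_neg]
  · obtain ⟨g, h1, h2, h3⟩ := hV m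
    refine ⟨g, fun i => ?_⟩
    rw [h.equivariant, map_wedge_of_diag he h1 h2 h3]

/-- The face-centred plane case. -/
theorem MonAct.relGen_of_centred [Finite G] (h : MonAct ρ r mon) {w y z e : M} (hb : IsBasis w y z)
    (he : e = (2 : ℤ) • w - y - z) (hg : ∀ g, SignPerm (r g) y z)
    (hge : ∀ g, r g e = e ∨ r g e = -e) {c : G}
    (hc : (r c e = e ∧ r c y = -y ∧ r c z = -z) ∨ (r c e = -e ∧ r c y = y ∧ r c z = z))
    (hBig : Big 3 ⊥ (monField k mon ⊤)) : RelGen ρ 3 ⊥ (monField k mon ⊤) := by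
  have hmul : ∀ g g' v, r (g * g') v = r g (r g' v) := fun g g' v => by
    rw [map_mul, Module.End.mul_apply]
  have htet : ((∃ g, TetAct (ρ g) (mon y) (mon z) (mon w) false false ∧ ρ g (mon y) = mon y ∧
      ρ g (mon z) = mon z) ∨ (∀ g, ∃ sw, TetAct (ρ g) (mon y) (mon z) (mon w) sw true) ∨
      ∀ g, ∃ ep, TetAct (ρ g) (mon y) (mon z) (mon w) (!ep) ep) →
      RelGen ρ 3 ⊥ (monField k mon ⊤) := by
    rw [← hb.cycle.span_eq, h.monField_triple] at hBig ⊢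
    refine RelGen.of_tetAct hBig fun g => ?_
    rcases hg g with hs | hs <;> rcases hge g with h0 | h0
    · exact ⟨false, true, h.tetAct he _ _ hs h0⟩
    · exact ⟨false, false, h.tetAct he _ _ hs h0⟩
    · exact ⟨true, true, h.tetAct he _ _ hs h0⟩
    · exact ⟨true, false, h.tetAct he _ _ hs h0⟩
  by_cases h1 : ∃ g, r g e = -e ∧ r g y = y ∧ r g z = z
  · obtain ⟨g, h0, hy, hz⟩ := h1
    exact htet (.inl ⟨g, h.tetAct he false false ⟨.inl hy, .inl hz⟩ h0,
      by rw [h.equivariant, hy], by rw [h.equivariant, hz]⟩)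
  have hc := hc.resolve_right fun hc => h1 ⟨c, hc⟩
  by_cases h2 : ∃ g, r g e = -e ∧ ((r g y = y ∧ r g z = -z) ∨ (r g y = -y ∧ r g z = z))
  · obtain ⟨g, h2, h3⟩ := h2
    refine h.relGen_of_wedge hb he hg hge (fun m => ?_) hBig
    fin_cases m
    · exact ⟨1, by simp [wedgeSign]⟩
    · exact ⟨c, by simp [wedgeSign, hc]⟩
    · rcases h3 with h3 | h3
      · exact ⟨g, by simp [wedgeSign, h2, h3]⟩
      · exact ⟨g * c, by simp [wedgeSign, hc, h2, h3]⟩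
    · rcases h3 with h3 | h3
      · exact ⟨g * c, by simp [wedgeSign, hc, h2, h3]⟩
      · exact ⟨g, by simp [wedgeSign, h2, h3]⟩
  have hD : ∀ g, (r g y = y ∨ r g y = -y) → (r g z = z ∨ r g z = -z) → r g e = e := fun g hy hz => by
    refine (hge g).resolve_right fun h0 => ?_
    rcases hy with hy | hy <;> rcases hz with hz | hz
    · exact h1 ⟨g, h0, hy, hz⟩
    · exact h2 ⟨g, h0, .inl ⟨hy, hz⟩⟩
    · exact h2 ⟨g, h0, .inr ⟨hy, hz⟩⟩
    · exact h1 ⟨g * c, by simp [hc, h0, hy, hz]⟩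
  by_cases h3 : ∃ g, r g e = e ∧ (r g y = z ∨ r g y = -z) ∧ (r g z = y ∨ r g z = -y)
  · obtain ⟨g', h0, h3, h4⟩ := h3
    have hE : ∀ g, r g e = e := fun g => by
      rcases hg g with ⟨hy, hz⟩ | ⟨hy, hz⟩
      · exact hD g hy hz
      · have := hD (g' * g) (by rcases hy with hy | hy <;> simp [hy, h4, neg_eq_iff_eq_neg, or_comm])
          (by rcases hz with hz | hz <;> simp [hz, h3, neg_eq_iff_eq_neg, or_comm])
        rw [hmul] at this
        refine (hge g).resolve_right fun h5 => ?_
        rw [h5, LinearMap.map_neg, h0, neg_eq_iff_eq_neg] at this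
        have := hb.indep 4 (-2) (-2) (by
          rw [show (4 : ℤ) • w + (-2 : ℤ) • y + (-2 : ℤ) • z = e - -e by rw [he]; module, ← this,
            sub_self])
        omega
    refine htet (.inr (.inl fun g => ?_))
    rcases hg g with hs | hs
    · exact ⟨false, h.tetAct he _ _ hs (hE g)⟩
    · exact ⟨true, h.tetAct he _ _ hs (hE g)⟩
  · refine htet (.inr (.inr fun g => ?_))
    rcases hg g with hs | hs
    · exact ⟨true, h.tetAct he false true hs (hD g hs.1 hs.2)⟩
    · exact ⟨false, h.tetAct he true false hs ((hge g).resolve_left fun h0 => h3 ⟨g, h0, hs⟩)⟩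

/-- The plane centred along one axis. -/
theorem MonAct.relGen_of_half_centred [Finite G] (h : MonAct ρ r mon) (hB : InvForm r B)
    {w y z e : M} (hb : IsBasis w y z) (he : e = (2 : ℤ) • w - y) (hg : ∀ g, SignPerm (r g) y z)
    (hge : ∀ g, r g e = e ∨ r g e = -e) (hBig : Big 3 ⊥ (monField k mon ⊤)) :
    RelGen ρ 3 ⊥ (monField k mon ⊤) := by
  have key : ∀ g, (r g y = y ∨ r g y = -y) ∧ (r g z = z ∨ r g z = -z) := fun g => by
    refine (hg g).resolve_right fun hs => ?_
    have hy := hs.1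
    obtain ⟨s, hs⟩ := exists_units_smul (hge g)
    obtain ⟨t, ht⟩ := exists_units_smul hy
    obtain ⟨p, q, n, hn⟩ := hb.exists_eq (r g w)
    have h1 : (2 : ℤ) • r g w - (t : ℤ) • z = (s : ℤ) • ((2 : ℤ) • w - y) := by
      rw [← he, ← hs, he, LinearMap.map_sub, map_smul, ht]
    rw [← hn] at h1
    have := (hb.indep (2 * p - 2 * s) (2 * q + s) (2 * n - t) (by
      rw [← sub_eq_zero] at h1; rw [← h1]; module)).2.2
    rcases Int.units_eq_one_or t with rfl | rfl <;> norm_num at this <;> omega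
  refine h.relGen_one_two hB hb.cycle.cycle (fun g => (key g).2) (fun g v hv => ?_) hBig
  have hgw : ∃ m n : ℤ, r g w = m • w + n • y := by
    rcases hge g with h0 | h0 <;> rcases (key g).1 with h1 | h1
    all_goals
      rw [he, LinearMap.map_sub, map_smul, h1, sub_eq_iff_eq_add] at h0
    · exact ⟨1, 0, eq_of_two_smul_eq (by rw [h0]; module)⟩
    · exact ⟨1, -1, eq_of_two_smul_eq (by rw [h0]; module)⟩
    · exact ⟨-1, 1, eq_of_two_smul_eq (by rw [h0]; module)⟩
    · exact ⟨-1, 0, eq_of_two_smul_eq (by rw [h0]; module)⟩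
  obtain ⟨m, n, hgw⟩ := hgw
  obtain ⟨a, b, rfl⟩ := Submodule.mem_span_pair.1 hv
  obtain ⟨t, ht⟩ := exists_units_smul (key g).1
  exact Submodule.mem_span_pair.2 ⟨a * m, a * n + b * t, by
    rw [LinearMap.map_add, map_smul, map_smul, hgw, ht]; module⟩

theorem IsBasis.swap {w y z : M} (hb : IsBasis w y z) : IsBasis w z y where
  exists_eq x := by
    obtain ⟨a, b, c, rfl⟩ := hb.exists_eq x
    exact ⟨a, c, b, by module⟩
  indep a b c e := by
    have := hb.indep a c b (by rw [← e]; module)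
    tauto

/-- Rank three lattices whose group has a suitable central involution. -/
theorem MonAct.relGen_of_involution [Finite G] (h : MonAct ρ r mon) (hB : InvForm r B)
    (hno : ∀ c, r c ^ 3 = 1 → r c = 1) {x u v : M} (hb : IsBasis x u v) {z : Module.End ℤ M}
    (hzz : z * z = 1) (hz : ∀ g, z * r g = r g * z) {c : G} (hc : r c = z ∨ r c = -z)
    (hker : ∀ w, z w = -w ↔ ∃ a b : ℤ, a • u + b • v = w)
    (hBig : Big 3 ⊥ (monField k mon ⊤)) : RelGen ρ 3 ⊥ (monField k mon ⊤) := by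
  obtain ⟨a, b, hab⟩ := (hker (z x - x)).1 (by
    rw [LinearMap.map_sub, ← Module.End.mul_apply, hzz, Module.End.one_apply, neg_sub])
  obtain ⟨w, y1, y2, hb, h1, h2, hg, p, q, hp, hq, hw⟩ :=
    hB.exists_signPerm hno hb hz hker (a := a) (b := b) (by rw [add_assoc, hab]; abel)
  have hge := hB.map_axis hb hz hw h1 h2
  rcases hp with rfl | rfl <;> rcases hq with rfl | rfl
  · refine h.relGen_one_two hB hb (fun g => ?_) (fun g v hv => ?_) hBig
    · have := hge g
      simp only [zero_smul, add_zero, map_smul, ← smul_neg] at this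
      exact this.imp eq_of_two_smul_eq eq_of_two_smul_eq
    · obtain ⟨a, b, rfl⟩ := Submodule.mem_span_pair.1 hv
      rw [LinearMap.map_add, map_smul, map_smul, Submodule.mem_span_pair]
      rcases hg g with ⟨hy, hz⟩ | ⟨hy, hz⟩
      all_goals
        obtain ⟨s, hs⟩ := exists_units_smul hy
        obtain ⟨t, ht⟩ := exists_units_smul hz
        rw [hs, ht]
      · exact ⟨a * s, b * t, by module⟩
      · exact ⟨b * t, a * s, by module⟩
  · refine h.relGen_of_half_centred hB (hb.swap) (by module) (fun g => ?_) hge hBig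
    have := hg g
    unfold SignPerm at this ⊢
    tauto
  · exact h.relGen_of_half_centred hB hb (by module) hg hge hBig
  · refine h.relGen_of_centred hb (c := c) (e := (2 : ℤ) • w - y1 - y2) rfl hg (fun g => ?_) ?_ hBig
    · have := hge g
      rwa [neg_one_smul, neg_one_smul, ← sub_eq_add_neg, ← sub_eq_add_neg] at this
    · have hze : z ((2 : ℤ) • w - y1 - y2) = (2 : ℤ) • w - y1 - y2 := by
        simp only [LinearMap.map_sub, map_smul, h1, h2, hw]
        module
      rcases hc with hc | hc <;> rw [hc]
      · exact .inl ⟨hze, h1, h2⟩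
      · refine .inr ⟨?_, ?_, ?_⟩ <;> rw [LinearMap.neg_apply]
        · rw [hze]
        · rw [h1, neg_neg]
        · rw [h2, neg_neg]

/-- Rank three lattices. -/
theorem MonAct.relGen_three [Finite G] [Module.Finite ℤ M] (h : MonAct ρ r mon)
    (hM : Module.finrank ℤ M = 3) (hBig : Big 3 ⊥ (monField k mon ⊤)) :
    RelGen ρ 3 ⊥ (monField k mon ⊤) := by
  obtain ⟨B, hB⟩ := exists_invForm r
  by_cases hno : ∀ c, r c ^ 3 = 1 → r c = 1
  · rcases exists_central_involution hM hno with hg | ⟨z, hzz, h1, h2, hz, c, hc⟩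
    · obtain ⟨x, y, z, hb⟩ := IsBasis.of_finrank hM
      refine h.relGen_one_two hB hb (fun g => ?_) (fun g v hv => ?_) hBig
      · rcases hg g with h | h <;> simp [h]
      · rcases hg g with h | h <;> simp only [h]
        · exact hv
        · exact neg_mem hv
    · have key : ∀ z : Module.End ℤ M, Module.finrank ℤ (LinearMap.ker (z + 1)) = 2 →
          ∃ x u v, IsBasis x u v ∧ ∀ w, z w = -w ↔ ∃ a b : ℤ, a • u + b • v = w := fun z hz => by
        obtain ⟨x, u, v, hb, hT⟩ := exists_isBasis_of_finrank_ker hM _ hz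
        exact ⟨x, u, v, hb, fun w => by rw [← hT, eq_neg_iff_add_eq_zero]; rfl⟩
      rcases finrank_ker_of_involution hM hzz h1 h2 with h0 | h0
      · obtain ⟨x, u, v, hb, hker⟩ := key z h0
        exact h.relGen_of_involution hB hno hb hzz hz hc hker hBig
      · obtain ⟨x, u, v, hb, hker⟩ := key (-z) h0
        refine h.relGen_of_involution hB hno hb (z := -z) (c := c) ?_ (fun g => ?_) ?_ hker hBig
        · rw [neg_mul_neg, hzz]
        · rw [neg_mul, hz, mul_neg]
        · rw [neg_neg]; exact hc.symm
  · push Not at hno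
    obtain ⟨c, h3, h1⟩ := hno
    exact h.relGen_threefold hM hB h3 h1 hBig

end

section

variable {ι k Ω : Type*} [Fintype ι] [Field k] [Field Ω] [Algebra k Ω] {G : Type*} [Group G]
  {ρ : G →* (Ω ≃ₐ[k] Ω)}

/-- The Laurent monomial in `x` with exponent vector `v`. -/
def laurent (x : ι → Ω) (v : ι → ℤ) : Ω := ∏ i, x i ^ v i

theorem laurent_single [DecidableEq ι] (x : ι → Ω) (i : ι) : laurent x (Pi.single i 1) = x i := by
  rw [laurent, Finset.prod_eq_single i] <;> simp +contextual

theorem laurent_add {x : ι → Ω} (hx : ∀ i, x i ≠ 0) (v w : ι → ℤ) :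
    laurent x (v + w) = laurent x v * laurent x w := by
  simp [laurent, zpow_add₀ (hx _), Finset.prod_mul_distrib]

theorem laurent_injective {x : ι → Ω} (hx : AlgebraicIndependent k x) :
    Function.Injective (laurent x) := fun v w h => by
  have h0 : ∀ i, x i ≠ 0 := hx.ne_zero
  let p : ι → ℕ := fun i => (v i - w i).toNat
  let q : ι → ℕ := fun i => (w i - v i).toNat
  have hpq : ∀ i, v i + q i = w i + p i := fun i => by simp only [p, q]; omega
  have hc : ∀ n : ι → ℕ, laurent x (fun i => (n i : ℤ)) =
      aeval x (monomial (Finsupp.equivFunOnFinite.symm n) (1 : k)) := fun n => by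
    simp [laurent, aeval_monomial, Finsupp.prod_fintype]
  have key : laurent x (fun i => (q i : ℤ)) = laurent x (fun i => (p i : ℤ)) := by
    refine mul_left_cancel₀ (a := laurent x v)
      (Finset.prod_ne_zero_iff.2 fun i _ => zpow_ne_zero _ (h0 i)) ?_
    nth_rw 2 [h]
    rw [← laurent_add h0, ← laurent_add h0]
    exact congrArg _ (funext hpq)
  rw [hc, hc] at key
  have := Finsupp.equivFunOnFinite.symm.injective
    ((monomial_left_inj one_ne_zero).1 (hx key))
  funext i
  have h1 := congrFun this i
  have h2 := hpq i
  omega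

theorem exists_monAct {x : ι → Ω} (hx : AlgebraicIndependent k x)
    (hA : ∀ g, ∃ A : Matrix ι ι ℤ, ∀ j, ρ g (x j) = ∏ i, x i ^ A i j) :
    ∃ r : Representation ℤ G (ι → ℤ), MonAct ρ r (laurent x) := by
  classical
  choose A hA using hA
  have h0 : ∀ i, x i ≠ 0 := hx.ne_zero
  have heq : ∀ g v, ρ g (laurent x v) = laurent x ((A g).mulVec v) := fun g v => by
    simp only [laurent, map_prod, map_zpow₀, hA, ← Finset.prod_zpow, Matrix.mulVec, dotProduct]
    rw [Finset.prod_comm]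
    refine Finset.prod_congr rfl fun i _ => ?_
    rw [← Finset.prod_congr rfl fun j _ => zpow_mul (x i) (A g i j) (v j)]
    induction (Finset.univ : Finset ι) using Finset.induction_on with
    | empty => simp
    | insert a s ha ih => rw [Finset.prod_insert ha, Finset.sum_insert ha, zpow_add₀ (h0 i), ih]
  refine ⟨{ toFun g := (A g).mulVecLin, map_one' := ?_, map_mul' g h := ?_ },
    laurent_add h0, fun v => Finset.prod_ne_zero_iff.2 fun i _ => zpow_ne_zero _ (h0 i), heq⟩
  · refine LinearMap.ext fun v => laurent_injective hx ?_
    rw [Matrix.mulVecLin_apply, ← heq, map_one]; rfl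
  · refine LinearMap.ext fun v => laurent_injective hx ?_
    rw [Matrix.mulVecLin_apply, ← heq, map_mul, AlgEquiv.mul_apply, heq, heq]; rfl

theorem MonAct.monField_laurent {x : ι → Ω} :
    monField k (laurent x) ⊤ = adjoin k (Set.range x) := by
  classical
  refine le_antisymm (monField_le.2 fun v _ => prod_mem fun i _ => zpow_mem
    (subset_adjoin k _ (Set.mem_range_self i)) _) (adjoin_le_iff.2 ?_)
  rintro _ ⟨i, rfl⟩
  rw [← laurent_single x i]
  exact mon_mem_monField _ trivial

/-- One variable splits off. -/
theorem relGen_three_one [Finite G] {x : Fin 4 → Ω} (hx : AlgebraicIndependent k x)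
    (htop : adjoin k (Set.range x) = ⊤) (hBig : Big 4 ⊥ (⊤ : IntermediateField k Ω)) (p : Fin 4)
    (hA : ∀ g, ∃ A : Matrix (Fin 4) (Fin 4) ℤ, (∀ i, i ≠ p → A i p = 0 ∧ A p i = 0) ∧
      ∀ j, ρ g (x j) = ∏ i, x i ^ A i j) : RelGen ρ 4 ⊥ ⊤ := by
  obtain ⟨s, hs⟩ := exists_monAct hx fun g => (hA g).imp fun A h => h.2
  have hy : AlgebraicIndependent k (x ∘ p.succAbove) := hx.comp _ Fin.succAbove_right_injective
  obtain ⟨r, hr⟩ := exists_monAct (ρ := ρ) hy fun g => by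
    obtain ⟨A, h0, hA⟩ := hA g
    refine ⟨A.submatrix p.succAbove p.succAbove, fun j => ?_⟩
    rw [Function.comp_apply, hA, Fin.prod_univ_succAbove _ p,
      (h0 _ (Fin.succAbove_ne p j)).2, zpow_zero, one_mul]
    rfl
  set K := monField k (laurent (x ∘ p.succAbove)) ⊤ with hK
  have hsup : K ⊔ k⟮x p⟯ = ⊤ := by
    rw [hK, MonAct.monField_laurent, ← adjoin_union, ← htop]
    congr 1
    ext y
    simp only [Set.mem_union, Set.mem_range, Set.mem_singleton_iff, Fin.exists_iff_succAbove p,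
      Function.comp_apply]
    tauto
  rw [← hsup] at hBig ⊢
  have hK3 : GenBy 3 ⊥ K := by
    classical
    refine ⟨Finset.univ.image (x ∘ p.succAbove), Finset.card_image_le, ?_⟩
    rw [hK, MonAct.monField_laurent, bot_sup_eq, Finset.coe_image, Finset.coe_univ, Set.image_univ]
  refine (hr.relGen_three (by simp) (Big.of_genBy_right (m := 3) hBig (GenBy.one _ _))).trans
    (RelGen.inv (hr.stable fun _ _ _ => Submodule.mem_top)
      ((Big.of_genBy (m := 3) (n := 1) hBig hK3).one (le_acl _)) fun g => ?_)
  have key : ∀ g, ∃ a : ℤ, s g (Pi.single p 1) = a • Pi.single p 1 := fun g => by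
    obtain ⟨A, h0, hA⟩ := hA g
    refine ⟨A p p, laurent_injective hx ?_⟩
    rw [← hs.equivariant, hs.map_zsmul, laurent_single, hA, Finset.prod_eq_single p]
    · intro i _ hi
      rw [(h0 i hi).1, zpow_zero]
    · simp
  obtain ⟨a, ha⟩ := key g
  obtain ⟨b, hb⟩ := key g⁻¹
  have hab : b * a = 1 := by
    have : s g⁻¹ (s g (Pi.single p 1)) = Pi.single p 1 := Representation.inv_self_apply s g _
    rw [ha, map_smul, hb, smul_smul] at this
    simpa [mul_comm] using congrFun this p
  rw [← laurent_single x p, hs.equivariant, ha]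
  rcases Int.isUnit_iff.1 (IsUnit.of_mul_eq_one_right _ hab) with rfl | rfl
  · simp
  · simp [hs.map_neg]

theorem relGen_top_of_two_two [Finite G] {x : Fin 4 → Ω} (hx : AlgebraicIndependent k x)
    (htop : adjoin k (Set.range x) = ⊤) (hBig : Big 4 ⊥ (⊤ : IntermediateField k Ω))
    (hA : ∀ g, ∃ A : Matrix (Fin 4) (Fin 4) ℤ,
      (∀ i j : Fin 4, ¬ (((i : ℕ) < 2) ↔ ((j : ℕ) < 2)) → A i j = 0) ∧
      ∀ j, ρ g (x j) = ∏ i, x i ^ A i j) : RelGen ρ 4 ⊥ ⊤ := by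
  obtain ⟨r, h⟩ := exists_monAct hx fun g => (hA g).imp fun A h => h.2
  obtain ⟨B, hB⟩ := exists_invForm r
  let e : Fin 4 → Fin 4 → ℤ := fun i => Pi.single i 1
  have hcol : ∀ g, ∃ A : Matrix (Fin 4) (Fin 4) ℤ,
      (∀ i j : Fin 4, ¬ (((i : ℕ) < 2) ↔ ((j : ℕ) < 2)) → A i j = 0) ∧
      ∀ j, r g (e j) = fun i => A i j := fun g => by
    obtain ⟨A, h0, hA⟩ := hA g
    refine ⟨A, h0, fun j => laurent_injective hx ?_⟩
    rw [← h.equivariant, laurent_single, hA, laurent]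
  have hst : ∀ a b : Fin 4, (∀ i j, i ≠ a → i ≠ b → (j = a ∨ j = b) →
      ¬ (((i : ℕ) < 2) ↔ ((j : ℕ) < 2))) → a ≠ b →
      ∀ g, ∀ v ∈ span ℤ {e a, e b}, r g v ∈ span ℤ {e a, e b} := by
    intro a b hab hne g
    obtain ⟨A, h0, hA⟩ := hcol g
    have : ∀ j, j = a ∨ j = b → r g (e j) ∈ span ℤ {e a, e b} := fun j hj => by
      rw [hA, Submodule.mem_span_pair]
      refine ⟨A a j, A b j, funext fun i => ?_⟩
      by_cases h1 : i = a
      · simp [e, h1, hne]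
      by_cases h2 : i = b
      · simp [e, h2, hne.symm]
      simp [e, h1, h2, h0 i j (hab i j h1 h2 hj)]
    change _ ≤ (span ℤ {e a, e b}).comap (r g)
    rw [Submodule.span_le]
    rintro _ (rfl | rfl)
    exacts [this a (.inl rfl), this b (.inr rfl)]
  have hsup : monField k (laurent x) (span ℤ {e 0, e 1}) ⊔
      monField k (laurent x) (span ℤ {e 2, e 3}) = ⊤ := by
    rw [eq_top_iff, ← htop, adjoin_le_iff]
    rintro _ ⟨i, rfl⟩
    rw [← laurent_single x i]
    fin_cases i
    · exact mem_left (mon_mem_monField _ (Submodule.subset_span (.inl rfl)))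
    · exact mem_left (mon_mem_monField _ (Submodule.subset_span (.inr rfl)))
    · rw [sup_comm]; exact mem_left (mon_mem_monField _ (Submodule.subset_span (.inl rfl)))
    · rw [sup_comm]; exact mem_left (mon_mem_monField _ (Submodule.subset_span (.inr rfl)))
  have hind : ∀ a b : Fin 4, a ≠ b → Indep (e a) (e b) := fun a b hab m n hmn =>
    ⟨by simpa [e, hab] using congrFun hmn a, by simpa [e, hab.symm] using congrFun hmn b⟩
  rw [← hsup] at hBig ⊢
  exact h.relGen_two_two hB (hind 0 1 (by decide)) (hind 2 3 (by decide))
    (hst 0 1 (by decide) (by decide)) (hst 2 3 (by decide) (by decide)) hBig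

theorem top_le_acl_fixedField [Finite G] (ρ : G →* (Ω ≃ₐ[k] Ω)) :
    ⊤ ≤ acl (fixedField ρ.range) := fun x _ => by
  have := Fintype.ofFinite G
  let p : Polynomial Ω := ∏ g : G, (Polynomial.X - Polynomial.C (ρ g x))
  refine mem_acl_of_poly p (Polynomial.monic_prod_X_sub_C _ _).ne_zero (fun i => ?_) ?_
  · rw [mem_fixedField_iff]
    rintro _ ⟨g, rfl⟩
    have hp : p.map (ρ g : Ω →+* Ω) = p := by
      simp only [p, Polynomial.map_prod, Polynomial.map_sub, Polynomial.map_X, Polynomial.map_C]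
      exact Fintype.prod_equiv (Equiv.mulLeft g) _ _ fun a => by simp
    nth_rw 2 [← hp]
    rw [Polynomial.coeff_map]
    rfl
  · rw [Polynomial.eval_prod]
    exact Finset.prod_eq_zero (Finset.mem_univ 1) (by simp)

end

end Framework

/-- **Hoshi–Kang–Kitayama.** Let `k` be a field and `G` a finite group acting on
`k(x₁,x₂,x₃,x₄)` by purely monomial `k`-automorphisms whose associated `G`-lattice of rank 4
is decomposable: there is `1 ≤ m ≤ 3` such that every `σ ∈ G` sends each of the first `m`
variables to a monomial in the first `m` variables and each of the remaining variables to a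
monomial in the remaining variables (and the exponent matrices lie in `GL₄(ℤ)`).
Then `k(x₁,x₂,x₃,x₄)^G` is `k`-rational. -/
theorem decomposable_purely_monomial_rank_four_rational
    (k : Type*) [Field k] (G : Type*) [Group G] [Finite G] (m : ℕ) (hm1 : 1 ≤ m) (hm3 : m ≤ 3)
    (ρ : G →* (FractionRing (MvPolynomial (Fin 4) k) ≃ₐ[k] FractionRing (MvPolynomial (Fin 4) k)))
    (hmono : ∀ σ : G, ∃ A : Matrix (Fin 4) (Fin 4) ℤ, IsUnit A.det ∧
      (∀ i j : Fin 4, ¬ (((i : ℕ) < m) ↔ ((j : ℕ) < m)) → A i j = 0) ∧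
      ∀ j : Fin 4, ρ σ (algebraMap (MvPolynomial (Fin 4) k) _ (X j)) =
        ∏ i : Fin 4, (algebraMap (MvPolynomial (Fin 4) k) _ (X i)) ^ (A i j)) :
    IsRational k (IntermediateField.fixedField ρ.range) := by
  let R := MvPolynomial (Fin 4) k
  let x : Fin 4 → FractionRing R := fun i => algebraMap R _ (X i)
  have hinj : Function.Injective (algebraMap R (FractionRing R)) := IsFractionRing.injective _ _
  have hx : AlgebraicIndependent k x :=
    (MvPolynomial.algebraicIndependent_X (Fin 4) k).map' (f := IsScalarTower.toAlgHom k R _) hinj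
  have hR : ∀ p : R, algebraMap R (FractionRing R) p ∈ IntermediateField.adjoin k (Set.range x) :=
    fun p => by
      induction p using MvPolynomial.induction_on with
      | C a =>
        rw [← MvPolynomial.algebraMap_eq, ← IsScalarTower.algebraMap_apply]
        exact algebraMap_mem _ a
      | add p q hp hq => rw [map_add]; exact add_mem hp hq
      | mul_X p i hp =>
        rw [map_mul]
        exact mul_mem hp (IntermediateField.subset_adjoin k _ (Set.mem_range_self i))
  have htop : IntermediateField.adjoin k (Set.range x) = ⊤ := eq_top_iff.2 fun y _ => by
    obtain ⟨p, q, -, rfl⟩ := IsFractionRing.div_surjective (A := R) y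
    exact div_mem (hR p) (hR q)
  have hb : IsTranscendenceBasis k x := by
    have := isAlgebraic_of_top_le_acl (htop.ge.trans (le_acl _))
    exact hx.isTranscendenceBasis_iff_isAlgebraic.2 this
  have htr : Algebra.trdeg k (FractionRing R) = (4 : ℕ) := by
    simpa using hb.lift_cardinalMk_eq_trdeg.symm
  have hrel : RelGen ρ 4 ⊥ ⊤ := by
    obtain rfl | rfl | rfl : m = 1 ∨ m = 2 ∨ m = 3 := by omega
    · refine relGen_three_one hx htop (big_of_trdeg htr) 0 fun g => ?_
      obtain ⟨A, -, h0, hA⟩ := hmono g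
      exact ⟨A, fun i hi => ⟨h0 _ _ (by simp; omega), h0 _ _ (by simp; omega)⟩, hA⟩
    · exact relGen_top_of_two_two hx htop (big_of_trdeg htr) fun g => (hmono g).imp fun A h => h.2
    · refine relGen_three_one hx htop (big_of_trdeg htr) 3 fun g => ?_
      obtain ⟨A, -, h0, hA⟩ := hmono g
      exact ⟨A, fun i hi => ⟨h0 _ _ (by simp; omega), h0 _ _ (by simp; omega)⟩, hA⟩
  rw [RelGen, fixIn_bot, FixIn, top_inf_eq] at hrel
  exact isRational_of_genBy htr hrel (top_le_acl_fixedField ρ)
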